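/- Let d ∈ ℕ, let ν₁,…,ν_d ∈ ℕ, and for each i = 1,…,d let ω^{(i)} ∈ ℝ^{ν_i} be non-resonant and satisfy the diophantine condition: there exist α_i, β_i > 0 such that |n_i · ω^{(i)}| ≥ α_i |n_i|^{−β_i} for all n_i ∈ ℤ^{ν_i} \ {0}. Let p_d = 2(d+2)/d and let ε > 0. Then there exists a constant K > 0 (depending on d, the ω^{(i)}, α_i, β_i, ε) such that for every finitely supported a : ℤ^{ν₁}×…×ℤ^{ν_d} → ℂ one has limsup_{L→∞} (1/(2L)^{d+1}) ∫_{[−L,L]^{d+1}} | ∑_{n} a_n e^{i(⟨n⟩_ω · x − t |⟨n⟩_ω|²)} |^{p_d} dx dt ≤ K^{p_d} · ( ∑_{n} (1+|n|)^{2ε} |a_n|^2 )^{p_d/2}, where the integration is over (t,x) ∈ [−L,L] × [−L,L]^d. (Time-averaged L^{p_d} Strichartz estimate for quasi-periodic functions in higher dimensions under a diophantine condition, Theorem 4.2.) -/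

import Mathlib

open MeasureTheory Filter

/-- The `i`-th component `⟨n_i⟩_{ω^{(i)}} = n_i · ω^{(i)}` of the frequency vector of a
multi-index `n ∈ ℤ^{ν₁} × … × ℤ^{ν_d}`. -/
noncomputable def freqVec {d : ℕ} {ν : Fin d → ℕ} (ω : ∀ i, Fin (ν i) → ℝ)
    (n : ∀ i, Fin (ν i) → ℤ) (i : Fin d) : ℝ :=
  ∑ j, (n i j : ℝ) * ω i j

/-- The height `|n|` (Euclidean norm of the full integer vector) of a multi-index. -/
noncomputable def heightVec {d : ℕ} {ν : Fin d → ℕ} (n : ∀ i, Fin (ν i) → ℤ) : ℝ :=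
  Real.sqrt (∑ i, ∑ j, ((n i j : ℝ)) ^ 2)

namespace QPS
set_option linter.all false
open scoped ENNReal NNReal BigOperators FourierTransform SchwartzMap ComplexConjugate

abbrev V (m : ℕ) := Fin m → ℝ

/-- polynomially decaying kernel -/
noncomputable def kk {m : ℕ} (B : ℕ) (y : V m) : ℝ≥0∞ := ENNReal.ofReal (((1 + ‖y‖) ^ B)⁻¹)

/-- slowly varying weights -/
def SV {m : ℕ} (A : ℕ) (r : ℝ) (W : V m → ℝ≥0∞) : Prop :=
  Measurable W ∧ ∀ x y, W (x + y) ≤ ENNReal.ofReal ((1 + ‖y‖ / r) ^ A) * W x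

noncomputable def Av {m : ℕ} (B : ℕ) (r : ℝ) (h : V m → ℝ≥0∞) (x : V m) : ℝ≥0∞ :=
  ∫⁻ y, h (x + r • y) * kk B y

variable {m : ℕ}

@[fun_prop]
lemma kk_meas (B : ℕ) : Measurable (kk B : V m → ℝ≥0∞) := by
  unfold kk; fun_prop

lemma kk_pos (B : ℕ) (y : V m) : 0 < kk B y := by
  unfold kk; rw [ENNReal.ofReal_pos]; positivity

lemma kk_ne_top (B : ℕ) (y : V m) : kk B y ≠ ∞ := ENNReal.ofReal_ne_top

lemma kk_le_one (B : ℕ) (y : V m) : kk B y ≤ 1 := by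
  unfold kk
  rw [ENNReal.ofReal_le_one]
  apply inv_le_one_of_one_le₀
  apply one_le_pow₀
  linarith [norm_nonneg y]

lemma kk_anti {B B' : ℕ} (h : B ≤ B') (y : V m) : kk B' y ≤ kk B y := by
  unfold kk
  apply ENNReal.ofReal_le_ofReal
  apply inv_anti₀ (by positivity)
  apply pow_le_pow_right₀ _ h
  linarith [norm_nonneg y]

lemma kk_add (A B : ℕ) (y : V m) : ENNReal.ofReal ((1 + ‖y‖) ^ A) * kk (A + B) y = kk B y := by
  unfold kk
  rw [← ENNReal.ofReal_mul (by positivity)]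
  congr 1
  have : (1 + ‖y‖) ≠ 0 := by positivity
  field_simp
  ring

lemma kk_neg (B : ℕ) (y : V m) : kk B (-y) = kk B y := by simp [kk]

lemma kk_shift (B : ℕ) (y v : V m) :
    kk B (y + v) ≤ ENNReal.ofReal ((1 + ‖v‖) ^ B) * kk B y := by
  unfold kk
  rw [← ENNReal.ofReal_mul (by positivity)]
  apply ENNReal.ofReal_le_ofReal
  have h1 : ‖y‖ ≤ ‖y + v‖ + ‖v‖ := by
    calc ‖y‖ = ‖(y + v) - v‖ := by simp
      _ ≤ _ := norm_sub_le _ _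
  have h2 : (1 + ‖y‖) ^ B ≤ ((1 + ‖v‖) * (1 + ‖y + v‖)) ^ B := by
    apply pow_le_pow_left₀ (by positivity)
    nlinarith [norm_nonneg v, norm_nonneg (y + v)]
  rw [mul_pow] at h2
  have p1 : 0 < (1 + ‖y‖) ^ B := by positivity
  have p2 : 0 < (1 + ‖y + v‖) ^ B := by positivity
  rw [← div_eq_mul_inv, inv_eq_one_div, div_le_div_iff₀ p2 p1]
  linarith

lemma kk_integrable {B : ℕ} (hB : m + 1 ≤ B) : (∫⁻ y : V m, kk B y) ≠ ∞ := by
  have h := finite_integral_one_add_norm (E := V m) (μ := volume) (r := (B : ℝ))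
    (by simp; exact_mod_cast hB)
  have : (∫⁻ y : V m, kk B y) = ∫⁻ y : V m, ENNReal.ofReal ((1 + ‖y‖) ^ (-(B : ℝ))) := by
    apply lintegral_congr
    intro y
    unfold kk
    rw [Real.rpow_neg (by positivity), Real.rpow_natCast]
  rw [this]
  exact h.ne

lemma kk_integral_pos (B : ℕ) : (∫⁻ y : V m, kk B y) ≠ 0 := by
  rw [Ne, lintegral_eq_zero_iff (kk_meas B)]
  intro h
  have : ∀ᵐ y : V m, False := by
    filter_upwards [h] with y hy
    exact (kk_pos B y).ne' hy
  rw [Filter.eventually_false_iff_eq_bot, ae_eq_bot] at this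
  exact NeZero.ne (volume : Measure (V m)) this

lemma SV.meas {A : ℕ} {r : ℝ} {W : V m → ℝ≥0∞} (h : SV A r W) : Measurable W := h.1

lemma SV.mono_r {A : ℕ} {r s : ℝ} {W : V m → ℝ≥0∞} (hr : 0 < r) (hrs : r ≤ s) (h : SV A s W) :
    SV A r W := by
  refine ⟨h.1, fun x y => (h.2 x y).trans ?_⟩
  have hs : 0 < s := hr.trans_le hrs
  have h0 : 0 ≤ 1 + ‖y‖ / s := by positivity
  gcongr

lemma SV.mono_A {A A' : ℕ} {r : ℝ} {W : V m → ℝ≥0∞} (hr : 0 < r) (hA : A ≤ A') (h : SV A r W) :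
    SV A' r W := by
  refine ⟨h.1, fun x y => (h.2 x y).trans ?_⟩
  gcongr
  have : 0 ≤ ‖y‖ / r := by positivity
  linarith

lemma SV.const_mul {A : ℕ} {r : ℝ} {W : V m → ℝ≥0∞} (c : ℝ≥0∞) (h : SV A r W) :
    SV A r (fun x => c * W x) := by
  refine ⟨h.1.const_mul c, fun x y => ?_⟩
  calc c * W (x + y) ≤ c * (ENNReal.ofReal ((1 + ‖y‖ / r) ^ A) * W x) := by gcongr; exact h.2 x y
    _ = _ := by ring

lemma SV.rev {A : ℕ} {r : ℝ} {W : V m → ℝ≥0∞} (h : SV A r W) (x y : V m) :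
    W x ≤ ENNReal.ofReal ((1 + ‖y‖ / r) ^ A) * W (x + y) := by
  have := h.2 (x + y) (-y)
  simpa using this

lemma SV.sum {ι : Type*} {A : ℕ} {r : ℝ} (s : Finset ι) {W : ι → V m → ℝ≥0∞} (h : ∀ i ∈ s, SV A r (W i)) :
    SV A r (fun x => ∑ i ∈ s, W i x) := by
  refine ⟨Finset.measurable_fun_sum s (fun i hi => (h i hi).1), fun x y => ?_⟩
  rw [Finset.mul_sum]
  exact Finset.sum_le_sum fun i hi => (h i hi).2 x y

/-- the kernel centred at `x0` at scale r is slowly varying -/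
lemma SV_kk (B : ℕ) {r : ℝ} (hr : 0 < r) (x0 : V m) :
    SV B r (fun z => kk B (r⁻¹ • (z - x0))) := by
  refine ⟨by fun_prop, fun x y => ?_⟩
  have := kk_shift B (r⁻¹ • (x - x0)) (r⁻¹ • y)
  rw [← smul_add, norm_smul] at this
  convert this using 3
  · congr 1; abel
  · rw [Real.norm_of_nonneg (by positivity)]; congr 2; field_simp

lemma lintegral_comp_smul (f : V m → ℝ≥0∞) (hf : Measurable f) {r : ℝ} (hr : 0 < r) :
    ∫⁻ y, f (r • y) = ENNReal.ofReal ((r ^ m)⁻¹) * ∫⁻ z, f z := by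
  have h := Measure.map_addHaar_smul (volume : Measure (V m)) hr.ne'
  rw [← lintegral_map (μ := volume) hf (measurable_const_smul r), h, lintegral_smul_measure]
  simp [abs_of_pos hr]

lemma lintegral_affine (f : V m → ℝ≥0∞) (hf : Measurable f) {r : ℝ} (hr : 0 < r) (x : V m) :
    ∫⁻ y, f (x + r • y) = ENNReal.ofReal ((r ^ m)⁻¹) * ∫⁻ z, f z := by
  rw [lintegral_comp_smul (fun y => f (x + y)) (by fun_prop) hr, lintegral_add_left_eq_self]

lemma Av_eq (B : ℕ) {r : ℝ} (hr : 0 < r) {h : V m → ℝ≥0∞} (hh : Measurable h) (x : V m) :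
    Av B r h x = ENNReal.ofReal ((r ^ m)⁻¹) * ∫⁻ z, h z * kk B (r⁻¹ • (z - x)) := by
  rw [← lintegral_affine _ (by fun_prop) hr x]
  unfold Av
  apply lintegral_congr
  intro y
  simp [smul_smul, hr.ne']

lemma Av_meas (B : ℕ) (r : ℝ) {h : V m → ℝ≥0∞} (hh : Measurable h) : Measurable (Av B r h) := by
  unfold Av
  apply Measurable.lintegral_prod_right'  (f := fun p : V m × V m => h (p.1 + r • p.2) * kk B p.2)
  fun_prop

lemma Av_mono {B : ℕ} {r : ℝ} {h h' : V m → ℝ≥0∞} (H : ∀ x, h x ≤ h' x) (x : V m) :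
    Av B r h x ≤ Av B r h' x := by
  unfold Av; gcongr; exact H _

lemma Av_anti {B B' : ℕ} (hB : B ≤ B') {r : ℝ} {h : V m → ℝ≥0∞} (x : V m) :
    Av B' r h x ≤ Av B r h x := by
  unfold Av; gcongr; exact kk_anti hB _

lemma Av_const_mul (B : ℕ) {r : ℝ} {h : V m → ℝ≥0∞} (hh : Measurable h) (c : ℝ≥0∞) (x : V m) :
    Av B r (fun x => c * h x) x = c * Av B r h x := by
  unfold Av
  rw [← lintegral_const_mul _ (by fun_prop)]
  simp only [mul_assoc]

lemma Av_sum {ι : Type*} (B : ℕ) {r : ℝ} (s : Finset ι) {h : ι → V m → ℝ≥0∞}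
    (hh : ∀ i ∈ s, Measurable (h i)) (x : V m) :
    Av B r (fun x => ∑ i ∈ s, h i x) x = ∑ i ∈ s, Av B r (h i) x := by
  unfold Av
  simp only [Finset.sum_mul]
  rw [lintegral_finsetSum']
  intro i hi
  have := hh i hi
  fun_prop

/-- L1 -/
lemma Av_le_SV {A B : ℕ} {r s : ℝ} (hr : 0 < r) (hrs : r ≤ s) {W : V m → ℝ≥0∞} (hW : SV A s W)
    (x : V m) : Av (A + B) r W x ≤ (∫⁻ y : V m, kk B y) * W x := by
  unfold Av
  rw [← lintegral_mul_const _ (by fun_prop)]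
  apply lintegral_mono
  intro y
  have h := (hW.mono_r hr hrs).2 x (r • y)
  have e : ‖r • y‖ / r = ‖y‖ := by
    rw [norm_smul, Real.norm_of_nonneg hr.le]; field_simp
  rw [e] at h
  calc W (x + r • y) * kk (A + B) y ≤ (ENNReal.ofReal ((1 + ‖y‖) ^ A) * W x) * kk (A + B) y := by gcongr
    _ = (ENNReal.ofReal ((1 + ‖y‖) ^ A) * kk (A + B) y) * W x := by ring
    _ = _ := by rw [kk_add]

/-- L2 -/
lemma SV_le_Av {A B : ℕ} {r s : ℝ} (hr : 0 < r) (hrs : r ≤ s) {W : V m → ℝ≥0∞} (hW : SV A s W)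
    (x : V m) : (∫⁻ y : V m, kk (A + B) y) * W x ≤ Av B r W x := by
  unfold Av
  rw [← lintegral_mul_const _ (by fun_prop)]
  apply lintegral_mono
  intro y
  have h := (hW.mono_r hr hrs).rev x (r • y)
  have e : ‖r • y‖ / r = ‖y‖ := by
    rw [norm_smul, Real.norm_of_nonneg hr.le]; field_simp
  rw [e] at h
  calc kk (A + B) y * W x ≤ kk (A + B) y * (ENNReal.ofReal ((1 + ‖y‖) ^ A) * W (x + r • y)) := by gcongr
    _ = W (x + r • y) * (ENNReal.ofReal ((1 + ‖y‖) ^ A) * kk (A + B) y) := by ring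
    _ = _ := by rw [kk_add]

/-- L3 -/
lemma SV_Av (B : ℕ) {r : ℝ} (hr : 0 < r) {h : V m → ℝ≥0∞} (hh : Measurable h) : SV B r (Av B r h) := by
  refine ⟨Av_meas B r hh, fun x u => ?_⟩
  rw [Av_eq B hr hh, Av_eq B hr hh, ← mul_assoc, mul_comm (ENNReal.ofReal _) (ENNReal.ofReal _), mul_assoc]
  gcongr
  rw [← lintegral_const_mul _ (by fun_prop)]
  apply lintegral_mono
  intro z
  have := (SV_kk B hr x).2 z (-u)
  rw [norm_neg] at this
  have e : z - (x + u) = z + -u - x := by abel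
  calc h z * kk B (r⁻¹ • (z - (x + u))) ≤ h z * (ENNReal.ofReal ((1 + ‖u‖ / r) ^ B) * kk B (r⁻¹ • (z - x))) := by
        rw [e]; gcongr
    _ = _ := by ring

/-- L4 -/
lemma Av_symm (B : ℕ) (r : ℝ) {h W : V m → ℝ≥0∞} (hh : Measurable h) (hW : Measurable W) :
    ∫⁻ x, Av B r h x * W x = ∫⁻ x, h x * Av B r W x := by
  unfold Av
  have e1 : ∀ x, (∫⁻ y, h (x + r • y) * kk B y) * W x = ∫⁻ y, h (x + r • y) * kk B y * W x := by
    intro x; rw [lintegral_mul_const _ (by fun_prop)]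
  have e2 : ∀ x, h x * (∫⁻ y, W (x + r • y) * kk B y) = ∫⁻ y, h x * (W (x + r • y) * kk B y) := by
    intro x; rw [lintegral_const_mul _ (by fun_prop)]
  simp_rw [e1, e2]
  rw [lintegral_lintegral_swap (by fun_prop),
    lintegral_lintegral_swap (f := fun x y => h x * (W (x + r • y) * kk B y)) (by fun_prop)]
  rw [← lintegral_neg_eq_self]
  apply lintegral_congr
  intro y
  rw [← lintegral_add_right_eq_self _ (r • y)]
  apply lintegral_congr
  intro x
  rw [kk_neg]
  simp
  ring

lemma kk_conv_pt {B : ℕ} {ρ : ℝ} (hρ : 0 < ρ) (y z : V m) :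
    kk B y * kk B (z - ρ • y) ≤
      ENNReal.ofReal (2 ^ B) * kk B z * (kk B y + ENNReal.ofReal (ρ ^ B) * kk B (z - ρ • y)) := by
  have hy := norm_nonneg y
  have hz := norm_nonneg z
  have hn : ‖ρ • y‖ = ρ * ‖y‖ := by rw [norm_smul, Real.norm_of_nonneg hρ.le]
  by_cases hc : ρ * ‖y‖ ≤ (1 + ‖z‖) / 2
  · have : kk B (z - ρ • y) ≤ ENNReal.ofReal (2 ^ B) * kk B z := by
      unfold kk
      rw [← ENNReal.ofReal_mul (by positivity)]
      apply ENNReal.ofReal_le_ofReal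
      have h1 : ‖z‖ - ‖ρ • y‖ ≤ ‖z - ρ • y‖ := norm_sub_norm_le _ _
      rw [hn] at h1
      have : (1 + ‖z‖) / 2 ≤ 1 + ‖z - ρ • y‖ := by linarith
      have := inv_anti₀ (by positivity) (pow_le_pow_left₀ (by positivity) this B)
      rw [div_pow, inv_div] at this
      rwa [div_eq_mul_inv] at this
    calc _ ≤ kk B y * (ENNReal.ofReal (2 ^ B) * kk B z) := by gcongr
      _ = ENNReal.ofReal (2 ^ B) * kk B z * kk B y := by ring
      _ ≤ _ := by gcongr; exact le_self_add
  · push Not at hc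
    have : kk B y ≤ ENNReal.ofReal (2 ^ B) * kk B z * ENNReal.ofReal (ρ ^ B) := by
      unfold kk
      rw [← ENNReal.ofReal_mul (by positivity), ← ENNReal.ofReal_mul (by positivity)]
      apply ENNReal.ofReal_le_ofReal
      have : (1 + ‖z‖) / (2 * ρ) ≤ 1 + ‖y‖ := by
        rw [div_le_iff₀ (by positivity)]; nlinarith
      have := inv_anti₀ (by positivity) (pow_le_pow_left₀ (by positivity) this B)
      rw [div_pow, inv_div] at this
      refine this.trans (le_of_eq ?_)
      rw [mul_pow]; field_simp
    calc _ ≤ (ENNReal.ofReal (2 ^ B) * kk B z * ENNReal.ofReal (ρ ^ B)) * kk B (z - ρ • y) := by gcongr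
      _ = ENNReal.ofReal (2 ^ B) * kk B z * (ENNReal.ofReal (ρ ^ B) * kk B (z - ρ • y)) := by ring
      _ ≤ _ := by gcongr; exact le_add_self

lemma kk_conv {B : ℕ} (hB : m ≤ B) {ρ : ℝ} (hρ : 0 < ρ) (hρ1 : ρ ≤ 1) (z : V m) :
    ∫⁻ y, kk B y * kk B (z - ρ • y) ≤
      (ENNReal.ofReal (2 ^ B) * 2 * ∫⁻ y : V m, kk B y) * kk B z := by
  calc _ ≤ ∫⁻ y, ENNReal.ofReal (2 ^ B) * kk B z * (kk B y + ENNReal.ofReal (ρ ^ B) * kk B (z - ρ • y)) :=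
        lintegral_mono fun y => kk_conv_pt hρ y z
    _ = ENNReal.ofReal (2 ^ B) * kk B z * ((∫⁻ y : V m, kk B y) +
          ENNReal.ofReal (ρ ^ B) * ∫⁻ y, kk B (z - ρ • y)) := by
        rw [lintegral_const_mul _ (by fun_prop), lintegral_add_left (by fun_prop),
          lintegral_const_mul _ (by fun_prop)]
    _ ≤ ENNReal.ofReal (2 ^ B) * kk B z * ((∫⁻ y : V m, kk B y) + ∫⁻ y : V m, kk B y) := by
        gcongr
        have : ∫⁻ y, kk B (z - ρ • y) = ENNReal.ofReal ((ρ ^ m)⁻¹) * ∫⁻ y : V m, kk B y := by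
          rw [← lintegral_affine _ (by fun_prop) hρ (-z)]
          apply lintegral_congr
          intro y
          rw [← kk_neg]; congr 1; abel
        rw [this, ← mul_assoc, ← ENNReal.ofReal_mul (by positivity)]
        calc _ ≤ 1 * ∫⁻ y : V m, kk B y := by
              gcongr
              rw [ENNReal.ofReal_le_one, ← div_eq_mul_inv, div_le_one (by positivity)]
              exact pow_le_pow_of_le_one hρ.le hρ1 hB
          _ = _ := one_mul _
    _ = _ := by ring

/-- L6 -/
lemma Av_Av {B : ℕ} (hB : m ≤ B) {r l : ℝ} (hr : 0 < r) (hrl : r ≤ l) {h : V m → ℝ≥0∞}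
    (hh : Measurable h) (x : V m) :
    Av B r (Av B l h) x ≤ (ENNReal.ofReal (2 ^ B) * 2 * ∫⁻ y : V m, kk B y) * Av B l h x := by
  have hl : 0 < l := hr.trans_le hrl
  have e : Av B r (Av B l h) x = ∫⁻ z, h (x + l • z) * ∫⁻ y, kk B y * kk B (z - (r / l) • y) := by
    calc Av B r (Av B l h) x = ∫⁻ y, (∫⁻ z, h (x + l • z) * kk B (z - (r / l) • y)) * kk B y := by
          unfold Av
          apply lintegral_congr
          intro y
          congr 1
          rw [← lintegral_add_right_eq_self (fun z => h (x + l • z) * kk B (z - (r / l) • y)) ((r / l) • y)]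
          apply lintegral_congr
          intro z
          have e1 : l • (z + (r / l) • y) = r • y + l • z := by
            rw [smul_add, smul_smul, mul_div_cancel₀ _ hl.ne', add_comm]
          simp only [e1, add_sub_cancel_right, add_assoc]
      _ = ∫⁻ y, ∫⁻ z, h (x + l • z) * (kk B y * kk B (z - (r / l) • y)) := by
          apply lintegral_congr
          intro y
          rw [← lintegral_mul_const _ (by fun_prop)]
          apply lintegral_congr
          intro z
          ring
      _ = ∫⁻ z, ∫⁻ y, h (x + l • z) * (kk B y * kk B (z - (r / l) • y)) :=
          lintegral_lintegral_swap (by fun_prop)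
      _ = _ := by
          apply lintegral_congr
          intro z
          rw [lintegral_const_mul _ (by fun_prop)]
  rw [e]
  unfold Av
  rw [← lintegral_const_mul _ (by fun_prop)]
  apply lintegral_mono
  intro z
  calc _ ≤ h (x + l • z) * ((ENNReal.ofReal (2 ^ B) * 2 * ∫⁻ y : V m, kk B y) * kk B z) :=
        mul_le_mul' le_rfl (kk_conv hB (by positivity) ((div_le_one hl).2 hrl) z)
    _ = _ := by ring

/-- averages commute -/
lemma Av_comm (B B' : ℕ) (r l : ℝ) {h : V m → ℝ≥0∞} (hh : Measurable h) (x : V m) :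
    Av B r (Av B' l h) x = Av B' l (Av B r h) x := by
  unfold Av
  have e1 : ∀ y, (∫⁻ z, h (x + r • y + l • z) * kk B' z) * kk B y
      = ∫⁻ z, h (x + r • y + l • z) * kk B' z * kk B y := by
    intro y; rw [lintegral_mul_const _ (by fun_prop)]
  have e2 : ∀ y, (∫⁻ z, h (x + l • y + r • z) * kk B z) * kk B' y
      = ∫⁻ z, h (x + l • y + r • z) * kk B z * kk B' y := by
    intro y; rw [lintegral_mul_const _ (by fun_prop)]
  simp_rw [e1, e2]
  rw [lintegral_lintegral_swap (by fun_prop)]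
  apply lintegral_congr; intro z
  apply lintegral_congr; intro y
  rw [show x + r • y + l • z = x + l • z + r • y by abel]
  ring

/-- Hölder: power of average -/
lemma lintegral_rpow_le {α : Type*} [MeasurableSpace α] (μ : Measure α) {f w : α → ℝ≥0∞}
    (hf : Measurable f) (hw : Measurable w) {s : ℝ} (hs : 1 ≤ s) :
    (∫⁻ x, f x * w x ∂μ) ^ s ≤ (∫⁻ x, w x ∂μ) ^ (s - 1) * ∫⁻ x, f x ^ s * w x ∂μ := by
  rcases eq_or_lt_of_le hs with rfl | hs
  · simp
  have hc : s.HolderConjugate (s / (s - 1)) := Real.HolderConjugate.conjExponent hs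
  have hp := hc.pos
  have hq := hc.symm.pos
  have key := ENNReal.lintegral_mul_le_Lp_mul_Lq μ hc (f := fun x => f x * w x ^ (1 / s))
    (g := fun x => w x ^ (1 / (s / (s - 1)))) (by fun_prop) (by fun_prop)
  have e0 : ∀ x, (f x * w x ^ (1 / s)) * w x ^ (1 / (s / (s - 1))) = f x * w x := by
    intro x
    rw [mul_assoc, ← ENNReal.rpow_add_of_nonneg _ _ (by positivity) (by positivity)]
    have : 1 / s + 1 / (s / (s - 1)) = 1 := by
      have := hc.inv_add_inv_eq_one; simpa using this
    rw [this, ENNReal.rpow_one]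
  have e1 : ∀ x, (f x * w x ^ (1 / s)) ^ s = f x ^ s * w x := by
    intro x
    rw [ENNReal.mul_rpow_of_nonneg _ _ hp.le, ← ENNReal.rpow_mul]
    have : 1 / s * s = 1 := by field_simp
    rw [this, ENNReal.rpow_one]
  have e2 : ∀ x, (w x ^ (1 / (s / (s - 1)))) ^ (s / (s - 1)) = w x := by
    intro x
    rw [← ENNReal.rpow_mul, one_div, inv_mul_cancel₀ hq.ne', ENNReal.rpow_one]
  simp only [Pi.mul_apply, e0, e1, e2] at key
  calc _ ≤ ((∫⁻ x, f x ^ s * w x ∂μ) ^ (1 / s) * (∫⁻ x, w x ∂μ) ^ (1 / (s / (s - 1)))) ^ s := by gcongr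
    _ = _ := by
      rw [ENNReal.mul_rpow_of_nonneg _ _ hp.le, ← ENNReal.rpow_mul, ← ENNReal.rpow_mul]
      have h1 : 1 / s * s = 1 := by field_simp
      have h2 : 1 / (s / (s - 1)) * s = s - 1 := by field_simp
      rw [h1, h2, ENNReal.rpow_one, mul_comm]

end QPS

namespace QPS
set_option linter.all false
open scoped ENNReal NNReal BigOperators FourierTransform SchwartzMap ComplexConjugate
variable {m : ℕ}

noncomputable def ch (l : V m) (x : V m) : ℂ :=
  Complex.exp (Complex.I * ((∑ i, l i * x i : ℝ) : ℂ))

noncomputable def TP (S : Set (V m)) : Submodule ℂ (V m → ℂ) := Submodule.span ℂ (Set.image ch S)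

lemma ch_norm (l x : V m) : ‖ch l x‖ = 1 := by
  unfold ch; rw [mul_comm]; exact Complex.norm_exp_ofReal_mul_I _

lemma ch_add (l x y : V m) : ch l (x + y) = ch l x * ch l y := by
  unfold ch
  rw [← Complex.exp_add]
  congr 1
  simp only [Pi.add_apply, mul_add, Finset.sum_add_distrib]
  push_cast; ring

lemma ch_add_left (l k x : V m) : ch (l + k) x = ch l x * ch k x := by
  unfold ch
  rw [← Complex.exp_add]
  congr 1
  simp only [Pi.add_apply, add_mul, Finset.sum_add_distrib]
  push_cast; ring

lemma ch_conj (l x : V m) : conj (ch l x) = ch (-l) x := by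
  unfold ch
  rw [← Complex.exp_conj]
  simp

@[fun_prop]
lemma ch_cont (l : V m) : Continuous (ch l) := by
  unfold ch; fun_prop

lemma ch_mem {S : Set (V m)} {l : V m} (h : l ∈ S) : ch l ∈ TP S :=
  Submodule.subset_span ⟨l, h, rfl⟩

lemma TP_mono {S S' : Set (V m)} (h : S ⊆ S') : TP S ≤ TP S' :=
  Submodule.span_mono (Set.image_mono h)

lemma TP_cont {S : Set (V m)} {f : V m → ℂ} (hf : f ∈ TP S) : Continuous f := by
  induction hf using Submodule.span_induction with
  | mem f hf => obtain ⟨l, -, rfl⟩ := hf; exact ch_cont l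
  | zero => exact continuous_zero
  | add f g _ _ hf hg => exact hf.add hg
  | smul a f _ hf => exact hf.const_smul a

lemma TP_bdd {S : Set (V m)} {f : V m → ℂ} (hf : f ∈ TP S) : ∃ C : ℝ, ∀ x, ‖f x‖ ≤ C := by
  induction hf using Submodule.span_induction with
  | mem f hf => obtain ⟨l, -, rfl⟩ := hf; exact ⟨1, fun x => (ch_norm l x).le⟩
  | zero => exact ⟨0, fun x => by simp⟩
  | add f g _ _ hf hg =>
    obtain ⟨C, hC⟩ := hf; obtain ⟨D, hD⟩ := hg
    exact ⟨C + D, fun x => (norm_add_le _ _).trans (add_le_add (hC x) (hD x))⟩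
  | smul a f _ hf =>
    obtain ⟨C, hC⟩ := hf
    exact ⟨‖a‖ * C, fun x => by
      simp only [Pi.smul_apply, smul_eq_mul, norm_mul]
      exact mul_le_mul_of_nonneg_left (hC x) (norm_nonneg _)⟩

lemma TP_meas {S : Set (V m)} {f : V m → ℂ} (hf : f ∈ TP S) : Measurable f := (TP_cont hf).measurable

lemma TP_comp {m' : ℕ} {S : Set (V m)} {S' : Set (V m')} {f : V m → ℂ} (hf : f ∈ TP S)
    (T : V m' → V m) (g : V m → V m') (hg : ∀ l x, ∑ i, l i * T x i = ∑ j, g l j * x j)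
    (x0 : V m) (k : V m') (hS : ∀ l ∈ S, g l + k ∈ S') :
    (fun x => ch k x * f (x0 + T x)) ∈ TP S' := by
  induction hf using Submodule.span_induction with
  | mem f hf =>
    obtain ⟨l, hl, rfl⟩ := hf
    have : (fun x => ch k x * ch l (x0 + T x)) = ch l x0 • ch (g l + k) := by
      ext x
      simp only [Pi.smul_apply, smul_eq_mul]
      rw [ch_add, ch_add_left]
      have : ch l (T x) = ch (g l) x := by unfold ch; rw [hg]
      rw [this]; ring
    rw [this]
    exact Submodule.smul_mem _ _ (ch_mem (hS l hl))
  | zero =>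
    convert Submodule.zero_mem (TP S') using 1
    ext x; simp
  | add f f' _ _ hf hf' =>
    convert Submodule.add_mem _ hf hf' using 1
    ext x; simp [mul_add]
  | smul a f _ hf =>
    convert Submodule.smul_mem _ a hf using 1
    ext x; simp; ring

lemma schwartz_decay (f : 𝓢(ℝ, ℂ)) (B : ℕ) : ∃ C : ℝ, 0 < C ∧ ∀ x, ‖f x‖ ≤ C * ((1 + |x|) ^ B)⁻¹ := by
  refine ⟨2 ^ B * ((Finset.Iic (B, 0)).sup (fun m => SchwartzMap.seminorm ℝ m.1 m.2)) f + 1, by positivity, fun x => ?_⟩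
  have h := SchwartzMap.one_add_le_sup_seminorm_apply (𝕜 := ℝ) (m := (B, 0)) le_rfl le_rfl f x
  rw [norm_iteratedFDeriv_zero, Real.norm_eq_abs] at h
  rw [← div_eq_mul_inv, le_div_iff₀ (by positivity)]
  linarith

lemma exists_psi (C0 : ℝ) (hC0 : 0 < C0) : ∃ ψ : ℝ → ℂ, Continuous ψ ∧
    (∀ B : ℕ, ∃ C : ℝ, 0 < C ∧ ∀ x, ‖ψ x‖ ≤ C * ((1 + |x|) ^ B)⁻¹) ∧
    ∀ l : ℝ, |l| ≤ C0 → ∫ x, ψ x * Complex.exp (Complex.I * ((l * x : ℝ) : ℂ)) = 1 := by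
  let b : ContDiffBump (0 : ℝ) := ⟨C0, C0 + 1, hC0, by linarith⟩
  let bc : ℝ → ℂ := fun x => ((b x : ℝ) : ℂ)
  have h1 : HasCompactSupport bc := b.hasCompactSupport.comp_left (g := fun x : ℝ => (x : ℂ)) (by simp)
  have h2 : ContDiff ℝ (⊤ : ℕ∞) bc := Complex.ofRealCLM.contDiff.comp b.contDiff
  let χ : 𝓢(ℝ, ℂ) := h1.toSchwartzMap h2
  refine ⟨((𝓕⁻ χ : 𝓢(ℝ, ℂ)) : ℝ → ℂ), (𝓕⁻ χ : 𝓢(ℝ, ℂ)).continuous, schwartz_decay _, fun l hl => ?_⟩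
  have e : 𝓕 (𝓕⁻ χ) = χ := FourierTransform.fourier_fourierInv_eq χ
  have e2 : (𝓕 (𝓕⁻ χ)) (-(l / (2 * Real.pi))) = χ (-(l / (2 * Real.pi))) := by rw [e]
  rw [SchwartzMap.fourier_coe, Real.fourier_real_eq_integral_exp_smul] at e2
  have e3 : χ (-(l / (2 * Real.pi))) = 1 := by
    show ((b _ : ℝ) : ℂ) = 1
    rw [b.one_of_mem_closedBall]; · simp
    rw [mem_closedBall_zero_iff, norm_neg, norm_div, Real.norm_eq_abs]
    apply le_trans (div_le_self (abs_nonneg _) _) hl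
    rw [Real.norm_of_nonneg (by positivity)]
    nlinarith [Real.pi_gt_three]
  rw [e3] at e2
  rw [← e2]
  congr 1; ext x
  rw [smul_eq_mul, mul_comm]
  congr 2
  have : Real.pi ≠ 0 := Real.pi_ne_zero
  rw [mul_comm Complex.I]; congr 2
  field_simp

lemma exists_phi : ∃ φ : ℝ → ℝ, Continuous φ ∧ (∀ x, 0 ≤ φ x) ∧ 0 < φ 0 ∧
    (∀ B : ℕ, ∃ C : ℝ, 0 < C ∧ ∀ x, φ x ≤ C * ((1 + |x|) ^ B)⁻¹) ∧
    ∀ l : ℝ, 1 ≤ |l| → ∫ x, (φ x : ℂ) * Complex.exp (Complex.I * ((l * x : ℝ) : ℂ)) = 0 := by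
  have hp := Real.pi_pos
  let b : ContDiffBump (0 : ℝ) := ⟨1 / (8 * Real.pi), 1 / (4 * Real.pi), by positivity, by
    apply one_div_lt_one_div_of_lt <;> nlinarith⟩
  let bc : ℝ → ℝ → ℂ := fun a x => ((b (x + a) : ℝ) : ℂ)
  have h1 : ∀ a, HasCompactSupport (bc a) := fun a =>
    (b.hasCompactSupport.comp_left (g := fun x : ℝ => (x : ℂ)) (by simp)).comp_homeomorph (Homeomorph.addRight a)
  have h2 : ∀ a, ContDiff ℝ (⊤ : ℕ∞) (bc a) := fun a =>
    Complex.ofRealCLM.contDiff.comp (b.contDiff.comp (by fun_prop))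
  let χ : ℝ → 𝓢(ℝ, ℂ) := fun a => (h1 a).toSchwartzMap (h2 a)
  let g : 𝓢(ℝ, ℂ) := 𝓕 (χ 0)
  have hg : ∀ a x, (𝓕 (χ a)) x = Complex.exp (((2 * Real.pi * a * x : ℝ) : ℂ) * Complex.I) * g x := by
    intro a x
    show (𝓕 (χ a)) x = _ * (𝓕 (χ 0)) x
    rw [SchwartzMap.fourier_coe, SchwartzMap.fourier_coe, Real.fourier_real_eq_integral_exp_smul,
      Real.fourier_real_eq_integral_exp_smul, ← integral_const_mul,
      ← integral_add_right_eq_self (μ := volume) (fun v : ℝ => Complex.exp (((2 * Real.pi * a * x : ℝ) : ℂ) * Complex.I) *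
        (Complex.exp (((-2 * Real.pi * v * x : ℝ) : ℂ) * Complex.I) • (χ 0) v)) a]
    congr 1; ext v
    have : χ a v = χ 0 (v + a) := by
      show ((b (v + a) : ℝ) : ℂ) = ((b (v + a + 0) : ℝ) : ℂ)
      rw [add_zero]
    rw [this, smul_eq_mul, smul_eq_mul, ← mul_assoc, ← Complex.exp_add]
    congr 2
    push_cast; ring
  refine ⟨fun x => ‖g x‖ ^ 2, by have := g.continuous; fun_prop, fun x => by positivity, ?_, ?_, ?_⟩
  · have : g 0 = ∫ v, χ 0 v := by
      show (𝓕 (χ 0)) 0 = _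
      rw [SchwartzMap.fourier_coe, Real.fourier_real_eq_integral_exp_smul]
      simp
    have h0 : g 0 = ((∫ v, b v : ℝ) : ℂ) := by
      rw [this, ← integral_complex_ofReal]
      congr 1; ext v
      show ((b (v + 0) : ℝ) : ℂ) = _
      rw [add_zero]
    show 0 < ‖g 0‖ ^ 2
    have := b.integral_pos (μ := volume)
    rw [h0, Complex.norm_real, Real.norm_of_nonneg this.le]
    positivity
  · intro B
    obtain ⟨C, hC, h⟩ := schwartz_decay g B
    refine ⟨C ^ 2, by positivity, fun x => ?_⟩
    show ‖g x‖ ^ 2 ≤ _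
    calc ‖g x‖ ^ 2 ≤ (C * ((1 + |x|) ^ B)⁻¹) ^ 2 := by gcongr; exact h x
      _ = C ^ 2 * (((1 + |x|) ^ B)⁻¹ * ((1 + |x|) ^ B)⁻¹) := by ring
      _ ≤ C ^ 2 * (((1 + |x|) ^ B)⁻¹ * 1) := by
        gcongr
        apply inv_le_one_of_one_le₀
        apply one_le_pow₀
        linarith [abs_nonneg x]
      _ = _ := by ring
  · intro l hl
    set a := l / (2 * Real.pi) with ha
    have key := SchwartzMap.integral_inner_fourier_fourier (χ 0) (χ a)
    have z : ∫ x, inner ℂ (χ 0 x) (χ a x) = 0 := by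
      have : ∀ x, inner ℂ (χ 0 x) (χ a x) = 0 := by
        intro x
        by_contra hne
        have n1 : χ 0 x ≠ 0 := fun h => hne (by simp [h])
        have n2 : χ a x ≠ 0 := fun h => hne (by simp [h])
        have n1' : b (x + 0) ≠ 0 := fun h => n1 (by show ((b (x + 0) : ℝ) : ℂ) = 0; rw [h]; simp)
        have n2' : b (x + a) ≠ 0 := fun h => n2 (by show ((b (x + a) : ℝ) : ℂ) = 0; rw [h]; simp)
        rw [← Function.mem_support, b.support_eq, mem_ball_zero_iff, Real.norm_eq_abs] at n1' n2'
        change |x + 0| < 1 / (4 * Real.pi) at n1'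
        change |x + a| < 1 / (4 * Real.pi) at n2'
        have h3 : |a| < 1 / (2 * Real.pi) := by
          have : |a| ≤ |x + a| + |x + 0| := by
            have := abs_sub (x + a) (x + 0)
            simpa using this
          have e : 1 / (4 * Real.pi) + 1 / (4 * Real.pi) = 1 / (2 * Real.pi) := by field_simp; norm_num
          linarith
        rw [ha, abs_div, abs_of_pos (by positivity : (0 : ℝ) < 2 * Real.pi)] at h3
        rw [div_lt_div_iff_of_pos_right (by positivity)] at h3
        linarith
      simp only [this, integral_zero]
    rw [z] at key
    rw [← key]
    congr 1; ext x
    rw [hg a x, hg 0 x]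
    simp only [mul_zero, zero_mul, Complex.ofReal_zero, Complex.exp_zero, one_mul, RCLike.inner_apply]
    rw [mul_assoc, Complex.mul_conj, Complex.normSq_eq_norm_sq, mul_comm]
    congr 2
    rw [mul_comm, ha]; congr 2
    field_simp

lemma prod_decay (C : ℝ) (hC : 0 < C) (B : ℕ) (y : V m) :
    ∏ i, (C * ((1 + |y i|) ^ B)⁻¹) ≤ C ^ m * ((1 + ‖y‖) ^ B)⁻¹ := by
  rw [Finset.prod_mul_distrib]
  simp only [Finset.prod_const, Finset.card_univ, Fintype.card_fin]
  gcongr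
  rw [Finset.prod_inv_distrib, Finset.prod_pow]
  apply inv_anti₀ (by positivity)
  gcongr
  have h1 : ∀ i, (1 : ℝ) ≤ 1 + |y i| := fun i => by linarith [abs_nonneg (y i)]
  have h2' : ∀ s : Finset (Fin m), (1 : ℝ) ≤ ∏ i ∈ s, (1 + |y i|) := fun s => by
    have := Finset.prod_le_prod (s := s) (fun i _ => zero_le_one) (fun i _ => h1 i)
    simpa using this
  have h2 := h2' Finset.univ
  have : ‖y‖ ≤ ∏ i, (1 + |y i|) - 1 := by
    rw [pi_norm_le_iff_of_nonneg (by linarith)]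
    intro i
    have : (1 + |y i|) ≤ ∏ i, (1 + |y i|) := by
      rw [← Finset.mul_prod_erase _ _ (Finset.mem_univ i)]
      exact le_mul_of_one_le_right (by positivity) (h2' _)
    rw [Real.norm_eq_abs]; linarith
  linarith

end QPS

namespace QPS
set_option linter.all false
open scoped ENNReal NNReal BigOperators FourierTransform SchwartzMap ComplexConjugate
variable {m : ℕ}

lemma integrable_of_decay {E : Type*} [NormedAddCommGroup E] {P : V m → E} (hP : Continuous P) {C : ℝ}
    (h : ∀ y, ‖P y‖ ≤ C * ((1 + ‖y‖) ^ (m + 1))⁻¹) : Integrable P := by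
  have h0 : Integrable (fun y : V m => C * (1 + ‖y‖) ^ (-((m + 1 : ℕ) : ℝ))) :=
    (integrable_one_add_norm (by simp)).const_mul C
  refine h0.mono' hP.aestronglyMeasurable (Eventually.of_forall fun y => (h y).trans (le_of_eq ?_))
  rw [Real.rpow_neg (by positivity), Real.rpow_natCast]

lemma integrable_mul_TP {P : V m → ℂ} (hP : Integrable P) {S : Set (V m)} {f : V m → ℂ}
    (hf : f ∈ TP S) (x : V m) : Integrable (fun y => P y * f (x + y)) := by
  obtain ⟨C, hC⟩ := TP_bdd hf
  have := TP_cont hf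
  exact hP.mul_bdd (c := C) (by fun_prop) (Eventually.of_forall fun y => hC _)

lemma repro (C0 : ℝ) (hC0 : 0 < C0) (B : ℕ) : ∃ P : V m → ℂ, Continuous P ∧ (∃ C : ℝ, 0 < C ∧
    ∀ y, ‖P y‖ ≤ C * ((1 + ‖y‖) ^ B)⁻¹) ∧ Integrable P ∧
    ∀ f ∈ TP {l : V m | ∀ i, |l i| ≤ C0}, ∀ x, f x = ∫ y, P y * f (x + y) := by
  obtain ⟨ψ, hc, hd, hI⟩ := exists_psi C0 hC0
  have hbd : ∀ B : ℕ, ∃ C : ℝ, 0 < C ∧ ∀ y : V m, ‖∏ i, ψ (y i)‖ ≤ C * ((1 + ‖y‖) ^ B)⁻¹ := by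
    intro B
    obtain ⟨C, hC, h⟩ := hd B
    refine ⟨C ^ m, by positivity, fun y => ?_⟩
    rw [norm_prod]
    exact (Finset.prod_le_prod (fun i _ => norm_nonneg _) (fun i _ => h (y i))).trans (prod_decay C hC B y)
  have hcont : Continuous (fun y : V m => ∏ i, ψ (y i)) := by fun_prop
  have hitg : Integrable (fun y : V m => ∏ i, ψ (y i)) := by
    obtain ⟨C, -, h⟩ := hbd (m + 1)
    exact integrable_of_decay hcont h
  refine ⟨_, hcont, hbd B, hitg, fun f hf x => ?_⟩
  induction hf using Submodule.span_induction with
  | mem f hf =>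
    obtain ⟨l, hl, rfl⟩ := hf
    have : ∀ y, (∏ i, ψ (y i)) * ch l (x + y) = ch l x * ∏ i, (ψ (y i) * Complex.exp (Complex.I * ((l i * y i : ℝ) : ℂ))) := by
      intro y
      rw [ch_add, Finset.prod_mul_distrib, ← Complex.exp_sum, ← Finset.mul_sum, ← Complex.ofReal_sum]
      unfold ch; ring
    simp_rw [this]
    rw [integral_const_mul, integral_fintype_prod_volume_eq_prod (fun i (t : ℝ) => ψ t * Complex.exp (Complex.I * ((l i * t : ℝ) : ℂ)))]
    simp [hI _ (hl _)]
    rw [Finset.prod_eq_one, mul_one]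
    intro i _
    have := hI _ (hl i)
    push_cast at this
    exact this
  | zero => simp
  | add f g hf' hg' hf hg =>
    simp only [Pi.add_apply, mul_add]
    rw [integral_add (integrable_mul_TP hitg hf' x) (integrable_mul_TP hitg hg' x), ← hf, ← hg]
  | smul a f hf' hf =>
    simp only [Pi.smul_apply, smul_eq_mul]
    rw [hf, ← integral_const_mul]
    congr 1; ext y; ring

lemma LC (C0 : ℝ) (hC0 : 0 < C0) (B : ℕ) (s : ℝ) (hs : 1 ≤ s) : ∃ C : ℝ≥0∞, C ≠ ∞ ∧
    ∀ f ∈ TP {l : V m | ∀ i, |l i| ≤ C0}, ∀ x,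
      ‖f x‖ₑ ^ s ≤ C * ∫⁻ y, ‖f (x + y)‖ₑ ^ s * kk B y := by
  obtain ⟨P, hP, ⟨C, hC, hd⟩, hitg, hrep⟩ := repro (m := m) C0 hC0 (B + (m + 1))
  refine ⟨ENNReal.ofReal C ^ s * (∫⁻ y : V m, kk (B + (m + 1)) y) ^ (s - 1), ?_, fun f hf x => ?_⟩
  · apply ENNReal.mul_ne_top
    · exact ENNReal.rpow_ne_top_of_nonneg (by linarith) ENNReal.ofReal_ne_top
    · exact ENNReal.rpow_ne_top_of_nonneg (by linarith) (kk_integrable (by omega))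
  have hfm := TP_meas hf
  have h1 : ‖f x‖ₑ ≤ ENNReal.ofReal C * ∫⁻ y, ‖f (x + y)‖ₑ * kk (B + (m + 1)) y := by
    conv_lhs => rw [hrep f hf x]
    refine (enorm_integral_le_lintegral_enorm _).trans ?_
    rw [← lintegral_const_mul _ (by fun_prop)]
    apply lintegral_mono
    intro y
    simp only [enorm_mul]
    have : ‖P y‖ₑ ≤ ENNReal.ofReal C * kk (B + (m + 1)) y := by
      unfold kk
      rw [← ENNReal.ofReal_mul hC.le, ← ofReal_norm_eq_enorm]
      exact ENNReal.ofReal_le_ofReal (hd y)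
    calc _ ≤ (ENNReal.ofReal C * kk (B + (m + 1)) y) * ‖f (x + y)‖ₑ := by gcongr
      _ = _ := by ring
  calc ‖f x‖ₑ ^ s ≤ (ENNReal.ofReal C * ∫⁻ y, ‖f (x + y)‖ₑ * kk (B + (m + 1)) y) ^ s := by gcongr
    _ = ENNReal.ofReal C ^ s * (∫⁻ y, ‖f (x + y)‖ₑ * kk (B + (m + 1)) y) ^ s := by
      rw [ENNReal.mul_rpow_of_nonneg _ _ (by linarith)]
    _ ≤ ENNReal.ofReal C ^ s * ((∫⁻ y : V m, kk (B + (m + 1)) y) ^ (s - 1) *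
          ∫⁻ y, ‖f (x + y)‖ₑ ^ s * kk (B + (m + 1)) y) := by
      gcongr
      exact lintegral_rpow_le volume (by fun_prop) (by fun_prop) hs
    _ ≤ ENNReal.ofReal C ^ s * ((∫⁻ y : V m, kk (B + (m + 1)) y) ^ (s - 1) *
          ∫⁻ y, ‖f (x + y)‖ₑ ^ s * kk B y) := by
      gcongr with y
      exact kk_anti (by omega) y
    _ = _ := by ring

/-- The L² orthogonality kernel -/
lemma exists_Phi : ∃ P : V m → ℝ, Continuous P ∧ (∀ x, 0 ≤ P x) ∧ 0 < P 0 ∧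
    (∀ B : ℕ, ∃ C : ℝ, 0 < C ∧ ∀ y, P y ≤ C * ((1 + ‖y‖) ^ B)⁻¹) ∧ Integrable P ∧
    ∀ S S' : Set (V m), (∀ l ∈ S, ∀ l' ∈ S', ∃ i, 1 ≤ |l i - l' i|) → ∀ f ∈ TP S, ∀ g ∈ TP S',
      ∫ y, (P y : ℂ) * (f y * conj (g y)) = 0 := by
  obtain ⟨φ, hc, h0, hpos, hd, hI⟩ := exists_phi
  have hbd : ∀ B : ℕ, ∃ C : ℝ, 0 < C ∧ ∀ y : V m, ∏ i, φ (y i) ≤ C * ((1 + ‖y‖) ^ B)⁻¹ := by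
    intro B
    obtain ⟨C, hC, h⟩ := hd B
    refine ⟨C ^ m, by positivity, fun y => ?_⟩
    exact (Finset.prod_le_prod (fun i _ => h0 _) (fun i _ => h (y i))).trans (prod_decay C hC B y)
  have hnn : ∀ y : V m, 0 ≤ ∏ i, φ (y i) := fun y => Finset.prod_nonneg fun i _ => h0 _
  have hcont : Continuous (fun y : V m => ∏ i, φ (y i)) := by fun_prop
  have hitg : Integrable (fun y : V m => ∏ i, φ (y i)) := by
    obtain ⟨C, -, h⟩ := hbd (m + 1)
    refine integrable_of_decay hcont (C := C) fun y => ?_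
    rw [Real.norm_of_nonneg (hnn y)]; exact h y
  refine ⟨_, hcont, hnn, Finset.prod_pos fun i _ => hpos, hbd, hitg, fun S S' hSS f hf g hg => ?_⟩
  have hintC : Integrable (fun y : V m => ((∏ i, φ (y i) : ℝ) : ℂ)) := hitg.ofReal
  have hI2 : ∀ f ∈ TP S, ∀ g ∈ TP S', Integrable (fun y => ((∏ i, φ (y i) : ℝ) : ℂ) * (f y * conj (g y))) := by
    intro f hf g hg
    obtain ⟨C, hC⟩ := TP_bdd hf
    obtain ⟨D, hD⟩ := TP_bdd hg
    have c1 := TP_cont hf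
    have c2 := TP_cont hg
    refine hintC.mul_bdd (c := C * D) (by fun_prop) (Eventually.of_forall fun y => ?_)
    rw [norm_mul, RCLike.norm_conj]
    exact mul_le_mul (hC y) (hD y) (norm_nonneg _) ((norm_nonneg _).trans (hC y))
  induction hf using Submodule.span_induction with
  | mem f hf =>
    obtain ⟨l, hl, rfl⟩ := hf
    induction hg using Submodule.span_induction with
    | mem g hg =>
      obtain ⟨l', hl', rfl⟩ := hg
      obtain ⟨i, hi⟩ := hSS l hl l' hl'
      have : ∀ y : V m, ((∏ i, φ (y i) : ℝ) : ℂ) * (ch l y * conj (ch l' y)) =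
          ∏ i, ((φ (y i) : ℂ) * Complex.exp (Complex.I * (((l i - l' i) * y i : ℝ) : ℂ))) := by
        intro y
        rw [ch_conj, ← ch_add_left, Finset.prod_mul_distrib, ← Complex.exp_sum, ← Finset.mul_sum, ← Complex.ofReal_sum]
        unfold ch
        push_cast
        simp [sub_eq_add_neg]
      simp_rw [this]
      rw [integral_fintype_prod_volume_eq_prod (fun i (t : ℝ) => (φ t : ℂ) * Complex.exp (Complex.I * (((l i - l' i) * t : ℝ) : ℂ)))]
      exact Finset.prod_eq_zero (Finset.mem_univ i) (hI _ hi)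
    | zero => simp
    | add g g' hg1 hg2 hg hg' =>
      simp only [Pi.add_apply, map_add, mul_add]
      rw [integral_add (hI2 _ (ch_mem hl) g hg1) (hI2 _ (ch_mem hl) g' hg2), hg, hg', add_zero]
    | smul a g hg1 hg =>
      have : ∀ y : V m, ((∏ i, φ (y i) : ℝ) : ℂ) * (ch l y * conj ((a • g) y)) = conj a * (((∏ i, φ (y i) : ℝ) : ℂ) * (ch l y * conj (g y))) := by
        intro y; simp; ring
      simp_rw [this]
      rw [integral_const_mul, hg, mul_zero]
  | zero => simp
  | add f f' hf1 hf2 hf hf' =>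
    simp only [Pi.add_apply, add_mul, mul_add]
    rw [integral_add (hI2 _ hf1 g hg) (hI2 _ hf2 g hg), hf, hf', add_zero]
  | smul a f hf1 hf =>
    have : ∀ y : V m, ((∏ i, φ (y i) : ℝ) : ℂ) * ((a • f) y * conj (g y)) = a * (((∏ i, φ (y i) : ℝ) : ℂ) * (f y * conj (g y))) := by
      intro y; simp; ring
    simp_rw [this]
    rw [integral_const_mul, hf, mul_zero]

end QPS

namespace QPS
set_option linter.all false
open scoped ENNReal NNReal BigOperators FourierTransform SchwartzMap ComplexConjugate
variable {m : ℕ}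

/-- weighted q-th power integral -/
noncomputable def II (q : ℝ) (W : V m → ℝ≥0∞) (f : V m → ℂ) : ℝ≥0∞ := ∫⁻ x, ‖f x‖ₑ ^ q * W x

lemma TP_sum {κ : Type*} {S : Set (V m)} (T : Finset κ) {f : κ → V m → ℂ} (hf : ∀ k ∈ T, f k ∈ TP S) :
    (fun y => ∑ k ∈ T, f k y) ∈ TP S := by
  have := Submodule.sum_mem (TP S) hf
  convert this using 1
  ext y; simp

lemma TP_comp_affine {S : Set (V m)} {f : V m → ℂ} (hf : f ∈ TP S) (R : ℝ) (x : V m) :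
    (fun u => f (x + R • u)) ∈ TP (Set.image (fun l : V m => R • l) S) := by
  have := TP_comp (S' := (Set.image (fun l : V m => R • l) S)) hf (fun u => R • u) (fun l => R • l) (by
    intro l x; apply Finset.sum_congr rfl; intro i _; simp; ring) x 0 (by
    intro l hl; rw [add_zero]; exact ⟨l, hl, rfl⟩)
  convert this using 1
  ext u; simp [ch]

lemma sq_sum_enorm {κ : Type*} (T : Finset κ) (z : κ → ℂ) :
    ‖∑ k ∈ T, z k‖ₑ ^ 2 ≤ (T.card : ℝ≥0∞) * ∑ k ∈ T, ‖z k‖ₑ ^ 2 := by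
  have h : ‖∑ k ∈ T, z k‖ ^ 2 ≤ (T.card : ℝ) * ∑ k ∈ T, ‖z k‖ ^ 2 := by
    calc ‖∑ k ∈ T, z k‖ ^ 2 ≤ (∑ k ∈ T, ‖z k‖) ^ 2 := by gcongr; exact norm_sum_le _ _
      _ ≤ _ := sq_sum_le_card_mul_sum_sq
  have := ENNReal.ofReal_le_ofReal h
  rw [ENNReal.ofReal_pow (norm_nonneg _), ofReal_norm_eq_enorm, ENNReal.ofReal_mul (by positivity),
    ENNReal.ofReal_natCast, ENNReal.ofReal_sum_of_nonneg (fun _ _ => by positivity)] at this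
  simpa [ENNReal.ofReal_pow] using this

lemma orth_sum {P : V m → ℝ} (hP0 : ∀ x, 0 ≤ P x) (hPi : Integrable P) (hPc : Continuous P)
    (ho : ∀ S S' : Set (V m), (∀ l ∈ S, ∀ l' ∈ S', ∃ i, 1 ≤ |l i - l' i|) → ∀ f ∈ TP S, ∀ g ∈ TP S',
      ∫ y, (P y : ℂ) * (f y * conj (g y)) = 0)
    {κ : Type*} (T : Finset κ) (S : κ → Set (V m)) (f : κ → V m → ℂ) (hf : ∀ k ∈ T, f k ∈ TP (S k))
    (hS : ∀ k ∈ T, ∀ k' ∈ T, k ≠ k' → ∀ l ∈ S k, ∀ l' ∈ S k', ∃ i, 1 ≤ |l i - l' i|) :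
    ∫⁻ y, ‖∑ k ∈ T, f k y‖ₑ ^ 2 * ENNReal.ofReal (P y) = ∑ k ∈ T, ∫⁻ y, ‖f k y‖ₑ ^ 2 * ENNReal.ofReal (P y) := by
  classical
  have hI : ∀ g : V m → ℂ, Continuous g → (∃ C, ∀ y, ‖g y‖ ≤ C) → Integrable (fun y => P y * ‖g y‖ ^ 2) := by
    intro g hg ⟨C, hC⟩
    refine hPi.mul_bdd (c := C ^ 2) (by fun_prop) (Eventually.of_forall fun y => ?_)
    rw [Real.norm_of_nonneg (by positivity)]
    have := norm_nonneg (g y)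
    gcongr; exact hC y
  have hL : ∀ g : V m → ℂ, Continuous g → (∃ C, ∀ y, ‖g y‖ ≤ C) →
      ∫⁻ y, ‖g y‖ₑ ^ 2 * ENNReal.ofReal (P y) = ENNReal.ofReal (∫ y, P y * ‖g y‖ ^ 2) := by
    intro g hg hb
    rw [ofReal_integral_eq_lintegral_ofReal (hI g hg hb) (Eventually.of_forall fun y => mul_nonneg (hP0 y) (by positivity))]
    apply lintegral_congr
    intro y
    rw [ENNReal.ofReal_mul (hP0 y), ENNReal.ofReal_pow (norm_nonneg _), ofReal_norm_eq_enorm, mul_comm]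
  have hsum : (fun y => ∑ k ∈ T, f k y) ∈ TP Set.univ := TP_sum T fun k hk => TP_mono (Set.subset_univ _) (hf k hk)
  rw [hL _ (TP_cont hsum) (TP_bdd hsum)]
  rw [Finset.sum_congr rfl fun k hk => hL _ (TP_cont (hf k hk)) (TP_bdd (hf k hk))]
  rw [← ENNReal.ofReal_sum_of_nonneg (fun k _ => integral_nonneg fun y => mul_nonneg (hP0 y) (by positivity))]
  congr 1
  rw [← Complex.ofReal_inj, ← integral_complex_ofReal]
  push_cast
  simp_rw [← integral_complex_ofReal]
  have hI2 : ∀ k ∈ T, ∀ k' ∈ T, Integrable (fun y => (P y : ℂ) * (f k y * conj (f k' y))) := by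
    intro k hk k' hk'
    obtain ⟨C, hC⟩ := TP_bdd (hf k hk)
    obtain ⟨D, hD⟩ := TP_bdd (hf k' hk')
    have c1 := TP_cont (hf k hk)
    have c2 := TP_cont (hf k' hk')
    refine (Integrable.ofReal (𝕜 := ℂ) hPi).mul_bdd (c := C * D) (by fun_prop) (Eventually.of_forall fun y => ?_)
    rw [norm_mul, RCLike.norm_conj]
    exact mul_le_mul (hC y) (hD y) (norm_nonneg _) ((norm_nonneg _).trans (hC y))
  have e1 : ∀ y, (P y : ℂ) * (‖∑ k ∈ T, f k y‖ : ℂ) ^ 2 = ∑ k ∈ T, ∑ k' ∈ T, (P y : ℂ) * (f k y * conj (f k' y)) := by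
    intro y
    rw [← Complex.ofReal_pow, ← Complex.normSq_eq_norm_sq, ← Complex.mul_conj, map_sum, Finset.sum_mul_sum, Finset.mul_sum]
    simp_rw [Finset.mul_sum]
  simp_rw [Complex.ofReal_mul, Complex.ofReal_pow, e1]
  rw [integral_finsetSum _ (fun k hk => integrable_finsetSum _ fun k' hk' => hI2 k hk k' hk')]
  apply Finset.sum_congr rfl
  intro k hk
  rw [integral_finsetSum _ (fun k' hk' => hI2 k hk k' hk'), Finset.sum_eq_single k]
  · congr 1; ext y
    rw [Complex.mul_conj, Complex.normSq_eq_norm_sq, Complex.ofReal_pow]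
  · intro k' hk' hne
    exact ho _ _ (hS k hk k' hk' hne.symm) _ (hf k hk) _ (hf k' hk')
  · intro h; exact absurd hk h

/-- L2 orthogonality with slowly varying weights -/
lemma L2O (d A : ℕ) : ∃ C : ℝ≥0∞, C ≠ ∞ ∧ ∀ R : ℝ, 0 < R → ∀ W : V (d + 1) → ℝ≥0∞, SV A R W →
    ∀ (T : Finset (Fin d → ℤ)) (f : (Fin d → ℤ) → V (d + 1) → ℂ),
      (∀ k ∈ T, f k ∈ TP {l | ∀ i : Fin d, |l i.succ - k i / R| ≤ 2 / R}) →
      II 2 W (fun x => ∑ k ∈ T, f k x) ≤ C * ∑ k ∈ T, II 2 W (f k) := by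
  classical
  obtain ⟨P, hPc, hP0, hP00, hPd, hPi, ho⟩ := exists_Phi (m := d + 1)
  obtain ⟨C, hC, hPC⟩ := hPd (A + (d + 2))
  set c : ℝ≥0∞ := ∫⁻ u : V (d + 1), kk A u * ENNReal.ofReal (P (-u)) with hc
  have hc0 : c ≠ 0 := by
    rw [hc, Ne, lintegral_eq_zero_iff (by fun_prop)]
    intro h
    have h2 : (fun u => kk A u * ENNReal.ofReal (P (-u))) = (0 : V (d + 1) → ℝ≥0∞) := by
      have hcc : Continuous (fun u : V (d + 1) => kk A u * ENNReal.ofReal (P (-u))) := by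
        unfold kk
        simp_rw [← ENNReal.ofReal_mul (inv_nonneg.2 (pow_nonneg (add_nonneg zero_le_one (norm_nonneg _)) A))]
        refine ENNReal.continuous_ofReal.comp (Continuous.mul (Continuous.inv₀ (by fun_prop) fun y => by positivity) (by fun_prop))
      exact Continuous.ae_eq_iff_eq volume hcc continuous_zero |>.1 h
    have := congrFun h2 0
    simp only [neg_zero, Pi.zero_apply, mul_eq_zero, ENNReal.ofReal_eq_zero] at this
    rcases this with h | h
    · exact (kk_pos A _).ne' h
    · linarith
  have hct : c ≠ ∞ := by
    have : c ≤ ∫⁻ u : V (d + 1), ENNReal.ofReal C * kk (d + 2) u := by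
      apply lintegral_mono
      intro u
      calc kk A u * ENNReal.ofReal (P (-u)) ≤ 1 * ENNReal.ofReal (P (-u)) := by gcongr; exact kk_le_one _ _
        _ ≤ ENNReal.ofReal C * kk (A + (d + 2)) u := by
          rw [one_mul, ← kk_neg]; unfold kk
          rw [← ENNReal.ofReal_mul hC.le]; exact ENNReal.ofReal_le_ofReal (hPC _)
        _ ≤ _ := mul_le_mul' le_rfl (kk_anti (by omega) u)
    refine ne_top_of_le_ne_top ?_ this
    rw [lintegral_const_mul _ (by fun_prop)]
    exact ENNReal.mul_ne_top ENNReal.ofReal_ne_top (kk_integrable (by omega))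
  refine ⟨c⁻¹ * ((8 ^ d : ℕ) : ℝ≥0∞) * (ENNReal.ofReal C * ∫⁻ y : V (d + 1), kk (d + 2) y), ?_, ?_⟩
  · refine ENNReal.mul_ne_top (ENNReal.mul_ne_top (ENNReal.inv_ne_top.2 hc0) (ENNReal.natCast_ne_top _))
      (ENNReal.mul_ne_top ENNReal.ofReal_ne_top (kk_integrable (by omega)))
  intro R hR W hW T f hf
  have hWm := hW.1
  have hfm : ∀ k ∈ T, Measurable (f k) := fun k hk => TP_meas (hf k hk)
  set Q : V (d + 1) → ℝ≥0∞ := fun x => ∫⁻ u, W (x + R • u) * ENNReal.ofReal (P (-u)) with hQ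
  have hRn : ∀ u : V (d + 1), ‖R • u‖ / R = ‖u‖ := fun u => by
    rw [norm_smul, Real.norm_of_nonneg hR.le]; field_simp
  have hQ1 : ∀ x, c * W x ≤ Q x := by
    intro x
    rw [hc, ← lintegral_mul_const _ (by fun_prop)]
    apply lintegral_mono
    intro u
    have h := hW.rev x (R • u)
    rw [hRn] at h
    calc kk A u * ENNReal.ofReal (P (-u)) * W x ≤ kk A u * ENNReal.ofReal (P (-u)) * (ENNReal.ofReal ((1 + ‖u‖) ^ A) * W (x + R • u)) := by gcongr
      _ = W (x + R • u) * ENNReal.ofReal (P (-u)) * (ENNReal.ofReal ((1 + ‖u‖) ^ A) * kk (A + 0) u) := by rw [add_zero]; ring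
      _ = _ := by rw [kk_add]; simp [kk]
  have hQ2 : ∀ x, Q x ≤ (ENNReal.ofReal C * ∫⁻ y : V (d + 1), kk (d + 2) y) * W x := by
    intro x
    calc Q x ≤ ENNReal.ofReal C * Av (A + (d + 2)) R W x := by
          unfold Av
          rw [hQ, ← lintegral_const_mul _ (by fun_prop)]
          apply lintegral_mono
          intro u
          calc W (x + R • u) * ENNReal.ofReal (P (-u)) ≤ W (x + R • u) * (ENNReal.ofReal C * kk (A + (d + 2)) u) := by
                gcongr
                rw [← kk_neg]; unfold kk
                rw [← ENNReal.ofReal_mul hC.le]; exact ENNReal.ofReal_le_ofReal (hPC _)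
            _ = _ := by ring
      _ ≤ ENNReal.ofReal C * ((∫⁻ y : V (d + 1), kk (d + 2) y) * W x) := by
          gcongr; exact Av_le_SV hR le_rfl hW x
      _ = _ := by ring
  -- rewriting of the Q-integral
  have hQI : ∀ F : V (d + 1) → ℂ, Measurable F →
      ∫⁻ x, ‖F x‖ₑ ^ 2 * Q x = ∫⁻ x, (∫⁻ u, ‖F (x + R • u)‖ₑ ^ 2 * ENNReal.ofReal (P u)) * W x := by
    intro F hF
    have e1 : ∀ x, ‖F x‖ₑ ^ 2 * Q x = ∫⁻ u, ‖F x‖ₑ ^ 2 * (W (x + R • u) * ENNReal.ofReal (P (-u))) := by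
      intro x; rw [lintegral_const_mul _ (by fun_prop)]
    have e2 : ∀ x, (∫⁻ u, ‖F (x + R • u)‖ₑ ^ 2 * ENNReal.ofReal (P u)) * W x = ∫⁻ u, ‖F (x + R • u)‖ₑ ^ 2 * ENNReal.ofReal (P u) * W x := by
      intro x; rw [lintegral_mul_const _ (by fun_prop)]
    simp_rw [e1, e2]
    rw [lintegral_lintegral_swap (by fun_prop),
      lintegral_lintegral_swap (f := fun x u => ‖F (x + R • u)‖ₑ ^ 2 * ENNReal.ofReal (P u) * W x) (by fun_prop)]
    rw [← lintegral_neg_eq_self]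
    apply lintegral_congr
    intro u
    rw [← lintegral_add_right_eq_self _ (R • u)]
    apply lintegral_congr
    intro x
    simp
    ring
  set col : (Fin d → ℤ) → (Fin d → Fin 8) := fun k i => ⟨(k i % 8).toNat, by omega⟩ with hcol
  have key : ∀ x, ∫⁻ u, ‖∑ k ∈ T, f k (x + R • u)‖ₑ ^ 2 * ENNReal.ofReal (P u) ≤
      ((8 ^ d : ℕ) : ℝ≥0∞) * ∑ k ∈ T, ∫⁻ u, ‖f k (x + R • u)‖ₑ ^ 2 * ENNReal.ofReal (P u) := by
    intro x
    have hm2 : ∀ k ∈ T, Measurable (fun u => f k (x + R • u)) := fun k hk => by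
      have := hfm k hk; fun_prop
    calc _ ≤ ∫⁻ u, (((8 ^ d : ℕ) : ℝ≥0∞) * ∑ j : Fin d → Fin 8, ‖∑ k ∈ T with col k = j, f k (x + R • u)‖ₑ ^ 2) * ENNReal.ofReal (P u) := by
          apply lintegral_mono
          intro u
          dsimp only
          gcongr
          rw [← Finset.sum_fiberwise T col]
          refine (sq_sum_enorm _ _).trans ?_
          simp
      _ = ((8 ^ d : ℕ) : ℝ≥0∞) * ∑ j : Fin d → Fin 8, ∫⁻ u, ‖∑ k ∈ T with col k = j, f k (x + R • u)‖ₑ ^ 2 * ENNReal.ofReal (P u) := by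
          have hm3 : ∀ j, Measurable (fun u => ∑ k ∈ T with col k = j, f k (x + R • u)) := fun j =>
            Finset.measurable_fun_sum _ fun k hk => hm2 k (Finset.mem_filter.1 hk).1
          simp_rw [mul_assoc, Finset.sum_mul]
          rw [lintegral_const_mul _ (by fun_prop), lintegral_finsetSum _ (by fun_prop)]
      _ = _ := by
          congr 1
          rw [← Finset.sum_fiberwise T col (fun k => ∫⁻ u, ‖f k (x + R • u)‖ₑ ^ 2 * ENNReal.ofReal (P u))]
          apply Finset.sum_congr rfl
          intro j _
          refine orth_sum hP0 hPi hPc ho _ (fun k => (Set.image (fun l : V (d + 1) => R • l) {l | ∀ i : Fin d, |l i.succ - k i / R| ≤ 2 / R}))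
            (fun k u => f k (x + R • u)) (fun k hk => TP_comp_affine (hf k (Finset.mem_filter.1 hk).1) R x) ?_
          rintro k hk k' hk' hne _ ⟨l, hl, rfl⟩ _ ⟨l', hl', rfl⟩
          obtain ⟨i, hi⟩ := Function.ne_iff.1 hne
          refine ⟨i.succ, ?_⟩
          have c1 : col k i = col k' i := by
            rw [(Finset.mem_filter.1 hk).2, (Finset.mem_filter.1 hk').2]
          have c2 : (k i % 8).toNat = (k' i % 8).toNat := by
            simpa [hcol] using c1
          have c3 : 8 ≤ |k i - k' i| := by
            rcases abs_cases (k i - k' i) with h | h <;> omega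
          have c4 : (8 : ℝ) ≤ |(k i : ℝ) - k' i| := by exact_mod_cast c3
          have h1 := hl i
          have h2 := hl' i
          have h1' : |R * l i.succ - k i| ≤ 2 := by
            have : R * l i.succ - k i = R * (l i.succ - k i / R) := by field_simp
            rw [this, abs_mul, abs_of_pos hR]
            calc R * _ ≤ R * (2 / R) := by gcongr
              _ = 2 := by field_simp
          have h2' : |R * l' i.succ - k' i| ≤ 2 := by
            have : R * l' i.succ - k' i = R * (l' i.succ - k' i / R) := by field_simp
            rw [this, abs_mul, abs_of_pos hR]
            calc R * _ ≤ R * (2 / R) := by gcongr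
              _ = 2 := by field_simp
          simp only [Pi.smul_apply, smul_eq_mul]
          rw [abs_le] at h1' h2'
          rcases le_abs.1 c4 with h | h
          · apply le_trans _ (le_abs_self _); linarith
          · apply le_trans _ (neg_le_abs _); linarith
  have hFm : Measurable (fun x => ∑ k ∈ T, f k x) := Finset.measurable_fun_sum _ hfm
  have hD : II 2 W (fun x => ∑ k ∈ T, f k x) ≤ c⁻¹ * ∫⁻ x, ‖∑ k ∈ T, f k x‖ₑ ^ 2 * Q x := by
    rw [← ENNReal.mul_le_iff_le_inv hc0 hct]
    unfold II
    rw [← lintegral_const_mul _ (by fun_prop)]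
    apply lintegral_mono
    intro x
    simp only [ENNReal.rpow_two]
    calc c * (‖∑ k ∈ T, f k x‖ₑ ^ 2 * W x) = ‖∑ k ∈ T, f k x‖ₑ ^ 2 * (c * W x) := by ring
      _ ≤ _ := by gcongr; exact hQ1 x
  refine hD.trans ?_
  have hQm : Measurable Q := by
    apply Measurable.lintegral_prod_right' (f := fun p : V (d + 1) × V (d + 1) => W (p.1 + R • p.2) * ENNReal.ofReal (P (-p.2)))
    fun_prop
  rw [mul_assoc, mul_assoc]
  gcongr
  rw [hQI _ hFm]
  calc _ ≤ ∫⁻ x, (((8 ^ d : ℕ) : ℝ≥0∞) * ∑ k ∈ T, ∫⁻ u, ‖f k (x + R • u)‖ₑ ^ 2 * ENNReal.ofReal (P u)) * W x := by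
        apply lintegral_mono; intro x; dsimp only; gcongr; exact key x
    _ = ((8 ^ d : ℕ) : ℝ≥0∞) * ∑ k ∈ T, ∫⁻ x, (∫⁻ u, ‖f k (x + R • u)‖ₑ ^ 2 * ENNReal.ofReal (P u)) * W x := by
        have hm4 : ∀ k ∈ T, Measurable (fun x => (∫⁻ u, ‖f k (x + R • u)‖ₑ ^ 2 * ENNReal.ofReal (P u)) * W x) := by
          intro k hk
          refine Measurable.mul ?_ hWm
          have := hfm k hk
          apply Measurable.lintegral_prod_right' (f := fun p : V (d + 1) × V (d + 1) => ‖f k (p.1 + R • p.2)‖ₑ ^ 2 * ENNReal.ofReal (P p.2))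
          fun_prop
        simp_rw [mul_assoc, Finset.sum_mul]
        rw [lintegral_const_mul _ (Finset.measurable_fun_sum _ hm4), lintegral_finsetSum' _ (fun k hk => (hm4 k hk).aemeasurable)]
    _ ≤ ((8 ^ d : ℕ) : ℝ≥0∞) * ∑ k ∈ T, (ENNReal.ofReal C * ∫⁻ y : V (d + 1), kk (d + 2) y) * II 2 W (f k) := by
        gcongr with k hk
        have := hfm k hk
        rw [← hQI _ this]
        unfold II
        rw [← lintegral_const_mul _ (by fun_prop)]
        apply lintegral_mono
        intro x
        simp only [ENNReal.rpow_two]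
        calc _ ≤ ‖f k x‖ₑ ^ 2 * ((ENNReal.ofReal C * ∫⁻ y : V (d + 1), kk (d + 2) y) * W x) := by gcongr; exact hQ2 x
          _ = _ := by ring
    _ = _ := by rw [← Finset.mul_sum]

end QPS

namespace QPS
set_option linter.all false
open scoped ENNReal NNReal BigOperators FourierTransform SchwartzMap ComplexConjugate

lemma lmarg_indep {n : ℕ} (μ : Measure ℝ) {F : V n → ℝ≥0∞} {j : Fin n}
    (hind : ∀ x t, F (Function.update x j t) = F x) (s : Finset (Fin n)) (hj : j ∉ s) (x : V n) (t : ℝ) :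
    (∫⋯∫⁻_s, F ∂(fun _ => μ)) (Function.update x j t) = (∫⋯∫⁻_s, F ∂(fun _ => μ)) x := by
  unfold lmarginal
  apply lintegral_congr
  intro y
  rw [← hind (Function.updateFinset x s y) t]
  congr 1
  ext i
  by_cases hi : i ∈ s
  · have : i ≠ j := fun h => hj (h ▸ hi)
    simp [Function.updateFinset, hi, this]
  · by_cases hij : i = j
    · subst hij; simp [Function.updateFinset, hi]
    · simp [Function.updateFinset, hi, hij]

lemma lmarg_indep' {n : ℕ} (μ : Measure ℝ) {F : V n → ℝ≥0∞} {j : Fin n}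
    (hind : ∀ x t, F (Function.update x j t) = F x) [IsProbabilityMeasure μ] (s : Finset (Fin n)) (hj : j ∉ s) (hF : Measurable F) (x : V n) :
    (∫⋯∫⁻_insert j s, F ∂(fun _ => μ)) x = (∫⋯∫⁻_s, F ∂(fun _ => μ)) x := by
  rw [lmarginal_insert _ hF hj]
  simp_rw [lmarg_indep μ hind s hj]
  simp

lemma LW {n : ℕ} (hn : 2 ≤ n) (μ : Measure ℝ) [IsProbabilityMeasure μ] (F : Fin n → V n → ℝ≥0∞)
    (hF : ∀ i, Measurable (F i)) (hind : ∀ i x t, F i (Function.update x i t) = F i x) :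
    ∫⁻ x, ∏ i, F i x ^ (1 / ((n : ℝ) - 1)) ∂(Measure.pi fun _ => μ) ≤
      ∏ i, (∫⁻ x, F i x ∂(Measure.pi fun _ => μ)) ^ (1 / ((n : ℝ) - 1)) := by
  classical
  have hn' : (0 : ℝ) < (n : ℝ) - 1 := by
    have : (2 : ℝ) ≤ n := by exact_mod_cast hn
    linarith
  set p : ℝ := 1 / ((n : ℝ) - 1) with hp
  have hp0 : 0 ≤ p := by positivity
  have claim : ∀ s : Finset (Fin n), ∀ x, (∫⋯∫⁻_s, (fun x => ∏ i, F i x ^ p) ∂(fun _ => μ)) x ≤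
      ∏ i, ((∫⋯∫⁻_s, F i ∂(fun _ => μ)) x) ^ p := by
    intro s
    induction s using Finset.induction_on with
    | empty => intro x; simp
    | insert j s hj ih =>
      intro x
      rw [lmarginal_insert _ (by fun_prop) hj]
      calc _ ≤ ∫⁻ t, ∏ i, ((∫⋯∫⁻_s, F i ∂(fun _ => μ)) (Function.update x j t)) ^ p ∂μ :=
            lintegral_mono fun t => ih _
        _ = ∫⁻ t, ((∫⋯∫⁻_s, F j ∂(fun _ => μ)) x) ^ p * ∏ i ∈ Finset.univ.erase j, ((∫⋯∫⁻_s, F i ∂(fun _ => μ)) (Function.update x j t)) ^ p ∂μ := by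
            apply lintegral_congr; intro t
            rw [← Finset.mul_prod_erase _ _ (Finset.mem_univ j), lmarg_indep μ (hind j) s hj]
        _ = ((∫⋯∫⁻_s, F j ∂(fun _ => μ)) x) ^ p * ∫⁻ t, ∏ i ∈ Finset.univ.erase j, ((∫⋯∫⁻_s, F i ∂(fun _ => μ)) (Function.update x j t)) ^ p ∂μ := by
            rw [lintegral_const_mul]
            apply Finset.measurable_fun_prod
            intro i _
            have := (hF i).lmarginal (fun _ : Fin n => μ) (s := s)
            fun_prop
        _ ≤ ((∫⋯∫⁻_s, F j ∂(fun _ => μ)) x) ^ p * ∏ i ∈ Finset.univ.erase j, (∫⁻ t, (∫⋯∫⁻_s, F i ∂(fun _ => μ)) (Function.update x j t) ∂μ) ^ p := by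
            gcongr
            apply ENNReal.lintegral_prod_norm_pow_le
            · intro i _
              have := (hF i).lmarginal (fun _ : Fin n => μ) (s := s)
              fun_prop
            · simp [hp]
              rw [Nat.cast_sub (by omega)]
              push_cast
              exact mul_inv_cancel₀ hn'.ne'
            · intro i _; exact hp0
        _ = _ := by
            rw [← Finset.mul_prod_erase _ _ (Finset.mem_univ j), lmarg_indep' μ (hind j) s hj (hF j)]
            congr 1
            apply Finset.prod_congr rfl
            intro i _
            rw [lmarginal_insert _ (hF i) hj]
  have := claim Finset.univ 0
  simpa [lmarginal_univ] using this

noncomputable def Emap {n : ℕ} (e : Fin n → V n) (s : V n) : V n := ∑ j, s j • e j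

lemma Emap_update {n : ℕ} (e : Fin n → V n) (s : V n) (i : Fin n) :
    Emap e s = Emap e (Function.update s i 0) + s i • e i := by
  classical
  unfold Emap
  rw [← Finset.add_sum_erase _ _ (Finset.mem_univ i), ← Finset.add_sum_erase _ (fun j => Function.update s i 0 j • e j) (Finset.mem_univ i)]
  rw [Function.update_self, zero_smul, zero_add, add_comm]
  congr 1
  apply Finset.sum_congr rfl
  intro j hj
  rw [Function.update_of_ne (Finset.ne_of_mem_erase hj)]

lemma Emap_norm {n : ℕ} {e : Fin n → V n} (he : ∀ i, ‖e i‖ ≤ 2) {s : V n} (hs : ∀ i, |s i| ≤ 1) :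
    ‖Emap e s‖ ≤ 2 * n := by
  unfold Emap
  calc _ ≤ ∑ j, ‖s j • e j‖ := norm_sum_le _ _
    _ ≤ ∑ j : Fin n, (2 : ℝ) := by
      apply Finset.sum_le_sum
      intro j _
      rw [norm_smul, Real.norm_eq_abs]
      nlinarith [hs j, he j, abs_nonneg (s j), norm_nonneg (e j)]
    _ = _ := by simp [mul_comm]

lemma Emap_meas {n : ℕ} (e : Fin n → V n) : Measurable (Emap e) := by unfold Emap; fun_prop

lemma lintegral_Emap {n : ℕ} {e : Fin n → V n} (he : (Matrix.of e).det ≠ 0) {f : V n → ℝ≥0∞} (hf : Measurable f) :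
    ∫⁻ s, f (Emap e s) = ENNReal.ofReal |(Matrix.of e).det⁻¹| * ∫⁻ z, f z := by
  have h := Real.map_matrix_volume_pi_eq_smul_volume_pi (M := (Matrix.of e).transpose) (by rwa [Matrix.det_transpose])
  rw [Matrix.det_transpose] at h
  have e1 : ∀ s, (Matrix.toLin' (Matrix.of e).transpose) s = Emap e s := by
    intro s
    ext i
    simp [Emap, Matrix.mulVec, dotProduct, mul_comm]
  have e2 : ((Matrix.toLin' (Matrix.of e).transpose) : V n → V n) = Emap e := funext e1
  rw [← lintegral_map hf (Emap_meas e), ← e2, h, lintegral_smul_measure, smul_eq_mul]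

lemma kak_step {n : ℕ} (hn : 2 ≤ n) (A1 A3 : ℕ) (hA1 : n + 1 ≤ A1) (nu : ℝ) (hnu : 0 < nu) (C0 : ℝ≥0∞) (hC0 : C0 ≠ ∞) :
    ∃ C : ℝ≥0∞, C ≠ ∞ ∧ ∀ e : Fin n → V n, (∀ i, ‖e i‖ ≤ 2) → nu ≤ |(Matrix.of e).det| →
    ∀ (K R2 r : ℝ), 1 ≤ K → 0 < r → K * r ≤ R2 → ∀ W : V n → ℝ≥0∞, SV A3 R2 W →
    ∀ (ι : Type) (Θ : Fin n → Finset ι) (u : ι → V n) (H : ι → V n → ℝ≥0∞) (c : ι → ℝ≥0∞),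
      (∀ i, ∀ θ ∈ Θ i, Measurable (H θ)) → (∀ i, ∀ θ ∈ Θ i, ‖u θ - e i‖ ≤ 2 / K) →
      (∀ i, ∀ θ ∈ Θ i, ∀ s : ℝ, |s| ≤ R2 → ∀ y, H θ (y + s • u θ) ≤ C0 * H θ y) →
      ∫⁻ x, (∏ i, (∑ θ ∈ Θ i, c θ * Av A1 r (H θ) x) ^ (1 / ((n : ℝ) - 1))) * W x ≤
        C * ∫⁻ x, (∏ i, (∑ θ ∈ Θ i, c θ * Av A1 (K * r) (H θ) x) ^ (1 / ((n : ℝ) - 1))) * W x := by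
  classical
  have hn' : (0 : ℝ) < (n : ℝ) - 1 := by
    have : (2 : ℝ) ≤ n := by exact_mod_cast hn
    linarith
  set p : ℝ := 1 / ((n : ℝ) - 1) with hp
  have hp0 : 0 ≤ p := by positivity
  set Cs : ℝ≥0∞ := C0 * ENNReal.ofReal (3 ^ A1) with hCs
  set Cn : ℝ≥0∞ := ENNReal.ofReal ((1 + 2 * (n : ℝ)) ^ A1) * ENNReal.ofReal nu⁻¹ with hCn
  set Ca : ℝ≥0∞ := ENNReal.ofReal (2 ^ A1) * 2 * ∫⁻ y : V n, kk A1 y with hCa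
  have hCst : Cs ≠ ∞ := ENNReal.mul_ne_top hC0 ENNReal.ofReal_ne_top
  have hCnt : Cn ≠ ∞ := ENNReal.mul_ne_top ENNReal.ofReal_ne_top ENNReal.ofReal_ne_top
  have hCat : Ca ≠ ∞ := ENNReal.mul_ne_top (by finiteness) (kk_integrable hA1)
  refine ⟨ENNReal.ofReal ((1 + 2 * (n : ℝ)) ^ A3) * ((Cs ^ p) ^ n * ((Cs * (Cn * Ca)) ^ p) ^ n), ?_, ?_⟩
  · have h1 : Cs ^ p ≠ ∞ := ENNReal.rpow_ne_top_of_nonneg hp0 hCst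
    have h2 : (Cs * (Cn * Ca)) ^ p ≠ ∞ := ENNReal.rpow_ne_top_of_nonneg hp0 (by finiteness)
    finiteness
  intro e he hdet K R2 r hK hr hKr W hW ι Θ u H c hHm hu hH
  have hK0 : 0 < K := by linarith
  have hl : 0 < K * r := by positivity
  have hR2 : 0 < R2 := hl.trans_le hKr
  have hWm := hW.1
  set G : Fin n → V n → ℝ≥0∞ := fun i x => ∑ θ ∈ Θ i, c θ * Av A1 r (H θ) x with hG
  have hGm : ∀ i, Measurable (G i) := fun i => Finset.measurable_fun_sum _ fun θ hθ =>
    (Av_meas A1 r (hHm i θ hθ)).const_mul _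
  -- near-invariance in direction e i
  have hinv : ∀ i z (σ : ℝ), |σ| ≤ K * r → G i (z + σ • e i) ≤ Cs * G i z := by
    intro i z σ hσ
    simp only [hG]
    rw [Finset.mul_sum]
    apply Finset.sum_le_sum
    intro θ hθ
    have hHt := hHm i θ hθ
    have h1 : Av A1 r (H θ) (z + σ • e i) ≤ C0 * Av A1 r (H θ) (z + σ • (e i - u θ)) := by
      unfold Av
      rw [← lintegral_const_mul _ (by fun_prop)]
      apply lintegral_mono
      intro y
      have := hH i θ hθ σ (hσ.trans hKr) (z + σ • (e i - u θ) + r • y)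
      have e1 : z + σ • (e i - u θ) + r • y + σ • u θ = z + σ • e i + r • y := by
        rw [smul_sub]; abel
      rw [e1] at this
      calc _ ≤ (C0 * H θ (z + σ • (e i - u θ) + r • y)) * kk A1 y := mul_le_mul' this le_rfl
        _ = _ := by ring
    have h2 : Av A1 r (H θ) (z + σ • (e i - u θ)) ≤ ENNReal.ofReal (3 ^ A1) * Av A1 r (H θ) z := by
      refine ((SV_Av A1 hr hHt).2 z _).trans ?_
      gcongr
      have : ‖σ • (e i - u θ)‖ ≤ K * r * (2 / K) := by
        rw [norm_smul, Real.norm_eq_abs, norm_sub_rev]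
        exact mul_le_mul hσ (hu i θ hθ) (norm_nonneg _) hl.le
      have h3 : K * r * (2 / K) = 2 * r := by field_simp
      rw [h3] at this
      have : ‖σ • (e i - u θ)‖ / r ≤ 2 := by rw [div_le_iff₀ hr]; exact this
      linarith
    calc c θ * Av A1 r (H θ) (z + σ • e i) ≤ c θ * (C0 * (ENNReal.ofReal (3 ^ A1) * Av A1 r (H θ) z)) := by
          gcongr; exact h1.trans (by gcongr)
      _ = _ := by rw [hCs]; ring
  set Q : Set (V n) := Set.pi Set.univ (fun _ => Set.Icc (0 : ℝ) 1) with hQ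
  have hQm : MeasurableSet Q := MeasurableSet.univ_pi fun _ => measurableSet_Icc
  let μ : Measure ℝ := volume.restrict (Set.Icc (0 : ℝ) 1)
  haveI : IsProbabilityMeasure μ := ⟨by simp [μ]⟩
  have hQpi : (volume : Measure (V n)).restrict Q = Measure.pi fun _ => μ := by
    rw [volume_pi, hQ, Measure.restrict_pi_pi]
  have hQ1 : (volume : Measure (V n)).restrict Q Set.univ = 1 := by
    rw [hQpi]; exact measure_univ
  have hQs : ∀ s ∈ Q, ∀ i, 0 ≤ s i ∧ s i ≤ 1 := fun s hs i => hs i (Set.mem_univ i)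
  have hQs' : ∀ s ∈ Q, ∀ i, |s i| ≤ 1 := fun s hs i => by
    rw [abs_of_nonneg (hQs s hs i).1]; exact (hQs s hs i).2
  set F : V n → ℝ≥0∞ := fun x => ∏ i, G i x ^ p with hF
  have hFm : Measurable F := by
    apply Finset.measurable_fun_prod; intro i _; exact (hGm i).pow_const p
  have hEm := Emap_meas e
  -- (2) averaging
  have s2 : ∫⁻ x, F x * W x ≤ ENNReal.ofReal ((1 + 2 * (n : ℝ)) ^ A3) *
      ∫⁻ y, (∫⁻ s in Q, F (y + (K * r) • Emap e s)) * W y := by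
    have a1 : ∀ s ∈ Q, ∫⁻ x, F x * W x ≤ ENNReal.ofReal ((1 + 2 * (n : ℝ)) ^ A3) * ∫⁻ y, F (y + (K * r) • Emap e s) * W y := by
      intro s hs
      have hE := Emap_norm he (hQs' s hs)
      rw [← lintegral_const_mul _ (by fun_prop)]
      rw [← lintegral_add_right_eq_self _ ((K * r) • Emap e s)]
      apply lintegral_mono
      intro y
      have h := hW.2 y ((K * r) • Emap e s)
      have hb : (1 + ‖(K * r) • Emap e s‖ / R2) ^ A3 ≤ (1 + 2 * (n : ℝ)) ^ A3 := by
        gcongr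
        rw [div_le_iff₀ hR2, norm_smul, Real.norm_of_nonneg hl.le, mul_comm]
        exact mul_le_mul hE hKr hl.le (by positivity)
      calc F (y + (K * r) • Emap e s) * W (y + (K * r) • Emap e s) ≤ F (y + (K * r) • Emap e s) * (ENNReal.ofReal ((1 + 2 * (n : ℝ)) ^ A3) * W y) := by
            gcongr
            exact h.trans (by gcongr)
        _ = _ := by ring
    calc ∫⁻ x, F x * W x = ∫⁻ s in Q, (∫⁻ x, F x * W x) := by
          rw [lintegral_const, hQ1, mul_one]
      _ ≤ ∫⁻ s in Q, ENNReal.ofReal ((1 + 2 * (n : ℝ)) ^ A3) * ∫⁻ y, F (y + (K * r) • Emap e s) * W y :=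
          setLIntegral_mono' hQm a1
      _ = ENNReal.ofReal ((1 + 2 * (n : ℝ)) ^ A3) * ∫⁻ s in Q, ∫⁻ y, F (y + (K * r) • Emap e s) * W y := by
          rw [lintegral_const_mul]
          apply Measurable.lintegral_prod_right' (f := fun q : V n × V n => F (q.2 + (K * r) • Emap e q.1) * W q.2)
          fun_prop
      _ = ENNReal.ofReal ((1 + 2 * (n : ℝ)) ^ A3) * ∫⁻ y, ∫⁻ s in Q, F (y + (K * r) • Emap e s) * W y := by
          rw [lintegral_lintegral_swap (by fun_prop)]
      _ = _ := by
          congr 1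
          apply lintegral_congr; intro y
          rw [lintegral_mul_const _ (by fun_prop)]
  refine s2.trans ?_
  rw [mul_assoc]
  gcongr
  rw [← lintegral_const_mul]
  swap
  · refine Measurable.mul ?_ hWm
    apply Finset.measurable_fun_prod; intro i _
    exact (Finset.measurable_fun_sum _ fun θ hθ => (Av_meas A1 _ (hHm i θ hθ)).const_mul _).pow_const p
  apply lintegral_mono
  intro y
  dsimp only
  rw [← mul_assoc]
  gcongr
  -- (3)
  have hupd : ∀ i, Measurable (fun s : V n => Function.update s i 0) := fun i => by
    rw [measurable_pi_iff]; intro j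
    by_cases h : j = i
    · subst h; simp
    · simp [Function.update_of_ne h]; fun_prop
  set Fi : Fin n → V n → ℝ≥0∞ := fun i s => G i (y + (K * r) • Emap e (Function.update s i 0)) with hFi
  have hFim : ∀ i, Measurable (Fi i) := fun i => by
    have := hupd i; have := hGm i; simp only [hFi]; fun_prop
  have b1 : ∀ s ∈ Q, F (y + (K * r) • Emap e s) ≤ (Cs ^ p) ^ n * ∏ i, Fi i s ^ p := by
    intro s hs
    have : (Cs ^ p) ^ n = ∏ i : Fin n, Cs ^ p := by simp
    rw [this, ← Finset.prod_mul_distrib]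
    simp only [hF]
    gcongr with i
    rw [← ENNReal.mul_rpow_of_nonneg _ _ hp0]
    gcongr
    rw [Emap_update e s i, smul_add, ← add_assoc, smul_smul]
    apply hinv
    rw [abs_mul, abs_of_pos hl]
    exact mul_le_of_le_one_right hl.le (hQs' s hs i)
  have b2 : ∀ i, ∀ s ∈ Q, Fi i s ≤ Cs * G i (y + (K * r) • Emap e s) := by
    intro i s hs
    have e1 : y + (K * r) • Emap e (Function.update s i 0) = y + (K * r) • Emap e s + (-((K * r) * s i)) • e i := by
      rw [Emap_update e s i, smul_add, smul_smul, neg_smul]; abel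
    simp only [hFi]
    rw [e1]
    apply hinv
    rw [abs_neg, abs_mul, abs_of_pos hl]
    exact mul_le_of_le_one_right hl.le (hQs' s hs i)
  have hdet0 : (Matrix.of e).det ≠ 0 := by
    intro h; rw [h, abs_zero] at hdet; linarith
  have b3 : ∀ i, ∫⁻ s in Q, G i (y + (K * r) • Emap e s) ≤ Cn * Av A1 (K * r) (G i) y := by
    intro i
    have hGi := hGm i
    calc ∫⁻ s in Q, G i (y + (K * r) • Emap e s) ≤ ∫⁻ s in Q, ENNReal.ofReal ((1 + 2 * (n : ℝ)) ^ A1) * (G i (y + (K * r) • Emap e s) * kk A1 (Emap e s)) := by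
          apply setLIntegral_mono' hQm
          intro s hs
          have hE := Emap_norm he (hQs' s hs)
          have : 1 ≤ ENNReal.ofReal ((1 + 2 * (n : ℝ)) ^ A1) * kk A1 (Emap e s) := by
            unfold kk
            rw [← ENNReal.ofReal_mul (by positivity), ENNReal.one_le_ofReal, ← div_eq_mul_inv, one_le_div (by positivity)]
            gcongr
          calc G i (y + (K * r) • Emap e s) = G i (y + (K * r) • Emap e s) * 1 := (mul_one _).symm
            _ ≤ G i (y + (K * r) • Emap e s) * (ENNReal.ofReal ((1 + 2 * (n : ℝ)) ^ A1) * kk A1 (Emap e s)) := by gcongr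
            _ = _ := by ring
      _ ≤ ∫⁻ s, ENNReal.ofReal ((1 + 2 * (n : ℝ)) ^ A1) * (G i (y + (K * r) • Emap e s) * kk A1 (Emap e s)) :=
          setLIntegral_le_lintegral _ _
      _ = ENNReal.ofReal ((1 + 2 * (n : ℝ)) ^ A1) * (ENNReal.ofReal |(Matrix.of e).det⁻¹| * Av A1 (K * r) (G i) y) := by
          rw [lintegral_const_mul _ (by fun_prop)]
          congr 1
          rw [lintegral_Emap hdet0 (f := fun z => G i (y + (K * r) • z) * kk A1 z) (by fun_prop)]
          rfl
      _ ≤ _ := by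
          rw [← mul_assoc, hCn]
          gcongr
          rw [abs_inv]
          exact inv_anti₀ hnu hdet
  have b4 : ∀ i, Av A1 (K * r) (G i) y ≤ Ca * ∑ θ ∈ Θ i, c θ * Av A1 (K * r) (H θ) y := by
    intro i
    simp only [hG]
    rw [Av_sum A1 (Θ i) (fun θ hθ => (Av_meas A1 r (hHm i θ hθ)).const_mul _), Finset.mul_sum]
    apply Finset.sum_le_sum
    intro θ hθ
    rw [Av_const_mul A1 (Av_meas A1 r (hHm i θ hθ)), Av_comm A1 A1 _ _ (hHm i θ hθ)]
    calc _ ≤ c θ * (Ca * Av A1 (K * r) (H θ) y) := by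
          gcongr
          exact Av_Av (by omega) hr (by nlinarith) (hHm i θ hθ) y
      _ = _ := by ring
  calc ∫⁻ s in Q, F (y + (K * r) • Emap e s) ≤ ∫⁻ s in Q, (Cs ^ p) ^ n * ∏ i, Fi i s ^ p := setLIntegral_mono' hQm b1
    _ = (Cs ^ p) ^ n * ∫⁻ s in Q, ∏ i, Fi i s ^ p := by
        rw [lintegral_const_mul]
        apply Finset.measurable_fun_prod; intro i _; exact (hFim i).pow_const p
    _ ≤ (Cs ^ p) ^ n * ∏ i, (∫⁻ s in Q, Fi i s) ^ p := by
        gcongr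
        rw [hQpi]
        apply LW hn μ Fi hFim
        intro i x t
        simp [hFi]
    _ ≤ (Cs ^ p) ^ n * ∏ i, ((Cs * (Cn * Ca)) * ∑ θ ∈ Θ i, c θ * Av A1 (K * r) (H θ) y) ^ p := by
        gcongr with i
        calc ∫⁻ s in Q, Fi i s ≤ ∫⁻ s in Q, Cs * G i (y + (K * r) • Emap e s) := setLIntegral_mono' hQm (b2 i)
          _ = Cs * ∫⁻ s in Q, G i (y + (K * r) • Emap e s) := by
            rw [lintegral_const_mul]
            have := hGm i; fun_prop
          _ ≤ Cs * (Cn * (Ca * ∑ θ ∈ Θ i, c θ * Av A1 (K * r) (H θ) y)) := by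
            gcongr
            exact (b3 i).trans (by gcongr; exact b4 i)
          _ = _ := by ring
    _ = _ := by
        simp_rw [ENNReal.mul_rpow_of_nonneg _ _ hp0]
        rw [Finset.prod_mul_distrib]
        simp [mul_assoc]

end QPS

namespace QPS
set_option linter.all false
open scoped ENNReal NNReal BigOperators FourierTransform SchwartzMap ComplexConjugate

lemma dual_c {ι : Type} (Θ : Finset ι) (s : ℝ) (hs : 0 < s) (hs1 : s ≤ 1) (X0 : ι → ℝ≥0∞) :
    ∃ c : ι → ℝ≥0∞, (∀ X : ι → ℝ≥0∞, (∑ θ ∈ Θ, X θ ^ s) ^ (1 / s) ≤ ∑ θ ∈ Θ, c θ * X θ) ∧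
      ∑ θ ∈ Θ, c θ * X0 θ ≤ (∑ θ ∈ Θ, X0 θ ^ s) ^ (1 / s) := by
  classical
  have hs' : 0 < 1 / s := by positivity
  have hs1' : 1 ≤ 1 / s := by rw [le_div_iff₀ hs]; linarith
  set S := ∑ θ ∈ Θ, X0 θ ^ s with hS
  -- with c = ∞
  have htop : ∀ X : ι → ℝ≥0∞, (∑ θ ∈ Θ, X θ ^ s) ^ (1 / s) ≤ ∑ θ ∈ Θ, ∞ * X θ := by
    intro X
    by_cases h : ∀ θ ∈ Θ, X θ = 0
    · have : ∑ θ ∈ Θ, X θ ^ s = 0 := Finset.sum_eq_zero fun θ hθ => by rw [h θ hθ, ENNReal.zero_rpow_of_pos hs]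
      rw [this, ENNReal.zero_rpow_of_pos hs']; exact zero_le
    · push Not at h
      obtain ⟨θ, hθ, h0⟩ := h
      have : ∑ θ ∈ Θ, ∞ * X θ = ∞ := by
        rw [ENNReal.sum_eq_top]; exact ⟨θ, hθ, ENNReal.top_mul h0⟩
      rw [this]; exact le_top
  by_cases hS0 : S = 0
  · refine ⟨fun _ => ∞, htop, ?_⟩
    have : ∀ θ ∈ Θ, X0 θ = 0 := fun θ hθ => by
      have := (Finset.sum_eq_zero_iff.1 hS0) θ hθ
      exact (ENNReal.rpow_eq_zero_iff_of_pos hs).1 this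
    rw [Finset.sum_eq_zero fun θ hθ => by rw [this θ hθ, mul_zero]]; exact zero_le
  by_cases hSt : S = ∞
  · refine ⟨fun _ => ∞, htop, ?_⟩
    rw [hSt, ENNReal.top_rpow_of_pos hs']; exact le_top
  set w : ι → ℝ≥0∞ := fun θ => X0 θ ^ s / S with hw
  have hw1 : ∑ θ ∈ Θ, w θ = 1 := by
    simp only [hw, div_eq_mul_inv]
    rw [← Finset.sum_mul]
    exact ENNReal.mul_inv_cancel hS0 hSt
  have hwt : ∀ θ ∈ Θ, w θ ≠ ∞ := fun θ hθ => by
    intro h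
    have := Finset.single_le_sum (f := w) (fun _ _ => zero_le) hθ
    rw [hw1, h] at this
    simp at this
  refine ⟨fun θ => if w θ = 0 then ∞ else w θ ^ (1 - 1 / s), ?_, ?_⟩
  · intro X
    by_cases hbad : ∃ θ ∈ Θ, w θ = 0 ∧ X θ ≠ 0
    · obtain ⟨θ, hθ, h0, hX⟩ := hbad
      have : ∑ θ ∈ Θ, (if w θ = 0 then ∞ else w θ ^ (1 - 1 / s)) * X θ = ∞ := by
        rw [ENNReal.sum_eq_top]; exact ⟨θ, hθ, by rw [if_pos h0, ENNReal.top_mul hX]⟩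
      rw [this]; exact le_top
    · push Not at hbad
      have e1 : ∑ θ ∈ Θ, X θ ^ s = ∑ θ ∈ Θ, w θ * (X θ ^ s / w θ) := by
        apply Finset.sum_congr rfl
        intro θ hθ
        by_cases h0 : w θ = 0
        · rw [hbad θ hθ h0, ENNReal.zero_rpow_of_pos hs]; simp
        · rw [ENNReal.mul_div_cancel h0 (hwt θ hθ)]
      rw [e1]
      refine (ENNReal.rpow_arith_mean_le_arith_mean_rpow Θ w _ hw1 hs1').trans ?_
      apply Finset.sum_le_sum
      intro θ hθ
      by_cases h0 : w θ = 0
      · rw [h0]; simp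
      · dsimp only
        rw [if_neg h0, ENNReal.div_rpow_of_nonneg _ _ hs'.le, ← ENNReal.rpow_mul, mul_one_div_cancel hs.ne', ENNReal.rpow_one,
          ENNReal.rpow_sub _ _ h0 (hwt θ hθ), ENNReal.rpow_one]
        simp only [div_eq_mul_inv]
        apply le_of_eq; ring
  · have : ∀ θ ∈ Θ, (if w θ = 0 then ∞ else w θ ^ (1 - 1 / s)) * X0 θ ≤ w θ * S ^ (1 / s) := by
      intro θ hθ
      have e1 : X0 θ = (w θ * S) ^ (1 / s) := by
        simp only [hw]
        rw [ENNReal.div_mul_cancel hS0 hSt, ← ENNReal.rpow_mul, mul_one_div_cancel hs.ne', ENNReal.rpow_one]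
      by_cases h0 : w θ = 0
      · rw [if_pos h0, e1, h0]; simp [hs]
      · rw [if_neg h0]
        rw [e1]
        rw [ENNReal.mul_rpow_of_nonneg _ _ hs'.le, ← mul_assoc, ← ENNReal.rpow_add _ _ h0 (hwt θ hθ)]
        simp
    refine (Finset.sum_le_sum this).trans ?_
    rw [← Finset.sum_mul, hw1, one_mul]

lemma SV.rpow {m A : ℕ} {r : ℝ} {W : V m → ℝ≥0∞} (h : SV A r W) {p : ℝ} (hp : 0 ≤ p) (x y : V m) :
    W (x + y) ^ p ≤ ENNReal.ofReal ((1 + ‖y‖ / r) ^ A) ^ p * W x ^ p := by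
  rw [← ENNReal.mul_rpow_of_nonneg _ _ hp]
  gcongr
  exact h.2 x y

lemma kak_loc {n : ℕ} (hn : 2 ≤ n) (A1 : ℕ) (hA1 : n + 1 ≤ A1) (nu : ℝ) (hnu : 0 < nu) (C0 : ℝ≥0∞) (hC0 : C0 ≠ ∞) :
    ∃ C : ℝ≥0∞, C ≠ ∞ ∧ ∀ e : Fin n → V n, (∀ i, ‖e i‖ ≤ 2) → nu ≤ |(Matrix.of e).det| →
    ∀ (K r : ℝ) (J : ℕ), 1 ≤ K → 0 < r → 
    ∀ (ι : Type) (Θ : Fin n → Finset ι) (u : ι → V n) (H : ι → V n → ℝ≥0∞) (c : ι → ℝ≥0∞),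
      (∀ i, ∀ θ ∈ Θ i, Measurable (H θ)) → (∀ i, ∀ θ ∈ Θ i, ‖u θ - e i‖ ≤ 2 / K) →
      (∀ i, ∀ θ ∈ Θ i, ∀ s : ℝ, |s| ≤ K ^ J * r → ∀ y, H θ (y + s • u θ) ≤ C0 * H θ y) →
      ∀ x, Av (2 * A1 + (n + 1)) (K ^ J * r) (fun x => ∏ i, (∑ θ ∈ Θ i, c θ * Av A1 r (H θ) x) ^ (1 / ((n : ℝ) - 1))) x ≤
        C ^ (J + 1) * ∏ i, (∑ θ ∈ Θ i, c θ * Av A1 (K ^ J * r) (H θ) x) ^ (1 / ((n : ℝ) - 1)) := by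
  classical
  have hn2 : (2 : ℝ) ≤ n := by exact_mod_cast hn
  have hn' : (0 : ℝ) < (n : ℝ) - 1 := by linarith
  set p : ℝ := 1 / ((n : ℝ) - 1) with hp
  have hp0 : 0 ≤ p := by positivity
  have hnp : (n : ℝ) * p ≤ 2 := by rw [hp, mul_one_div, div_le_iff₀ hn']; linarith
  obtain ⟨C1, hC1, h1⟩ := kak_step hn A1 (2 * A1 + (n + 1)) hA1 nu hnu C0 hC0
  refine ⟨max C1 (∫⁻ y : V n, kk (n + 1) y), (max_lt hC1.lt_top (kk_integrable (m := n) le_rfl).lt_top).ne, ?_⟩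
  intro e he hdet K r J hK hr ι Θ u H c hHm hu hH x
  set Cm := max C1 (∫⁻ y : V n, kk (n + 1) y) with hCm
  have hK0 : 0 < K := by linarith
  set R2 := K ^ J * r with hR2
  have hR2p : 0 < R2 := by positivity
  have hm : ∀ r, Measurable (fun x => ∏ i, (∑ θ ∈ Θ i, c θ * Av A1 r (H θ) x) ^ p) := fun r => by
    apply Finset.measurable_fun_prod; intro i _
    exact (Finset.measurable_fun_sum _ fun θ hθ => (Av_meas A1 _ (hHm i θ hθ)).const_mul _).pow_const p
  have hit : ∀ j ≤ J, Av (2 * A1 + (n + 1)) R2 (fun x => ∏ i, (∑ θ ∈ Θ i, c θ * Av A1 r (H θ) x) ^ p) x ≤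
      C1 ^ j * Av (2 * A1 + (n + 1)) R2 (fun x => ∏ i, (∑ θ ∈ Θ i, c θ * Av A1 (K ^ j * r) (H θ) x) ^ p) x := by
    intro j
    induction j with
    | zero => intro _; simp
    | succ j ih =>
      intro hj
      refine (ih (by omega)).trans ?_
      rw [pow_succ, mul_assoc]
      gcongr
      have hle : K * (K ^ j * r) ≤ R2 := by
        rw [← mul_assoc, ← pow_succ', hR2]
        gcongr
      have := h1 e he hdet K R2 (K ^ j * r) hK (by positivity) hle _ (SV_kk (2 * A1 + (n + 1)) hR2p x) ι Θ u H c hHm hu hH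
      rw [Av_eq _ hR2p (hm _), Av_eq _ hR2p (hm _), mul_left_comm]
      gcongr
      have e1 : K * (K ^ j * r) = K ^ (j + 1) * r := by ring
      rw [e1] at this
      exact this
  refine (hit J le_rfl).trans ?_
  rw [pow_succ, mul_assoc]
  have hle1 : C1 ≤ Cm := le_max_left _ _
  gcongr
  refine le_trans ?_ (mul_le_mul' (le_max_right _ _ : _ ≤ Cm) le_rfl)
  unfold Av
  rw [← lintegral_mul_const _ (kk_meas _)]
  apply lintegral_mono
  intro y
  have hSV : ∀ i, SV A1 R2 (fun x => ∑ θ ∈ Θ i, c θ * Av A1 R2 (H θ) x) := fun i =>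
    SV.sum _ fun θ hθ => (SV_Av A1 hR2p (hHm i θ hθ)).const_mul _
  have hb : ∏ i, ((∑ θ ∈ Θ i, c θ * Av A1 R2 (H θ) (x + R2 • y))) ^ p ≤
      ENNReal.ofReal ((1 + ‖y‖) ^ (2 * A1)) * ∏ i, (∑ θ ∈ Θ i, c θ * Av A1 R2 (H θ) x) ^ p := by
    refine (Finset.prod_le_prod' fun i _ => (hSV i).rpow hp0 x (R2 • y)).trans ?_
    rw [Finset.prod_mul_distrib]
    gcongr
    rw [Finset.prod_const, Finset.card_univ, Fintype.card_fin, norm_smul, Real.norm_of_nonneg hR2p.le, mul_div_cancel_left₀ _ hR2p.ne']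
    rw [ENNReal.ofReal_rpow_of_nonneg (by positivity) hp0, ← ENNReal.ofReal_pow (by positivity)]
    apply ENNReal.ofReal_le_ofReal
    rw [← Real.rpow_natCast, ← Real.rpow_natCast, ← Real.rpow_natCast, ← Real.rpow_mul (by positivity), ← Real.rpow_mul (by positivity)]
    apply Real.rpow_le_rpow_of_exponent_le (by linarith [norm_nonneg y])
    push_cast
    have : (0 : ℝ) ≤ A1 := by positivity
    nlinarith
  refine (mul_le_mul' hb le_rfl).trans ?_
  dsimp only
  rw [← kk_add (2 * A1) (n + 1) y]
  apply le_of_eq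
  unfold Av
  ring

lemma ENN_one_le_pow {C : ℝ≥0∞} (hC : 1 ≤ C) {k : ℕ} {s : ℝ} (hs : 0 ≤ s) (hs1 : s ≤ 1) : (C ^ k) ^ s ≤ C ^ k := by
  calc (C ^ k) ^ s ≤ (C ^ k) ^ (1 : ℝ) := ENNReal.rpow_le_rpow_of_exponent_le (one_le_pow₀ hC) hs1
    _ = _ := by rw [ENNReal.rpow_one]

/-- abstract ball inflation -/
lemma ball_infl {n : ℕ} (hn : 2 ≤ n) (A1 : ℕ) (hA1 : n + 1 ≤ A1) (nu : ℝ) (hnu : 0 < nu) (C0 : ℝ≥0∞) (hC0 : C0 ≠ ∞)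
    (q t : ℝ) (ht : 2 ≤ t) (hq : 2 ≤ q) (hqt : q / (n * t) ≤ 1 / ((n : ℝ) - 1)) :
    ∃ C : ℝ≥0∞, C ≠ ∞ ∧ ∀ e : Fin n → V n, (∀ i, ‖e i‖ ≤ 2) → nu ≤ |(Matrix.of e).det| →
    ∀ (K r : ℝ) (J : ℕ), 1 ≤ K → 0 < r → 
    ∀ (ι : Type) (Θ : Fin n → Finset ι) (u : ι → V n) (F H : ι → V n → ℝ≥0∞),
      (∀ i, ∀ θ ∈ Θ i, Measurable (H θ)) → (∀ i, ∀ θ ∈ Θ i, Measurable (F θ)) → (∀ i, ∀ θ ∈ Θ i, ‖u θ - e i‖ ≤ 2 / K) →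
      (∀ i, ∀ θ ∈ Θ i, ∀ s : ℝ, |s| ≤ K ^ J * r → ∀ y, H θ (y + s • u θ) ≤ C0 * H θ y) →
      (∀ i, ∀ θ ∈ Θ i, ∀ y, F θ y ^ t ≤ C0 * H θ y) →
      (∀ i, ∀ θ ∈ Θ i, ∀ y, Av A1 (K ^ J * r) (H θ) y ≤ C0 * Av A1 (K ^ J * r) (fun z => F θ z ^ t) y) →
      ∀ x, Av (2 * A1 + (n + 1)) (K ^ J * r) (fun x => ∏ i, (∑ θ ∈ Θ i, Av A1 r (fun z => F θ z ^ (2:ℝ)) x) ^ (q / (2 * n))) x ≤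
        C ^ (J + 1) * ∏ i, (∑ θ ∈ Θ i, (Av A1 (K ^ J * r) (fun z => F θ z ^ t) x) ^ (2 / t)) ^ (q / (2 * n)) := by
  classical
  have hn2 : (2 : ℝ) ≤ n := by exact_mod_cast hn
  have hn' : (0 : ℝ) < (n : ℝ) - 1 := by linarith
  have hn0 : (0 : ℝ) < n := by linarith
  set p : ℝ := 1 / ((n : ℝ) - 1) with hp
  have hp0 : 0 < p := by positivity
  obtain ⟨C1, hC1, h1⟩ := kak_loc hn A1 hA1 nu hnu C0 hC0
  set s : ℝ := 2 / t with hs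
  have hs0 : 0 < s := by positivity
  have hs1 : s ≤ 1 := by rw [hs, div_le_one (by linarith)]; exact ht
  set ρ := q / (n * t) with hρ
  have hρ0 : 0 < ρ := by positivity
  set I1 := ∫⁻ y : V n, kk A1 y with hI1
  set I3 := ∫⁻ y : V n, kk (2 * A1 + (n + 1)) y with hI3
  have hI1t : I1 ≠ ∞ := kk_integrable hA1
  have hI3t : I3 ≠ ∞ := kk_integrable (by omega)
  set m0 := q / (2 * n) with hm0
  have hm0' : 0 < m0 := by positivity
  have hms : m0 = (1 / s) * ρ := by
    rw [hm0, hs, hρ]; field_simp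
  set Ca := I1 ^ (t / 2 - 1) with hCa
  have hCat : Ca ≠ ∞ := ENNReal.rpow_ne_top_of_nonneg (by linarith) hI1t
  set Cb := ((Ca * C0) ^ s) ^ m0 with hCb
  have hCbt : Cb ≠ ∞ := ENNReal.rpow_ne_top_of_nonneg hm0'.le (ENNReal.rpow_ne_top_of_nonneg hs0.le (by finiteness))
  set Cd := (C0 ^ s) ^ m0 with hCd
  have hCdt : Cd ≠ ∞ := ENNReal.rpow_ne_top_of_nonneg hm0'.le (ENNReal.rpow_ne_top_of_nonneg hs0.le (by finiteness))
  set Ce := (I3 ^ (p / ρ - 1)) ^ (ρ / p) with hCe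
  have hpρ : 1 ≤ p / ρ := by rw [le_div_iff₀ hρ0]; linarith
  have hCet : Ce ≠ ∞ := ENNReal.rpow_ne_top_of_nonneg (by positivity) (ENNReal.rpow_ne_top_of_nonneg (by linarith) hI3t)
  set Cf := Cb ^ n * Ce * Cd ^ n with hCf
  have hCft : Cf ≠ ∞ := by finiteness
  refine ⟨max Cf 1 * max C1 1, ENNReal.mul_ne_top (max_lt hCft.lt_top ENNReal.one_lt_top).ne (max_lt hC1.lt_top ENNReal.one_lt_top).ne, ?_⟩
  intro e he hdet K r J hK hr ι Θ u F H hHm hFm hu hH hFH hHF x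
  have hK0 : 0 < K := by linarith
  set R2 := K ^ J * r with hR2
  choose c hc1 hc2 using fun i => dual_c (Θ i) s hs0 hs1 (fun θ => Av A1 R2 (H θ) x)
  -- the constants c depend on i; encode with index Fin n × ι
  have hpt : ∀ y, ∏ i, (∑ θ ∈ Θ i, Av A1 r (fun z => F θ z ^ (2:ℝ)) y) ^ m0 ≤
      Cb ^ n * (∏ i, (∑ θ ∈ Θ i, c i θ * Av A1 r (H θ) y) ^ p) ^ (ρ / p) := by
    intro y
    have e0 : Cb ^ n = ∏ i : Fin n, Cb := by simp
    rw [e0, ← ENNReal.prod_rpow_of_nonneg (by positivity), ← Finset.prod_mul_distrib]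
    gcongr with i _
    rw [← ENNReal.rpow_mul, mul_div_cancel₀ _ hp0.ne']
    have a1 : ∀ θ ∈ Θ i, Av A1 r (fun z => F θ z ^ (2:ℝ)) y ≤ (Ca * C0) ^ s * (Av A1 r (H θ) y) ^ s := by
      intro θ hθ
      have := hFm i θ hθ
      have := hHm i θ hθ
      have hm1 : Measurable (fun z => F θ z ^ (2:ℝ)) := by fun_prop
      have j1 := lintegral_rpow_le volume (f := fun z => F θ (y + r • z) ^ (2:ℝ)) (w := kk A1) (by fun_prop) (kk_meas A1) (s := t / 2) (by linarith)
      have j2 : (Av A1 r (fun z => F θ z ^ (2:ℝ)) y) ^ (t / 2) ≤ Ca * C0 * Av A1 r (H θ) y := by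
        refine j1.trans ?_
        rw [mul_assoc]
        gcongr
        unfold Av
        rw [← lintegral_const_mul _ (by have := kk_meas (m := n) A1; fun_prop)]
        apply lintegral_mono
        intro z
        dsimp only
        rw [← ENNReal.rpow_mul, mul_div_cancel₀ _ (by norm_num), ← mul_assoc]
        gcongr
        exact hFH i θ hθ _
      calc Av A1 r (fun z => F θ z ^ (2:ℝ)) y = ((Av A1 r (fun z => F θ z ^ (2:ℝ)) y) ^ (t / 2)) ^ s := by
            rw [← ENNReal.rpow_mul, hs, div_mul_div_cancel₀ (by norm_num), div_self (by linarith), ENNReal.rpow_one]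
        _ ≤ (Ca * C0 * Av A1 r (H θ) y) ^ s := by gcongr
        _ = _ := by rw [ENNReal.mul_rpow_of_nonneg _ _ hs0.le]
    calc (∑ θ ∈ Θ i, Av A1 r (fun z => F θ z ^ (2:ℝ)) y) ^ m0 ≤ ((Ca * C0) ^ s * ∑ θ ∈ Θ i, (Av A1 r (H θ) y) ^ s) ^ m0 := by
          gcongr; rw [Finset.mul_sum]; exact Finset.sum_le_sum a1
      _ = Cb * ((∑ θ ∈ Θ i, (Av A1 r (H θ) y) ^ s) ^ (1 / s)) ^ ρ := by
          rw [ENNReal.mul_rpow_of_nonneg _ _ hm0'.le, ← ENNReal.rpow_mul _ (1 / s), ← hms]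
      _ ≤ _ := by
          gcongr
          exact hc1 i _
  have hk := h1 e he hdet K r J hK hr (Fin n × ι) (fun i => (Θ i).map ⟨fun θ => (i, θ), fun a b h => by simpa using h⟩) (fun q => u q.2) (fun q => H q.2) (fun q => c q.1 q.2)
    (by intro i θ hθ; simp at hθ; obtain ⟨a, ha, rfl⟩ := hθ; exact hHm i a ha)
    (by intro i θ hθ; simp at hθ; obtain ⟨a, ha, rfl⟩ := hθ; exact hu i a ha)
    (by intro i θ hθ; simp at hθ; obtain ⟨a, ha, rfl⟩ := hθ; exact hH i a ha) x
  simp only [Finset.sum_map, Function.Embedding.coeFn_mk] at hk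
  set Y : V n → ℝ≥0∞ := fun y => ∏ i, (∑ θ ∈ Θ i, c i θ * Av A1 r (H θ) y) ^ p with hY
  have hYm : Measurable Y := by
    apply Finset.measurable_fun_prod; intro i _
    exact (Finset.measurable_fun_sum _ fun θ hθ => (Av_meas A1 _ (hHm i θ hθ)).const_mul _).pow_const p
  have j3 : Av (2 * A1 + (n + 1)) R2 (fun y => Y y ^ (ρ / p)) x ≤ Ce * (Av (2 * A1 + (n + 1)) R2 Y x) ^ (ρ / p) := by
    have j1 := lintegral_rpow_le volume (f := fun z => Y (x + R2 • z) ^ (ρ / p)) (w := kk (2 * A1 + (n + 1))) (by fun_prop) (kk_meas _) (s := p / ρ) hpρ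
    have e1 : ∀ z, (Y (x + R2 • z) ^ (ρ / p)) ^ (p / ρ) = Y (x + R2 • z) := fun z => by
      rw [← ENNReal.rpow_mul, div_mul_div_cancel₀ hp0.ne', div_self hρ0.ne', ENNReal.rpow_one]
    simp_rw [e1] at j1
    calc Av (2 * A1 + (n + 1)) R2 (fun y => Y y ^ (ρ / p)) x = ((Av (2 * A1 + (n + 1)) R2 (fun y => Y y ^ (ρ / p)) x) ^ (p / ρ)) ^ (ρ / p) := by
          rw [← ENNReal.rpow_mul, div_mul_div_cancel₀ hρ0.ne', div_self hp0.ne', ENNReal.rpow_one]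
      _ ≤ (I3 ^ (p / ρ - 1) * Av (2 * A1 + (n + 1)) R2 Y x) ^ (ρ / p) := by
          gcongr
          exact j1
      _ = _ := by rw [ENNReal.mul_rpow_of_nonneg _ _ (by positivity)]
  have hρp : ρ / p ≤ 1 := by rw [div_le_one hp0]; exact hqt
  have j4 : (∏ i, (∑ θ ∈ Θ i, c i θ * Av A1 R2 (H θ) x) ^ p) ^ (ρ / p) ≤
      Cd ^ n * ∏ i, (∑ θ ∈ Θ i, (Av A1 R2 (fun z => F θ z ^ t) x) ^ s) ^ m0 := by
    have e0 : Cd ^ n = ∏ i : Fin n, Cd := by simp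
    rw [e0, ← ENNReal.prod_rpow_of_nonneg (by positivity), ← Finset.prod_mul_distrib]
    gcongr with i _
    rw [← ENNReal.rpow_mul, mul_div_cancel₀ _ hp0.ne']
    calc _ ≤ ((∑ θ ∈ Θ i, (Av A1 R2 (H θ) x) ^ s) ^ (1 / s)) ^ ρ := by gcongr; exact hc2 i
      _ = (∑ θ ∈ Θ i, (Av A1 R2 (H θ) x) ^ s) ^ m0 := by rw [← ENNReal.rpow_mul, ← hms]
      _ ≤ (C0 ^ s * ∑ θ ∈ Θ i, (Av A1 R2 (fun z => F θ z ^ t) x) ^ s) ^ m0 := by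
          gcongr
          rw [Finset.mul_sum]
          apply Finset.sum_le_sum
          intro θ hθ
          rw [← ENNReal.mul_rpow_of_nonneg _ _ hs0.le]
          gcongr
          exact hHF i θ hθ x
      _ = _ := by rw [ENNReal.mul_rpow_of_nonneg _ _ hm0'.le]
  have hC1m : C1 ≤ max C1 1 := le_max_left _ _
  calc _ ≤ Av (2 * A1 + (n + 1)) R2 (fun y => Cb ^ n * Y y ^ (ρ / p)) x := Av_mono hpt x
    _ = Cb ^ n * Av (2 * A1 + (n + 1)) R2 (fun y => Y y ^ (ρ / p)) x := Av_const_mul _ (by fun_prop) _ _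
    _ ≤ Cb ^ n * (Ce * ((max C1 1) ^ (J + 1) * ∏ i, (∑ θ ∈ Θ i, c i θ * Av A1 R2 (H θ) x) ^ p) ^ (ρ / p)) := by
        gcongr
        refine j3.trans ?_
        gcongr
        exact hk.trans (mul_le_mul' (pow_le_pow_left' hC1m _) le_rfl)
    _ ≤ Cb ^ n * (Ce * ((max C1 1) ^ (J + 1) * (Cd ^ n * ∏ i, (∑ θ ∈ Θ i, (Av A1 R2 (fun z => F θ z ^ t) x) ^ s) ^ m0))) := by
        rw [ENNReal.mul_rpow_of_nonneg _ _ (by positivity)]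
        gcongr
        exact ENN_one_le_pow (le_max_right _ _) (by positivity) hρp
    _ = Cf * (max C1 1) ^ (J + 1) * ∏ i, (∑ θ ∈ Θ i, (Av A1 R2 (fun z => F θ z ^ t) x) ^ s) ^ m0 := by
        rw [hCf]; ring
    _ ≤ _ := by
        rw [mul_pow]
        gcongr
        calc Cf ≤ max Cf 1 := le_max_left _ _
          _ ≤ _ := by
            exact le_self_pow₀ (le_max_right _ _) (by omega)

end QPS

namespace QPS
set_option linter.all false
open scoped ENNReal NNReal BigOperators FourierTransform SchwartzMap ComplexConjugate
variable {m : ℕ}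

lemma Lp_sum_le {α : Type*} [MeasurableSpace α] (μ : Measure α) {ι : Type*} (T : Finset ι) (g : ι → α → ℝ≥0∞)
    (hg : ∀ l ∈ T, AEMeasurable (g l) μ) {p : ℝ} (hp : 1 ≤ p) :
    (∫⁻ x, (∑ l ∈ T, g l x) ^ p ∂μ) ^ (1 / p) ≤ ∑ l ∈ T, (∫⁻ x, g l x ^ p ∂μ) ^ (1 / p) := by
  classical
  induction T using Finset.induction_on with
  | empty =>
    have hp0 : 0 < p := by linarith
    simp [hp0]
  | insert a T ha ih =>
    rw [Finset.sum_insert ha]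
    have h1 := hg a (Finset.mem_insert_self _ _)
    have h2 : ∀ l ∈ T, AEMeasurable (g l) μ := fun l hl => hg l (Finset.mem_insert_of_mem hl)
    refine le_trans ?_ (add_le_add le_rfl (ih h2))
    have := ENNReal.lintegral_Lp_add_le (μ := μ) h1 (Finset.aemeasurable_fun_sum T h2) hp
    refine le_trans (le_of_eq ?_) this
    congr 1
    apply lintegral_congr
    intro x
    simp [Finset.sum_insert ha]

lemma mink {α : Type*} [MeasurableSpace α] (μ : Measure α) {ι : Type*} (T : Finset ι) (Y : ι → α → ℝ≥0∞)
    (hY : ∀ l ∈ T, Measurable (Y l)) {q : ℝ} (hq : 2 ≤ q) :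
    ∫⁻ x, (∑ l ∈ T, Y l x ^ (2 / q)) ^ (q / 2) ∂μ ≤ (∑ l ∈ T, (∫⁻ x, Y l x ∂μ) ^ (2 / q)) ^ (q / 2) := by
  have h := Lp_sum_le μ T (fun l x => Y l x ^ (2 / q)) (fun l hl => ((hY l hl).pow_const _).aemeasurable) (p := q / 2) (by linarith)
  have e : ∀ y : ℝ≥0∞, (y ^ (2 / q)) ^ (q / 2) = y := fun y => by
    rw [← ENNReal.rpow_mul, div_mul_div_cancel₀ (by linarith), div_self (by norm_num), ENNReal.rpow_one]
  simp only [e] at h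
  have e2 : 1 / (q / 2) = 2 / q := by field_simp
  rw [e2] at h
  calc _ = ((∫⁻ x, (∑ l ∈ T, Y l x ^ (2 / q)) ^ (q / 2) ∂μ) ^ (2 / q)) ^ (q / 2) := by rw [e]
    _ ≤ _ := by gcongr

/-- squared weighted norm -/
noncomputable def N2 (q : ℝ) (W : V m → ℝ≥0∞) (f : V m → ℂ) : ℝ≥0∞ := (II q W f) ^ (2 / q)

lemma N2_rpow {q : ℝ} (hq : 2 ≤ q) (W : V m → ℝ≥0∞) (f : V m → ℂ) : N2 q W f ^ (q / 2) = II q W f := by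
  unfold N2
  rw [← ENNReal.rpow_mul, div_mul_div_cancel₀ (by linarith), div_self (by norm_num), ENNReal.rpow_one]

lemma II_sum_le {ι : Type*} (T : Finset ι) (f : ι → V m → ℂ) (hf : ∀ l ∈ T, Measurable (f l)) {W : V m → ℝ≥0∞} (hW : Measurable W)
    {q : ℝ} (hq : 1 ≤ q) :
    (II q W (fun x => ∑ l ∈ T, f l x)) ^ (1 / q) ≤ ∑ l ∈ T, (II q W (f l)) ^ (1 / q) := by
  have hq0 : 0 < q := by linarith
  have e : ∀ g : ℝ≥0∞, ∀ x, (g * W x ^ (1 / q)) ^ q = g ^ q * W x := fun g x => by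
    rw [ENNReal.mul_rpow_of_nonneg _ _ hq0.le, ← ENNReal.rpow_mul, one_div_mul_cancel hq0.ne', ENNReal.rpow_one]
  have h := Lp_sum_le volume T (fun l x => ‖f l x‖ₑ * W x ^ (1 / q)) (fun l hl => by
    have := hf l hl; fun_prop) hq
  simp only [e] at h
  refine le_trans ?_ h
  unfold II
  gcongr with x
  rw [← Finset.sum_mul, e]
  gcongr
  exact enorm_sum_le _ _

lemma sq_sum_ENN {ι : Type*} (T : Finset ι) (z : ι → ℝ≥0∞) :
    (∑ k ∈ T, z k) ^ 2 ≤ (T.card : ℝ≥0∞) * ∑ k ∈ T, z k ^ 2 := by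
  have := ENNReal.inner_le_Lp_mul_Lq T (fun _ => 1) z (p := 2) (q := 2) (by norm_num [Real.holderConjugate_iff])
  simp only [one_mul, ENNReal.one_rpow, Finset.sum_const, nsmul_eq_mul, mul_one] at this
  calc (∑ k ∈ T, z k) ^ 2 ≤ ((T.card : ℝ≥0∞) ^ (1 / (2:ℝ)) * (∑ k ∈ T, z k ^ (2:ℝ)) ^ (1 / (2:ℝ))) ^ 2 := by gcongr
    _ = _ := by
      rw [mul_pow, ← ENNReal.rpow_two, ← ENNReal.rpow_two, ← ENNReal.rpow_mul, ← ENNReal.rpow_mul]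
      simp

lemma N2_eq_sq {q : ℝ} (hq : 2 ≤ q) (W : V m → ℝ≥0∞) (f : V m → ℂ) : N2 q W f = ((II q W f) ^ (1 / q)) ^ 2 := by
  unfold N2
  rw [← ENNReal.rpow_two, ← ENNReal.rpow_mul]; congr 1; ring

lemma N2_sum_le {ι : Type*} (T : Finset ι) (f : ι → V m → ℂ) (hf : ∀ l ∈ T, Measurable (f l)) {W : V m → ℝ≥0∞} (hW : Measurable W)
    {q : ℝ} (hq : 2 ≤ q) :
    N2 q W (fun x => ∑ l ∈ T, f l x) ≤ (T.card : ℝ≥0∞) * ∑ l ∈ T, N2 q W (f l) := by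
  rw [N2_eq_sq hq]
  simp_rw [N2_eq_sq hq]
  exact (pow_le_pow_left' (II_sum_le T f hf hW (by linarith)) 2).trans (sq_sum_ENN _ _)

lemma lintegral_lin (T : V m ≃ₗ[ℝ] V m) : ∃ c : ℝ≥0∞, c ≠ 0 ∧ c ≠ ∞ ∧ ∀ h : V m → ℝ≥0∞, Measurable h →
    ∫⁻ z, h (T z) = c * ∫⁻ z, h z := by
  have hd : LinearMap.det (T : V m →ₗ[ℝ] V m) ≠ 0 := T.isUnit_det'.ne_zero
  have h := Measure.map_linearMap_addHaar_eq_smul_addHaar (volume : Measure (V m)) hd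
  refine ⟨ENNReal.ofReal |(LinearMap.det (T : V m →ₗ[ℝ] V m))⁻¹|, ?_, ENNReal.ofReal_ne_top, ?_⟩
  · simp [hd]
  · intro g hg
    have hT : Measurable (T : V m → V m) := (LinearMap.continuous_of_finiteDimensional (T : V m →ₗ[ℝ] V m)).measurable
    rw [← lintegral_map (μ := volume) (f := g) hg hT]
    have : Measure.map (T : V m → V m) volume = Measure.map (T : V m →ₗ[ℝ] V m) volume := rfl
    rw [this, h, lintegral_smul_measure, smul_eq_mul]

/-- caps -/
def cap (d a : ℕ) (k : Fin d → ℤ) : Set (V (d + 1)) :=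
  {l | (∀ i : Fin d, |l i.succ - k i / 2 ^ a| ≤ 2 / 2 ^ a) ∧ |l 0 - ∑ i : Fin d, (l i.succ) ^ 2| ≤ 1 / 4 ^ a}

def Dec (d : ℕ) (q : ℝ) (A a : ℕ) (D : ℝ≥0∞) : Prop :=
  ∀ (S : Finset (Fin d → ℤ)), (∀ k ∈ S, ∀ i, |k i| ≤ 2 ^ a) → ∀ f : (Fin d → ℤ) → V (d + 1) → ℂ,
    (∀ k ∈ S, f k ∈ TP (cap d a k)) → ∀ W : V (d + 1) → ℝ≥0∞, SV A (4 ^ a) W →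
    N2 q W (fun x => ∑ k ∈ S, f k x) ≤ D * ∑ k ∈ S, N2 q W (f k)

/-- parent -/
def par {d : ℕ} (j : ℕ) (k : Fin d → ℤ) : Fin d → ℤ := fun i => k i / 2 ^ j

lemma cap_sub {d a b : ℕ} (hab : b < a) (k : Fin d → ℤ) : cap d a k ⊆ cap d b (par (a - b) k) := by
  obtain ⟨j, rfl⟩ : ∃ j, a = b + (j + 1) := ⟨a - b - 1, by omega⟩
  have hj : b + (j + 1) - b = j + 1 := by omega
  rw [hj]
  rintro l ⟨h1, h2⟩
  constructor
  · intro i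
    have h := h1 i
    have h3 := Int.mul_ediv_add_emod (k i) (2 ^ (j + 1))
    have h4 := Int.emod_nonneg (k i) (show (2 : ℤ) ^ (j + 1) ≠ 0 by positivity)
    have h5 := Int.emod_lt_of_pos (k i) (show (0 : ℤ) < 2 ^ (j + 1) by positivity)
    set k' := k i / 2 ^ (j + 1)
    set r := k i % 2 ^ (j + 1)
    have h3' : (k i : ℝ) = 2 ^ (j + 1) * k' + r := by exact_mod_cast h3.symm
    have h4' : (0 : ℝ) ≤ r := by exact_mod_cast h4
    have h5' : (r : ℝ) < 2 ^ (j + 1) := by exact_mod_cast h5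
    have hb : (0 : ℝ) < 2 ^ b := by positivity
    have hjp : (0 : ℝ) < 2 ^ j := by positivity
    have hj1 : (1 : ℝ) ≤ 2 ^ j := one_le_pow₀ (by norm_num)
    have e1 : (k i : ℝ) / 2 ^ (b + (j + 1)) = k' / 2 ^ b + (r / 2 ^ (j + 1)) / 2 ^ b := by
      rw [h3']; field_simp; ring
    have e2 : (2 : ℝ) / 2 ^ (b + (j + 1)) ≤ 1 / 2 ^ b := by
      rw [div_le_div_iff₀ (by positivity) hb, pow_add, pow_succ]
      nlinarith
    have e3 : (r : ℝ) / 2 ^ (j + 1) / 2 ^ b ≤ 1 / 2 ^ b := by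
      gcongr
      rw [div_le_one (by positivity)]; exact h5'.le
    have e4 : 0 ≤ (r : ℝ) / 2 ^ (j + 1) / 2 ^ b := by positivity
    have e5 : (2 : ℝ) / 2 ^ b = 1 / 2 ^ b + 1 / 2 ^ b := by ring
    show |l i.succ - ((k' : ℤ) : ℝ) / 2 ^ b| ≤ 2 / 2 ^ b
    rw [abs_le] at h ⊢
    constructor <;> linarith [h.1, h.2]
  · refine h2.trans ?_
    apply one_div_le_one_div_of_le (by positivity)
    exact pow_le_pow_right₀ (by norm_num) (by omega)

lemma par_bound {d a b : ℕ} (hab : b ≤ a) {k : Fin d → ℤ} (hk : ∀ i, |k i| ≤ 2 ^ a) (i : Fin d) : |par (a - b) k i| ≤ 2 ^ b := by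
  have hp : (0 : ℤ) < 2 ^ (a - b) := by positivity
  have e : (2 : ℤ) ^ a = 2 ^ b * 2 ^ (a - b) := by rw [← pow_add]; congr 1; omega
  have h := abs_le.1 (hk i)
  rw [abs_le]
  constructor
  · show _ ≤ k i / 2 ^ (a - b)
    rw [Int.le_ediv_iff_mul_le hp]; linarith [h.1]
  · show k i / 2 ^ (a - b) ≤ _
    rw [e] at h
    have := Int.ediv_le_ediv hp h.2
    rwa [Int.mul_ediv_cancel _ hp.ne'] at this

lemma par_par {d : ℕ} (i j : ℕ) (k : Fin d → ℤ) : par i (par j k) = par (j + i) k := by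
  ext t
  simp only [par]
  rw [pow_add, Int.ediv_ediv_of_nonneg (by positivity)]

/-- parabolic rescaling -/
noncomputable def PM {d : ℕ} (b : ℕ) (c : Fin d → ℝ) : V (d + 1) ≃ₗ[ℝ] V (d + 1) where
  toFun z := Fin.cons (4 ^ b * z 0) (fun i => 2 ^ b * z i.succ - 2 * c i * 4 ^ b * z 0)
  invFun w := Fin.cons (w 0 / 4 ^ b) (fun i => (w i.succ + 2 * c i * w 0) / 2 ^ b)
  map_add' x y := by
    ext i
    refine Fin.cases ?_ (fun i => ?_) i
    · simp; ring
    · simp; ring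
  map_smul' r x := by
    ext i
    refine Fin.cases ?_ (fun i => ?_) i
    · simp; ring
    · simp; ring
  left_inv x := by
    ext i
    refine Fin.cases ?_ (fun i => ?_) i
    · simp
    · simp; field_simp; ring
  right_inv x := by
    ext i
    refine Fin.cases ?_ (fun i => ?_) i
    · simp; field_simp
    · simp; field_simp; ring

lemma PM_zero {d : ℕ} (b : ℕ) (c : Fin d → ℝ) (z) : PM b c z 0 = 4 ^ b * z 0 := rfl
lemma PM_succ {d : ℕ} (b : ℕ) (c : Fin d → ℝ) (z) (i : Fin d) : PM b c z i.succ = 2 ^ b * z i.succ - 2 * c i * 4 ^ b * z 0 := rfl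

lemma PM_norm {d : ℕ} (b : ℕ) {c : Fin d → ℝ} (hc : ∀ i, |c i| ≤ 1) (z) : ‖PM b c z‖ ≤ 3 * 4 ^ b * ‖z‖ := by
  rw [pi_norm_le_iff_of_nonneg (by positivity)]
  have h24 : (2 : ℝ) ^ b ≤ 4 ^ b := pow_le_pow_left₀ (by norm_num) (by norm_num) b
  have h4 : (0 : ℝ) < 4 ^ b := by positivity
  have h0 : |z 0| ≤ ‖z‖ := norm_le_pi_norm z 0
  intro i
  refine Fin.cases ?_ (fun i => ?_) i
  · rw [PM_zero, Real.norm_eq_abs, abs_mul, abs_of_pos h4]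
    nlinarith [norm_nonneg z]
  · rw [PM_succ, Real.norm_eq_abs]
    have h1 : |z i.succ| ≤ ‖z‖ := norm_le_pi_norm z i.succ
    calc |2 ^ b * z i.succ - 2 * c i * 4 ^ b * z 0| ≤ |2 ^ b * z i.succ| + |2 * c i * 4 ^ b * z 0| := abs_sub _ _
      _ = 2 ^ b * |z i.succ| + 2 * |c i| * 4 ^ b * |z 0| := by
        rw [abs_mul, abs_mul, abs_mul, abs_mul, abs_of_pos h4, abs_of_pos (by norm_num : (0:ℝ) < 2), abs_of_pos (by positivity : (0:ℝ) < 2 ^ b)]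
      _ ≤ 4 ^ b * ‖z‖ + 2 * 1 * 4 ^ b * ‖z‖ := by
        gcongr
        exact hc i
      _ = _ := by ring

/-- frequency side of the rescaling -/
noncomputable def PF {d : ℕ} (b : ℕ) (c : Fin d → ℝ) (l : V (d + 1)) : V (d + 1) :=
  Fin.cons (4 ^ b * (l 0 - ∑ i, 2 * c i * l i.succ)) (fun i => 2 ^ b * l i.succ)
noncomputable def PK {d : ℕ} (b : ℕ) (c : Fin d → ℝ) : V (d + 1) :=
  Fin.cons (4 ^ b * ∑ i, c i ^ 2) (fun i => - (2 ^ b * c i))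

lemma PF_adj {d : ℕ} (b : ℕ) (c : Fin d → ℝ) (l x : V (d + 1)) :
    ∑ i, l i * PM b c x i = ∑ j, PF b c l j * x j := by
  rw [Fin.sum_univ_succ, Fin.sum_univ_succ]
  simp only [PM_zero, PM_succ, PF, Fin.cons_zero, Fin.cons_succ]
  rw [mul_sub, sub_mul, Finset.mul_sum, Finset.sum_mul]
  have : ∑ i : Fin d, l i.succ * (2 ^ b * x i.succ - 2 * c i * 4 ^ b * x 0) = ∑ i : Fin d, 2 ^ b * l i.succ * x i.succ - ∑ i : Fin d, 4 ^ b * (2 * c i * l i.succ) * x 0 := by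
    rw [← Finset.sum_sub_distrib]; apply Finset.sum_congr rfl; intro i _; ring
  rw [this]; ring

lemma PF_succ {d : ℕ} (b : ℕ) (c : Fin d → ℝ) (l : V (d + 1)) (i : Fin d) : (PF b c l + PK b c) i.succ = 2 ^ b * (l i.succ - c i) := by
  simp [PF, PK]; ring

lemma PF_par {d : ℕ} (b : ℕ) (c : Fin d → ℝ) (l : V (d + 1)) :
    (PF b c l + PK b c) 0 - ∑ i : Fin d, ((PF b c l + PK b c) i.succ) ^ 2 = 4 ^ b * (l 0 - ∑ i : Fin d, (l i.succ) ^ 2) := by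
  simp_rw [PF_succ]
  simp only [PF, PK, Pi.add_apply, Fin.cons_zero]
  have h4 : (4 : ℝ) ^ b = (2 ^ b) ^ 2 := by rw [← pow_mul, mul_comm, pow_mul]; norm_num
  have : ∑ i : Fin d, (2 ^ b * (l i.succ - c i)) ^ 2 = 4 ^ b * ∑ i : Fin d, (l i.succ) ^ 2 - 4 ^ b * ∑ i, 2 * c i * l i.succ + 4 ^ b * ∑ i, c i ^ 2 := by
    rw [Finset.mul_sum, Finset.mul_sum, Finset.mul_sum, ← Finset.sum_sub_distrib, ← Finset.sum_add_distrib]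
    apply Finset.sum_congr rfl; intro i _; rw [h4]; ring
  rw [this]; ring

end QPS

namespace QPS
set_option linter.all false
open scoped ENNReal NNReal BigOperators FourierTransform SchwartzMap ComplexConjugate
variable {m : ℕ}

lemma PM_meas {d : ℕ} (b : ℕ) (c : Fin d → ℝ) : Measurable (PM b c : V (d+1) → V (d+1)) :=
  (LinearMap.continuous_of_finiteDimensional (PM b c : V (d+1) →ₗ[ℝ] V (d+1))).measurable

lemma ch_enorm_mul (l x : V m) (z : ℂ) : ‖ch l x * z‖ₑ = ‖z‖ₑ := by
  rw [enorm_mul]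
  have : ‖ch l x‖ₑ = 1 := by
    rw [← ofReal_norm_eq_enorm, ch_norm]; simp
  rw [this, one_mul]

lemma tube_pt (d B : ℕ) (t : ℝ) (ht : 1 ≤ t) : ∃ C : ℝ≥0∞, C ≠ ∞ ∧ ∀ (b : ℕ) (k : Fin d → ℤ),
    ∀ f ∈ TP (cap d b k), ∀ x, ‖f x‖ₑ ^ t ≤ C * ∫⁻ y, ‖f (x + PM b (fun i => k i / 2 ^ b) y)‖ₑ ^ t * kk B y := by
  obtain ⟨C, hC, h⟩ := LC (m := d + 1) (4 * d + 2) (by positivity) B t ht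
  refine ⟨C, hC, fun b k f hf x => ?_⟩
  set c : Fin d → ℝ := fun i => k i / 2 ^ b with hc
  have hmem := TP_comp (S' := {l : V (d + 1) | ∀ i, |l i| ≤ 4 * d + 2}) hf (PM b c) (PF b c) (PF_adj b c) x (PK b c) (by
    rintro l ⟨h1, h2⟩
    have hs : ∀ i : Fin d, |(PF b c l + PK b c) i.succ| ≤ 2 := fun i => by
      rw [PF_succ, abs_mul, abs_of_pos (by positivity : (0:ℝ) < 2 ^ b)]
      have := h1 i
      calc 2 ^ b * |l i.succ - c i| ≤ 2 ^ b * (2 / 2 ^ b) := by gcongr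
        _ = 2 := by field_simp
    intro i
    refine Fin.cases ?_ (fun i => ?_) i
    · have h3 := PF_par b c l
      have h4 : |4 ^ b * (l 0 - ∑ i : Fin d, (l i.succ) ^ 2)| ≤ 1 := by
        rw [abs_mul, abs_of_pos (by positivity : (0:ℝ) < 4 ^ b)]
        calc _ ≤ (4:ℝ) ^ b * (1 / 4 ^ b) := by gcongr
          _ = 1 := by field_simp
      rw [← h3] at h4
      have h5 : ∑ i : Fin d, ((PF b c l + PK b c) i.succ) ^ 2 ≤ 4 * d := by
        calc _ ≤ ∑ i : Fin d, (4 : ℝ) := by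
              apply Finset.sum_le_sum; intro i _
              have := hs i
              rw [← sq_abs]; nlinarith [abs_nonneg ((PF b c l + PK b c) i.succ)]
          _ = _ := by simp [mul_comm]
      have h6 : 0 ≤ ∑ i : Fin d, ((PF b c l + PK b c) i.succ) ^ 2 := by positivity
      rw [abs_le] at h4 ⊢
      constructor <;> linarith [h4.1, h4.2]
    · have := hs i
      have hd : (0:ℝ) ≤ d := by positivity
      linarith)
  have := h _ hmem 0
  simp only [ch_enorm_mul, map_zero, add_zero, zero_add] at this
  exact this

lemma tube (d A1 : ℕ) (hA1 : d + 2 ≤ A1) (t : ℝ) (ht : 1 ≤ t) : ∃ C0 : ℝ≥0∞, C0 ≠ ∞ ∧ ∀ (b : ℕ) (k : Fin d → ℤ), (∀ i, |k i| ≤ 2 ^ b) →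
    ∀ f ∈ TP (cap d b k), ∃ H : V (d + 1) → ℝ≥0∞, Measurable H ∧
      (∀ s : ℝ, |s| ≤ 4 ^ b → ∀ y, H (y + s • (Fin.cons 1 (fun i => -2 * (k i / 2 ^ b)) : V (d + 1))) ≤ C0 * H y) ∧
      (∀ y, ‖f y‖ₑ ^ t ≤ C0 * H y) ∧
      (∀ y, Av A1 (4 ^ b) H y ≤ C0 * Av A1 (4 ^ b) (fun z => ‖f z‖ₑ ^ t) y) := by
  set B := A1 + (d + 2) with hB
  obtain ⟨C, hC, h⟩ := tube_pt d B t ht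
  set C2 : ℝ≥0∞ := ENNReal.ofReal (3 ^ A1) * ∫⁻ y : V (d + 1), kk (d + 2) y with hC2
  have hC2t : C2 ≠ ∞ := ENNReal.mul_ne_top ENNReal.ofReal_ne_top (kk_integrable (by omega))
  set C0 := max C (max C2 (ENNReal.ofReal (2 ^ B))) with hC0
  refine ⟨C0, (max_lt hC.lt_top (max_lt hC2t.lt_top ENNReal.ofReal_lt_top)).ne, fun b k hk f hf => ?_⟩
  set c : Fin d → ℝ := fun i => k i / 2 ^ b with hc
  have hfm := TP_meas hf
  have hPM := PM_meas b c
  have hkk := kk_meas (m := d + 1)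
  have hc1 : ∀ i, |c i| ≤ 1 := fun i => by
    rw [hc, abs_div, abs_of_pos (by positivity : (0:ℝ) < 2 ^ b), div_le_one (by positivity)]
    exact_mod_cast hk i
  set H : V (d + 1) → ℝ≥0∞ := fun x => ∫⁻ y, ‖f (x + PM b c y)‖ₑ ^ t * kk B y with hH
  have hHm : Measurable H := by
    apply Measurable.lintegral_prod_right' (f := fun p : V (d+1) × V (d+1) => ‖f (p.1 + PM b c p.2)‖ₑ ^ t * kk B p.2)
    have := hkk B
    fun_prop
  refine ⟨H, hHm, ?_, ?_, ?_⟩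
  · intro s hs y
    set z : V (d + 1) := Fin.cons (s / 4 ^ b) (fun _ => 0) with hz
    have hz1 : ‖z‖ ≤ 1 := by
      rw [pi_norm_le_iff_of_nonneg (by norm_num)]
      intro i
      refine Fin.cases ?_ (fun i => ?_) i
      · rw [hz, Fin.cons_zero, Real.norm_eq_abs, abs_div, abs_of_pos (by positivity : (0:ℝ) < 4 ^ b), div_le_one (by positivity)]
        exact hs
      · simp [hz]
    have e1 : s • (Fin.cons 1 (fun i => -2 * (k i / 2 ^ b)) : V (d + 1)) = PM b c z := by
      ext i
      refine Fin.cases ?_ (fun i => ?_) i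
      · rw [PM_zero]; simp [hz]; field_simp
      · rw [PM_succ]; simp [hz, hc]; field_simp
    rw [e1]
    calc H (y + PM b c z) = ∫⁻ w, ‖f (y + PM b c (w + z))‖ₑ ^ t * kk B w := by
          simp only [hH]; apply lintegral_congr; intro w; rw [map_add]; congr 4; abel
      _ = ∫⁻ w, ‖f (y + PM b c w)‖ₑ ^ t * kk B (w + -z) := by
          rw [← lintegral_add_right_eq_self (fun w => ‖f (y + PM b c w)‖ₑ ^ t * kk B (w + -z)) z]
          apply lintegral_congr; intro w; simp
      _ ≤ ∫⁻ w, ENNReal.ofReal (2 ^ B) * (‖f (y + PM b c w)‖ₑ ^ t * kk B w) := by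
          apply lintegral_mono; intro w; dsimp only
          rw [mul_left_comm]
          gcongr
          refine (kk_shift B w (-z)).trans ?_
          gcongr
          rw [norm_neg]; linarith
      _ = ENNReal.ofReal (2 ^ B) * H y := by
          rw [lintegral_const_mul]
          have := hkk B
          fun_prop
      _ ≤ _ := by gcongr; exact (le_max_right _ _).trans (le_max_right _ _)
  · intro y
    exact (h b k f hf y).trans (by gcongr; exact le_max_left _ _)
  · intro x
    have hk1 := hkk A1
    have hkB := hkk B
    set R : ℝ := 4 ^ b with hR
    have hRp : 0 < R := by positivity
    set F : V (d + 1) → ℝ≥0∞ := fun z => ‖f z‖ₑ ^ t with hF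
    have hFm : Measurable F := by fun_prop
    have hin : ∀ z, ∫⁻ y, F (x + R • y + PM b c z) * kk A1 y ≤ ENNReal.ofReal (3 ^ A1) * ENNReal.ofReal ((1 + ‖z‖) ^ A1) * Av A1 R F x := by
      intro z
      set v : V (d + 1) := R⁻¹ • PM b c z with hv
      have hvn : ‖v‖ ≤ 3 * ‖z‖ := by
        rw [hv, norm_smul, Real.norm_of_nonneg (by positivity)]
        have := PM_norm b hc1 z
        rw [inv_mul_le_iff₀ hRp]; rw [← hR] at this; linarith
      calc ∫⁻ y, F (x + R • y + PM b c z) * kk A1 y = ∫⁻ y, F (x + R • (y + v)) * kk A1 y := by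
            apply lintegral_congr; intro y
            rw [smul_add, hv, smul_inv_smul₀ hRp.ne', add_assoc]
        _ = ∫⁻ y, F (x + R • y) * kk A1 (y + -v) := by
            rw [← lintegral_add_right_eq_self (fun y => F (x + R • y) * kk A1 (y + -v)) v]
            apply lintegral_congr; intro w; simp
        _ ≤ ∫⁻ y, (ENNReal.ofReal (3 ^ A1) * ENNReal.ofReal ((1 + ‖z‖) ^ A1)) * (F (x + R • y) * kk A1 y) := by
            apply lintegral_mono; intro y; dsimp only
            rw [mul_left_comm]
            gcongr
            refine (kk_shift A1 y (-v)).trans ?_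
            gcongr
            rw [← ENNReal.ofReal_mul (by positivity), ← mul_pow, norm_neg]
            apply ENNReal.ofReal_le_ofReal
            gcongr
            linarith [norm_nonneg z]
        _ = _ := by
            rw [lintegral_const_mul _ (by fun_prop)]; rfl
    calc Av A1 R H x = ∫⁻ y, ∫⁻ z, F (x + R • y + PM b c z) * kk B z * kk A1 y := by
          unfold Av
          apply lintegral_congr; intro y
          simp only [hH]
          rw [← lintegral_mul_const _ (by fun_prop)]
      _ = ∫⁻ z, ∫⁻ y, F (x + R • y + PM b c z) * kk B z * kk A1 y := by
          rw [lintegral_lintegral_swap (by fun_prop)]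
      _ = ∫⁻ z, kk B z * ∫⁻ y, F (x + R • y + PM b c z) * kk A1 y := by
          apply lintegral_congr; intro z
          rw [← lintegral_const_mul _ (by fun_prop)]
          apply lintegral_congr; intro y; ring
      _ ≤ ∫⁻ z, kk (d + 2) z * (ENNReal.ofReal (3 ^ A1) * Av A1 R F x) := by
          apply lintegral_mono; intro z; dsimp only
          refine (mul_le_mul' le_rfl (hin z)).trans ?_
          rw [← kk_add A1 (d + 2) z]
          apply le_of_eq; rw [hB]; ring
      _ = C2 * Av A1 R F x := by
          rw [lintegral_mul_const _ (hkk _), hC2]; ring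
      _ ≤ _ := by gcongr; exact (le_max_left _ _).trans (le_max_right _ _)

lemma cap_sub_one {d a b : ℕ} (hab : b < a) {S : Finset (Fin d → ℤ)} {f : (Fin d → ℤ) → V (d + 1) → ℂ}
    (hf : ∀ k ∈ S, f k ∈ TP (cap d a k)) (k' : Fin d → ℤ) :
    (fun x => ∑ k ∈ S with par (a - b) k = k', f k x) ∈ TP (cap d b k') := by
  classical
  apply TP_sum
  intro k hk
  simp only [Finset.mem_filter] at hk
  exact TP_mono (hk.2 ▸ cap_sub hab k) (hf k hk.1)

lemma sum_fiber {d : ℕ} (j : ℕ) (S : Finset (Fin d → ℤ)) (g : (Fin d → ℤ) → ℂ) :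
    ∑ k ∈ S, g k = ∑ k' ∈ S.image (par j), ∑ k ∈ S with par j k = k', g k :=
  (Finset.sum_fiberwise_of_maps_to (fun k hk => Finset.mem_image_of_mem _ hk) g).symm

lemma fiber_card {d : ℕ} (j : ℕ) (S : Finset (Fin d → ℤ)) (k' : Fin d → ℤ) :
    (S.filter (fun k => par j k = k')).card ≤ (2 ^ j) ^ d := by
  have hsub : S.filter (fun k => par j k = k') ⊆ Fintype.piFinset (fun i => Finset.Ico (2 ^ j * k' i) (2 ^ j * k' i + 2 ^ j)) := by
    intro k hk
    simp only [Finset.mem_filter] at hk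
    rw [Fintype.mem_piFinset]
    intro i
    have h := congrFun hk.2 i
    simp only [par] at h
    have h3 := Int.mul_ediv_add_emod (k i) (2 ^ j)
    have h4 := Int.emod_nonneg (k i) (show (2 : ℤ) ^ j ≠ 0 by positivity)
    have h5 := Int.emod_lt_of_pos (k i) (show (0 : ℤ) < 2 ^ j by positivity)
    rw [h] at h3
    rw [Finset.mem_Ico]; constructor <;> linarith
  refine (Finset.card_le_card hsub).trans ?_
  rw [Fintype.card_piFinset]
  simp
  exact le_of_eq (by
    congr 1)

/-- coarsening -/
lemma Dec_coarsen {d : ℕ} {q : ℝ} (hq : 2 ≤ q) {A a : ℕ} {D : ℝ≥0∞} (h : Dec d q A a D) (j : ℕ)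
    (S : Finset (Fin d → ℤ)) (hS : ∀ k ∈ S, ∀ i, |k i| ≤ 2 ^ (a + j)) (f : (Fin d → ℤ) → V (d + 1) → ℂ)
    (hf : ∀ k ∈ S, f k ∈ TP (cap d (a + j) k)) (W : V (d + 1) → ℝ≥0∞) (hW : SV A (4 ^ a) W) :
    N2 q W (fun x => ∑ k ∈ S, f k x) ≤ ((2 ^ j) ^ d : ℕ) * D * ∑ k ∈ S, N2 q W (f k) := by
  classical
  rcases Nat.eq_zero_or_pos j with rfl | hj
  · simpa using h S hS f hf W hW
  have hj' : a + j - a = j := by omega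
  have e1 : (fun x => ∑ k ∈ S, f k x) = fun x => ∑ k' ∈ S.image (par j), ∑ k ∈ S with par j k = k', f k x := by
    ext x; exact sum_fiber j S (fun k => f k x)
  rw [e1]
  refine (h (S.image (par j)) ?_ (fun k' x => ∑ k ∈ S with par j k = k', f k x) ?_ W hW).trans ?_
  · intro k' hk'
    obtain ⟨k, hk, rfl⟩ := Finset.mem_image.1 hk'
    have := par_bound (b := a) (by omega) (hS k hk)
    rwa [hj'] at this
  · intro k' hk'
    have := cap_sub_one (b := a) (by omega) hf k'
    rwa [hj'] at this
  · calc _ ≤ D * ∑ k' ∈ S.image (par j), ((2 ^ j) ^ d : ℕ) * ∑ k ∈ S with par j k = k', N2 q W (f k) := by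
          gcongr with k' hk'
          refine (N2_sum_le _ _ ?_ hW.1 hq).trans ?_
          · intro k hk; exact TP_meas (hf k (Finset.mem_filter.1 hk).1)
          · gcongr
            exact fiber_card j S k'
      _ = _ := by
          rw [← Finset.mul_sum, Finset.sum_fiberwise_of_maps_to (fun k hk => Finset.mem_image_of_mem _ hk)]
          ring

/-- parabolic rescaling -/
lemma Dec_rescale {d : ℕ} {q : ℝ} (hq : 2 ≤ q) {A a' : ℕ} {D : ℝ≥0∞} (h : Dec d q A a' D) (b : ℕ)
    (S : Finset (Fin d → ℤ)) (f : (Fin d → ℤ) → V (d + 1) → ℂ) (k' : Fin d → ℤ) (hk' : ∀ i, |k' i| ≤ 2 ^ b)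
    (hS : ∀ k ∈ S, par (a' + 1) k = k')
    (hf : ∀ k ∈ S, f k ∈ TP (cap d (b + (a' + 1)) k)) (W : V (d + 1) → ℝ≥0∞) (hW : SV A (4 ^ (b + (a' + 1))) W) :
    N2 q W (fun x => ∑ k ∈ S, f k x) ≤ (2 ^ d : ℕ) * D * ∑ k ∈ S, N2 q W (f k) := by
  classical
  set j := a' + 1 with hj
  set c : Fin d → ℝ := fun i => k' i / 2 ^ b with hc
  have hc1 : ∀ i, |c i| ≤ 1 := fun i => by
    rw [hc, abs_div, abs_of_pos (by positivity : (0:ℝ) < 2 ^ b), div_le_one (by positivity)]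
    exact_mod_cast hk' i
  have hPM := PM_meas b c
  obtain ⟨C, hC0, hCt, hch⟩ := lintegral_lin (PM b c)
  have hq0 : 0 < q := by linarith
  -- shift map
  set sh : (Fin d → ℤ) → (Fin d → ℤ) := fun k => fun i => k i - 2 ^ j * k' i with hsh
  set us : (Fin d → ℤ) → (Fin d → ℤ) := fun k => fun i => k i + 2 ^ j * k' i with hus
  have hus' : ∀ k, us (sh k) = k := fun k => by ext i; simp [hus, hsh]
  have hinj : Set.InjOn sh S := fun k _ l _ hkl => by rw [← hus' k, hkl, hus']
  set g : (Fin d → ℤ) → V (d + 1) → ℂ := fun k x => ch (PK b c) x * f (us k) (0 + PM b c x) with hg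
  set Wt : V (d + 1) → ℝ≥0∞ := fun x => W (PM b c x) with hWt
  have hWm := hW.1
  have hWtSV : SV A (4 ^ a') Wt := by
    refine ⟨by fun_prop, fun x y => ?_⟩
    simp only [hWt, map_add]
    refine (hW.2 _ _).trans ?_
    refine mul_le_mul' (ENNReal.ofReal_le_ofReal (pow_le_pow_left₀ (by positivity) (add_le_add le_rfl ?_) _)) le_rfl
    rw [div_le_div_iff₀ (by positivity) (by positivity)]
    have := PM_norm b hc1 y
    have e : (4:ℝ) ^ (b + j) = 4 ^ b * 4 ^ a' * 4 := by rw [hj, pow_add, pow_succ]; ring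
    rw [e]
    have h4 : (0:ℝ) < 4 ^ a' := by positivity
    have h5 : (0:ℝ) ≤ 4 ^ b * ‖y‖ := by positivity
    nlinarith
  have key := Dec_coarsen hq h 1 (S.image sh) ?_ g ?_ Wt hWtSV
  · have hN : ∀ F : V (d + 1) → ℂ, Measurable F → N2 q Wt (fun x => ch (PK b c) x * F (0 + PM b c x)) = C ^ (2 / q) * N2 q W F := by
      intro F hF
      unfold N2
      rw [← ENNReal.mul_rpow_of_nonneg _ _ (by positivity)]
      congr 1
      unfold II
      rw [← hch (fun x => ‖F x‖ₑ ^ q * W x) (by fun_prop)]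
      apply lintegral_congr; intro x
      rw [ch_enorm_mul, zero_add]
    have e1 : (fun x => ∑ k ∈ S.image sh, g k x) = fun x => ch (PK b c) x * (fun y => ∑ k ∈ S, f k y) (0 + PM b c x) := by
      ext x
      rw [Finset.sum_image hinj]
      simp only [hg, hus', Finset.mul_sum]
    rw [e1, hN _ (Finset.measurable_fun_sum _ fun k hk => TP_meas (hf k hk)), Finset.sum_image hinj] at key
    have e2 : ∑ k ∈ S, N2 q Wt (g (sh k)) = C ^ (2 / q) * ∑ k ∈ S, N2 q W (f k) := by
      rw [Finset.mul_sum]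
      apply Finset.sum_congr rfl
      intro k hk
      simp only [hg, hus']
      exact hN _ (TP_meas (hf k hk))
    rw [e2, mul_left_comm, pow_one] at key
    rwa [ENNReal.mul_le_mul_iff_right] at key
    · simp [hC0, hCt]
    · exact ENNReal.rpow_ne_top_of_nonneg (by positivity) hCt
  · intro k hk i
    obtain ⟨l, hl, rfl⟩ := Finset.mem_image.1 hk
    have h0 := congrFun (hS l hl) i
    simp only [par] at h0
    have h3 := Int.mul_ediv_add_emod (l i) (2 ^ j)
    have h4 := Int.emod_nonneg (l i) (show (2 : ℤ) ^ j ≠ 0 by positivity)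
    have h5 := Int.emod_lt_of_pos (l i) (show (0 : ℤ) < 2 ^ j by positivity)
    rw [h0] at h3
    simp only [hsh]
    rw [abs_le]; constructor <;> linarith
  · intro k hk
    obtain ⟨l, hl, rfl⟩ := Finset.mem_image.1 hk
    simp only [hg, hus']
    refine TP_comp (hf l hl) (PM b c) (PF b c) (PF_adj b c) 0 (PK b c) ?_
    rintro w ⟨h1, h2⟩
    constructor
    · intro i
      rw [PF_succ]
      have e : (2:ℝ) ^ b * (w i.succ - c i) - ((sh l i : ℤ) : ℝ) / 2 ^ (a' + 1) = 2 ^ b * (w i.succ - l i / 2 ^ (b + j)) := by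
        simp only [hsh, hc]; push_cast; rw [← hj, pow_add]; field_simp; ring
      rw [e, abs_mul, abs_of_pos (by positivity : (0:ℝ) < 2 ^ b)]
      calc _ ≤ (2:ℝ) ^ b * (2 / 2 ^ (b + j)) := by gcongr; exact h1 i
        _ = _ := by rw [pow_add]; field_simp; rw [hj]
    · rw [PF_par, abs_mul, abs_of_pos (by positivity : (0:ℝ) < 4 ^ b)]
      calc _ ≤ (4:ℝ) ^ b * (1 / 4 ^ (b + j)) := by gcongr
        _ = _ := by rw [pow_add]; field_simp; rw [hj]

end QPS

namespace QPS
set_option linter.all false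
open scoped ENNReal NNReal BigOperators FourierTransform SchwartzMap ComplexConjugate
variable {m : ℕ}

noncomputable def fb {d : ℕ} (a : ℕ) (S : Finset (Fin d → ℤ)) (f : (Fin d → ℤ) → V (d + 1) → ℂ) (b : ℕ) (k' : Fin d → ℤ) : V (d + 1) → ℂ :=
  fun x => ∑ k ∈ S with par (a - b) k = k', f k x

lemma par_zero {d : ℕ} (k : Fin d → ℤ) : par 0 k = k := by ext i; simp [par]

lemma fb_mem {d a b : ℕ} (hab : b ≤ a) {S : Finset (Fin d → ℤ)} {f : (Fin d → ℤ) → V (d + 1) → ℂ}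
    (hf : ∀ k ∈ S, f k ∈ TP (cap d a k)) (k' : Fin d → ℤ) : fb a S f b k' ∈ TP (cap d b k') := by
  rcases hab.lt_or_eq with h | rfl
  · exact cap_sub_one h hf k'
  · unfold fb
    apply TP_sum
    intro k hk
    rw [Finset.mem_filter, Nat.sub_self, par_zero] at hk
    rw [← hk.2]; exact hf k hk.1

lemma fb_self {d a : ℕ} {S : Finset (Fin d → ℤ)} {f : (Fin d → ℤ) → V (d + 1) → ℂ} {k : Fin d → ℤ} (hk : k ∈ S) : fb a S f a k = f k := by
  classical
  ext x
  unfold fb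
  rw [Nat.sub_self]
  simp_rw [par_zero]
  rw [Finset.sum_filter, Finset.sum_ite_eq' S k]
  simp [hk]

lemma fb_fb {d a b c : ℕ} (hbc : b ≤ c) (hca : c ≤ a) (S : Finset (Fin d → ℤ)) (f : (Fin d → ℤ) → V (d + 1) → ℂ) (k' : Fin d → ℤ) :
    fb a S f b k' = fun x => ∑ k ∈ (S.image (par (a - c))) with par (c - b) k = k', fb a S f c k x := by
  classical
  ext x
  unfold fb
  have hp : ∀ k : Fin d → ℤ, par (c - b) (par (a - c) k) = par (a - b) k := fun k => by
    rw [par_par]; congr 1; omega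
  rw [← Finset.sum_fiberwise_of_maps_to (s := S.filter (fun k => par (a - b) k = k')) (t := (S.image (par (a - c))).filter (fun k => par (c - b) k = k')) (g := par (a - c))]
  · apply Finset.sum_congr rfl
    intro k hk
    rw [Finset.filter_filter]
    apply Finset.sum_congr _ (fun _ _ => rfl)
    ext l
    simp only [Finset.mem_filter] at hk ⊢
    constructor
    · rintro ⟨h1, h2, h3⟩; exact ⟨h1, h3⟩
    · rintro ⟨h1, h2⟩; refine ⟨h1, ?_, h2⟩; rw [← hp, h2]; exact hk.2
  · intro k hk
    rw [Finset.mem_filter] at hk ⊢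
    exact ⟨Finset.mem_image_of_mem _ hk.1, by rw [hp]; exact hk.2⟩

lemma sum_sqrt_le {ι : Type*} (T : Finset ι) (x y : ι → ℝ≥0∞) :
    ∑ k ∈ T, x k ^ (1 / 2 : ℝ) * y k ^ (1 / 2 : ℝ) ≤ (∑ k ∈ T, x k) ^ (1 / 2 : ℝ) * (∑ k ∈ T, y k) ^ (1 / 2 : ℝ) := by
  have := ENNReal.inner_le_Lp_mul_Lq T (fun k => x k ^ (1 / 2 : ℝ)) (fun k => y k ^ (1 / 2 : ℝ)) (p := 2) (q := 2) (by norm_num [Real.holderConjugate_iff])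
  have e : ∀ z : ℝ≥0∞, (z ^ (1 / 2 : ℝ)) ^ (2 : ℝ) = z := by
    intro z; rw [← ENNReal.rpow_mul]; norm_num
  simp only [e] at this
  exact this

/-- the last steps: from local L^q averages to norms -/
lemma mult_end {n : ℕ} (hn : 1 ≤ n) (A : ℕ) (q : ℝ) (hq : 2 ≤ q) : ∃ C : ℝ≥0∞, C ≠ ∞ ∧ ∀ (R s : ℝ), 0 < R → R ≤ s → ∀ W : V n → ℝ≥0∞, SV A s W →
    ∀ (ι : Type) (Θ : Fin n → Finset ι) (f : ι → V n → ℂ), (∀ i, ∀ θ ∈ Θ i, Measurable (f θ)) →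
    ∫⁻ x, (∏ i, (∑ θ ∈ Θ i, (Av (A + (n + 1)) R (fun z => ‖f θ z‖ₑ ^ q) x) ^ (2 / q)) ^ (q / (2 * n))) * W x ≤
      C * ∏ i, (∑ θ ∈ Θ i, N2 q W (f θ)) ^ (q / (2 * n)) := by
  have hn0 : (0 : ℝ) < n := by exact_mod_cast hn
  have hq0 : 0 < q := by linarith
  set I := ∫⁻ y : V n, kk (n + 1) y with hI
  have hIt : I ≠ ∞ := kk_integrable le_rfl
  have hm0 : 0 ≤ q / (2 * n) := by positivity
  refine ⟨((I ^ (2 / q)) ^ (q / (2 * n))) ^ n, ?_, ?_⟩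
  · have : (I ^ (2 / q)) ^ (q / (2 * n)) ≠ ∞ := ENNReal.rpow_ne_top_of_nonneg hm0 (ENNReal.rpow_ne_top_of_nonneg (by positivity) hIt)
    finiteness
  intro R s hR hRs W hW ι Θ f hf
  have hWm := hW.1
  set Av' : ι → V n → ℝ≥0∞ := fun θ => Av (A + (n + 1)) R (fun z => ‖f θ z‖ₑ ^ q) with hAv
  have hAvm : ∀ i, ∀ θ ∈ Θ i, Measurable (Av' θ) := fun i θ hθ => Av_meas _ _ (by have := hf i θ hθ; fun_prop)
  set Y : Fin n → V n → ℝ≥0∞ := fun i x => ∑ θ ∈ Θ i, (Av' θ x) ^ (2 / q) with hY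
  have hYm : ∀ i, Measurable (Y i) := fun i => Finset.measurable_fun_sum _ fun θ hθ => (hAvm i θ hθ).pow_const _
  calc ∫⁻ x, (∏ i, Y i x ^ (q / (2 * n))) * W x = ∫⁻ x, ∏ i, (Y i x ^ (q / 2) * W x) ^ (1 / (n : ℝ)) := by
        apply lintegral_congr; intro x
        simp_rw [ENNReal.mul_rpow_of_nonneg _ _ (show (0:ℝ) ≤ 1 / n by positivity)]
        rw [Finset.prod_mul_distrib]
        congr 1
        · apply Finset.prod_congr rfl; intro i _
          rw [← ENNReal.rpow_mul]; congr 1; field_simp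
        · rw [Finset.prod_const, Finset.card_univ, Fintype.card_fin, ← ENNReal.rpow_natCast, ← ENNReal.rpow_mul]
          rw [one_div_mul_cancel hn0.ne', ENNReal.rpow_one]
    _ ≤ ∏ i, (∫⁻ x, Y i x ^ (q / 2) * W x) ^ (1 / (n : ℝ)) := by
        apply ENNReal.lintegral_prod_norm_pow_le
        · intro i _; have := hYm i; fun_prop
        · simp; field_simp
        · intro i _; positivity
    _ ≤ ∏ i, ((I ^ (2 / q)) ^ (q / (2 * n)) * (∑ θ ∈ Θ i, N2 q W (f θ)) ^ (q / (2 * n))) := by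
        gcongr with i _
        have e1 : ∀ x, Y i x ^ (q / 2) * W x = (∑ θ ∈ Θ i, (Av' θ x * W x) ^ (2 / q)) ^ (q / 2) := by
          intro x
          simp_rw [ENNReal.mul_rpow_of_nonneg _ _ (show (0:ℝ) ≤ 2 / q by positivity)]
          rw [← Finset.sum_mul, ENNReal.mul_rpow_of_nonneg _ _ (show (0:ℝ) ≤ q / 2 by positivity), ← ENNReal.rpow_mul, div_mul_div_cancel₀ hq0.ne',
            div_self (by norm_num), ENNReal.rpow_one]
        simp_rw [e1]
        have h1 := mink volume (Θ i) (fun θ x => Av' θ x * W x) (fun θ hθ => (hAvm i θ hθ).mul hWm) hq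
        calc _ ≤ ((∑ θ ∈ Θ i, (∫⁻ x, Av' θ x * W x) ^ (2 / q)) ^ (q / 2)) ^ (1 / (n : ℝ)) := by gcongr
          _ = (∑ θ ∈ Θ i, (∫⁻ x, Av' θ x * W x) ^ (2 / q)) ^ (q / (2 * n)) := by
              rw [← ENNReal.rpow_mul]; congr 1; field_simp
          _ ≤ (∑ θ ∈ Θ i, I ^ (2 / q) * N2 q W (f θ)) ^ (q / (2 * n)) := by
              gcongr with θ hθ
              unfold N2
              rw [← ENNReal.mul_rpow_of_nonneg _ _ (by positivity)]
              gcongr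
              have hfm := hf i θ hθ
              simp only [hAv]
              rw [Av_symm _ _ (by fun_prop) hWm]
              unfold II
              rw [← lintegral_const_mul _ (by fun_prop)]
              apply lintegral_mono; intro x; dsimp only
              rw [mul_left_comm]
              gcongr
              exact Av_le_SV hR hRs hW x
          _ = _ := by
              rw [← Finset.mul_sum, ENNReal.mul_rpow_of_nonneg _ _ hm0]
    _ = _ := by
        rw [Finset.prod_mul_distrib, Finset.prod_const, Finset.card_univ, Fintype.card_fin]

lemma Av_holder {n : ℕ} (B : ℕ) (R : ℝ) {F : V n → ℝ≥0∞} (hF : Measurable F) {q : ℝ} (hq : 2 ≤ q) (x : V n) :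
    (Av B R (fun z => F z ^ (4 * q / (q + 2))) x) ^ (2 / (4 * q / (q + 2))) ≤
     (Av B R (fun z => F z ^ (2:ℝ)) x) ^ (1 / 2 : ℝ) * ((Av B R (fun z => F z ^ q) x) ^ (2 / q)) ^ (1 / 2 : ℝ) := by
  have hq0 : 0 < q := by linarith
  set t := 4 * q / (q + 2) with ht
  have ht0 : 0 < t := by positivity
  have h1 : t / 4 + t / (2 * q) = 1 := by rw [ht]; field_simp; ring
  have hkk := kk_meas (m := n) B
  have h := ENNReal.lintegral_mul_norm_pow_le (μ := volume) (f := fun y => F (x + R • y) ^ (2:ℝ) * kk B y) (g := fun y => F (x + R • y) ^ q * kk B y)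
    (by fun_prop) (by fun_prop) (p := t / 4) (q := t / (2 * q)) (by positivity) (by positivity) h1
  have e : ∀ y, (F (x + R • y) ^ (2:ℝ) * kk B y) ^ (t / 4) * (F (x + R • y) ^ q * kk B y) ^ (t / (2 * q)) = F (x + R • y) ^ t * kk B y := by
    intro y
    rw [ENNReal.mul_rpow_of_nonneg _ _ (by positivity), ENNReal.mul_rpow_of_nonneg _ _ (by positivity), ← ENNReal.rpow_mul, ← ENNReal.rpow_mul]
    have e1 : kk B y ^ (t / 4) * kk B y ^ (t / (2 * q)) = kk B y := by
      rw [← ENNReal.rpow_add_of_nonneg _ _ (by positivity) (by positivity), h1, ENNReal.rpow_one]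
    have e2 : F (x + R • y) ^ (2 * (t / 4)) * F (x + R • y) ^ (q * (t / (2 * q))) = F (x + R • y) ^ t := by
      rw [← ENNReal.rpow_add_of_nonneg _ _ (by positivity) (by positivity)]
      congr 1; field_simp; ring
    calc _ = (F (x + R • y) ^ (2 * (t / 4)) * F (x + R • y) ^ (q * (t / (2 * q)))) * (kk B y ^ (t / 4) * kk B y ^ (t / (2 * q))) := by ring
      _ = _ := by rw [e1, e2]
  simp_rw [e] at h
  calc _ ≤ ((Av B R (fun z => F z ^ (2:ℝ)) x) ^ (t / 4) * (Av B R (fun z => F z ^ q) x) ^ (t / (2 * q))) ^ (2 / t) := by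
        apply ENNReal.rpow_le_rpow h (by positivity)
    _ = _ := by
        rw [ENNReal.mul_rpow_of_nonneg _ _ (by positivity), ← ENNReal.rpow_mul, ← ENNReal.rpow_mul, ← ENNReal.rpow_mul]
        congr 2 <;> field_simp <;> norm_num

lemma Av_jensen {n : ℕ} (B : ℕ) (hB : n + 1 ≤ B) (R : ℝ) {F : V n → ℝ≥0∞} (hF : Measurable F) {q : ℝ} (hq : 2 ≤ q) (x : V n) :
    Av B R (fun z => F z ^ (2:ℝ)) x ≤ ((∫⁻ y : V n, kk B y) ^ (q / 2 - 1)) ^ (2 / q) * (Av B R (fun z => F z ^ q) x) ^ (2 / q) := by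
  have hkk := kk_meas (m := n) B
  have j1 := lintegral_rpow_le volume (f := fun z => F (x + R • z) ^ (2:ℝ)) (w := kk B) (by fun_prop) hkk (s := q / 2) (by linarith)
  have e1 : ∀ z, (F (x + R • z) ^ (2:ℝ)) ^ (q / 2) = F (x + R • z) ^ q := fun z => by
    rw [← ENNReal.rpow_mul]; congr 1; ring
  simp_rw [e1] at j1
  have hq0 : 0 < q := by linarith
  calc _ = ((Av B R (fun z => F z ^ (2:ℝ)) x) ^ (q / 2)) ^ (2 / q) := by
        rw [← ENNReal.rpow_mul, div_mul_div_cancel₀ (by norm_num), div_self hq0.ne', ENNReal.rpow_one]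
    _ ≤ _ := by
        rw [← ENNReal.mul_rpow_of_nonneg _ _ (by positivity)]
        apply ENNReal.rpow_le_rpow j1 (by positivity)

lemma L2O_Av (d B : ℕ) : ∃ C : ℝ≥0∞, C ≠ ∞ ∧ ∀ b : ℕ, 
    ∀ (T : Finset (Fin d → ℤ)) (f : (Fin d → ℤ) → V (d + 1) → ℂ), (∀ k ∈ T, f k ∈ TP (cap d b k)) → ∀ x,
      Av B (2 ^ b) (fun z => ‖∑ k ∈ T, f k z‖ₑ ^ (2:ℝ)) x ≤ C * ∑ k ∈ T, Av B (2 ^ b) (fun z => ‖f k z‖ₑ ^ (2:ℝ)) x := by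
  obtain ⟨C, hC, h⟩ := L2O d B
  refine ⟨C, hC, fun b T f hf x => ?_⟩
  have hR : (0:ℝ) < 2 ^ b := by positivity
  have hm : ∀ k ∈ T, Measurable (f k) := fun k hk => TP_meas (hf k hk)
  have := h (2 ^ b) hR _ (SV_kk B hR x) T f (fun k hk => TP_mono (fun l hl => hl.1) (hf k hk))
  rw [Av_eq _ hR (by have := Finset.measurable_fun_sum T hm; fun_prop)]
  rw [Finset.sum_congr rfl (fun k hk => Av_eq B hR (h := fun z => ‖f k z‖ₑ ^ (2:ℝ)) (by have := hm k hk; fun_prop) x), ← Finset.mul_sum, mul_left_comm]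
  gcongr
  exact this

end QPS

namespace QPS
set_option linter.all false
open scoped ENNReal NNReal BigOperators FourierTransform SchwartzMap ComplexConjugate
variable {m : ℕ}

noncomputable def Th {d : ℕ} (a κ : ℕ) (S : Finset (Fin d → ℤ)) (b : ℕ) (t : Fin d → ℤ) : Finset (Fin d → ℤ) :=
  (S.image (par (a - b))).filter (fun k => par (b - κ) k = t)

noncomputable def GG {d : ℕ} (A1 a κ : ℕ) (S : Finset (Fin d → ℤ)) (f : (Fin d → ℤ) → V (d + 1) → ℂ) (b : ℕ) (t : Fin d → ℤ) (x : V (d + 1)) : ℝ≥0∞ :=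
  ∑ θ ∈ Th a κ S b t, Av A1 (2 ^ b) (fun z => ‖fb a S f b θ z‖ₑ ^ (2:ℝ)) x

noncomputable def AA {d : ℕ} (q : ℝ) (A1 a κ : ℕ) (S : Finset (Fin d → ℤ)) (f : (Fin d → ℤ) → V (d + 1) → ℂ) (W : V (d + 1) → ℝ≥0∞)
    (τ : Fin (d + 1) → Fin d → ℤ) (b : ℕ) : ℝ≥0∞ :=
  ∫⁻ x, (∏ i, (GG A1 a κ S f b (τ i) x) ^ (q / (2 * ((d + 1 : ℕ) : ℝ)))) * W x

noncomputable def YY {d : ℕ} (q : ℝ) (a κ : ℕ) (S : Finset (Fin d → ℤ)) (f : (Fin d → ℤ) → V (d + 1) → ℂ) (W : V (d + 1) → ℝ≥0∞)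
    (τ : Fin (d + 1) → Fin d → ℤ) (b : ℕ) : ℝ≥0∞ :=
  ∏ i, (∑ θ ∈ Th a κ S b (τ i), N2 q W (fb a S f b θ)) ^ (q / (2 * ((d + 1 : ℕ) : ℝ)))

noncomputable def ev {d : ℕ} (κ : ℕ) (t : Fin d → ℤ) : V (d + 1) := Fin.cons 1 (fun i => -2 * (t i / 2 ^ κ))

lemma ev_norm {d κ : ℕ} {t : Fin d → ℤ} (ht : ∀ i, |t i| ≤ 2 ^ κ) : ‖ev κ t‖ ≤ 2 := by
  rw [pi_norm_le_iff_of_nonneg (by norm_num)]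
  intro i
  refine Fin.cases ?_ (fun i => ?_) i
  · simp [ev]
  · have : |(t i : ℝ)| ≤ 2 ^ κ := by exact_mod_cast ht i
    simp only [ev, Fin.cons_succ, Real.norm_eq_abs, abs_mul, abs_div]
    rw [abs_of_pos (show (0:ℝ) < 2 ^ κ by positivity)]
    have h2 : |(t i : ℝ)| / 2 ^ κ ≤ 1 := by rw [div_le_one (by positivity)]; exact this
    norm_num
    linarith

lemma par_close {d b κ : ℕ} (hb : κ ≤ b) (k : Fin d → ℤ) (i : Fin d) :
    |(k i : ℝ) / 2 ^ b - (par (b - κ) k i : ℝ) / 2 ^ κ| ≤ 1 / 2 ^ κ := by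
  have hp : (0 : ℤ) < 2 ^ (b - κ) := by positivity
  have e : (2 : ℝ) ^ b = 2 ^ κ * 2 ^ (b - κ) := by rw [← pow_add]; congr 1; omega
  have h1 : (par (b - κ) k i) * 2 ^ (b - κ) ≤ k i := Int.ediv_mul_le _ hp.ne'
  have h2 : k i < (par (b - κ) k i + 1) * 2 ^ (b - κ) := Int.lt_ediv_add_one_mul_self _ hp
  have h1' : (par (b - κ) k i : ℝ) * 2 ^ (b - κ) ≤ k i := by exact_mod_cast h1
  have h2' : (k i : ℝ) < (par (b - κ) k i + 1) * 2 ^ (b - κ) := by exact_mod_cast h2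
  have e2 : (k i : ℝ) / 2 ^ b - (par (b - κ) k i : ℝ) / 2 ^ κ = (k i - par (b - κ) k i * 2 ^ (b - κ)) / 2 ^ b := by
    rw [e]; field_simp
  have e3 : 1 / (2:ℝ) ^ κ = 2 ^ (b - κ) / 2 ^ b := by rw [e]; field_simp
  rw [e2, e3, abs_div, abs_of_pos (show (0:ℝ) < 2 ^ b by positivity)]
  gcongr
  rw [abs_of_nonneg (by linarith)]
  linarith

lemma ev_close {d b κ : ℕ} (hb : κ ≤ b) (k : Fin d → ℤ) : ‖ev b k - ev κ (par (b - κ) k)‖ ≤ 2 / 2 ^ κ := by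
  rw [pi_norm_le_iff_of_nonneg (by positivity)]
  intro i
  refine Fin.cases ?_ (fun i => ?_) i
  · simp [ev]; positivity
  · have := par_close hb k i
    simp only [ev, Pi.sub_apply, Fin.cons_succ, Real.norm_eq_abs]
    rw [← mul_sub, abs_mul, show |(-2:ℝ)| = 2 by norm_num]
    calc _ ≤ 2 * (1 / 2 ^ κ : ℝ) := by gcongr
      _ = _ := by ring

lemma Th_bound {d a κ b : ℕ} {S : Finset (Fin d → ℤ)} (hS : ∀ k ∈ S, ∀ i, |k i| ≤ 2 ^ a) (hb : b ≤ a) {t θ : Fin d → ℤ} (h : θ ∈ Th a κ S b t) (i : Fin d) :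
    |θ i| ≤ 2 ^ b := by
  unfold Th at h
  rw [Finset.mem_filter, Finset.mem_image] at h
  obtain ⟨⟨k, hk, rfl⟩, _⟩ := h
  exact par_bound hb (hS k hk) i

lemma GG_meas {d A1 a κ b : ℕ} {S : Finset (Fin d → ℤ)} {f : (Fin d → ℤ) → V (d + 1) → ℂ} (hb : b ≤ a)
    (hf : ∀ k ∈ S, f k ∈ TP (cap d a k)) (t : Fin d → ℤ) : Measurable (GG A1 a κ S f b t) := by
  unfold GG
  apply Finset.measurable_fun_sum
  intro θ _
  apply Av_meas
  have := TP_meas (fb_mem hb hf θ)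
  fun_prop

/-- passing from scale b to double scale in local L2 -/
lemma GG_L2 (d A1 : ℕ) : ∃ C : ℝ≥0∞, C ≠ ∞ ∧ ∀ (a κ b c : ℕ), κ ≤ b → b ≤ c → c ≤ a → ∀ (S : Finset (Fin d → ℤ)) (f : (Fin d → ℤ) → V (d + 1) → ℂ),
    (∀ k ∈ S, f k ∈ TP (cap d a k)) → ∀ t x, 
    ∑ θ ∈ Th a κ S b t, Av A1 (2 ^ c) (fun z => ‖fb a S f b θ z‖ₑ ^ (2:ℝ)) x ≤ C * GG A1 a κ S f c t x := by
  classical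
  obtain ⟨C, hC, h⟩ := L2O_Av d A1
  refine ⟨C, hC, fun a κ b c hκ hbc hca S f hf t x => ?_⟩
  have h1 : ∀ θ ∈ Th a κ S b t, Av A1 (2 ^ c) (fun z => ‖fb a S f b θ z‖ₑ ^ (2:ℝ)) x ≤ 
      C * ∑ k ∈ (S.image (par (a - c))) with par (c - b) k = θ, Av A1 (2 ^ c) (fun z => ‖fb a S f c k z‖ₑ ^ (2:ℝ)) x := by
    intro θ _
    rw [fb_fb hbc hca]
    exact h c _ _ (fun k _ => fb_mem hca hf k) x
  refine (Finset.sum_le_sum h1).trans ?_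
  rw [← Finset.mul_sum]
  gcongr
  unfold GG
  have hp : ∀ k : Fin d → ℤ, par (b - κ) (par (c - b) k) = par (c - κ) k := fun k => by
    rw [par_par]; congr 1; omega
  rw [← Finset.sum_fiberwise_of_maps_to (s := Th a κ S c t) (t := Th a κ S b t) (g := par (c - b))]
  · apply Finset.sum_le_sum
    intro θ hθ
    apply le_of_eq
    apply Finset.sum_congr _ (fun _ _ => rfl)
    ext k
    simp only [Th, Finset.mem_filter] at hθ ⊢
    constructor
    · rintro ⟨h1, h2⟩; refine ⟨⟨h1, ?_⟩, h2⟩; rw [← hp, h2]; exact hθ.2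
    · rintro ⟨⟨h1, _⟩, h2⟩; exact ⟨h1, h2⟩
  · intro k hk
    simp only [Th, Finset.mem_filter, Finset.mem_image] at hk ⊢
    obtain ⟨⟨l, hl, rfl⟩, h2⟩ := hk
    refine ⟨⟨l, hl, ?_⟩, ?_⟩
    · rw [par_par]; congr 1; omega
    · rw [hp]; exact h2


lemma cs_int {X : Type*} [MeasurableSpace X] {μ : Measure X} {P Q W : X → ℝ≥0∞} (hP : Measurable P) (hQ : Measurable Q) (hW : Measurable W) :
    ∫⁻ x, (P x ^ (1 / 2 : ℝ) * Q x ^ (1 / 2 : ℝ)) * W x ∂μ ≤ (∫⁻ x, P x * W x ∂μ) ^ (1 / 2 : ℝ) * (∫⁻ x, Q x * W x ∂μ) ^ (1 / 2 : ℝ) := by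
  have h := ENNReal.lintegral_mul_norm_pow_le (μ := μ) (f := fun x => P x * W x) (g := fun x => Q x * W x) (by fun_prop) (by fun_prop) (p := 1 / 2) (q := 1 / 2) (by norm_num) (by norm_num) (by norm_num)
  refine le_trans (le_of_eq ?_) h
  apply lintegral_congr
  intro x
  rw [ENNReal.mul_rpow_of_nonneg _ _ (by norm_num), ENNReal.mul_rpow_of_nonneg _ _ (by norm_num)]
  have : W x = W x ^ (1 / 2 : ℝ) * W x ^ (1 / 2 : ℝ) := by
    rw [← ENNReal.rpow_add_of_nonneg _ _ (by norm_num) (by norm_num)]; norm_num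
  calc _ = (P x ^ (1 / 2 : ℝ) * Q x ^ (1 / 2 : ℝ)) * (W x ^ (1 / 2 : ℝ) * W x ^ (1 / 2 : ℝ)) := by rw [← this]
    _ = _ := by ring

lemma ml_step (d : ℕ) (hd : 1 ≤ d) (A : ℕ) (q : ℝ) (hq : 2 ≤ q) (hqd : q * d ≤ 2 * d + 4) (nu : ℝ) (hnu : 0 < nu) :
    ∃ C : ℝ≥0∞, C ≠ ∞ ∧ ∀ (κ : ℕ) (τ : Fin (d + 1) → Fin d → ℤ), (∀ i j, |τ i j| ≤ 2 ^ κ) →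
      nu ≤ |(Matrix.of (fun i => ev κ (τ i))).det| → ∀ (a J : ℕ), 1 ≤ J → 2 * (J * κ) ≤ a →
      ∀ (S : Finset (Fin d → ℤ)), (∀ k ∈ S, ∀ i, |k i| ≤ 2 ^ a) → ∀ f : (Fin d → ℤ) → V (d + 1) → ℂ,
      (∀ k ∈ S, f k ∈ TP (cap d a k)) → ∀ W : V (d + 1) → ℝ≥0∞, SV A (4 ^ a) W →
      AA q (A + (d + 2)) a κ S f W τ (J * κ) ≤ C ^ (J + 1) * ((AA q (A + (d + 2)) a κ S f W τ (2 * (J * κ))) ^ (1 / 2 : ℝ) * (YY q a κ S f W τ (J * κ)) ^ (1 / 2 : ℝ)) := by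
  classical
  set n := d + 1 with hn
  set A1 := A + (d + 2) with hA1
  have hq0 : 0 < q := by linarith
  set t := 4 * q / (q + 2) with ht
  have hd0 : (1 : ℝ) ≤ d := by exact_mod_cast hd
  have ht2 : 2 ≤ t := by rw [ht, le_div_iff₀ (by linarith)]; linarith
  have hnc : (n : ℝ) = d + 1 := by rw [hn]; push_cast; ring
  have hqt : q / (n * t) ≤ 1 / ((n : ℝ) - 1) := by
    rw [hnc, div_le_div_iff₀ (by positivity) (by linarith)]
    rw [ht, one_mul, mul_div_assoc', le_div_iff₀ (by linarith)]
    nlinarith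
  obtain ⟨C0, hC0, hT⟩ := tube d A1 (by omega) t (by linarith)
  obtain ⟨C1, hC1, hB⟩ := ball_infl (n := n) (by omega) A1 (by omega) nu hnu C0 hC0 q t ht2 hq hqt
  obtain ⟨C2, hC2, hL⟩ := GG_L2 d A1
  obtain ⟨C3, hC3, hE⟩ := mult_end (n := n) (by omega) A q hq
  set p := q / (2 * (n : ℝ)) with hp
  have hp0 : 0 ≤ p := by positivity
  set c := ∫⁻ y : V n, kk (A + (2 * A1 + (n + 1))) y with hc
  have hc0 : c ≠ 0 := kk_integral_pos _
  have hct : c ≠ ∞ := kk_integrable (by omega)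
  set E := c⁻¹ * (((C2 ^ (1 / 2 : ℝ)) ^ p) ^ n * C3 ^ (1 / 2 : ℝ)) with hEd
  have hEt : E ≠ ∞ := by
    have h1 : ((C2 ^ (1 / 2 : ℝ)) ^ p) ^ n ≠ ∞ := ENNReal.pow_ne_top (ENNReal.rpow_ne_top_of_nonneg hp0 (ENNReal.rpow_ne_top_of_nonneg (by norm_num) hC2))
    have h2 : C3 ^ (1 / 2 : ℝ) ≠ ∞ := ENNReal.rpow_ne_top_of_nonneg (by norm_num) hC3
    have h3 : c⁻¹ ≠ ∞ := ENNReal.inv_ne_top.2 hc0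
    finiteness
  refine ⟨(1 + E) * C1, by finiteness, fun κ τ hτ hdet a J hJ hJa S hS f hf W hW => ?_⟩
  set b := J * κ with hb
  have hκb : κ ≤ b := by rw [hb]; nlinarith
  have hba : b ≤ a := by omega
  have hK : ((2:ℝ) ^ κ) ^ J * 2 ^ b = 4 ^ b := by
    rw [← pow_mul, mul_comm κ J, ← hb, ← mul_pow]; norm_num
  have h4 : (2:ℝ) ^ (2 * b) = 4 ^ b := by rw [pow_mul]; norm_num
  have hfm : ∀ b' ≤ a, ∀ θ, Measurable (fb a S f b' θ) := fun b' hb' θ => TP_meas (fb_mem hb' hf θ)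
  have hch : ∀ θ : Fin d → ℤ, ∃ H : V n → ℝ≥0∞, (∀ i, |θ i| ≤ 2 ^ b) → (Measurable H ∧
      (∀ s : ℝ, |s| ≤ 4 ^ b → ∀ y, H (y + s • ev b θ) ≤ C0 * H y) ∧
      (∀ y, ‖fb a S f b θ y‖ₑ ^ t ≤ C0 * H y) ∧
      (∀ y, Av A1 (4 ^ b) H y ≤ C0 * Av A1 (4 ^ b) (fun z => ‖fb a S f b θ z‖ₑ ^ t) y)) := by
    intro θ
    by_cases h : ∀ i, |θ i| ≤ 2 ^ b
    · obtain ⟨H, hH⟩ := hT b θ h _ (fb_mem hba hf θ)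
      exact ⟨H, fun _ => hH⟩
    · exact ⟨0, fun h' => absurd h' h⟩
  choose H hH using hch
  set Θ : Fin n → Finset (Fin d → ℤ) := fun i => Th a κ S b (τ i) with hΘ
  have hΘb : ∀ i, ∀ θ ∈ Θ i, ∀ j, |θ j| ≤ 2 ^ b := fun i θ hθ j => Th_bound hS hba hθ j
  have key := hB (fun i => ev κ (τ i)) (fun i => ev_norm (hτ i)) hdet (2 ^ κ) (2 ^ b) J (one_le_pow₀ (by norm_num)) (by positivity)
    (Fin d → ℤ) Θ (fun θ => ev b θ) (fun θ z => ‖fb a S f b θ z‖ₑ) H (fun i θ hθ => (hH θ (hΘb i θ hθ)).1)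
    (fun i θ hθ => (hfm b hba θ).enorm) (fun i θ hθ => by
      have h1 := ev_close hκb θ
      have h2 : par (b - κ) θ = τ i := (Finset.mem_filter.1 hθ).2
      rw [h2] at h1; exact h1) (fun i θ hθ => by rw [hK]; exact (hH θ (hΘb i θ hθ)).2.1)
    (fun i θ hθ => (hH θ (hΘb i θ hθ)).2.2.1) (fun i θ hθ => by rw [hK]; exact (hH θ (hΘb i θ hθ)).2.2.2)
  rw [hK] at key
  -- pointwise bound of the right side
  set P : V n → ℝ≥0∞ := fun x => ∏ i, (GG A1 a κ S f (2 * b) (τ i) x) ^ p with hP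
  set Q : V n → ℝ≥0∞ := fun x => ∏ i, (∑ θ ∈ Θ i, (Av A1 (4 ^ b) (fun z => ‖fb a S f b θ z‖ₑ ^ q) x) ^ (2 / q)) ^ p with hQ
  have pw : ∀ x, ∏ i, (∑ θ ∈ Θ i, (Av A1 (4 ^ b) (fun z => ‖fb a S f b θ z‖ₑ ^ t) x) ^ (2 / t)) ^ p ≤
      ((C2 ^ (1 / 2 : ℝ)) ^ p) ^ n * (P x ^ (1 / 2 : ℝ) * Q x ^ (1 / 2 : ℝ)) := by
    intro x
    have h1 : ∀ i, (∑ θ ∈ Θ i, (Av A1 (4 ^ b) (fun z => ‖fb a S f b θ z‖ₑ ^ t) x) ^ (2 / t)) ^ p ≤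
        (C2 ^ (1 / 2 : ℝ)) ^ p * (((GG A1 a κ S f (2 * b) (τ i) x) ^ p) ^ (1 / 2 : ℝ) * ((∑ θ ∈ Θ i, (Av A1 (4 ^ b) (fun z => ‖fb a S f b θ z‖ₑ ^ q) x) ^ (2 / q)) ^ p) ^ (1 / 2 : ℝ)) := by
      intro i
      have h2 := Finset.sum_le_sum (fun θ (hθ : θ ∈ Θ i) => Av_holder A1 (4 ^ b) ((hfm b hba θ).enorm) hq x)
      have h3 := h2.trans (sum_sqrt_le _ _ _)
      have h4' := hL a κ b (2 * b) hκb (by omega) hJa S f hf (τ i) x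
      rw [h4] at h4'
      have h5 := h3.trans (mul_le_mul_left (ENNReal.rpow_le_rpow h4' (by norm_num : (0:ℝ) ≤ 1 / 2)) _)
      refine (ENNReal.rpow_le_rpow h5 hp0).trans (le_of_eq ?_)
      rw [ENNReal.mul_rpow_of_nonneg _ _ (by norm_num : (0:ℝ) ≤ 1 / 2), ENNReal.mul_rpow_of_nonneg _ _ hp0, ENNReal.mul_rpow_of_nonneg _ _ hp0, mul_assoc]
      congr 2
      · rw [← ENNReal.rpow_mul, ← ENNReal.rpow_mul, mul_comm p]
      · rw [← ENNReal.rpow_mul, ← ENNReal.rpow_mul, mul_comm p]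
    refine (Finset.prod_le_prod' fun i _ => h1 i).trans (le_of_eq ?_)
    rw [Finset.prod_mul_distrib, Finset.prod_mul_distrib, Finset.prod_const, Finset.card_univ, Fintype.card_fin]
    rw [ENNReal.prod_rpow_of_nonneg (r := 1 / 2) (by norm_num), ENNReal.prod_rpow_of_nonneg (r := 1 / 2) (by norm_num)]
  have hPm : Measurable P := by
    apply Finset.measurable_fun_prod
    intro i _
    exact (GG_meas hJa hf (τ i)).pow_const _
  have hQm : Measurable Q := by
    apply Finset.measurable_fun_prod
    intro i _
    apply Measurable.pow_const
    apply Finset.measurable_fun_sum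
    intro θ _
    apply Measurable.pow_const
    apply Av_meas
    have := hfm b hba θ
    fun_prop
  set h0 : V n → ℝ≥0∞ := fun x => ∏ i, (GG A1 a κ S f b (τ i) x) ^ p with hh0
  have h0m : Measurable h0 := by
    apply Finset.measurable_fun_prod
    intro i _
    exact (GG_meas hba hf (τ i)).pow_const _
  have h4b : (4:ℝ) ^ b ≤ 4 ^ a := pow_le_pow_right₀ (by norm_num) hba
  have s1 : c * ∫⁻ x, h0 x * W x ≤ ∫⁻ x, Av (2 * A1 + (n + 1)) (4 ^ b) h0 x * W x := by
    rw [Av_symm _ _ h0m hW.1, ← lintegral_const_mul _ (by have := hW.1; fun_prop)]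
    apply lintegral_mono
    intro x
    have := SV_le_Av (B := 2 * A1 + (n + 1)) (by positivity) h4b hW x
    calc c * (h0 x * W x) = h0 x * (c * W x) := by ring
      _ ≤ _ := mul_le_mul_right this _
  have s2 : ∫⁻ x, Av (2 * A1 + (n + 1)) (4 ^ b) h0 x * W x ≤ ∫⁻ x, (C1 ^ (J + 1) * ((C2 ^ (1 / 2 : ℝ)) ^ p) ^ n) * ((P x ^ (1 / 2 : ℝ) * Q x ^ (1 / 2 : ℝ)) * W x) := by
    apply lintegral_mono
    intro x
    have := (key x).trans (mul_le_mul_right (pw x) _)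
    calc _ ≤ _ := mul_le_mul_left this _
      _ = _ := by ring
  have s3 := cs_int (μ := volume) hPm hQm hW.1
  have s4 := hE (4 ^ b) (4 ^ a) (by positivity) h4b W hW (Fin d → ℤ) Θ (fun θ => fb a S f b θ) (fun i θ _ => hfm b hba θ)
  have s5 : ∫⁻ x, h0 x * W x ≤ c⁻¹ * ((C1 ^ (J + 1) * ((C2 ^ (1 / 2 : ℝ)) ^ p) ^ n) * ((∫⁻ x, P x * W x) ^ (1 / 2 : ℝ) * (C3 * YY q a κ S f W τ b) ^ (1 / 2 : ℝ))) := by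
    rw [← ENNReal.mul_le_iff_le_inv hc0 hct]
    refine s1.trans (s2.trans ?_)
    rw [lintegral_const_mul _ (by have := hW.1; fun_prop)]
    gcongr
    refine s3.trans ?_
    gcongr
    exact s4
  change ∫⁻ x, h0 x * W x ≤ _
  refine s5.trans ?_
  rw [ENNReal.mul_rpow_of_nonneg _ _ (by norm_num)]
  calc _ = (E * C1 ^ (J + 1)) * ((∫⁻ x, P x * W x) ^ (1 / 2 : ℝ) * (YY q a κ S f W τ b) ^ (1 / 2 : ℝ)) := by rw [hEd]; ring
    _ ≤ ((1 + E) * C1) ^ (J + 1) * ((∫⁻ x, P x * W x) ^ (1 / 2 : ℝ) * (YY q a κ S f W τ b) ^ (1 / 2 : ℝ)) := by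
        gcongr
        rw [mul_pow]
        gcongr
        calc E ≤ 1 + E := le_add_self
          _ ≤ _ := le_self_pow (by simp) (by omega)

lemma ml_end (d : ℕ) (A : ℕ) (q : ℝ) (hq : 2 ≤ q) :
    ∃ C : ℝ≥0∞, C ≠ ∞ ∧ ∀ (κ : ℕ) (τ : Fin (d + 1) → Fin d → ℤ) (a : ℕ),
      ∀ (S : Finset (Fin d → ℤ)) (f : (Fin d → ℤ) → V (d + 1) → ℂ),
      (∀ k ∈ S, f k ∈ TP (cap d a k)) → ∀ W : V (d + 1) → ℝ≥0∞, SV A (4 ^ a) W →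
      AA q (A + (d + 2)) a κ S f W τ a ≤ C * YY q a κ S f W τ a := by
  obtain ⟨C3, hC3, hE⟩ := mult_end (n := d + 1) (by omega) A q hq
  set n := d + 1 with hn
  set A1 := A + (d + 2) with hA1
  set p := q / (2 * (n : ℝ)) with hp
  have hq0 : 0 < q := by linarith
  have hp0 : 0 ≤ p := by positivity
  set I := ((∫⁻ y : V n, kk A1 y) ^ (q / 2 - 1)) ^ (2 / q) with hI
  have hIt : I ≠ ∞ := ENNReal.rpow_ne_top_of_nonneg (by positivity) (ENNReal.rpow_ne_top_of_nonneg (by linarith) (kk_integrable (by omega)))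
  have hIp : I ^ p ≠ ∞ := ENNReal.rpow_ne_top_of_nonneg hp0 hIt
  refine ⟨(I ^ p) ^ n * C3, by finiteness, fun κ τ a S f hf W hW => ?_⟩
  have hfm : ∀ θ, Measurable (fb a S f a θ) := fun θ => TP_meas (fb_mem le_rfl hf θ)
  have s4 := hE (2 ^ a) (4 ^ a) (by positivity) (pow_le_pow_left₀ (by norm_num) (by norm_num) _) W hW (Fin d → ℤ) (fun i => Th a κ S a (τ i)) (fun θ => fb a S f a θ) (fun i θ _ => hfm θ)
  rw [mul_assoc]
  refine le_trans ?_ (mul_le_mul_right s4 _)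
  have hAm : ∀ θ, Measurable (Av A1 (2 ^ a) (fun z => ‖fb a S f a θ z‖ₑ ^ q)) := fun θ => by
    apply Av_meas; have := hfm θ; fun_prop
  rw [← lintegral_const_mul']
  swap
  · finiteness
  apply lintegral_mono
  intro x
  dsimp only
  rw [← mul_assoc]
  apply mul_le_mul_left
  have : ∀ i, (GG A1 a κ S f a (τ i) x) ^ p ≤ I ^ p * (∑ θ ∈ Th a κ S a (τ i), (Av A1 (2 ^ a) (fun z => ‖fb a S f a θ z‖ₑ ^ q) x) ^ (2 / q)) ^ p := by
    intro i
    rw [← ENNReal.mul_rpow_of_nonneg _ _ hp0, Finset.mul_sum]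
    apply ENNReal.rpow_le_rpow _ hp0
    unfold GG
    exact Finset.sum_le_sum fun θ _ => Av_jensen A1 (by omega) (2 ^ a) ((hfm θ).enorm) hq x
  refine (Finset.prod_le_prod' fun i _ => this i).trans (le_of_eq ?_)
  rw [Finset.prod_mul_distrib, Finset.prod_const, Finset.card_univ, Fintype.card_fin]

end QPS

namespace QPS
set_option linter.all false
open scoped ENNReal NNReal BigOperators FourierTransform SchwartzMap ComplexConjugate
variable {m : ℕ}

lemma two_rpow_add (x y : ℝ) : (2:ℝ≥0∞) ^ (x + y) = 2 ^ x * 2 ^ y := ENNReal.rpow_add x y (by norm_num) (by norm_num)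

lemma two_rpow_mono {x y : ℝ} (h : x ≤ y) : (2:ℝ≥0∞) ^ x ≤ 2 ^ y := ENNReal.rpow_le_rpow_of_exponent_le (by norm_num) h

lemma two_rpow_ne_top (x : ℝ) : (2:ℝ≥0∞) ^ x ≠ ∞ := by
  exact ENNReal.rpow_ne_top_of_ne_zero (by norm_num) (by norm_num)

def DB (d : ℕ) (q : ℝ) (A : ℕ) (η : ℝ) (Cη : ℝ≥0∞) : Prop := ∀ a : ℕ, Dec d q A a (Cη * 2 ^ ((a : ℝ) * η))

lemma sum_N2_rescale_lt {d : ℕ} {q : ℝ} (hq : 2 ≤ q) {A : ℕ} {η : ℝ} (hη : 0 ≤ η) {Cη : ℝ≥0∞} (hC : 1 ≤ Cη) 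
    {a b : ℕ} (h : ∀ a' < a, Dec d q A a' (Cη * 2 ^ ((a' : ℝ) * η))) (hb : b ≤ a) {S : Finset (Fin d → ℤ)} (hS : ∀ k ∈ S, ∀ i, |k i| ≤ 2 ^ a) {f : (Fin d → ℤ) → V (d + 1) → ℂ}
    (hf : ∀ k ∈ S, f k ∈ TP (cap d a k)) {W : V (d + 1) → ℝ≥0∞} (hW : SV A (4 ^ a) W) (T : Finset (Fin d → ℤ)) (hT : T ⊆ S.image (par (a - b))) :
    ∑ θ ∈ T, N2 q W (fb a S f b θ) ≤ (2 ^ d : ℕ) * Cη * 2 ^ (((a : ℝ) - b) * η) * ∑ k ∈ S, N2 q W (f k) := by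
  classical
  have h1 : ∀ θ ∈ T, N2 q W (fb a S f b θ) ≤ (2 ^ d : ℕ) * Cη * 2 ^ (((a : ℝ) - b) * η) * ∑ k ∈ S with par (a - b) k = θ, N2 q W (f k) := by
    intro θ hθ
    obtain ⟨k0, hk0, rfl⟩ := Finset.mem_image.1 (hT hθ)
    rcases hb.lt_or_eq with hlt | rfl
    · obtain ⟨a', rfl⟩ : ∃ a', a = b + (a' + 1) := ⟨a - b - 1, by omega⟩
      have e : b + (a' + 1) - b = a' + 1 := by omega
      have := Dec_rescale hq (h a' (by omega)) b (S.filter (fun k => par (a' + 1) k = par (a' + 1) k0)) f (par (a' + 1) k0) (fun i => by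
        have := par_bound hb (hS k0 hk0) i; rw [e] at this; exact this) (fun k hk => (Finset.mem_filter.1 hk).2)
        (fun k hk => hf k (Finset.mem_filter.1 hk).1) W hW
      unfold fb
      rw [e]
      refine this.trans ?_
      rw [← mul_assoc]
      gcongr
      · norm_num
      · push_cast; linarith
    · have e1 : b - b = 0 := by omega
      simp only [e1, par_zero]
      rw [fb_self hk0, Finset.sum_filter, Finset.sum_ite_eq' S k0, if_pos hk0]
      have : (1:ℝ≥0∞) ≤ (2 ^ d : ℕ) * Cη * 2 ^ (((b : ℝ) - b) * η) := by
        rw [sub_self, zero_mul, ENNReal.rpow_zero, mul_one]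
        have : (1:ℝ≥0∞) ≤ (2 ^ d : ℕ) := by exact_mod_cast Nat.one_le_two_pow
        exact one_le_mul this hC
      exact le_mul_of_one_le_left zero_le this
  refine (Finset.sum_le_sum h1).trans ?_
  rw [← Finset.mul_sum]
  gcongr
  calc _ ≤ ∑ θ ∈ S.image (par (a - b)), ∑ k ∈ S with par (a - b) k = θ, N2 q W (f k) := Finset.sum_le_sum_of_subset hT
    _ = _ := Finset.sum_fiberwise_of_maps_to (fun k hk => Finset.mem_image_of_mem _ hk) _

lemma sum_N2_rescale {d : ℕ} {q : ℝ} (hq : 2 ≤ q) {A : ℕ} {η : ℝ} (hη : 0 ≤ η) {Cη : ℝ≥0∞} (hC : 1 ≤ Cη) (h : DB d q A η Cη)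
    {a b : ℕ} (hb : b ≤ a) {S : Finset (Fin d → ℤ)} (hS : ∀ k ∈ S, ∀ i, |k i| ≤ 2 ^ a) {f : (Fin d → ℤ) → V (d + 1) → ℂ}
    (hf : ∀ k ∈ S, f k ∈ TP (cap d a k)) {W : V (d + 1) → ℝ≥0∞} (hW : SV A (4 ^ a) W) (T : Finset (Fin d → ℤ)) (hT : T ⊆ S.image (par (a - b))) :
    ∑ θ ∈ T, N2 q W (fb a S f b θ) ≤ (2 ^ d : ℕ) * Cη * 2 ^ (((a : ℝ) - b) * η) * ∑ k ∈ S, N2 q W (f k) :=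
  sum_N2_rescale_lt hq hη hC (fun a' _ => h a') hb hS hf hW T hT

lemma YY_bound {d : ℕ} {q : ℝ} (hq : 2 ≤ q) {A : ℕ} {η : ℝ} (hη : 0 ≤ η) {Cη : ℝ≥0∞} (hC : 1 ≤ Cη) (h : DB d q A η Cη)
    {a b κ : ℕ} (hb : b ≤ a) {S : Finset (Fin d → ℤ)} (hS : ∀ k ∈ S, ∀ i, |k i| ≤ 2 ^ a) {f : (Fin d → ℤ) → V (d + 1) → ℂ}
    (hf : ∀ k ∈ S, f k ∈ TP (cap d a k)) {W : V (d + 1) → ℝ≥0∞} (hW : SV A (4 ^ a) W) (τ : Fin (d + 1) → Fin d → ℤ) :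
    YY q a κ S f W τ b ≤ ((2 ^ d : ℕ) * Cη * ∑ k ∈ S, N2 q W (f k)) ^ (q / 2) * 2 ^ ((q / 2) * (((a : ℝ) - b) * η)) := by
  unfold YY
  set p := q / (2 * ((d + 1 : ℕ) : ℝ)) with hp
  have hp0 : 0 ≤ p := by positivity
  have h1 : ∀ i, (∑ θ ∈ Th a κ S b (τ i), N2 q W (fb a S f b θ)) ^ p ≤ ((2 ^ d : ℕ) * Cη * 2 ^ (((a : ℝ) - b) * η) * ∑ k ∈ S, N2 q W (f k)) ^ p := by
    intro i
    exact ENNReal.rpow_le_rpow (sum_N2_rescale hq hη hC h hb hS hf hW _ (Finset.filter_subset _ _)) hp0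
  refine (Finset.prod_le_prod' fun i _ => h1 i).trans (le_of_eq ?_)
  rw [Finset.prod_const, Finset.card_univ, Fintype.card_fin, ← ENNReal.rpow_natCast, ← ENNReal.rpow_mul]
  have e : p * ((d + 1 : ℕ) : ℝ) = q / 2 := by
    rw [hp]; field_simp
  rw [e, mul_comm (q / 2) (_ * η), ENNReal.rpow_mul 2 _ (q / 2), ← ENNReal.mul_rpow_of_nonneg _ _ (by linarith)]
  congr 1
  ring

noncomputable def eM (η ε : ℝ) (i : ℕ) : ℝ := η * (1 - (1 / 2) ^ i * (1 + i / 2)) + ε * i * (1 / 2) ^ i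

lemma eM_succ (η ε : ℝ) (i : ℕ) : eM η ε (i + 1) = eM η ε i / 2 + η * (1 - (1 / 2) ^ (i + 1)) / 2 + ε * (1 / 2) ^ (i + 1) := by
  unfold eM
  push_cast
  ring

lemma eM_zero (η ε : ℝ) : eM η ε 0 = 0 := by simp [eM]

lemma ml_bound (d : ℕ) (hd : 1 ≤ d) (A : ℕ) (q : ℝ) (hq : 2 ≤ q) (hqd : q * d ≤ 2 * d + 4) (nu : ℝ) (hnu : 0 < nu) (ε : ℝ) (hε : 0 < ε) :
    ∃ (κ1 : ℕ) (K : ℝ≥0∞), K ≠ ∞ ∧ ∀ (η : ℝ) (Cη : ℝ≥0∞), 0 ≤ η → 1 ≤ Cη → DB d q A η Cη →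
      ∀ κ, κ1 ≤ κ → ∀ (τ : Fin (d + 1) → Fin d → ℤ), (∀ i j, |τ i j| ≤ 2 ^ κ) →
      nu ≤ |(Matrix.of (fun i => ev κ (τ i))).det| → ∀ (i a J : ℕ), 1 ≤ J → a = 2 ^ i * (J * κ) →
      ∀ (S : Finset (Fin d → ℤ)), (∀ k ∈ S, ∀ i, |k i| ≤ 2 ^ a) → ∀ f : (Fin d → ℤ) → V (d + 1) → ℂ,
      (∀ k ∈ S, f k ∈ TP (cap d a k)) → ∀ W : V (d + 1) → ℝ≥0∞, SV A (4 ^ a) W →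
      AA q (A + (d + 2)) a κ S f W τ (J * κ) ≤ K * (((2 ^ d : ℕ) * Cη * ∑ k ∈ S, N2 q W (f k)) ^ (q / 2) * 2 ^ ((q / 2) * (a * eM η ε i))) := by
  obtain ⟨C1, hC1, h1⟩ := ml_step d hd A q hq hqd nu hnu
  obtain ⟨C2, hC2, h2⟩ := ml_end d A q hq
  set C := C1 + C2 + 1 with hC
  have hCt : C ≠ ∞ := by finiteness
  have hC1' : 1 ≤ C := le_add_self
  obtain ⟨κ1, hκ1⟩ : ∃ κ1 : ℕ, C ≤ 2 ^ ((κ1 : ℝ) * (ε * (q / 2))) := by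
    obtain ⟨N, hN⟩ := ENNReal.exists_nat_gt hCt
    obtain ⟨κ1, h⟩ := exists_nat_ge ((N : ℝ) / (ε * (q / 2)))
    refine ⟨κ1, hN.le.trans ?_⟩
    rw [div_le_iff₀ (by positivity)] at h
    calc (N : ℝ≥0∞) ≤ (2 : ℝ≥0∞) ^ N := by exact_mod_cast (Nat.lt_two_pow_self).le
      _ = 2 ^ (N : ℝ) := (ENNReal.rpow_natCast _ _).symm
      _ ≤ _ := two_rpow_mono h
  refine ⟨κ1, C ^ 2, by finiteness, fun η Cη hη hCη hDB κ hκ τ hτ hdet i => ?_⟩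
  have hCκ : C ≤ 2 ^ ((κ : ℝ) * (ε * (q / 2))) := hκ1.trans (two_rpow_mono (by gcongr))
  induction i with
  | zero =>
    intro a J hJ ha S hS f hf W hW
    rw [pow_zero, one_mul] at ha
    rw [← ha]
    refine (h2 κ τ a S f hf W hW).trans ?_
    have := YY_bound hq hη hCη hDB (κ := κ) (le_refl a) hS hf hW τ
    rw [eM_zero, mul_zero, mul_zero, ENNReal.rpow_zero, mul_one]
    rw [sub_self, zero_mul, mul_zero, ENNReal.rpow_zero, mul_one] at this
    gcongr
    calc C2 ≤ C := by rw [hC]; calc C2 ≤ C1 + C2 := le_add_self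
                          _ ≤ _ := le_self_add
      _ ≤ C ^ 2 := le_self_pow hC1' (by norm_num)
  | succ i ih =>
    intro a J hJ ha S hS f hf W hW
    have ha2 : a = 2 ^ i * ((2 * J) * κ) := by rw [ha, pow_succ]; ring
    have hih := ih a (2 * J) (by omega) ha2 S hS f hf W hW
    have hle : 2 * (J * κ) ≤ a := by
      rw [ha2]
      have : 1 ≤ 2 ^ i := Nat.one_le_two_pow
      nlinarith
    have hs := h1 κ τ hτ hdet a J hJ hle S hS f hf W hW
    have hy := YY_bound hq hη hCη hDB (κ := κ) (b := J * κ) (by omega) hS hf hW τ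
    rw [← mul_assoc 2 J κ] at hs
    set E := ((2 ^ d : ℕ) * Cη * ∑ k ∈ S, N2 q W (f k)) ^ (q / 2) with hE
    set u := (q / 2) * (a * eM η ε i) with hu
    set v := (q / 2) * (((a : ℝ) - (J * κ : ℕ)) * η) with hv
    refine hs.trans ?_
    have hCJ : C1 ^ (J + 1) ≤ C * 2 ^ ((J * κ : ℕ) * (ε * (q / 2))) := by
      calc C1 ^ (J + 1) ≤ C ^ (J + 1) := by gcongr; rw [hC, add_assoc]; exact le_self_add
        _ = C * C ^ J := by rw [pow_succ]; ring
        _ ≤ C * (2 ^ ((κ : ℝ) * (ε * (q / 2)))) ^ J := by gcongr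
        _ = _ := by
          rw [← ENNReal.rpow_natCast, ← ENNReal.rpow_mul]; congr 2; push_cast; ring
    calc _ ≤ (C * 2 ^ ((J * κ : ℕ) * (ε * (q / 2)))) * ((C ^ 2 * (E * 2 ^ u)) ^ (1 / 2 : ℝ) * (E * 2 ^ v) ^ (1 / 2 : ℝ)) := by
          gcongr
      _ = (C * (C ^ 2) ^ (1 / 2 : ℝ)) * ((E ^ (1 / 2 : ℝ) * E ^ (1 / 2 : ℝ)) * (2 ^ ((J * κ : ℕ) * (ε * (q / 2))) * ((2 ^ u) ^ (1 / 2 : ℝ) * (2 ^ v) ^ (1 / 2 : ℝ)))) := by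
          rw [ENNReal.mul_rpow_of_nonneg _ _ (by norm_num), ENNReal.mul_rpow_of_nonneg _ _ (by norm_num), ENNReal.mul_rpow_of_nonneg _ _ (by norm_num)]
          ring
      _ = C ^ 2 * (E * 2 ^ ((q / 2) * (a * eM η ε (i + 1)))) := by
          rw [← ENNReal.rpow_add_of_nonneg _ _ (by norm_num) (by norm_num), ← ENNReal.rpow_mul 2 u, ← ENNReal.rpow_mul 2 v, ← two_rpow_add, ← two_rpow_add]
          have e1 : (C ^ 2) ^ (1 / 2 : ℝ) = C := by
            rw [← ENNReal.rpow_natCast, ← ENNReal.rpow_mul]; norm_num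
          have e2 : ((J * κ : ℕ) : ℝ) = a * (1 / 2) ^ (i + 1) := by
            rw [ha]; push_cast; rw [one_div, inv_pow]; field_simp
          rw [e1, show (1 / 2 : ℝ) + 1 / 2 = 1 by norm_num, ENNReal.rpow_one, eM_succ, hu, hv, e2]
          congr 1
          · ring
          · congr 2; ring

end QPS

namespace QPS
set_option linter.all false
open scoped ENNReal NNReal BigOperators FourierTransform SchwartzMap ComplexConjugate
variable {m : ℕ}

lemma exists_perp {n : ℕ} (u : Fin n → V n) (i : Fin n) : ∃ w : V n, ‖w‖ = 1 ∧ ∀ l < i, ∑ j, w j * u l j = 0 := by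
  classical
  set M : Matrix (Fin n) (Fin n) ℝ := Matrix.of (fun l j => if l < i then u l j else 0) with hM
  have hdet : M.det = 0 := Matrix.det_eq_zero_of_row_eq_zero i (fun j => by simp [hM])
  obtain ⟨w, hw0, hw⟩ := Matrix.exists_mulVec_eq_zero_iff.2 hdet
  have hn : ‖w‖ ≠ 0 := norm_ne_zero_iff.2 hw0
  refine ⟨‖w‖⁻¹ • w, ?_, ?_⟩
  · rw [norm_smul, norm_inv, norm_norm, inv_mul_cancel₀ hn]
  · intro l hl
    have := congrFun hw l
    simp only [Matrix.mulVec, dotProduct, hM, Matrix.of_apply, if_pos hl, Pi.zero_apply] at this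
    simp only [Pi.smul_apply, smul_eq_mul, mul_assoc]
    rw [← Finset.mul_sum]
    simp only [mul_comm (w _)]
    rw [this, mul_zero]

lemma transv {n : ℕ} (U : Set (V n)) {δ : ℝ} (hδ : 0 < δ) (h : ∀ w : V n, ‖w‖ = 1 → ∃ u ∈ U, δ < |∑ j, w j * u j|) :
    ∃ u : Fin n → V n, (∀ i, u i ∈ U) ∧ δ ^ n / (n.factorial : ℝ) ≤ |(Matrix.of u).det| := by
  classical
  have key : ∀ i ≤ n, ∃ u w : Fin n → V n, ∀ j : Fin n, (j : ℕ) < i → u j ∈ U ∧ ‖w j‖ = 1 ∧ δ < |∑ k, w j k * u j k| ∧ ∀ l < j, ∑ k, w j k * u l k = 0 := by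
    intro i
    induction i with
    | zero => intro _; exact ⟨0, 0, fun j hj => absurd hj (by omega)⟩
    | succ i ih =>
      intro hi
      have hin : i < n := by omega
      obtain ⟨u, w, huw⟩ := ih (by omega)
      obtain ⟨w', hw1, hw2⟩ := exists_perp u ⟨i, hin⟩
      obtain ⟨u', hu1, hu2⟩ := h w' hw1
      refine ⟨Function.update u ⟨i, hin⟩ u', Function.update w ⟨i, hin⟩ w', fun j hj => ?_⟩
      by_cases hji : j = ⟨i, hin⟩
      · subst hji
        simp only [Function.update_self]
        refine ⟨hu1, hw1, hu2, fun l hl => ?_⟩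
        rw [Function.update_of_ne hl.ne]
        exact hw2 l hl
      · have hlt : (j : ℕ) < i := by
          have : (j : ℕ) ≠ i := fun e => hji (Fin.ext e)
          omega
        rw [Function.update_of_ne hji, Function.update_of_ne hji]
        obtain ⟨h1, h2, h3, h4⟩ := huw j hlt
        refine ⟨h1, h2, h3, fun l hl => ?_⟩
        have hli : l ≠ ⟨i, hin⟩ := by
          intro e; subst e
          have : i < (j : ℕ) := hl
          omega
        rw [Function.update_of_ne hli]
        exact h4 l hl
  obtain ⟨u, w, huw⟩ := key n le_rfl
  refine ⟨u, fun i => (huw i i.2).1, ?_⟩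
  set P : Matrix (Fin n) (Fin n) ℝ := Matrix.of w * (Matrix.of u).transpose with hP
  have hPe : ∀ i j, P i j = ∑ k, w i k * u j k := fun i j => by
    simp [hP, Matrix.mul_apply]
  have hPd : P.det = ∏ i, P i i := by
    apply Matrix.det_of_upperTriangular
    intro i j hij
    rw [hPe]
    exact (huw i i.2).2.2.2 j hij
  have h1 : δ ^ n ≤ |P.det| := by
    rw [hPd, Finset.abs_prod]
    calc δ ^ n = ∏ i : Fin n, δ := by simp
      _ ≤ _ := Finset.prod_le_prod (fun _ _ => hδ.le) (fun i _ => by rw [hPe]; exact (huw i i.2).2.2.1.le)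
  have h2 : |(Matrix.of w).det| ≤ n.factorial := by
    have := Matrix.det_le (A := Matrix.of w) (abv := AbsoluteValue.abs) (x := 1) (fun i j => by
      have := norm_le_pi_norm (w i) j
      rw [(huw i i.2).2.1] at this
      exact this)
    simpa using this
  rw [hP, Matrix.det_mul, Matrix.det_transpose, abs_mul] at h1
  rw [div_le_iff₀ (by positivity)]
  refine h1.trans ?_
  rw [mul_comm]
  gcongr

/-- from an approximate annihilator to a hyperplane -/
lemma hyperplane {d : ℕ} (w : V (d + 1)) (hw : ‖w‖ = 1) (κ1 : ℕ) (Sg : Finset (Fin d → ℤ)) (hSg : Sg.Nonempty)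
    (hb : ∀ τ ∈ Sg, ∀ i, |τ i| ≤ 2 ^ κ1) {δ : ℝ} (hδ : δ ≤ 1 / 2) (h : ∀ τ ∈ Sg, |∑ j, w j * ev κ1 τ j| ≤ δ) :
    ∃ (v : EuclideanSpace ℝ (Fin d)) (s0 : ℝ), ‖v‖ = 1 ∧ |s0| ≤ 3 * d ∧ ∀ τ ∈ Sg, |∑ j, v j * (τ j / 2 ^ κ1) - s0| ≤ 2 * d * δ := by
  have hsum : ∀ τ : Fin d → ℤ, ∑ j, w j * ev κ1 τ j = w 0 - 2 * ∑ j : Fin d, w j.succ * (τ j / 2 ^ κ1) := by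
    intro τ
    rw [Fin.sum_univ_succ]
    simp only [ev, Fin.cons_zero, Fin.cons_succ]
    rw [Finset.mul_sum, sub_eq_add_neg, ← Finset.sum_neg_distrib, mul_one]
    congr 1
    apply Finset.sum_congr rfl; intro j _; ring
  have hc : ∀ τ ∈ Sg, ∀ j, |(τ j : ℝ) / 2 ^ κ1| ≤ 1 := by
    intro τ hτ j
    have : |(τ j : ℝ)| ≤ 2 ^ κ1 := by exact_mod_cast hb τ hτ j
    rw [abs_div, abs_of_pos (show (0:ℝ) < 2 ^ κ1 by positivity), div_le_one (by positivity)]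
    exact this
  set N := ∑ j : Fin d, |w j.succ| with hN
  have hw0 : |w 0| ≤ δ + 2 * N := by
    obtain ⟨τ, hτ⟩ := hSg
    have h1 := h τ hτ
    rw [hsum] at h1
    have h2 : |∑ j : Fin d, w j.succ * (τ j / 2 ^ κ1)| ≤ N := by
      refine (Finset.abs_sum_le_sum_abs _ _).trans (Finset.sum_le_sum fun j _ => ?_)
      rw [abs_mul]
      exact mul_le_of_le_one_right (abs_nonneg _) (hc τ hτ j)
    have := abs_sub_abs_le_abs_sub (w 0) (2 * ∑ j : Fin d, w j.succ * (τ j / 2 ^ κ1))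
    rw [abs_mul, abs_two] at this
    linarith
  have hN0 : 0 ≤ N := Finset.sum_nonneg fun _ _ => abs_nonneg _
  have hNq : 1 / 4 ≤ N := by
    by_contra hlt
    push Not at hlt
    have : ‖w‖ < 1 := by
      rw [pi_norm_lt_iff one_pos]
      intro i
      refine Fin.cases ?_ (fun i => ?_) i
      · rw [Real.norm_eq_abs]; linarith
      · rw [Real.norm_eq_abs]
        have := Finset.single_le_sum (f := fun j : Fin d => |w j.succ|) (fun _ _ => abs_nonneg _) (Finset.mem_univ i)
        linarith
    linarith
  set w' : EuclideanSpace ℝ (Fin d) := WithLp.toLp 2 (fun j => w j.succ) with hw'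
  have hw'j : ∀ j, w' j = w j.succ := fun j => rfl
  have hd0 : 0 < d := by
    rcases Nat.eq_zero_or_pos d with rfl | h'
    · simp [hN] at hNq; linarith
    · exact h'
  have hdr : (1:ℝ) ≤ d := by exact_mod_cast hd0
  have hNd : N ≤ d * ‖w'‖ := by
    calc N ≤ ∑ j : Fin d, ‖w'‖ := Finset.sum_le_sum fun j _ => by
          have := EuclideanSpace.norm_eq w'
          have h2 := PiLp.norm_apply_le w' j
          exact h2
      _ = _ := by simp
  have hwpos : 0 < ‖w'‖ := by
    by_contra hh
    have : ‖w'‖ = 0 := le_antisymm (not_lt.1 hh) (norm_nonneg _)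
    rw [this] at hNd; linarith
  have hw14 : 1 / 4 ≤ d * ‖w'‖ := hNq.trans hNd
  refine ⟨‖w'‖⁻¹ • w', w 0 / (2 * ‖w'‖), ?_, ?_, ?_⟩
  · rw [norm_smul, norm_inv, norm_norm, inv_mul_cancel₀ hwpos.ne']
  · rw [abs_div, abs_of_pos (show 0 < 2 * ‖w'‖ by positivity), div_le_iff₀ (by positivity)]
    nlinarith
  · intro τ hτ
    have h1 := h τ hτ
    rw [hsum] at h1
    have e : ∑ j, (‖w'‖⁻¹ • w') j * ((τ j : ℝ) / 2 ^ κ1) - w 0 / (2 * ‖w'‖) = - (w 0 - 2 * ∑ j : Fin d, w j.succ * (τ j / 2 ^ κ1)) / (2 * ‖w'‖) := by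
      have : ∑ j, (‖w'‖⁻¹ • w') j * ((τ j : ℝ) / 2 ^ κ1) = ‖w'‖⁻¹ * ∑ j : Fin d, w j.succ * (τ j / 2 ^ κ1) := by
        rw [Finset.mul_sum]
        apply Finset.sum_congr rfl
        intro j _
        simp [hw'j, mul_assoc]
      rw [this]
      field_simp
      ring
    rw [e, abs_div, abs_neg, abs_of_pos (show 0 < 2 * ‖w'‖ by positivity), div_le_iff₀ (by positivity)]
    have hδ0 : 0 ≤ δ := (abs_nonneg _).trans h1
    nlinarith

end QPS

namespace QPS
set_option linter.all false
open scoped ENNReal NNReal BigOperators FourierTransform SchwartzMap ComplexConjugate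
variable {m : ℕ}

noncomputable def sn {n : ℕ} (u : V n) (y : ℝ) : V (n + 1) := Fin.snoc (α := fun _ => ℝ) u y

lemma sn_last {n : ℕ} (u : V n) (y : ℝ) : sn u y (Fin.last n) = y := Fin.snoc_last _ _
lemma sn_castSucc {n : ℕ} (u : V n) (y : ℝ) (i : Fin n) : sn u y i.castSucc = u i := Fin.snoc_castSucc _ _ _
lemma sn_zero {n : ℕ} (u : V (n + 1)) (y : ℝ) : sn u y 0 = u 0 := sn_castSucc u y 0
lemma sn_succ {n : ℕ} (u : V (n + 1)) (y : ℝ) (i : Fin n) : sn u y i.castSucc.succ = u i.succ := by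
  rw [Fin.succ_castSucc]; exact sn_castSucc u y _
lemma sn_succ_last {n : ℕ} (u : V (n + 1)) (y : ℝ) : sn u y (Fin.last n).succ = y := sn_last u y

lemma sn_add {n : ℕ} (u u' : V n) (y y' : ℝ) : sn (u + u') (y + y') = sn u y + sn u' y' := by
  ext i
  refine Fin.lastCases ?_ (fun i => ?_) i
  · simp [sn_last]
  · simp [sn_castSucc]

lemma sn_norm {n : ℕ} (u : V n) : ‖sn u 0‖ ≤ ‖u‖ := by
  rw [pi_norm_le_iff_of_nonneg (norm_nonneg _)]
  intro i
  refine Fin.lastCases ?_ (fun i => ?_) i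
  · simp [sn_last]
  · rw [sn_castSucc]; exact norm_le_pi_norm u i

lemma sn_meas {n : ℕ} : Measurable (fun p : ℝ × V n => sn p.2 p.1) := by
  rw [measurable_pi_iff]
  intro i
  refine Fin.lastCases ?_ (fun i => ?_) i
  · simp only [sn_last]; fun_prop
  · simp only [sn_castSucc]; fun_prop

lemma lintegral_sn {n : ℕ} (h : V (n + 1) → ℝ≥0∞) (hh : Measurable h) :
    ∫⁻ z, h z = ∫⁻ y : ℝ, ∫⁻ u : V n, h (sn u y) := by
  have hmp := (volume_preserving_piFinSuccAbove (fun _ : Fin (n + 1) => ℝ) (Fin.last n)).symm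
  rw [← hmp.lintegral_comp hh, Measure.volume_eq_prod, lintegral_prod]
  · apply lintegral_congr; intro y
    apply lintegral_congr; intro u
    congr 1
    show Fin.insertNth (α := fun _ => ℝ) (Fin.last n) y u = _
    rw [Fin.insertNth_last']; rfl
  · exact (hh.comp (MeasurableEquiv.measurable _)).aemeasurable

lemma card_cluster {d : ℕ} (S : Finset (Fin d → ℤ)) (N : ℕ) (h : ∀ α ∈ S, ∀ β ∈ S, ∀ i, |α i - β i| ≤ N) :
    S.card ≤ (2 * N + 1) ^ d := by
  classical
  rcases S.eq_empty_or_nonempty with rfl | ⟨β, hβ⟩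
  · simp
  · have : S ⊆ Fintype.piFinset (fun i => Finset.Icc (β i - N) (β i + N)) := by
      intro α hα
      rw [Fintype.mem_piFinset]
      intro i
      have := abs_le.1 (h α hα β hβ i)
      rw [Finset.mem_Icc]; constructor <;> omega
    refine (Finset.card_le_card this).trans ?_
    rw [Fintype.card_piFinset]
    simp only [Int.card_Icc]
    have : ∀ i, (β i + (N:ℤ) + 1 - (β i - N)).toNat = 2 * N + 1 := fun i => by omega
    simp [this]

/-- orthonormal frame data -/
lemma frame {e : ℕ} (v : EuclideanSpace ℝ (Fin (e + 1))) (hv : ‖v‖ = 1) :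
    ∃ B : Fin (e + 1) → Fin (e + 1) → ℝ, (∀ i, B (Fin.last e) i = v i) ∧
      (∀ j i, |B j i| ≤ 1) ∧ (∀ l : Fin (e + 1) → ℝ, ∀ i, l i = ∑ j, (∑ i', B j i' * l i') * B j i) ∧
      (∀ l : Fin (e + 1) → ℝ, ∑ i, l i ^ 2 = ∑ j, (∑ i', B j i' * l i') ^ 2) ∧
      (∀ c : Fin (e + 1) → ℝ, (∀ i, ∑ j, c j * B j i = 0) → c = 0) := by
  have hon : Orthonormal ℝ (({Fin.last e} : Set (Fin (e + 1))).restrict (fun _ => v)) := by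
    constructor
    · intro i; exact hv
    · intro i j hij; exact absurd (Subtype.ext (by rw [i.2, j.2])) hij
  obtain ⟨b, hb⟩ := hon.exists_orthonormalBasis_extension_of_card_eq (by simp) 
  have hbl : b (Fin.last e) = v := hb _ rfl
  have hin : ∀ (j) (l : Fin (e+1) → ℝ), inner ℝ (b j) (WithLp.toLp 2 l) = ∑ i', b j i' * l i' := by
    intro j l
    simp [PiLp.inner_apply, mul_comm]
  refine ⟨fun j i => b j i, fun i => by dsimp only; rw [hbl], fun j i => ?_, fun l i => ?_, fun l => ?_, fun c hc => ?_⟩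
  · have := PiLp.norm_apply_le (b j) i
    rwa [b.norm_eq_one] at this
  · have := b.sum_repr' (WithLp.toLp 2 l)
    have := congrArg (fun w : EuclideanSpace ℝ (Fin (e+1)) => w i) this
    simp only [hin] at this
    rw [WithLp.ofLp_sum, Finset.sum_apply] at this
    simpa using this.symm
  · have := b.sum_sq_norm_inner_right (WithLp.toLp 2 l)
    simp only [hin, Real.norm_eq_abs, sq_abs] at this
    rw [this, EuclideanSpace.norm_sq_eq]
    simp
  · have h0 : ∑ j, c j • b j = 0 := by
      ext i
      rw [WithLp.ofLp_sum, Finset.sum_apply]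
      simpa using hc i
    ext j
    exact Fintype.linearIndependent_iff.1 b.orthonormal.linearIndependent c h0 j

/-- the narrow map -/
noncomputable def NM {e : ℕ} (B : Fin (e + 1) → Fin (e + 1) → ℝ) (s0 : ℝ) (γ : ℕ) : V (e + 2) →ₗ[ℝ] V (e + 2) where
  toFun p := Fin.cons ((4 ^ γ)⁻¹ * p 0) (fun i => ∑ j, ((2 ^ γ)⁻¹ * p j.succ - (if j = Fin.last e then 2 * s0 * ((4 ^ γ)⁻¹ * p 0) else 0)) * B j i)
  map_add' x y := by
    ext i
    refine Fin.cases ?_ (fun i => ?_) i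
    · simp; ring
    · simp only [Fin.cons_succ, Pi.add_apply]
      rw [← Finset.sum_add_distrib]
      apply Finset.sum_congr rfl; intro j _
      split_ifs <;> ring
  map_smul' c x := by
    ext i
    refine Fin.cases ?_ (fun i => ?_) i
    · simp; ring
    · simp only [Fin.cons_succ, Pi.smul_apply, smul_eq_mul, RingHom.id_apply]
      rw [Finset.mul_sum]
      apply Finset.sum_congr rfl; intro j _
      split_ifs <;> ring

lemma NM_zero {e : ℕ} (B : Fin (e + 1) → Fin (e + 1) → ℝ) (s0 : ℝ) (γ : ℕ) (p) : NM B s0 γ p 0 = (4 ^ γ)⁻¹ * p 0 := rfl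
lemma NM_succ {e : ℕ} (B : Fin (e + 1) → Fin (e + 1) → ℝ) (s0 : ℝ) (γ : ℕ) (p) (i : Fin (e + 1)) : NM B s0 γ p i.succ =
    ∑ j, ((2 ^ γ)⁻¹ * p j.succ - (if j = Fin.last e then 2 * s0 * ((4 ^ γ)⁻¹ * p 0) else 0)) * B j i := rfl

lemma NM_inj {e : ℕ} (B : Fin (e + 1) → Fin (e + 1) → ℝ) (s0 : ℝ) (γ : ℕ)
    (hB : ∀ c : Fin (e + 1) → ℝ, (∀ i, ∑ j, c j * B j i = 0) → c = 0) : Function.Injective (NM B s0 γ) := by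
  rw [← LinearMap.ker_eq_bot, LinearMap.ker_eq_bot']
  intro p hp
  have h0 : p 0 = 0 := by
    have := congrFun hp 0
    rw [NM_zero] at this
    simpa using this
  have h1 := hB _ (fun i => by
    have := congrFun hp i.succ
    rw [NM_succ] at this
    exact this)
  ext i
  refine Fin.cases h0 (fun i => ?_) i
  have := congrFun h1 i
  simp only [h0, mul_zero, ite_self, sub_zero, Pi.zero_apply] at this
  simpa using this

noncomputable def NG {e : ℕ} (B : Fin (e + 1) → Fin (e + 1) → ℝ) (s0 : ℝ) (γ : ℕ) (l : V (e + 2)) : V (e + 1) :=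
  Fin.cons ((4 ^ γ)⁻¹ * (l 0 - 2 * s0 * ∑ i, B (Fin.last e) i * l i.succ)) (fun j => (2 ^ γ)⁻¹ * ∑ i, B j.castSucc i * l i.succ)

lemma NG_adj {e : ℕ} (B : Fin (e + 1) → Fin (e + 1) → ℝ) (s0 : ℝ) (γ : ℕ) (l : V (e + 2)) (x : V (e + 1)) :
    ∑ i, l i * NM B s0 γ (sn x 0) i = ∑ j, NG B s0 γ l j * x j := by
  rw [Fin.sum_univ_succ, Fin.sum_univ_succ (f := fun j => NG B s0 γ l j * x j)]
  simp only [NM_zero, NM_succ, NG, Fin.cons_zero, Fin.cons_succ, sn_zero]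
  have : ∑ i : Fin (e + 1), l i.succ * ∑ j, ((2 ^ γ)⁻¹ * sn x 0 j.succ - (if j = Fin.last e then 2 * s0 * ((4 ^ γ)⁻¹ * x 0) else 0)) * B j i
      = ∑ j : Fin (e + 1), ((2 ^ γ)⁻¹ * sn x 0 j.succ - (if j = Fin.last e then 2 * s0 * ((4 ^ γ)⁻¹ * x 0) else 0)) * ∑ i, B j i * l i.succ := by
    simp_rw [Finset.mul_sum]
    rw [Finset.sum_comm]
    apply Finset.sum_congr rfl; intro j _
    apply Finset.sum_congr rfl; intro i _
    ring
  rw [this, Fin.sum_univ_castSucc]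
  simp only [sn_succ, sn_succ_last, Fin.castSucc_ne_last, if_false, if_true]
  have : ∑ i : Fin e, ((2 ^ γ)⁻¹ * x i.succ - 0) * ∑ i_1, B i.castSucc i_1 * l i_1.succ = ∑ j : Fin e, ((2 ^ γ)⁻¹ * ∑ i, B j.castSucc i * l i.succ) * x j.succ := by
    apply Finset.sum_congr rfl; intro j _; ring
  rw [this]; ring

lemma NM_norm {e : ℕ} (B : Fin (e + 1) → Fin (e + 1) → ℝ) (hB1 : ∀ j i, |B j i| ≤ 1) {s0 : ℝ} (hs : |s0| ≤ 3 * ((e + 1 : ℕ) : ℝ)) {γ : ℕ}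
    (hγ : 6 * ((e + 1 : ℕ) : ℝ) + 1 ≤ 2 ^ γ) (p) : ‖NM B s0 γ p‖ ≤ ‖p‖ := by
  rw [pi_norm_le_iff_of_nonneg (norm_nonneg _)]
  have h4 : ((4 : ℝ) ^ γ)⁻¹ = ((2 ^ γ)⁻¹) ^ 2 := by rw [← inv_pow, ← inv_pow, ← pow_mul, mul_comm, pow_mul]; norm_num
  set g : ℝ := (2 ^ γ)⁻¹ with hg
  set D : ℝ := ((e + 1 : ℕ) : ℝ) with hD
  have hD1 : 1 ≤ D := by rw [hD]; push_cast; have : (0:ℝ) ≤ e := by positivity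
                         linarith
  have hg0 : 0 < g := by positivity
  have hgD : 6 * D * g ≤ 1 := by
    rw [hg, mul_inv_le_iff₀ (by positivity)]; linarith
  have hg1 : g ≤ 1 := by nlinarith
  have hp0 : |p 0| ≤ ‖p‖ := norm_le_pi_norm p 0
  intro i
  refine Fin.cases ?_ (fun i => ?_) i
  · rw [NM_zero, h4, Real.norm_eq_abs, abs_mul, abs_of_pos (by positivity)]
    calc g ^ 2 * |p 0| ≤ 1 * ‖p‖ := mul_le_mul (by nlinarith) hp0 (abs_nonneg _) (by norm_num)
      _ = _ := one_mul _
  · rw [NM_succ, Real.norm_eq_abs, h4]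
    refine (Finset.abs_sum_le_sum_abs _ _).trans ?_
    have hpn := norm_nonneg p
    calc ∑ j, |(g * p j.succ - (if j = Fin.last e then 2 * s0 * (g ^ 2 * p 0) else 0)) * B j i| 
        ≤ ∑ j : Fin (e + 1), (g * ‖p‖ + 2 * (3 * D) * (g ^ 2 * ‖p‖)) := by
          apply Finset.sum_le_sum; intro j _
          rw [abs_mul]
          refine (mul_le_of_le_one_right (abs_nonneg _) (hB1 j i)).trans ?_
          refine (abs_sub _ _).trans (add_le_add ?_ ?_)
          · rw [abs_mul, abs_of_pos hg0]
            exact mul_le_mul_of_nonneg_left (norm_le_pi_norm p _) hg0.le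
          · split_ifs
            · rw [abs_mul, abs_mul, abs_mul, abs_two, abs_of_pos (show 0 < g ^ 2 by positivity)]
              gcongr
            · rw [abs_zero]; positivity
      _ = (D * g + 6 * (D * g) ^ 2) * ‖p‖ := by
          simp only [Finset.sum_const, Finset.card_univ, Fintype.card_fin, nsmul_eq_mul]; ring
      _ ≤ 1 * ‖p‖ := by
          gcongr
          have : D * g ≤ 1 / 6 := by linarith
          have : 0 ≤ D * g := by positivity
          nlinarith
      _ = _ := one_mul _

noncomputable def nb {e : ℕ} (B : Fin (e + 1) → Fin (e + 1) → ℝ) (γ : ℕ) (α : Fin (e + 1) → ℤ) : Fin e → ℤ :=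
  fun j => ⌊(2 ^ γ)⁻¹ * ∑ i, B j.castSucc i * (α i : ℝ)⌋

lemma nb_bound {e : ℕ} (B : Fin (e + 1) → Fin (e + 1) → ℝ) (hB1 : ∀ j i, |B j i| ≤ 1) {γ κ : ℕ}
    (hγ : 6 * ((e + 1 : ℕ) : ℝ) + 1 ≤ 2 ^ γ) (α : Fin (e + 1) → ℤ) (hα : ∀ i, |α i| ≤ 2 ^ κ) (j) : |nb B γ α j| ≤ 2 ^ κ := by
  have h1 : |(2 ^ γ)⁻¹ * ∑ i, B j.castSucc i * (α i : ℝ)| ≤ 2 ^ κ := by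
    rw [abs_mul, abs_of_pos (by positivity), inv_mul_le_iff₀ (by positivity)]
    refine (Finset.abs_sum_le_sum_abs _ _).trans ?_
    calc ∑ i, |B j.castSucc i * (α i : ℝ)| ≤ ∑ i : Fin (e + 1), (2:ℝ) ^ κ := by
          apply Finset.sum_le_sum; intro i _
          rw [abs_mul]
          have : |(α i : ℝ)| ≤ 2 ^ κ := by exact_mod_cast hα i
          exact (mul_le_of_le_one_left (abs_nonneg _) (hB1 _ i)).trans this
      _ = ((e + 1 : ℕ) : ℝ) * 2 ^ κ := by simp
      _ ≤ _ := by gcongr; have : (0:ℝ) ≤ ((e + 1 : ℕ) : ℝ) := by positivity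
                  linarith
  have h2 := abs_le.1 h1
  rw [abs_le]
  constructor
  · apply Int.le_floor.2; push_cast; exact h2.1
  · have := Int.floor_le ((2 ^ γ)⁻¹ * ∑ i, B j.castSucc i * (α i : ℝ))
    have h3 : ((nb B γ α j : ℤ) : ℝ) ≤ 2 ^ κ := this.trans h2.2
    exact_mod_cast h3

lemma NG_cap {e : ℕ} (B : Fin (e + 1) → Fin (e + 1) → ℝ) (hB1 : ∀ j i, |B j i| ≤ 1)
    (hP : ∀ l : Fin (e + 1) → ℝ, ∑ i, l i ^ 2 = ∑ j, (∑ i', B j i' * l i') ^ 2) {s0 Ch : ℝ} (hCh : 0 ≤ Ch) {γ κ : ℕ}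
    (hγ : 6 * ((e + 1 : ℕ) : ℝ) + 1 + Ch ≤ 2 ^ γ) (α : Fin (e + 1) → ℤ)
    (hα : |∑ i, B (Fin.last e) i * ((α i : ℝ) / 2 ^ κ) - s0| ≤ Ch / 2 ^ κ) (l : V (e + 2)) (hl : l ∈ cap (e + 1) κ α) :
    NG B s0 γ l + (Fin.cons ((4 ^ γ)⁻¹ * s0 ^ 2) 0 : V (e + 1)) ∈ cap e κ (nb B γ α) := by
  obtain ⟨hl1, hl2⟩ := hl
  set D : ℝ := ((e + 1 : ℕ) : ℝ) with hD
  have hD0 : 0 ≤ D := by positivity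
  have hO : ∀ j, |∑ i, B j i * l i.succ - ∑ i, B j i * ((α i : ℝ) / 2 ^ κ)| ≤ D * (2 / 2 ^ κ) := by
    intro j
    rw [← Finset.sum_sub_distrib]
    refine (Finset.abs_sum_le_sum_abs _ _).trans ?_
    calc _ ≤ ∑ i : Fin (e + 1), (2 : ℝ) / 2 ^ κ := by
          apply Finset.sum_le_sum; intro i _
          rw [← mul_sub, abs_mul]
          exact (mul_le_of_le_one_left (abs_nonneg _) (hB1 _ i)).trans (hl1 i)
      _ = _ := by simp [hD]
  have hk : (0:ℝ) < 2 ^ κ := by positivity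
  have hg : (0:ℝ) < 2 ^ γ := by positivity
  constructor
  · intro j
    have h1 := hO j.castSucc
    have e1 : (NG B s0 γ l + (Fin.cons ((4 ^ γ)⁻¹ * s0 ^ 2) 0 : V (e + 1))) j.succ = (2 ^ γ)⁻¹ * ∑ i, B j.castSucc i * l i.succ := by
      simp [NG]
    rw [e1]
    set x := (2 ^ γ)⁻¹ * ∑ i, B j.castSucc i * (α i : ℝ) with hx
    have hf1 := Int.floor_le x
    have hf2 := Int.lt_floor_add_one x
    have e2 : ∑ i, B j.castSucc i * ((α i : ℝ) / 2 ^ κ) = 2 ^ γ * x / 2 ^ κ := by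
      rw [hx, mul_inv_cancel_left₀ hg.ne', Finset.sum_div]
      apply Finset.sum_congr rfl; intro i _; ring
    rw [e2] at h1
    show |_ - ((⌊x⌋ : ℤ) : ℝ) / 2 ^ κ| ≤ _
    set y := ∑ i, B j.castSucc i * l i.succ
    have e3 : (2 ^ γ)⁻¹ * y - (⌊x⌋ : ℝ) / 2 ^ κ = (2 ^ γ)⁻¹ * (y - 2 ^ γ * x / 2 ^ κ) + (x - ⌊x⌋) / 2 ^ κ := by
      field_simp; ring
    rw [e3]
    refine (abs_add_le _ _).trans ?_
    rw [abs_mul, abs_of_pos (inv_pos.2 hg), abs_div, abs_of_pos hk, abs_of_nonneg (by linarith : 0 ≤ x - ⌊x⌋)]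
    have : (2 ^ γ)⁻¹ * |y - 2 ^ γ * x / 2 ^ κ| ≤ 1 / 2 ^ κ := by
      rw [inv_mul_le_iff₀ hg]
      refine h1.trans ?_
      rw [mul_div_assoc', mul_one_div]
      gcongr; linarith
    have : (x - ⌊x⌋) / 2 ^ κ ≤ 1 / 2 ^ κ := by gcongr; linarith
    have : (2:ℝ) / 2 ^ κ = 1 / 2 ^ κ + 1 / 2 ^ κ := by ring
    linarith
  · have h1 := hO (Fin.last e)
    set Lv := ∑ i, B (Fin.last e) i * l i.succ with hLv
    have h2 : |Lv - s0| ≤ (2 * D + Ch) / 2 ^ κ := by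
      have := abs_add_le (Lv - ∑ i, B (Fin.last e) i * ((α i : ℝ) / 2 ^ κ)) (∑ i, B (Fin.last e) i * ((α i : ℝ) / 2 ^ κ) - s0)
      rw [sub_add_sub_cancel] at this
      have e4 : (2 * D + Ch) / 2 ^ κ = D * (2 / 2 ^ κ) + Ch / 2 ^ κ := by ring
      linarith
    have h4 : ∀ t : ℕ, (4 : ℝ) ^ t = (2 ^ t) ^ 2 := fun t => by rw [← pow_mul, mul_comm, pow_mul]; norm_num
    have hP' := hP (fun i => l i.succ)
    rw [Fin.sum_univ_castSucc (f := fun j => (∑ i', B j i' * l i'.succ) ^ 2), ← hLv] at hP'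
    have e1 : (NG B s0 γ l + (Fin.cons ((4 ^ γ)⁻¹ * s0 ^ 2) 0 : V (e + 1))) 0 - ∑ j : Fin e, ((NG B s0 γ l + (Fin.cons ((4 ^ γ)⁻¹ * s0 ^ 2) 0 : V (e + 1))) j.succ) ^ 2
        = (4 ^ γ)⁻¹ * ((l 0 - ∑ i : Fin (e + 1), l i.succ ^ 2) + (Lv - s0) ^ 2) := by
      simp only [NG, Pi.add_apply, Fin.cons_zero, Fin.cons_succ, Pi.zero_apply, add_zero, mul_pow]
      rw [← Finset.mul_sum, hP', ← hLv, h4]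
      ring
    rw [e1, abs_mul, abs_of_pos (by positivity), inv_mul_le_iff₀ (by positivity)]
    refine (abs_add_le _ _).trans ?_
    rw [abs_of_nonneg (sq_nonneg (Lv - s0))]
    have h5 : (Lv - s0) ^ 2 ≤ ((2 * D + Ch) / 2 ^ κ) ^ 2 := by rw [← sq_abs]; gcongr
    rw [div_pow, ← h4] at h5
    have h6 : 1 + (2 * D + Ch) ^ 2 ≤ (4:ℝ) ^ γ := by
      rw [h4]
      nlinarith
    calc _ ≤ 1 / 4 ^ κ + (2 * D + Ch) ^ 2 / 4 ^ κ := add_le_add hl2 h5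
      _ = (1 + (2 * D + Ch) ^ 2) / 4 ^ κ := by ring
      _ ≤ 4 ^ γ / 4 ^ κ := by gcongr
      _ = _ := by ring

lemma nb_cluster {e : ℕ} (B : Fin (e + 1) → Fin (e + 1) → ℝ) (hB1 : ∀ j i, |B j i| ≤ 1)
    (hR : ∀ l : Fin (e + 1) → ℝ, ∀ i, l i = ∑ j, (∑ i', B j i' * l i') * B j i) {s0 Ch : ℝ} (hCh : 0 ≤ Ch) {γ κ : ℕ}
    (hγ : 6 * ((e + 1 : ℕ) : ℝ) + 1 + Ch ≤ 2 ^ γ) (α β : Fin (e + 1) → ℤ)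
    (hα : |∑ i, B (Fin.last e) i * ((α i : ℝ) / 2 ^ κ) - s0| ≤ Ch / 2 ^ κ)
    (hβ : |∑ i, B (Fin.last e) i * ((β i : ℝ) / 2 ^ κ) - s0| ≤ Ch / 2 ^ κ) (hn : nb B γ α = nb B γ β) (i) :
    |α i - β i| ≤ ((2 ^ γ * 2 ^ γ : ℕ) : ℤ) := by
  have hk : (0:ℝ) < 2 ^ κ := by positivity
  have hg : (0:ℝ) < 2 ^ γ := by positivity
  have hD0 : (0:ℝ) ≤ ((e + 1 : ℕ) : ℝ) := by positivity
  have key : ∀ j, |∑ i', B j i' * ((α i' : ℝ) - β i')| ≤ 2 * 2 ^ γ := by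
    intro j
    have es : ∑ i', B j i' * ((α i' : ℝ) - β i') = ∑ i', B j i' * (α i' : ℝ) - ∑ i', B j i' * (β i' : ℝ) := by
      rw [← Finset.sum_sub_distrib]; apply Finset.sum_congr rfl; intro i _; ring
    rw [es]
    refine Fin.lastCases ?_ (fun j => ?_) j
    · have h1 := abs_sub_le (∑ i, B (Fin.last e) i * ((α i : ℝ) / 2 ^ κ)) s0 (∑ i, B (Fin.last e) i * ((β i : ℝ) / 2 ^ κ))
      rw [abs_sub_comm s0] at h1
      have e1 : ∀ α : Fin (e + 1) → ℤ, ∑ i, B (Fin.last e) i * ((α i : ℝ) / 2 ^ κ) = (∑ i, B (Fin.last e) i * (α i : ℝ)) / 2 ^ κ := by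
        intro α; rw [Finset.sum_div]; apply Finset.sum_congr rfl; intro i _; ring
      have h2 := h1.trans (add_le_add hα hβ)
      rw [e1, e1, ← sub_div, abs_div, abs_of_pos hk, ← add_div, div_le_div_iff_of_pos_right hk] at h2
      linarith
    · have h1 := congrFun hn j
      simp only [nb] at h1
      set x := (2 ^ γ)⁻¹ * ∑ i, B j.castSucc i * (α i : ℝ) with hx
      set y := (2 ^ γ)⁻¹ * ∑ i, B j.castSucc i * (β i : ℝ) with hy
      have hxy : |x - y| < 1 := Int.abs_sub_lt_one_of_floor_eq_floor h1
      have ex : ∑ i, B j.castSucc i * (α i : ℝ) = 2 ^ γ * x := by rw [hx, mul_inv_cancel_left₀ hg.ne']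
      have ey : ∑ i, B j.castSucc i * (β i : ℝ) = 2 ^ γ * y := by rw [hy, mul_inv_cancel_left₀ hg.ne']
      rw [ex, ey, ← mul_sub, abs_mul, abs_of_pos hg]
      nlinarith
  have h := hR (fun i => (α i : ℝ) - β i) i
  have h2 : |(α i : ℝ) - β i| ≤ 2 ^ γ * 2 ^ γ := by
    rw [h]
    refine (Finset.abs_sum_le_sum_abs _ _).trans ?_
    calc _ ≤ ∑ j : Fin (e + 1), (2 * 2 ^ γ : ℝ) := by
          apply Finset.sum_le_sum; intro j _
          rw [abs_mul]
          exact (mul_le_of_le_one_right (abs_nonneg _) (hB1 j i)).trans (key j)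
      _ = ((e + 1 : ℕ) : ℝ) * (2 * 2 ^ γ) := by simp
      _ ≤ _ := by nlinarith
  have h3 : ((|α i - β i| : ℤ) : ℝ) ≤ 2 ^ γ * 2 ^ γ := by push_cast; exact h2
  exact_mod_cast h3

lemma narrow (e : ℕ) (q : ℝ) (hq : 2 ≤ q) (Ch : ℝ) (hCh : 0 ≤ Ch) : ∃ C : ℕ, ∀ (A κ : ℕ) (D : ℝ≥0∞), Dec e q A κ D →
    ∀ (v : EuclideanSpace ℝ (Fin (e + 1))) (s0 : ℝ), ‖v‖ = 1 → |s0| ≤ 3 * ((e + 1 : ℕ) : ℝ) →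
    ∀ S : Finset (Fin (e + 1) → ℤ), (∀ α ∈ S, ∀ i, |α i| ≤ 2 ^ κ) → (∀ α ∈ S, |∑ i, v i * ((α i : ℝ) / 2 ^ κ) - s0| ≤ Ch / 2 ^ κ) →
    ∀ f : (Fin (e + 1) → ℤ) → V (e + 2) → ℂ, (∀ α ∈ S, f α ∈ TP (cap (e + 1) κ α)) → ∀ W : V (e + 2) → ℝ≥0∞, SV A (4 ^ κ) W →
    N2 q W (fun x => ∑ α ∈ S, f α x) ≤ C * D * ∑ α ∈ S, N2 q W (f α) := by
  classical
  obtain ⟨γ, hγ⟩ := pow_unbounded_of_one_lt (6 * ((e + 1 : ℕ) : ℝ) + 1 + Ch) (one_lt_two)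
  replace hγ := hγ.le
  have hγ' : 6 * ((e + 1 : ℕ) : ℝ) + 1 ≤ 2 ^ γ := by linarith
  refine ⟨(2 * (2 ^ γ * 2 ^ γ) + 1) ^ (e + 1), ?_⟩
  intro A κ D hDec v s0 hv hs S hS hSh f hf W hW
  set Nc := (2 * (2 ^ γ * 2 ^ γ) + 1) ^ (e + 1) with hNc
  obtain ⟨B, hBv, hB1, hR, hP, hLI⟩ := frame v hv
  simp only [← hBv] at hSh
  set T : V (e + 2) ≃ₗ[ℝ] V (e + 2) := LinearEquiv.ofInjectiveEndo (NM B s0 γ) (NM_inj B s0 γ hLI) with hT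
  have hTe : ∀ p, T p = NM B s0 γ p := fun p => rfl
  have hTm : Measurable T := (LinearMap.continuous_of_finiteDimensional (NM B s0 γ)).measurable
  have hTs : Measurable (fun p : ℝ × V (e + 1) => T (sn p.2 p.1)) := hTm.comp sn_meas
  obtain ⟨c, hc0, hct, hc⟩ := lintegral_lin T
  set kv : V (e + 1) := Fin.cons ((4 ^ γ)⁻¹ * s0 ^ 2) 0 with hkv
  have hq0 : 0 < q := by linarith
  have hWm := hW.1
  have hfm : ∀ α ∈ S, Measurable (f α) := fun α hα => TP_meas (hf α hα)
  -- pointwise in y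
  have hfix : ∀ y : ℝ, ∫⁻ u : V (e + 1), ‖∑ α ∈ S, f α (T (sn u y))‖ₑ ^ q * W (T (sn u y)) ≤
      ((Nc : ℝ≥0∞) * D) ^ (q / 2) * (∑ α ∈ S, (∫⁻ u : V (e + 1), ‖f α (T (sn u y))‖ₑ ^ q * W (T (sn u y))) ^ (2 / q)) ^ (q / 2) := by
    intro y
    set g : (Fin (e + 1) → ℤ) → V (e + 1) → ℂ := fun α u => ch kv u * f α (T (sn u y)) with hg
    have hgT : ∀ α ∈ S, g α ∈ TP (cap e κ (nb B γ α)) := by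
      intro α hα
      have := TP_comp (hf α hα) (fun u => NM B s0 γ (sn u 0)) (NG B s0 γ) (NG_adj B s0 γ) (NM B s0 γ (sn 0 y)) kv
        (fun l hl => NG_cap B hB1 hP hCh hγ α (hSh α hα) l hl)
      convert this using 3 with u
      rw [hTe, ← map_add, ← sn_add]; simp
    have hgm : ∀ α ∈ S, Measurable (g α) := fun α hα => TP_meas (hgT α hα)
    have hgn : ∀ α u, ‖g α u‖ₑ = ‖f α (T (sn u y))‖ₑ := by
      intro α u
      simp only [hg, enorm_mul]
      rw [← ofReal_norm, ch_norm]; simp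
    set Wy : V (e + 1) → ℝ≥0∞ := fun u => W (T (sn u y)) with hWy
    have hWyS : SV A (4 ^ κ) Wy := by
      refine ⟨hWm.comp (hTs.comp (measurable_const.prodMk measurable_id)), fun u u' => ?_⟩
      have e1 : T (sn (u + u') y) = T (sn u y) + T (sn u' 0) := by
        rw [← map_add, ← sn_add, add_zero]
      simp only [hWy, e1]
      refine (hW.2 _ _).trans ?_
      gcongr
      rw [hTe]
      exact (NM_norm B hB1 hs hγ' _).trans (sn_norm u')
    set S' := S.image (nb B γ) with hS'
    set G : (Fin e → ℤ) → V (e + 1) → ℂ := fun β u => ∑ α ∈ S with nb B γ α = β, g α u with hG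
    have hsumG : ∀ u, ∑ β ∈ S', G β u = ∑ α ∈ S, g α u := fun u =>
      Finset.sum_fiberwise_of_maps_to (fun α hα => Finset.mem_image_of_mem _ hα) _
    have hGT : ∀ β ∈ S', G β ∈ TP (cap e κ β) := by
      intro β _
      have e1 : G β = ∑ α ∈ S with nb B γ α = β, g α := by ext u; simp [hG]
      rw [e1]
      apply Submodule.sum_mem
      intro α hα
      rw [Finset.mem_filter] at hα
      rw [← hα.2]; exact hgT α hα.1
    have h1 := hDec S' (fun β hβ => by
      obtain ⟨α, hα, rfl⟩ := Finset.mem_image.1 hβ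
      exact nb_bound B hB1 hγ' α (hS α hα)) G hGT Wy hWyS
    have h2 : ∀ β ∈ S', N2 q Wy (G β) ≤ (Nc : ℝ≥0∞) * ∑ α ∈ S with nb B γ α = β, N2 q Wy (g α) := by
      intro β _
      refine (N2_sum_le _ g (fun α hα => hgm α (Finset.mem_filter.1 hα).1) hWyS.1 hq).trans ?_
      gcongr
      apply card_cluster
      intro α hα α' hα' i
      rw [Finset.mem_filter] at hα hα'
      exact nb_cluster B hB1 hR hCh hγ α α' (hSh α hα.1) (hSh α' hα'.1) (hα.2.trans hα'.2.symm) i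
    have h3 : N2 q Wy (fun u => ∑ α ∈ S, g α u) ≤ (Nc : ℝ≥0∞) * D * ∑ α ∈ S, N2 q Wy (g α) := by
      calc N2 q Wy (fun u => ∑ α ∈ S, g α u) = N2 q Wy (fun u => ∑ β ∈ S', G β u) := by simp only [hsumG]
        _ ≤ D * ∑ β ∈ S', N2 q Wy (G β) := h1
        _ ≤ D * ∑ β ∈ S', (Nc : ℝ≥0∞) * ∑ α ∈ S with nb B γ α = β, N2 q Wy (g α) := by gcongr with β hβ; exact h2 β hβ
        _ = _ := by
          rw [← Finset.mul_sum, Finset.sum_fiberwise_of_maps_to (fun α hα => Finset.mem_image_of_mem _ hα)]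
          ring
    have h4 := ENNReal.rpow_le_rpow h3 (show 0 ≤ q / 2 by positivity)
    rw [N2_rpow hq, ENNReal.mul_rpow_of_nonneg _ _ (by positivity : 0 ≤ q / 2)] at h4
    have e5 : ∀ u, ‖∑ α ∈ S, g α u‖ₑ = ‖∑ α ∈ S, f α (T (sn u y))‖ₑ := by
      intro u
      simp only [hg]
      rw [← Finset.mul_sum, enorm_mul, ← ofReal_norm, ch_norm]; simp
    simp only [N2, II, e5, hgn] at h4
    exact h4
  have htot : ∀ h : V (e + 2) → ℂ, Measurable h → ∫⁻ y : ℝ, ∫⁻ u : V (e + 1), ‖h (T (sn u y))‖ₑ ^ q * W (T (sn u y)) = c * II q W h := by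
    intro h hh
    have hm : Measurable (fun z => ‖h z‖ₑ ^ q * W z) := by fun_prop
    rw [II, ← hc _ hm]
    exact (lintegral_sn _ (hm.comp hTm)).symm
  have hmeas : ∀ α ∈ S, Measurable (fun y : ℝ => ∫⁻ u : V (e + 1), ‖f α (T (sn u y))‖ₑ ^ q * W (T (sn u y))) := by
    intro α hα
    have hm : Measurable (fun z => ‖f α z‖ₑ ^ q * W z) := by have := hfm α hα; fun_prop
    exact (hm.comp hTs).lintegral_prod_right'
  have hfs : Measurable (fun x => ∑ α ∈ S, f α x) := Finset.measurable_fun_sum _ hfm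
  have hD1 : c * II q W (fun x => ∑ α ∈ S, f α x) ≤ ((Nc : ℝ≥0∞) * D) ^ (q / 2) * (c * (∑ α ∈ S, N2 q W (f α)) ^ (q / 2)) := by
    rw [← htot _ hfs]
    refine (lintegral_mono hfix).trans ?_
    have hm2 : Measurable (fun y => (∑ α ∈ S, (∫⁻ u : V (e + 1), ‖f α (T (sn u y))‖ₑ ^ q * W (T (sn u y))) ^ (2 / q)) ^ (q / 2)) :=
      (Finset.measurable_fun_sum _ (fun α hα => (hmeas α hα).pow_const _)).pow_const _
    rw [lintegral_const_mul _ hm2]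
    refine mul_le_mul_right ((mink volume S _ hmeas hq).trans ?_) _
    have : ∀ α ∈ S, (∫⁻ y : ℝ, ∫⁻ u : V (e + 1), ‖f α (T (sn u y))‖ₑ ^ q * W (T (sn u y))) ^ (2 / q) = c ^ (2 / q) * N2 q W (f α) := by
      intro α hα
      rw [htot _ (hfm α hα), ENNReal.mul_rpow_of_nonneg _ _ (by positivity : 0 ≤ 2 / q)]; rfl
    rw [Finset.sum_congr rfl this, ← Finset.mul_sum, ENNReal.mul_rpow_of_nonneg _ _ (by positivity : 0 ≤ q / 2), ← ENNReal.rpow_mul,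
      div_mul_div_cancel₀ hq0.ne', div_self (by norm_num), ENNReal.rpow_one]
  have hD2 : II q W (fun x => ∑ α ∈ S, f α x) ≤ ((Nc : ℝ≥0∞) * D) ^ (q / 2) * (∑ α ∈ S, N2 q W (f α)) ^ (q / 2) := by
    rw [mul_left_comm] at hD1
    exact (ENNReal.mul_le_mul_iff_right hc0 hct).1 hD1
  have := ENNReal.rpow_le_rpow hD2 (show 0 ≤ 2 / q by positivity)
  rw [← ENNReal.mul_rpow_of_nonneg _ _ (by positivity : 0 ≤ q / 2), ← ENNReal.rpow_mul, div_mul_div_cancel₀ (by norm_num), div_self hq0.ne', ENNReal.rpow_one] at this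
  exact this

end QPS

namespace QPS
set_option linter.all false
open scoped ENNReal NNReal BigOperators FourierTransform SchwartzMap ComplexConjugate
variable {m : ℕ}

lemma N2_add_le {q : ℝ} (hq : 2 ≤ q) {W : V m → ℝ≥0∞} (hW : Measurable W) {f g : V m → ℂ} (hf : Measurable f) (hg : Measurable g) :
    N2 q W (fun x => f x + g x) ≤ 2 * (N2 q W f + N2 q W g) := by
  have := N2_sum_le (Finset.univ : Finset (Fin 2)) ![f, g] (by intro l _; fin_cases l <;> assumption) hW hq
  simpa [Fin.sum_univ_two] using this

lemma II_neg {q : ℝ} {W : V m → ℝ≥0∞} {f : V m → ℂ} : II q W (fun x => - f x) = II q W f := by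
  unfold II; simp

lemma N2_sub_le {q : ℝ} (hq : 2 ≤ q) {W : V m → ℝ≥0∞} (hW : Measurable W) {f g : V m → ℂ} (hf : Measurable f) (hg : Measurable g) :
    N2 q W (fun x => f x - g x) ≤ 2 * (N2 q W f + N2 q W g) := by
  have := N2_add_le hq hW hf hg.neg
  have e : N2 q W (-g) = N2 q W g := by unfold N2; rw [← II_neg (f := g)]; rfl
  rw [e] at this
  simpa [sub_eq_add_neg] using this

lemma N2_zero {q : ℝ} (hq : 2 ≤ q) (W : V m → ℝ≥0∞) : N2 q W (fun _ => 0) = 0 := by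
  unfold N2 II
  have : 0 < q := by linarith
  simp [this]

lemma card_box {d : ℕ} (κ : ℕ) (S : Finset (Fin d → ℤ)) (hS : ∀ k ∈ S, ∀ i, |k i| ≤ 2 ^ κ) : S.card ≤ (2 * (2 * 2 ^ κ) + 1) ^ d := by
  apply card_cluster
  intro α hα β hβ i
  have h1 := hS α hα i
  have h2 := hS β hβ i
  have := abs_sub (α i) (β i)
  push_cast
  linarith

lemma bn_point (e : ℕ) (q : ℝ) (hq : 2 ≤ q) : ∃ C : ℕ, ∀ (κ0 κ1 a A2 : ℕ) (D : ℝ≥0∞), 1 ≤ κ0 → κ0 ≤ κ1 → κ1 ≤ a → 1 ≤ D → Dec e q A2 κ0 D →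
    ∀ S : Finset (Fin (e + 1) → ℤ), (∀ α ∈ S, ∀ i, |α i| ≤ 2 ^ a) →
    ∀ f : (Fin (e + 1) → ℤ) → V (e + 2) → ℂ, (∀ α ∈ S, f α ∈ TP (cap (e + 1) a α)) → ∀ W : V (e + 2) → ℝ≥0∞, SV A2 (4 ^ κ0) W →
    N2 q W (fun x => ∑ α ∈ S, f α x) ≤ C * D * (∑ α ∈ S.image (par (a - κ0)), N2 q W (fb a S f κ0 α) + ∑ τ ∈ S.image (par (a - κ1)), N2 q W (fb a S f κ1 τ)) +
      (((2 * (2 * 2 ^ κ1) + 1) ^ (e + 1)) ^ 4 : ℕ) * ∑ τ ∈ (Fintype.piFinset (fun _ : Fin (e + 2) => S.image (par (a - κ1)))) with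
        ((1 / 2 ^ κ0 : ℝ) ^ (e + 2) / ((e + 2).factorial : ℝ) ≤ |(Matrix.of (fun i => ev κ1 (τ i))).det|), ∏ i, (N2 q W (fb a S f κ1 (τ i))) ^ (1 / ((e + 2 : ℕ) : ℝ)) := by
  classical
  obtain ⟨Cn, hCn⟩ := narrow e q hq (3 * ((e + 1 : ℕ) : ℝ)) (by positivity)
  refine ⟨4 * Cn + 2, ?_⟩
  intro κ0 κ1 a A2 D hκ0 hκ01 hκ1a hD hDec S hS f hf W hW
  set M : ℕ := (2 * (2 * 2 ^ κ1) + 1) ^ (e + 1) with hM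
  set T1 := S.image (par (a - κ1)) with hT1
  set T0 := S.image (par (a - κ0)) with hT0
  set F := fb a S f κ1 with hF
  have hWm := hW.1
  have hFT : ∀ τ, F τ ∈ TP (cap (e + 1) κ1 τ) := fun τ => fb_mem hκ1a hf τ
  have hFm : ∀ τ, Measurable (F τ) := fun τ => TP_meas (hFT τ)
  have hfT : ∀ α, fb a S f κ0 α ∈ TP (cap (e + 1) κ0 α) := fun τ => fb_mem (hκ01.trans hκ1a) hf τ
  have hT1b : ∀ τ ∈ T1, ∀ i, |τ i| ≤ 2 ^ κ1 := by
    intro τ hτ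
    obtain ⟨k, hk, rfl⟩ := Finset.mem_image.1 hτ
    exact par_bound hκ1a (hS k hk)
  have hcard : T1.card ≤ M := card_box κ1 T1 hT1b
  have hfsum : (fun x => ∑ α ∈ S, f α x) = fun x => ∑ τ ∈ T1, F τ x := by
    ext x; exact sum_fiber (a - κ1) S (fun k => f k x)
  rcases S.eq_empty_or_nonempty with hSe | hSne
  · subst hSe; simp [N2_zero hq]
  have hT1ne : T1.Nonempty := hSne.image _
  obtain ⟨τm, hτm, hmax⟩ := T1.exists_max_image (fun τ => N2 q W (F τ)) hT1ne
  set T := N2 q W (F τm) with hTdef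
  have hTle : T ≤ ∑ τ ∈ T1, N2 q W (F τ) := Finset.single_le_sum (f := fun τ => N2 q W (F τ)) (fun _ _ => zero_le) hτm
  have hM1 : 1 ≤ M := Nat.one_le_pow _ _ (by omega)
  have hM1' : (1:ℝ≥0∞) ≤ M := by exact_mod_cast hM1
  set Sig := T1.filter (fun τ => T ≤ (M : ℝ≥0∞) ^ 2 * N2 q W (F τ)) with hSig
  set Rest := T1.filter (fun τ => ¬ T ≤ (M : ℝ≥0∞) ^ 2 * N2 q W (F τ)) with hRest
  have hτmS : τm ∈ Sig := by
    rw [hSig, Finset.mem_filter]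
    refine ⟨hτm, ?_⟩
    exact le_mul_of_one_le_left zero_le (one_le_pow₀ hM1')
  have hrest : (M : ℝ≥0∞) * ∑ τ ∈ Rest, N2 q W (F τ) ≤ T := by
    rw [Finset.mul_sum]
    by_cases hR : Rest.card = 0
    · rw [Finset.card_eq_zero] at hR; rw [hR]; simp
    calc ∑ τ ∈ Rest, (M : ℝ≥0∞) * N2 q W (F τ) ≤ ∑ τ ∈ Rest, T / M := by
          apply Finset.sum_le_sum; intro τ hτ
          rw [hRest, Finset.mem_filter, not_le] at hτ
          rw [ENNReal.le_div_iff_mul_le (by left; exact_mod_cast (by omega : M ≠ 0)) (by left; simp)]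
          refine le_trans (le_of_eq ?_) hτ.2.le
          ring
      _ = Rest.card * (T / M) := by simp
      _ ≤ M * (T / M) := by gcongr; exact (Finset.card_le_card (Finset.filter_subset _ _)).trans hcard
      _ ≤ T := ENNReal.mul_div_le
  have hsplit : ∀ x, ∑ τ ∈ T1, F τ x = ∑ τ ∈ Sig, F τ x + ∑ τ ∈ Rest, F τ x := fun x =>
    (Finset.sum_filter_add_sum_filter_not _ _ _).symm
  have hsumRest : N2 q W (fun x => ∑ τ ∈ Rest, F τ x) ≤ T := by
    refine (N2_sum_le Rest F (fun τ _ => hFm τ) hWm hq).trans (le_trans ?_ hrest)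
    gcongr
    exact (Finset.card_le_card (Finset.filter_subset _ _)).trans hcard
  set δ : ℝ := 1 / 2 ^ κ0 with hδ
  have hδ0 : 0 < δ := by positivity
  by_cases hbr : ∀ w : V (e + 2), ‖w‖ = 1 → ∃ u ∈ (fun τ => ev κ1 τ) '' (Sig : Set (Fin (e + 1) → ℤ)), δ < |∑ j, w j * u j|
  ·
    obtain ⟨u, hu, hdet⟩ := transv _ hδ0 hbr
    choose τ hτS hτu using hu
    refine le_trans ?_ le_add_self
    have hmem : τ ∈ (Fintype.piFinset (fun _ : Fin (e + 2) => T1)).filter (fun τ => (δ ^ (e + 2) / ((e + 2).factorial : ℝ) ≤ |(Matrix.of (fun i => ev κ1 (τ i))).det|)) := by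
      rw [Finset.mem_filter, Fintype.mem_piFinset]
      refine ⟨fun i => (Finset.mem_filter.1 (hτS i)).1, ?_⟩
      have : (fun i => ev κ1 (τ i)) = u := funext hτu
      rw [this]; exact hdet
    have h1 : T ≤ (M : ℝ≥0∞) ^ 2 * ∏ i, (N2 q W (F (τ i))) ^ (1 / ((e + 2 : ℕ) : ℝ)) := by
      have hn0 : ((e + 2 : ℕ) : ℝ) ≠ 0 := by positivity
      have h2 : ∀ i, T ^ (1 / ((e + 2 : ℕ) : ℝ)) ≤ ((M : ℝ≥0∞) ^ 2) ^ (1 / ((e + 2 : ℕ) : ℝ)) * (N2 q W (F (τ i))) ^ (1 / ((e + 2 : ℕ) : ℝ)) := by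
        intro i
        rw [← ENNReal.mul_rpow_of_nonneg _ _ (by positivity)]
        apply ENNReal.rpow_le_rpow _ (by positivity)
        exact (Finset.mem_filter.1 (hτS i)).2
      have hpw : ∀ z : ℝ≥0∞, ∏ i : Fin (e + 2), z ^ (1 / ((e + 2 : ℕ) : ℝ)) = z := by
        intro z
        rw [Finset.prod_const, Finset.card_univ, Fintype.card_fin, ← ENNReal.rpow_natCast, ← ENNReal.rpow_mul, one_div_mul_cancel hn0, ENNReal.rpow_one]
      have h3 := Finset.prod_le_prod' (fun i (_ : i ∈ Finset.univ) => h2 i)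
      rw [Finset.prod_mul_distrib, hpw, hpw] at h3
      exact h3
    calc N2 q W (fun x => ∑ α ∈ S, f α x) ≤ (T1.card : ℝ≥0∞) * ∑ τ ∈ T1, N2 q W (F τ) := by
          rw [hfsum]; exact N2_sum_le T1 F (fun τ _ => hFm τ) hWm hq
      _ ≤ (M : ℝ≥0∞) * ∑ τ ∈ T1, T := by gcongr with τ hτ; exact hmax τ hτ
      _ = (M : ℝ≥0∞) * (T1.card * T) := by simp
      _ ≤ (M : ℝ≥0∞) * (M * ((M : ℝ≥0∞) ^ 2 * ∏ i, (N2 q W (F (τ i))) ^ (1 / ((e + 2 : ℕ) : ℝ)))) := by gcongr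
      _ = ((M ^ 4 : ℕ) : ℝ≥0∞) * ∏ i, (N2 q W (F (τ i))) ^ (1 / ((e + 2 : ℕ) : ℝ)) := by push_cast; ring
      _ ≤ _ := by
        refine mul_le_mul_right ?_ _
        exact Finset.single_le_sum (f := fun τ : Fin (e + 2) → Fin (e + 1) → ℤ => ∏ i, (N2 q W (F (τ i))) ^ (1 / ((e + 2 : ℕ) : ℝ))) (fun _ _ => zero_le) hmem
  ·
    push Not at hbr
    obtain ⟨w, hw, hwb⟩ := hbr
    refine le_trans ?_ le_self_add
    have hδh : δ ≤ 1 / 2 := by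
      rw [hδ]
      apply one_div_le_one_div_of_le (by norm_num)
      calc (2:ℝ) = 2 ^ 1 := by norm_num
        _ ≤ 2 ^ κ0 := pow_le_pow_right₀ (by norm_num) hκ0
    have hSigb : ∀ τ ∈ Sig, ∀ i, |τ i| ≤ 2 ^ κ1 := fun τ hτ => hT1b τ (Finset.mem_filter.1 hτ).1
    obtain ⟨v, s0, hv, hs0, hvs⟩ := hyperplane w hw κ1 Sig ⟨τm, hτmS⟩ hSigb hδh (fun τ hτ => hwb _ ⟨τ, hτ, rfl⟩)
    set S' := Sig.image (par (κ1 - κ0)) with hS'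
    have hS'b : ∀ α ∈ S', ∀ i, |α i| ≤ 2 ^ κ0 := by
      intro α hα
      obtain ⟨k, hk, rfl⟩ := Finset.mem_image.1 hα
      exact par_bound hκ01 (hSigb k hk)
    have hS'h : ∀ α ∈ S', |∑ i, v i * ((α i : ℝ) / 2 ^ κ0) - s0| ≤ 3 * ((e + 1 : ℕ) : ℝ) / 2 ^ κ0 := by
      intro α hα
      obtain ⟨τ, hτ, rfl⟩ := Finset.mem_image.1 hα
      have h1 := hvs τ hτ
      have h2 : |∑ i, v i * ((par (κ1 - κ0) τ i : ℝ) / 2 ^ κ0) - ∑ i, v i * ((τ i : ℝ) / 2 ^ κ1)| ≤ ((e + 1 : ℕ) : ℝ) * (1 / 2 ^ κ0) := by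
        rw [← Finset.sum_sub_distrib]
        refine (Finset.abs_sum_le_sum_abs _ _).trans ?_
        calc _ ≤ ∑ i : Fin (e + 1), (1 : ℝ) / 2 ^ κ0 := by
              apply Finset.sum_le_sum; intro i _
              have hvi : |v i| ≤ 1 := by have := PiLp.norm_apply_le v i; rwa [hv] at this
              rw [← mul_sub, abs_mul, abs_sub_comm]
              exact (mul_le_of_le_one_left (abs_nonneg _) hvi).trans (par_close hκ01 τ i)
          _ = _ := by simp
      have h3 := abs_sub_le (∑ i, v i * ((par (κ1 - κ0) τ i : ℝ) / 2 ^ κ0)) (∑ i, v i * ((τ i : ℝ) / 2 ^ κ1)) s0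
      rw [hδ] at h1
      have : 3 * ((e + 1 : ℕ) : ℝ) / 2 ^ κ0 = ((e + 1 : ℕ) : ℝ) * (1 / 2 ^ κ0) + 2 * ((e + 1 : ℕ) : ℝ) * (1 / 2 ^ κ0) := by ring
      linarith
    have hgT : ∀ α, fb κ1 Sig F κ0 α ∈ TP (cap (e + 1) κ0 α) := fun α => fb_mem hκ01 (fun τ _ => hFT τ) α
    have hrT : ∀ α, fb κ1 Rest F κ0 α ∈ TP (cap (e + 1) κ0 α) := fun α => fb_mem hκ01 (fun τ _ => hFT τ) α
    have hnar := hCn A2 κ0 D hDec v s0 hv hs0 S' hS'b hS'h (fb κ1 Sig F κ0) (fun α _ => hgT α) W hW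
    have hsumS : (fun x => ∑ α ∈ S', fb κ1 Sig F κ0 α x) = fun x => ∑ τ ∈ Sig, F τ x := by
      ext x; exact (sum_fiber (κ1 - κ0) Sig (fun k => F k x)).symm
    rw [hsumS] at hnar
    have hS'T0 : S' ⊆ T0 := by
      intro α hα
      obtain ⟨τ, hτ, rfl⟩ := Finset.mem_image.1 hα
      obtain ⟨k, hk, rfl⟩ := Finset.mem_image.1 (Finset.mem_filter.1 hτ).1
      rw [par_par]
      apply Finset.mem_image.2 ⟨k, hk, ?_⟩
      congr 1; omega
    have hdiff : ∀ α, fb κ1 Sig F κ0 α = fun x => fb a S f κ0 α x - fb κ1 Rest F κ0 α x := by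
      intro α
      rw [fb_fb hκ01 hκ1a S f α]
      ext x
      have : ∑ τ ∈ T1 with par (κ1 - κ0) τ = α, F τ x = fb κ1 Sig F κ0 α x + fb κ1 Rest F κ0 α x := by
        unfold fb
        rw [← Finset.sum_filter_add_sum_filter_not (T1.filter _) (fun τ => T ≤ (M : ℝ≥0∞) ^ 2 * N2 q W (F τ))]
        congr 1
        · rw [hSig, Finset.filter_filter, Finset.filter_filter]
          apply Finset.sum_congr _ (fun _ _ => rfl)
          ext t; simp only [Finset.mem_filter]; tauto
        · rw [hRest, Finset.filter_filter, Finset.filter_filter]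
          apply Finset.sum_congr _ (fun _ _ => rfl)
          ext t; simp only [Finset.mem_filter]; tauto
      exact eq_sub_of_add_eq this.symm
    have hrestα : ∑ α ∈ S', N2 q W (fb κ1 Rest F κ0 α) ≤ T := by
      calc _ ≤ ∑ α ∈ S', (M : ℝ≥0∞) * ∑ τ ∈ Rest with par (κ1 - κ0) τ = α, N2 q W (F τ) := by
            apply Finset.sum_le_sum; intro α _
            refine (N2_sum_le _ F (fun τ _ => hFm τ) hWm hq).trans ?_
            gcongr
            exact (Finset.card_le_card ((Finset.filter_subset _ _).trans (Finset.filter_subset _ _))).trans hcard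
        _ = (M : ℝ≥0∞) * ∑ α ∈ S', ∑ τ ∈ Rest with par (κ1 - κ0) τ = α, N2 q W (F τ) := by rw [Finset.mul_sum]
        _ ≤ (M : ℝ≥0∞) * ∑ τ ∈ Rest, N2 q W (F τ) := by
            refine mul_le_mul_right ?_ _
            calc _ ≤ ∑ α ∈ S' ∪ Rest.image (par (κ1 - κ0)), ∑ τ ∈ Rest with par (κ1 - κ0) τ = α, N2 q W (F τ) := Finset.sum_le_sum_of_subset Finset.subset_union_left
              _ = _ := Finset.sum_fiberwise_of_maps_to (fun k hk => Finset.mem_union_right _ (Finset.mem_image_of_mem _ hk)) _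
        _ ≤ T := hrest
    have hsα : ∑ α ∈ S', N2 q W (fb κ1 Sig F κ0 α) ≤ 2 * (∑ α ∈ T0, N2 q W (fb a S f κ0 α) + T) := by
      calc _ ≤ ∑ α ∈ S', 2 * (N2 q W (fb a S f κ0 α) + N2 q W (fb κ1 Rest F κ0 α)) := by
            apply Finset.sum_le_sum; intro α _
            rw [hdiff α]
            exact N2_sub_le hq hWm (TP_meas (hfT α)) (TP_meas (hrT α))
        _ = 2 * (∑ α ∈ S', N2 q W (fb a S f κ0 α) + ∑ α ∈ S', N2 q W (fb κ1 Rest F κ0 α)) := by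
            rw [← Finset.mul_sum, Finset.sum_add_distrib]
        _ ≤ _ := by
            refine mul_le_mul_right (add_le_add (Finset.sum_le_sum_of_subset hS'T0) hrestα) _
    have hSm : Measurable (fun x => ∑ τ ∈ Sig, F τ x) := Finset.measurable_fun_sum _ (fun τ _ => hFm τ)
    have hRm : Measurable (fun x => ∑ τ ∈ Rest, F τ x) := Finset.measurable_fun_sum _ (fun τ _ => hFm τ)
    set X0 := ∑ α ∈ T0, N2 q W (fb a S f κ0 α) with hX0
    calc N2 q W (fun x => ∑ α ∈ S, f α x) = N2 q W (fun x => ∑ τ ∈ Sig, F τ x + ∑ τ ∈ Rest, F τ x) := by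
          rw [hfsum]; simp only [hsplit]
      _ ≤ 2 * (N2 q W (fun x => ∑ τ ∈ Sig, F τ x) + N2 q W (fun x => ∑ τ ∈ Rest, F τ x)) := N2_add_le hq hWm hSm hRm
      _ ≤ 2 * (Cn * D * (2 * (X0 + T)) + 1 * T) := by
          rw [one_mul]
          refine mul_le_mul_right (add_le_add (hnar.trans (mul_le_mul_right hsα _)) hsumRest) _
      _ ≤ 2 * (Cn * D * (2 * (X0 + T)) + D * (X0 + T)) := by
          gcongr; exact le_add_self
      _ = ((4 * Cn + 2 : ℕ) : ℝ≥0∞) * D * (X0 + T) := by push_cast; ring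
      _ ≤ _ := by gcongr

end QPS

namespace QPS
set_option linter.all false
open scoped ENNReal NNReal BigOperators FourierTransform SchwartzMap ComplexConjugate
variable {m : ℕ}

lemma SV.rpow_SV {A Q : ℕ} {r : ℝ} (hr : 0 < r) {W : V m → ℝ≥0∞} (h : SV A r W) {p : ℝ} (hp : 0 ≤ p) (hpQ : p ≤ Q) :
    SV (A * Q) r (fun x => W x ^ p) := by
  refine ⟨h.1.pow_const _, fun x y => (h.rpow hp x y).trans ?_⟩
  refine mul_le_mul_left ?_ _
  have h1 : (1:ℝ) ≤ (1 + ‖y‖ / r) := by have : 0 ≤ ‖y‖ / r := by positivity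
                                        linarith
  have h2 : (1:ℝ) ≤ (1 + ‖y‖ / r) ^ A := one_le_pow₀ h1
  rw [ENNReal.ofReal_rpow_of_nonneg (by positivity) hp]
  apply ENNReal.ofReal_le_ofReal
  rw [pow_mul, ← Real.rpow_natCast _ Q]
  exact Real.rpow_le_rpow_of_exponent_le h2 hpQ

lemma cap_bdd {d b : ℕ} {θ : Fin d → ℤ} (hθ : ∀ i, |θ i| ≤ 2 ^ b) : cap d b θ ⊆ {l | ∀ i, |l i| ≤ 9 * (d : ℝ) + 10} := by
  rintro l ⟨h1, h2⟩
  have hb : (1:ℝ) ≤ 2 ^ b := one_le_pow₀ (by norm_num)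
  have hb4 : (1:ℝ) ≤ 4 ^ b := one_le_pow₀ (by norm_num)
  have h3 : ∀ i : Fin d, |l i.succ| ≤ 3 := by
    intro i
    have e1 := h1 i
    have e2 : |(θ i : ℝ) / 2 ^ b| ≤ 1 := by
      rw [abs_div, abs_of_pos (by positivity : (0:ℝ) < 2 ^ b), div_le_one (by positivity)]
      have := hθ i
      exact_mod_cast this
    have e3 : (2:ℝ) / 2 ^ b ≤ 2 := by rw [div_le_iff₀ (by positivity)]; linarith
    have e4 := abs_add_le (l i.succ - θ i / 2 ^ b) (θ i / 2 ^ b)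
    rw [sub_add_cancel] at e4
    linarith
  intro i
  refine Fin.cases ?_ (fun i => ?_) i
  · have e1 : ∑ i : Fin d, (l i.succ) ^ 2 ≤ 9 * d := by
      calc _ ≤ ∑ i : Fin d, (9:ℝ) := by
            apply Finset.sum_le_sum; intro i _
            have := h3 i
            rw [← sq_abs]; nlinarith [abs_nonneg (l i.succ)]
        _ = _ := by simp; ring
    have e2 : (0:ℝ) ≤ ∑ i : Fin d, (l i.succ) ^ 2 := Finset.sum_nonneg (fun _ _ => sq_nonneg _)
    have e3 : (1:ℝ) / 4 ^ b ≤ 1 := by rw [div_le_one (by positivity)]; exact hb4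
    rw [abs_le] at h2 ⊢
    constructor <;> linarith
  · have := h3 i
    have : (0:ℝ) ≤ d := by positivity
    linarith

lemma Av_scale (B : ℕ) {r : ℝ} (hr : 1 ≤ r) {h : V m → ℝ≥0∞} (hh : Measurable h) (x : V m) :
    ∫⁻ y, h (x + y) * kk B y ≤ ENNReal.ofReal (r ^ m) * Av B r h x := by
  have hr0 : 0 < r := by linarith
  rw [Av_eq B hr0 hh x, ← mul_assoc, ← ENNReal.ofReal_mul (by positivity), mul_inv_cancel₀ (by positivity), ENNReal.ofReal_one, one_mul]
  have e := lintegral_affine (fun z => h z * kk B (r⁻¹ • (z - x))) (by fun_prop) one_pos x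
  simp only [one_smul, one_pow, inv_one, ENNReal.ofReal_one, one_mul, add_sub_cancel_left] at e
  rw [← e]
  apply lintegral_mono
  intro y
  refine mul_le_mul' le_rfl ?_
  unfold kk
  apply ENNReal.ofReal_le_ofReal
  apply inv_anti₀ (by positivity)
  gcongr
  rw [norm_smul, norm_inv, Real.norm_of_nonneg hr0.le]
  exact mul_le_of_le_one_left (norm_nonneg _) (inv_le_one_of_one_le₀ hr)

lemma GG_point (d A1 Q : ℕ) (q : ℝ) (hq : 2 ≤ q) (hQ : q / 2 ≤ Q) : ∃ C : ℝ≥0∞, C ≠ ∞ ∧ ∀ (a κ b : ℕ) (R : ℝ), 0 < R → R ≤ 2 ^ b → κ ≤ b → b ≤ a →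
    ∀ S : Finset (Fin d → ℤ), (∀ α ∈ S, ∀ i, |α i| ≤ 2 ^ a) →
    ∀ f : (Fin d → ℤ) → V (d + 1) → ℂ, (∀ α ∈ S, f α ∈ TP (cap d a α)) → ∀ τ x,
    Av (A1 * Q + (d + 2)) R (fun z => ‖fb a S f κ τ z‖ₑ ^ q) x ≤ C * (((2 ^ b) ^ (2 * d + 1) : ℕ) : ℝ≥0∞) ^ (q / 2) * (GG A1 a κ S f b τ x) ^ (q / 2) := by
  obtain ⟨C, hC, hLC⟩ := LC (m := d + 1) (9 * (d : ℝ) + 10) (by positivity) A1 2 (by norm_num)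
  refine ⟨C ^ (q / 2) * (∫⁻ y : V (d + 1), kk (d + 2) y), ?_, ?_⟩
  · exact ENNReal.mul_ne_top (ENNReal.rpow_ne_top_of_nonneg (by positivity) hC) (kk_integrable (by omega))
  intro a κ b R hR hRb hκb hba S hS f hf τ x
  have hTm : ∀ θ, Measurable (fb a S f b θ) := fun θ => TP_meas (fb_mem hba hf θ)
  have hpt : ∀ z, ‖fb a S f κ τ z‖ₑ ^ (2:ℝ) ≤ C * (((2 ^ b) ^ (2 * d + 1) : ℕ) : ℝ≥0∞) * GG A1 a κ S f b τ z := by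
    intro z
    rw [fb_fb hκb hba S f τ]
    have h1 := sq_sum_enorm (Th a κ S b τ) (fun θ => fb a S f b θ z)
    have hcard : (Th a κ S b τ).card ≤ (2 ^ b) ^ d := by
      refine (fiber_card (b - κ) (S.image (par (a - b))) τ).trans ?_
      gcongr
      · norm_num
      · omega
    have h2 : ∀ θ ∈ Th a κ S b τ, ‖fb a S f b θ z‖ₑ ^ 2 ≤ C * (((2 ^ b) ^ (d + 1) : ℕ) : ℝ≥0∞) * Av A1 (2 ^ b) (fun z => ‖fb a S f b θ z‖ₑ ^ (2:ℝ)) z := by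
      intro θ hθ
      have := hLC (fb a S f b θ) (TP_mono (cap_bdd (Th_bound hS hba hθ)) (fb_mem hba hf θ)) z
      rw [ENNReal.rpow_two] at this
      refine this.trans ?_
      rw [mul_assoc]
      refine mul_le_mul_right ?_ _
      have h3 := Av_scale A1 (r := 2 ^ b) (one_le_pow₀ (by norm_num)) (h := fun z => ‖fb a S f b θ z‖ₑ ^ (2:ℝ)) (by have := hTm θ; fun_prop) z
      refine h3.trans (le_of_eq ?_)
      congr 1
      rw [← ENNReal.ofReal_natCast]; push_cast; rfl
    rw [ENNReal.rpow_two]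
    refine h1.trans ?_
    calc _ ≤ (((2 ^ b) ^ d : ℕ) : ℝ≥0∞) * ∑ θ ∈ Th a κ S b τ, C * (((2 ^ b) ^ (d + 1) : ℕ) : ℝ≥0∞) * Av A1 (2 ^ b) (fun z => ‖fb a S f b θ z‖ₑ ^ (2:ℝ)) z := by
          refine mul_le_mul' (by exact_mod_cast hcard) (Finset.sum_le_sum h2)
      _ = _ := by
          rw [← Finset.mul_sum]; unfold GG; push_cast
          rw [← mul_assoc]; congr 1; ring
  have hSV : SV (A1 * Q) (2 ^ b) (fun x => (GG A1 a κ S f b τ x) ^ (q / 2)) := by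
    apply SV.rpow_SV (by positivity) _ (by linarith) hQ
    unfold GG
    apply SV.sum
    intro θ _
    exact SV_Av A1 (by positivity) (by have := hTm θ; fun_prop)
  calc _ ≤ Av (A1 * Q + (d + 2)) R (fun z => (C * (((2 ^ b) ^ (2 * d + 1) : ℕ) : ℝ≥0∞)) ^ (q / 2) * (GG A1 a κ S f b τ z) ^ (q / 2)) x := by
        apply Av_mono
        intro z
        have := ENNReal.rpow_le_rpow (hpt z) (z := q / 2) (by linarith)
        rw [← ENNReal.rpow_mul, ENNReal.mul_rpow_of_nonneg _ _ (by linarith)] at this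
        convert this using 2; ring
    _ = (C * (((2 ^ b) ^ (2 * d + 1) : ℕ) : ℝ≥0∞)) ^ (q / 2) * Av (A1 * Q + (d + 2)) R (fun z => (GG A1 a κ S f b τ z) ^ (q / 2)) x := Av_const_mul _ hSV.1 _ _
    _ ≤ (C * (((2 ^ b) ^ (2 * d + 1) : ℕ) : ℝ≥0∞)) ^ (q / 2) * ((∫⁻ y : V (d + 1), kk (d + 2) y) * (GG A1 a κ S f b τ x) ^ (q / 2)) :=
        mul_le_mul_right (Av_le_SV hR hRb hSV x) _
    _ = _ := by rw [ENNReal.mul_rpow_of_nonneg _ _ (by linarith)]; ring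

end QPS

namespace QPS
set_option linter.all false
open scoped ENNReal NNReal BigOperators FourierTransform SchwartzMap ComplexConjugate
variable {m : ℕ}

noncomputable def om (B : ℕ) (R : ℝ) (x z : V m) : ℝ≥0∞ := ENNReal.ofReal ((R ^ m)⁻¹) * kk B (R⁻¹ • (z - x))

lemma om_SV (B : ℕ) {R : ℝ} (hR : 0 < R) (x : V m) : SV B R (om B R x) := (SV_kk B hR x).const_mul _

lemma II_om (B : ℕ) {R : ℝ} (hR : 0 < R) {q : ℝ} {g : V m → ℂ} (hg : Measurable g) (x : V m) :
    II q (om B R x) g = Av B R (fun z => ‖g z‖ₑ ^ q) x := by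
  rw [Av_eq B hR (by fun_prop), ← lintegral_const_mul _ (by fun_prop)]
  unfold II om
  apply lintegral_congr; intro z; ring

lemma Av_int_le {A B : ℕ} {R s : ℝ} (hR : 0 < R) (hRs : R ≤ s) {W : V m → ℝ≥0∞} (hW : SV A s W) {h : V m → ℝ≥0∞} (hh : Measurable h) :
    ∫⁻ x, Av (A + B) R h x * W x ≤ (∫⁻ y : V m, kk B y) * ∫⁻ x, h x * W x := by
  have := hW.1
  rw [Av_symm _ _ hh hW.1, ← lintegral_const_mul _ (by fun_prop)]
  apply lintegral_mono; intro x
  calc h x * Av (A + B) R W x ≤ h x * ((∫⁻ y : V m, kk B y) * W x) := mul_le_mul_right (Av_le_SV hR hRs hW x) _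
    _ = _ := by ring

lemma lin_term {ι : Type*} (T : Finset ι) {g : ι → V m → ℂ} (hg : ∀ l, Measurable (g l)) {A B : ℕ} {R s : ℝ} (hR : 0 < R) (hRs : R ≤ s)
    {W : V m → ℝ≥0∞} (hW : SV A s W) {q : ℝ} (hq : 2 ≤ q) :
    ∫⁻ x, (∑ l ∈ T, N2 q (om (A + B) R x) (g l)) ^ (q / 2) * W x ≤ (∫⁻ y : V m, kk B y) * (∑ l ∈ T, N2 q W (g l)) ^ (q / 2) := by
  have hWm := hW.1
  have hq0 : 0 < q := by linarith
  have e1 : ∀ x, (∑ l ∈ T, N2 q (om (A + B) R x) (g l)) ^ (q / 2) * W x = (∑ l ∈ T, (Av (A + B) R (fun z => ‖g l z‖ₑ ^ q) x * W x) ^ (2 / q)) ^ (q / 2) := by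
    intro x
    have : ∑ l ∈ T, (Av (A + B) R (fun z => ‖g l z‖ₑ ^ q) x * W x) ^ (2 / q) = (∑ l ∈ T, N2 q (om (A + B) R x) (g l)) * W x ^ (2 / q) := by
      rw [Finset.sum_mul]
      apply Finset.sum_congr rfl; intro l _
      unfold N2
      rw [II_om _ hR (hg l), ENNReal.mul_rpow_of_nonneg _ _ (by positivity)]
    rw [this, ENNReal.mul_rpow_of_nonneg _ _ (by positivity), ← ENNReal.rpow_mul, div_mul_div_cancel₀ (by linarith), div_self (by norm_num), ENNReal.rpow_one]
  simp_rw [e1]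
  refine (mink volume T _ ?_ hq).trans ?_
  · intro l _
    exact (Av_meas _ _ (by have := hg l; fun_prop)).mul hWm
  have e2 : ∀ l ∈ T, (∫⁻ x, Av (A + B) R (fun z => ‖g l z‖ₑ ^ q) x * W x) ^ (2 / q) ≤ (∫⁻ y : V m, kk B y) ^ (2 / q) * N2 q W (g l) := by
    intro l _
    unfold N2
    rw [← ENNReal.mul_rpow_of_nonneg _ _ (by positivity)]
    apply ENNReal.rpow_le_rpow _ (by positivity)
    exact Av_int_le hR hRs hW (by have := hg l; fun_prop)
  calc _ ≤ (∑ l ∈ T, (∫⁻ y : V m, kk B y) ^ (2 / q) * N2 q W (g l)) ^ (q / 2) := ENNReal.rpow_le_rpow (Finset.sum_le_sum e2) (by positivity)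
    _ = _ := by
      rw [← Finset.mul_sum, ENNReal.mul_rpow_of_nonneg _ _ (by positivity), ← ENNReal.rpow_mul, div_mul_div_cancel₀ (by linarith), div_self (by norm_num), ENNReal.rpow_one]

noncomputable def MM (e κ : ℕ) : ℕ := (2 * (2 * 2 ^ κ) + 1) ^ (e + 1)

noncomputable def TT {e : ℕ} (κ0 κ1 a : ℕ) (S : Finset (Fin (e + 1) → ℤ)) : Finset (Fin (e + 2) → Fin (e + 1) → ℤ) :=
  (Fintype.piFinset (fun _ : Fin (e + 2) => S.image (par (a - κ1)))).filter
        (fun τ => (1 / 2 ^ κ0 : ℝ) ^ (e + 2) / ((e + 2).factorial : ℝ) ≤ |(Matrix.of (fun i => ev κ1 (τ i))).det|)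

lemma TT_card {e κ0 κ1 a : ℕ} (h : κ1 ≤ a) {S : Finset (Fin (e + 1) → ℤ)} (hS : ∀ α ∈ S, ∀ i, |α i| ≤ 2 ^ a) : (TT κ0 κ1 a S).card ≤ MM e κ1 ^ (e + 2) := by
  unfold TT
  refine (Finset.card_filter_le _ _).trans ?_
  rw [Fintype.card_piFinset]
  simp only [Finset.prod_const, Finset.card_univ, Fintype.card_fin]
  apply Nat.pow_le_pow_left
  apply card_box
  intro τ hτ
  obtain ⟨k, hk, rfl⟩ := Finset.mem_image.1 hτ
  exact par_bound h (hS k hk)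

lemma bn_point2 (e : ℕ) (q : ℝ) (hq : 2 ≤ q) : ∃ C : ℕ, ∀ (κ0 κ1 a A2 : ℕ) (D : ℝ≥0∞), 1 ≤ κ0 → κ0 ≤ κ1 → κ1 ≤ a → 1 ≤ D → Dec e q A2 κ0 D →
    ∀ S : Finset (Fin (e + 1) → ℤ), (∀ α ∈ S, ∀ i, |α i| ≤ 2 ^ a) →
    ∀ f : (Fin (e + 1) → ℤ) → V (e + 2) → ℂ, (∀ α ∈ S, f α ∈ TP (cap (e + 1) a α)) → ∀ W : V (e + 2) → ℝ≥0∞, SV A2 (4 ^ κ0) W →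
    N2 q W (fun x => ∑ α ∈ S, f α x) ≤ C * D * (∑ α ∈ S.image (par (a - κ0)), N2 q W (fb a S f κ0 α) + ∑ τ ∈ S.image (par (a - κ1)), N2 q W (fb a S f κ1 τ)) +
      ((MM e κ1 ^ 4 : ℕ) : ℝ≥0∞) * ∑ τ ∈ TT κ0 κ1 a S, ∏ i, (N2 q W (fb a S f κ1 (τ i))) ^ (1 / ((e + 2 : ℕ) : ℝ)) := by
  obtain ⟨C, h⟩ := bn_point e q hq
  refine ⟨C, ?_⟩
  unfold MM TT
  exact h

attribute [irreducible] MM TT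

set_option maxHeartbeats 1600000 in
lemma bn_int (e : ℕ) (q : ℝ) (hq : 2 ≤ q) (A Q : ℕ) (hQ : q / 2 ≤ Q) : ∃ C : ℝ≥0∞, C ≠ ∞ ∧ ∀ κ0 κ1 : ℕ, ∃ K : ℝ≥0∞, K ≠ ∞ ∧ ∀ (D : ℝ≥0∞) (a b : ℕ),
    1 ≤ κ0 → κ0 ≤ κ1 → κ1 ≤ b → 2 * κ0 ≤ b → b ≤ a → 1 ≤ D → Dec e q ((A + (e + 3)) * Q + (e + 3)) κ0 D →
    ∀ S : Finset (Fin (e + 1) → ℤ), (∀ α ∈ S, ∀ i, |α i| ≤ 2 ^ a) →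
    ∀ f : (Fin (e + 1) → ℤ) → V (e + 2) → ℂ, (∀ α ∈ S, f α ∈ TP (cap (e + 1) a α)) → ∀ W : V (e + 2) → ℝ≥0∞, SV A (4 ^ a) W →
    II q W (fun x => ∑ α ∈ S, f α x) ≤ C * D ^ (q / 2) * ((∑ α ∈ S.image (par (a - κ0)), N2 q W (fb a S f κ0 α)) ^ (q / 2) +
        (∑ τ ∈ S.image (par (a - κ1)), N2 q W (fb a S f κ1 τ)) ^ (q / 2)) +
      K * (((2 ^ b) ^ (2 * (e + 1) + 1) : ℕ) : ℝ≥0∞) ^ (q / 2) * ∑ τ ∈ TT κ0 κ1 a S, AA q (A + (e + 3)) a κ1 S f W τ b := by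
  classical
  obtain ⟨Cb, hCb⟩ := bn_point2 e q hq
  obtain ⟨Cg, hCg, hGG⟩ := GG_point (e + 1) (A + (e + 3)) Q q hq hQ
  have hp0 : 0 < q / 2 := by linarith
  have hp1 : 1 ≤ q / 2 := by linarith
  have hQ1 : 1 ≤ Q := by
    have : (1:ℝ) ≤ Q := by linarith
    exact_mod_cast this
  set A2 := (A + (e + 3)) * Q + (e + 3) with hA2
  obtain ⟨B, hB⟩ : ∃ B, A2 = A + B := ⟨A2 - A, by
    have : A ≤ (A + (e + 3)) * Q := by nlinarith
    omega⟩
  have hBge : e + 3 ≤ B := by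
    have : A ≤ (A + (e + 3)) * Q := by nlinarith
    omega
  set n := e + 2 with hn
  set c0 := ∫⁻ y : V n, kk (A + A2) y with hc0
  set c1 := ∫⁻ y : V n, kk B y with hc1
  have hc1t : c1 ≠ ∞ := kk_integrable (by omega)
  have hc00 : c0 ≠ 0 := kk_integral_pos _
  have hc0t : c0 ≠ ∞ := kk_integrable (by omega)
  set P : ℝ≥0∞ := 2 ^ (q / 2 - 1) with hP
  have hPt : P ≠ ∞ := by rw [hP]; apply ENNReal.rpow_ne_top_of_nonneg (by linarith); norm_num
  refine ⟨c0⁻¹ * (P * ((Cb : ℝ≥0∞) ^ (q / 2) * (P * c1))), ?_, ?_⟩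
  · have : (Cb : ℝ≥0∞) ^ (q / 2) ≠ ∞ := ENNReal.rpow_ne_top_of_nonneg hp0.le (by simp)
    have : c0⁻¹ ≠ ∞ := by simpa using hc00
    finiteness
  intro κ0 κ1
  set M4 : ℝ≥0∞ := ((MM e κ1 ^ 4 : ℕ) : ℝ≥0∞) ^ (q / 2) * ((MM e κ1 ^ (e + 2) : ℕ) : ℝ≥0∞) ^ (q / 2 - 1) with hM4
  have hM4t : M4 ≠ ∞ := by
    apply ENNReal.mul_ne_top
    · exact ENNReal.rpow_ne_top_of_nonneg hp0.le (by simp)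
    · exact ENNReal.rpow_ne_top_of_nonneg (by linarith) (by simp)
  refine ⟨c0⁻¹ * (P * (M4 * Cg)), ?_, ?_⟩
  · have : c0⁻¹ ≠ ∞ := by simpa using hc00
    finiteness
  intro D a b hκ0 hκ01 hκ1b hκ0b hba hD hDec S hS f hf W hW
  have hWm := hW.1
  set R : ℝ := 4 ^ κ0 with hR
  have hR0 : 0 < R := by positivity
  have hRa : R ≤ 4 ^ a := pow_le_pow_right₀ (by norm_num) (by omega)
  have hRb : R ≤ 2 ^ b := by
    rw [hR, show (4:ℝ) = 2 ^ 2 by norm_num, ← pow_mul]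
    exact pow_le_pow_right₀ (by norm_num) hκ0b
  set T0 := S.image (par (a - κ0)) with hT0
  set T1 := S.image (par (a - κ1)) with hT1
  have hm0 : ∀ α, Measurable (fb a S f κ0 α) := fun α => TP_meas (fb_mem (by omega) hf α)
  have hm1 : ∀ α, Measurable (fb a S f κ1 α) := fun α => TP_meas (fb_mem (by omega) hf α)
  have hfm : Measurable (fun x => ∑ α ∈ S, f α x) := Finset.measurable_fun_sum _ (fun α hα => TP_meas (hf α hα))
  set F := fun x => ∑ α ∈ S, f α x with hF
  -- localize
  have s1 : c0 * II q W F ≤ ∫⁻ x, Av A2 R (fun z => ‖F z‖ₑ ^ q) x * W x := by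
    rw [Av_symm _ _ (by fun_prop) hWm]
    unfold II
    rw [← lintegral_const_mul _ (by fun_prop)]
    apply lintegral_mono; intro x
    calc c0 * (‖F x‖ₑ ^ q * W x) = ‖F x‖ₑ ^ q * (c0 * W x) := by ring
      _ ≤ _ := mul_le_mul_right (SV_le_Av hR0 hRa hW x) _
  set Mb : ℝ≥0∞ := (((2 ^ b) ^ (2 * (e + 1) + 1) : ℕ) : ℝ≥0∞) ^ (q / 2) with hMb
  set X0 := fun x : V n => (∑ α ∈ T0, N2 q (om A2 R x) (fb a S f κ0 α)) ^ (q / 2) with hX0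
  set X1 := fun x : V n => (∑ α ∈ T1, N2 q (om A2 R x) (fb a S f κ1 α)) ^ (q / 2) with hX1
  set Z := fun x : V n => ∑ τ ∈ TT κ0 κ1 a S, ∏ i, (GG (A + (e + 3)) a κ1 S f b (τ i) x) ^ (q / (2 * ((e + 1 + 1 : ℕ) : ℝ))) with hZ
  have s2 : ∀ x, Av A2 R (fun z => ‖F z‖ₑ ^ q) x ≤ P * ((Cb : ℝ≥0∞) ^ (q / 2) * D ^ (q / 2) * (P * (X0 x + X1 x)) + M4 * Cg * Mb * Z x) := by
    intro x
    rw [← II_om A2 hR0 hfm, ← N2_rpow hq]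
    have hb := hCb κ0 κ1 a A2 D hκ0 hκ01 (by omega) hD hDec S hS f hf (om A2 R x) (om_SV A2 hR0 x)
    refine (ENNReal.rpow_le_rpow hb hp0.le).trans ?_
    refine (ENNReal.rpow_add_le_mul_rpow_add_rpow _ _ hp1).trans ?_
    refine mul_le_mul_right (add_le_add ?_ ?_) _
    · rw [ENNReal.mul_rpow_of_nonneg _ _ hp0.le, ENNReal.mul_rpow_of_nonneg _ _ hp0.le]
      refine mul_le_mul_right ?_ _
      exact ENNReal.rpow_add_le_mul_rpow_add_rpow _ _ hp1
    · rw [ENNReal.mul_rpow_of_nonneg _ _ hp0.le]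
      have t1 : ∀ τ ∈ TT κ0 κ1 a S, (∏ i, (N2 q (om A2 R x) (fb a S f κ1 (τ i))) ^ (1 / ((e + 2 : ℕ) : ℝ))) ^ (q / 2) ≤
          Cg * Mb * ∏ i, (GG (A + (e + 3)) a κ1 S f b (τ i) x) ^ (q / (2 * ((e + 1 + 1 : ℕ) : ℝ))) := by
        intro τ _
        rw [← ENNReal.prod_rpow_of_nonneg hp0.le]
        calc _ ≤ ∏ i : Fin (e + 2), (Cg * Mb) ^ (1 / ((e + 2 : ℕ) : ℝ)) * (GG (A + (e + 3)) a κ1 S f b (τ i) x) ^ (q / (2 * ((e + 1 + 1 : ℕ) : ℝ))) := by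
              apply Finset.prod_le_prod'
              intro i _
              rw [← ENNReal.rpow_mul, mul_comm (1 / _) (q / 2), ENNReal.rpow_mul _ (q / 2), N2_rpow hq, II_om A2 hR0 (hm1 _)]
              have := hGG a κ1 b R hR0 hRb hκ1b hba S hS f hf (τ i) x
              refine (ENNReal.rpow_le_rpow this (by positivity)).trans (le_of_eq ?_)
              rw [ENNReal.mul_rpow_of_nonneg _ _ (by positivity), ← ENNReal.rpow_mul _ (q / 2)]
              congr 2
              push_cast
              field_simp
              ring
          _ = _ := by
              rw [Finset.prod_mul_distrib]
              congr 1
              rw [Finset.prod_const, Finset.card_univ, Fintype.card_fin, ← ENNReal.rpow_natCast, ← ENNReal.rpow_mul]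
              rw [one_div, inv_mul_cancel₀ (by positivity), ENNReal.rpow_one]
      calc _ ≤ ((MM e κ1 ^ 4 : ℕ) : ℝ≥0∞) ^ (q / 2) * (((MM e κ1 ^ (e + 2) : ℕ) : ℝ≥0∞) ^ (q / 2 - 1) * ∑ τ ∈ TT κ0 κ1 a S, (∏ i, (N2 q (om A2 R x) (fb a S f κ1 (τ i))) ^ (1 / ((e + 2 : ℕ) : ℝ))) ^ (q / 2)) := by
            refine mul_le_mul' le_rfl ?_
            refine (ENNReal.rpow_sum_le_const_mul_sum_rpow _ _ hp1).trans ?_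
            refine mul_le_mul' ?_ le_rfl
            apply ENNReal.rpow_le_rpow _ (by linarith)
            exact_mod_cast TT_card (by omega) hS
        _ ≤ ((MM e κ1 ^ 4 : ℕ) : ℝ≥0∞) ^ (q / 2) * (((MM e κ1 ^ (e + 2) : ℕ) : ℝ≥0∞) ^ (q / 2 - 1) * ∑ τ ∈ TT κ0 κ1 a S, Cg * Mb * ∏ i, (GG (A + (e + 3)) a κ1 S f b (τ i) x) ^ (q / (2 * ((e + 1 + 1 : ℕ) : ℝ)))) :=
            mul_le_mul' le_rfl (mul_le_mul' le_rfl (Finset.sum_le_sum t1))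
        _ = _ := by rw [← Finset.mul_sum, hM4, hZ]; ring
  have hN0 : ∀ α, Measurable (fun x => N2 q (om A2 R x) (fb a S f κ0 α)) := by
    intro α
    unfold N2
    apply Measurable.pow_const
    simp_rw [II_om A2 hR0 (hm0 α)]
    exact Av_meas _ _ (by have := hm0 α; fun_prop)
  have hN1 : ∀ α, Measurable (fun x => N2 q (om A2 R x) (fb a S f κ1 α)) := by
    intro α
    unfold N2
    apply Measurable.pow_const
    simp_rw [II_om A2 hR0 (hm1 α)]
    exact Av_meas _ _ (by have := hm1 α; fun_prop)
  have hX0m : Measurable X0 := (Finset.measurable_fun_sum _ (fun α _ => hN0 α)).pow_const _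
  have hX1m : Measurable X1 := (Finset.measurable_fun_sum _ (fun α _ => hN1 α)).pow_const _
  have hGm : ∀ τ : Fin (e + 2) → Fin (e + 1) → ℤ, Measurable (fun x => ∏ i, (GG (A + (e + 3)) a κ1 S f b (τ i) x) ^ (q / (2 * ((e + 1 + 1 : ℕ) : ℝ)))) := by
    intro τ
    apply Finset.measurable_fun_prod
    intro i _
    exact (GG_meas hba hf (τ i)).pow_const _
  have hZm : Measurable Z := Finset.measurable_fun_sum _ (fun τ _ => hGm τ)
  have s3 : ∫⁻ x, X0 x * W x ≤ c1 * (∑ α ∈ T0, N2 q W (fb a S f κ0 α)) ^ (q / 2) := by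
    have := lin_term (B := B) T0 hm0 hR0 hRa hW hq
    rw [← hB] at this
    exact this
  have s4 : ∫⁻ x, X1 x * W x ≤ c1 * (∑ α ∈ T1, N2 q W (fb a S f κ1 α)) ^ (q / 2) := by
    have := lin_term (B := B) T1 hm1 hR0 hRa hW hq
    rw [← hB] at this
    exact this
  have s5 : ∫⁻ x, Z x * W x = ∑ τ ∈ TT κ0 κ1 a S, AA q (A + (e + 3)) a κ1 S f W τ b := by
    unfold AA
    simp_rw [hZ, Finset.sum_mul]
    rw [lintegral_finsetSum]
    intro τ _
    exact (hGm τ).mul hWm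
  have s6 : c0 * II q W F ≤ P * ((Cb : ℝ≥0∞) ^ (q / 2) * D ^ (q / 2) * (P * ((∫⁻ x, X0 x * W x) + ∫⁻ x, X1 x * W x)) + M4 * Cg * Mb * ∫⁻ x, Z x * W x) := by
    refine s1.trans ?_
    calc _ ≤ ∫⁻ x, (P * ((Cb : ℝ≥0∞) ^ (q / 2) * D ^ (q / 2) * P * (X0 x * W x) + (Cb : ℝ≥0∞) ^ (q / 2) * D ^ (q / 2) * P * (X1 x * W x)  + M4 * Cg * Mb * (Z x * W x))) := by
          apply lintegral_mono; intro x
          refine (mul_le_mul_left (s2 x) _).trans (le_of_eq ?_)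
          ring
      _ = _ := by
          rw [lintegral_const_mul _ (by fun_prop), lintegral_add_left (by fun_prop), lintegral_add_left (by fun_prop), lintegral_const_mul _ (by fun_prop), lintegral_const_mul _ (by fun_prop), lintegral_const_mul _ (by fun_prop)]
          ring
  rw [s5] at s6
  have s7 : c0 * II q W F ≤ P * ((Cb : ℝ≥0∞) ^ (q / 2) * D ^ (q / 2) * (P * (c1 * (∑ α ∈ T0, N2 q W (fb a S f κ0 α)) ^ (q / 2) + c1 * (∑ α ∈ T1, N2 q W (fb a S f κ1 α)) ^ (q / 2))) + M4 * Cg * Mb * ∑ τ ∈ TT κ0 κ1 a S, AA q (A + (e + 3)) a κ1 S f W τ b) := by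
    refine s6.trans ?_
    refine mul_le_mul_right (add_le_add_left ?_ _) _
    exact mul_le_mul_right (mul_le_mul_right (add_le_add s3 s4) _) _
  rw [ENNReal.mul_le_iff_le_inv hc00 hc0t] at s7
  refine s7.trans (le_of_eq ?_)
  ring

end QPS

namespace QPS
set_option linter.all false
open scoped ENNReal NNReal BigOperators FourierTransform SchwartzMap ComplexConjugate
variable {m : ℕ}

lemma exists_two_pow {C : ℝ≥0∞} (hC : C ≠ ∞) {s : ℝ} (hs : 0 < s) : ∃ κ : ℕ, 1 ≤ κ ∧ C ≤ 2 ^ ((κ : ℝ) * s) := by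
  obtain ⟨N, hN⟩ := ENNReal.exists_nat_gt hC
  obtain ⟨κ1, h⟩ := exists_nat_ge ((N : ℝ) / s)
  refine ⟨κ1 + 1, by omega, hN.le.trans ?_⟩
  rw [div_le_iff₀ (by positivity)] at h
  calc (N : ℝ≥0∞) ≤ (2 : ℝ≥0∞) ^ N := by exact_mod_cast (Nat.lt_two_pow_self).le
    _ = 2 ^ (N : ℝ) := (ENNReal.rpow_natCast _ _).symm
    _ ≤ _ := two_rpow_mono (by push_cast; nlinarith)

lemma Dec_trivial {d : ℕ} {q : ℝ} (hq : 2 ≤ q) (A a : ℕ) : Dec d q A a (((2 * (2 * 2 ^ a) + 1) ^ d : ℕ) : ℝ≥0∞) := by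
  intro S hS f hf W hW
  refine (N2_sum_le S f (fun k hk => TP_meas (hf k hk)) hW.1 hq).trans ?_
  refine mul_le_mul_left ?_ _
  exact_mod_cast card_box a S hS

lemma Dec_mono {d : ℕ} {q : ℝ} {A a : ℕ} {D D' : ℝ≥0∞} (h : D ≤ D') (hD : Dec d q A a D) : Dec d q A a D' := by
  intro S hS f hf W hW
  exact (hD S hS f hf W hW).trans (mul_le_mul_left h _)

lemma sum_N2_fb {d a b : ℕ} {q : ℝ} (hq : 2 ≤ q) (hb : b ≤ a) {S : Finset (Fin d → ℤ)} {f : (Fin d → ℤ) → V (d + 1) → ℂ}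
    (hf : ∀ k ∈ S, f k ∈ TP (cap d a k)) {W : V (d + 1) → ℝ≥0∞} (hW : Measurable W) {N : ℕ} (hN : a - b ≤ N) :
    ∑ k ∈ S.image (par (a - b)), N2 q W (fb a S f b k) ≤ (((2 ^ N) ^ d : ℕ) : ℝ≥0∞) * ∑ k ∈ S, N2 q W (f k) := by
  classical
  calc _ ≤ ∑ k' ∈ S.image (par (a - b)), (((2 ^ N) ^ d : ℕ) : ℝ≥0∞) * ∑ k ∈ S with par (a - b) k = k', N2 q W (f k) := by
        apply Finset.sum_le_sum; intro k' _
        unfold fb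
        refine (N2_sum_le _ f (fun k hk => TP_meas (hf k (Finset.mem_filter.1 hk).1)) hW hq).trans ?_
        refine mul_le_mul_left ?_ _
        have h1 := fiber_card (a - b) S k'
        have h2 : (2 ^ (a - b)) ^ d ≤ (2 ^ N) ^ d := by
          apply Nat.pow_le_pow_left
          exact Nat.pow_le_pow_right (by norm_num) hN
        exact_mod_cast h1.trans h2
    _ = _ := by
        rw [← Finset.mul_sum]; congr 1
        exact Finset.sum_fiberwise_of_maps_to (fun k hk => Finset.mem_image_of_mem _ hk) _

lemma exp_bound {d M : ℕ} {η : ℝ} (hη : 0 < η) (hM : 4 * (2 * (d : ℝ) + 1) ≤ η * M) :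
    eM η (η / 4) M + (1 / 2) ^ M * (2 * (d : ℝ) + 1) ≤ (1 - (1 / 2) ^ M) * η := by
  unfold eM
  have : (0:ℝ) < (1 / 2) ^ M := by positivity
  nlinarith

set_option maxHeartbeats 1600000 in
lemma boot (e : ℕ) (q : ℝ) (hq : 2 ≤ q) (A : ℕ) (hqd : q * ((e + 1 : ℕ) : ℝ) ≤ 2 * ((e + 1 : ℕ) : ℝ) + 4)
    (IH : ∀ (A' : ℕ) (η : ℝ), 0 < η → ∃ C : ℝ≥0∞, C ≠ ∞ ∧ 1 ≤ C ∧ DB e q A' η C) (η : ℝ) (hη : 0 < η) (M : ℕ)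
    (hM : 4 * (2 * ((e + 1 : ℕ) : ℝ) + 1) ≤ η * M) (Cη : ℝ≥0∞) (hCt : Cη ≠ ∞) (hC1 : 1 ≤ Cη) (hDB : DB (e + 1) q A η Cη) :
    ∃ C' : ℝ≥0∞, C' ≠ ∞ ∧ 1 ≤ C' ∧ DB (e + 1) q A ((1 - (1 / 2) ^ M) * η) C' := by
  classical
  have hM1 : 1 ≤ M := by
    rcases Nat.eq_zero_or_pos M with h | h
    · subst h
      have : (0:ℝ) ≤ ((e + 1 : ℕ) : ℝ) := by positivity
      simp only [Nat.cast_zero, mul_zero] at hM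
      linarith
    · exact h
  set σ := (1 - (1 / 2 : ℝ) ^ M) * η with hσ
  have hσ0 : 0 < σ := by
    have : (1 / 2 : ℝ) ^ M < 1 := pow_lt_one₀ (by norm_num) (by norm_num) (by omega)
    exact mul_pos (by linarith) hη
  have hp0 : 0 < q / 2 := by linarith
  have hq2 : 0 < 2 / q := by positivity
  have hq21 : 2 / q ≤ 1 := by rw [div_le_one (by linarith)]; exact hq
  have hpp : (q / 2) * (2 / q) = 1 := by field_simp
  have hroot : ∀ x : ℝ≥0∞, (x ^ (q / 2)) ^ (2 / q) = x := by
    intro x; rw [← ENNReal.rpow_mul, hpp, ENNReal.rpow_one]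
  obtain ⟨C, hC, hbn⟩ := bn_int e q hq A ⌈q / 2⌉₊ (Nat.le_ceil _)
  obtain ⟨CI, hCIt, hCI1, hIH⟩ := IH ((A + (e + 3)) * ⌈q / 2⌉₊ + (e + 3)) (σ / 2) (by linarith)
  set C2 := (C * 2) ^ (2 / q) with hC2
  have hC2t : C2 ≠ ∞ := ENNReal.rpow_ne_top_of_nonneg hq2.le (by finiteness)
  obtain ⟨κ0, hκ0, hκ0C⟩ := exists_two_pow (C := 2 * C2 * CI * (2 ^ (e + 1) : ℕ)) (by finiteness) (half_pos hσ0)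
  obtain ⟨κb, K', hK', hml⟩ := ml_bound (e + 1) (by omega) A q hq hqd ((1 / 2 ^ κ0 : ℝ) ^ (e + 2) / ((e + 2).factorial : ℝ)) (by positivity) (η / 4) (by linarith)
  set κ1 := max κb (2 * κ0) with hκ1
  have hκ1b : κb ≤ κ1 := le_max_left _ _
  have hκ1κ0 : 2 * κ0 ≤ κ1 := le_max_right _ _
  clear_value κ1
  obtain ⟨K, hK, hbn2⟩ := hbn κ0 κ1
  set N := 2 ^ M * κ1 with hN
  have hN1 : 1 ≤ N := Nat.mul_pos (by positivity) (by omega)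
  have hNκ : κ1 ≤ N := Nat.le_mul_of_pos_left _ (by positivity)
  set C'' := (K * ((MM e κ1 ^ (e + 2) : ℕ) : ℝ≥0∞) * K') ^ (2 / q) * ((2 ^ (e + 1) : ℕ) * Cη * (((2 ^ N) ^ (e + 1) : ℕ) : ℝ≥0∞)) with hC''
  have hC''t : C'' ≠ ∞ := by
    apply ENNReal.mul_ne_top
    · exact ENNReal.rpow_ne_top_of_nonneg hq2.le (by finiteness)
    · finiteness
  set C' := (((2 * (2 * 2 ^ N) + 1) ^ (e + 1) : ℕ) : ℝ≥0∞) + 2 * C'' with hC'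
  have hC'1 : 1 ≤ C' := by
    refine le_add_right ?_
    exact_mod_cast Nat.one_le_pow _ _ (by omega)
  refine ⟨C', by finiteness, hC'1, ?_⟩
  intro a
  induction a using Nat.strong_induction_on with
  | _ a ih =>
  rcases lt_or_ge a N with haN | haN
  · refine Dec_mono ?_ (Dec_trivial hq A a)
    have h1 : (((2 * (2 * 2 ^ a) + 1) ^ (e + 1) : ℕ) : ℝ≥0∞) ≤ C' := by
      refine le_add_right ?_
      have : (2 * (2 * 2 ^ a) + 1) ^ (e + 1) ≤ (2 * (2 * 2 ^ N) + 1) ^ (e + 1) := by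
        gcongr
        norm_num
      exact_mod_cast this
    have h2 : (1:ℝ≥0∞) ≤ 2 ^ ((a : ℝ) * σ) := by
      rw [← ENNReal.rpow_zero (x := 2)]
      exact two_rpow_mono (by positivity)
    exact h1.trans (le_mul_of_one_le_right zero_le h2)
  intro S hS f hf W hW
  have hWm := hW.1
  set J := a / N with hJ
  have hJ1 : 1 ≤ J := (Nat.one_le_div_iff (by omega)).2 haN
  set a0 := N * J with ha0
  have ha0a : a0 ≤ a := Nat.mul_div_le a N
  have har : a - a0 ≤ N := by
    have := Nat.mod_lt a (show 0 < N by omega)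
    have h2 : a0 + a % N = a := Nat.div_add_mod a N
    exact Nat.sub_le_iff_le_add.2 (by linarith)
  have hNa0 : N ≤ a0 := Nat.le_mul_of_pos_right _ (by omega)
  have ha0J : a0 = 2 ^ M * (J * κ1) := by rw [ha0, hN]; ring
  set b := J * κ1 with hb
  have hbκ : κ1 ≤ b := Nat.le_mul_of_pos_left _ (by omega)
  have hba : b ≤ a0 := by rw [ha0J]; exact Nat.le_mul_of_pos_left _ (by positivity)
  clear_value J a0 b
  set S' := S.image (par (a - a0)) with hS'
  set F := fb a S f a0 with hF
  have hS'b : ∀ k ∈ S', ∀ i, |k i| ≤ 2 ^ a0 := by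
    intro τ hτ
    obtain ⟨k, hk, rfl⟩ := Finset.mem_image.1 hτ
    exact par_bound ha0a (hS k hk)
  have hFT : ∀ k ∈ S', F k ∈ TP (cap (e + 1) a0 k) := fun k _ => fb_mem ha0a hf k
  have hW0 : SV A (4 ^ a0) W := hW.mono_r (by positivity) (pow_le_pow_right₀ (by norm_num) ha0a)
  have hsum : (fun x => ∑ k ∈ S, f k x) = fun x => ∑ k ∈ S', F k x := by
    ext x
    exact sum_fiber (a - a0) S (fun k => f k x)
  have hfbfb : ∀ c, c ≤ a0 → ∀ α, fb a0 S' F c α = fb a S f c α := by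
    intro c hc α
    rw [fb_fb hc ha0a S f α]
    rfl
  have himg : ∀ c, c ≤ a0 → S'.image (par (a0 - c)) = S.image (par (a - c)) := by
    intro c hc
    rw [hS', Finset.image_image]
    congr 1
    ext1 k
    simp only [Function.comp]
    rw [par_par]
    congr 1
    omega
  set X := ∑ k ∈ S, N2 q W (f k) with hX
  set X' := ∑ k ∈ S', N2 q W (F k) with hX'
  have hXX : X' ≤ (((2 ^ N) ^ (e + 1) : ℕ) : ℝ≥0∞) * X := sum_N2_fb hq ha0a hf hWm har
  set D := CI * 2 ^ ((κ0 : ℝ) * (σ / 2)) with hD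
  have hD1 : 1 ≤ D := by
    refine one_le_mul hCI1 ?_
    rw [← ENNReal.rpow_zero (x := 2)]
    exact two_rpow_mono (by positivity)
  have hII := hbn2 D a0 b hκ0 (by omega) hbκ (by omega) hba hD1 (hIH κ0) S' hS'b F hFT W hW0
  set U := (2 ^ (e + 1) : ℕ) * C' * 2 ^ (((a : ℝ) - κ0) * σ) * X with hU
  have hY0 : ∑ α ∈ S'.image (par (a0 - κ0)), N2 q W (fb a0 S' F κ0 α) ≤ U := by
    rw [himg κ0 (by omega)]
    simp_rw [hfbfb κ0 (by omega)]
    exact sum_N2_rescale_lt hq hσ0.le hC'1 ih (by omega) hS hf hW _ subset_rfl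
  have hY1 : ∑ α ∈ S'.image (par (a0 - κ1)), N2 q W (fb a0 S' F κ1 α) ≤ U := by
    rw [himg κ1 (by omega)]
    simp_rw [hfbfb κ1 (by omega)]
    refine (sum_N2_rescale_lt hq hσ0.le hC'1 ih (by omega) hS hf hW _ subset_rfl).trans ?_
    rw [hU]
    refine mul_le_mul_left (mul_le_mul_right (two_rpow_mono ?_) _) _
    have : (κ0 : ℝ) ≤ κ1 := by exact_mod_cast (by omega : κ0 ≤ κ1)
    nlinarith
  have hAA : ∑ τ ∈ TT κ0 κ1 a0 S', AA q (A + (e + 3)) a0 κ1 S' F W τ b ≤ ((MM e κ1 ^ (e + 2) : ℕ) : ℝ≥0∞) *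
      (K' * (((2 ^ (e + 1) : ℕ) * Cη * X') ^ (q / 2) * 2 ^ ((q / 2) * (a0 * eM η (η / 4) M)))) := by
    calc _ ≤ ∑ τ ∈ TT κ0 κ1 a0 S', K' * (((2 ^ (e + 1) : ℕ) * Cη * X') ^ (q / 2) * 2 ^ ((q / 2) * (a0 * eM η (η / 4) M))) := by
          apply Finset.sum_le_sum
          intro τ hτ
          unfold TT at hτ
          rw [Finset.mem_filter, Fintype.mem_piFinset] at hτ
          have := hml η Cη hη.le hC1 hDB κ1 hκ1b τ ?_ hτ.2 M a0 J hJ1 (by rw [ha0J, hb]) S' hS'b F hFT W hW0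
          · rw [hb]; exact this
          · intro i j
            obtain ⟨k, hk, hk2⟩ := Finset.mem_image.1 (hτ.1 i)
            rw [← hk2]
            exact par_bound (by omega) (hS'b k hk) j
      _ ≤ _ := by
          rw [Finset.sum_const, nsmul_eq_mul]
          refine mul_le_mul_left ?_ _
          exact_mod_cast TT_card (by omega) hS'b
  set Mb := (((2 ^ b) ^ (2 * (e + 1) + 1) : ℕ) : ℝ≥0∞) with hMb
  have hII2 : II q W (fun x => ∑ k ∈ S', F k x) ≤ (C * 2) * D ^ (q / 2) * U ^ (q / 2) + (K * ((MM e κ1 ^ (e + 2) : ℕ) : ℝ≥0∞) * K') *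
      (Mb ^ (q / 2) * ((2 ^ (e + 1) : ℕ) * Cη * X') ^ (q / 2) * (2 ^ (a0 * eM η (η / 4) M)) ^ (q / 2)) := by
    refine hII.trans (add_le_add ?_ ?_)
    · calc _ ≤ C * D ^ (q / 2) * (U ^ (q / 2) + U ^ (q / 2)) :=
            mul_le_mul_right (add_le_add (ENNReal.rpow_le_rpow hY0 hp0.le) (ENNReal.rpow_le_rpow hY1 hp0.le)) _
        _ = _ := by ring
    · refine (mul_le_mul_right hAA _).trans (le_of_eq ?_)
      rw [← ENNReal.rpow_mul, mul_comm (q / 2) (_ * eM _ _ _)]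
      ring
  have hN2 : N2 q W (fun x => ∑ k ∈ S', F k x) ≤ C2 * D * U + (K * ((MM e κ1 ^ (e + 2) : ℕ) : ℝ≥0∞) * K') ^ (2 / q) *
      (Mb * ((2 ^ (e + 1) : ℕ) * Cη * X') * (2 ^ (a0 * eM η (η / 4) M))) := by
    unfold N2
    refine (ENNReal.rpow_le_rpow hII2 hq2.le).trans ?_
    refine (ENNReal.rpow_add_le_add_rpow _ _ hq2.le hq21).trans (le_of_eq ?_)
    simp only [ENNReal.mul_rpow_of_nonneg _ _ hq2.le, hroot]
    rw [hC2, ENNReal.mul_rpow_of_nonneg _ _ hq2.le]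
  rw [hsum]
  refine hN2.trans ?_
  set G := C' * 2 ^ ((a : ℝ) * σ) * X with hG
  have hG1 : 2 * (C2 * D * U) ≤ G := by
    calc 2 * (C2 * D * U) = (2 * C2 * CI * (2 ^ (e + 1) : ℕ)) * (2 ^ ((κ0 : ℝ) * (σ / 2)) * 2 ^ (((a : ℝ) - κ0) * σ)) * C' * X := by rw [hD, hU]; ring
      _ ≤ 2 ^ ((κ0 : ℝ) * (σ / 2)) * (2 ^ ((κ0 : ℝ) * (σ / 2)) * 2 ^ (((a : ℝ) - κ0) * σ)) * C' * X := by gcongr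
      _ = G := by
          rw [← two_rpow_add, ← two_rpow_add, hG, mul_comm C']
          congr 3; ring
  have hMb2 : Mb * 2 ^ (a0 * eM η (η / 4) M) ≤ 2 ^ ((a : ℝ) * σ) := by
    have e1 : Mb = 2 ^ ((b : ℝ) * (2 * ((e + 1 : ℕ) : ℝ) + 1)) := by
      rw [hMb]; push_cast
      rw [← pow_mul, ← ENNReal.rpow_natCast]
      push_cast; rfl
    rw [e1, ← two_rpow_add]
    apply two_rpow_mono
    have hb2 : (b : ℝ) = a0 * (1 / 2) ^ M := by
      rw [ha0J]; push_cast
      have : (2:ℝ) ^ M * (1 / 2) ^ M = 1 := by rw [← mul_pow]; norm_num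
      linear_combination (-(b : ℝ)) * this
    rw [hb2]
    have h1 := exp_bound hη hM
    have h2 : (a0 : ℝ) ≤ a := by exact_mod_cast ha0a
    have h3 : (0:ℝ) ≤ a0 := by positivity
    calc _ = (a0 : ℝ) * (eM η (η / 4) M + (1 / 2) ^ M * (2 * ((e + 1 : ℕ) : ℝ) + 1)) := by ring
      _ ≤ a0 * σ := mul_le_mul_of_nonneg_left h1 h3
      _ ≤ _ := by gcongr
  have hG2 : 2 * ((K * ((MM e κ1 ^ (e + 2) : ℕ) : ℝ≥0∞) * K') ^ (2 / q) *
      (Mb * ((2 ^ (e + 1) : ℕ) * Cη * X') * (2 ^ (a0 * eM η (η / 4) M)))) ≤ G := by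
    calc _ = 2 * ((K * ((MM e κ1 ^ (e + 2) : ℕ) : ℝ≥0∞) * K') ^ (2 / q) * ((2 ^ (e + 1) : ℕ) * Cη) * (Mb * 2 ^ (a0 * eM η (η / 4) M)) * X') := by ring
      _ ≤ 2 * ((K * ((MM e κ1 ^ (e + 2) : ℕ) : ℝ≥0∞) * K') ^ (2 / q) * ((2 ^ (e + 1) : ℕ) * Cη) * (2 ^ ((a : ℝ) * σ)) * ((((2 ^ N) ^ (e + 1) : ℕ) : ℝ≥0∞) * X)) :=
          mul_le_mul_right (mul_le_mul' (mul_le_mul_right hMb2 _) hXX) _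
      _ = (2 * C'') * 2 ^ ((a : ℝ) * σ) * X := by rw [hC'']; ring
      _ ≤ G := by
          rw [hG]
          refine mul_le_mul_left (mul_le_mul_left ?_ _) _
          exact le_add_self
  have hfin := add_le_add hG1 hG2
  rw [← mul_add, ← two_mul] at hfin
  exact (ENNReal.mul_le_mul_iff_right (by norm_num) (by norm_num)).1 hfin

end QPS

namespace QPS
set_option linter.all false
open scoped ENNReal NNReal BigOperators FourierTransform SchwartzMap ComplexConjugate
variable {m : ℕ}

lemma DB_mono {d : ℕ} {q : ℝ} {A : ℕ} {η η' : ℝ} (h : η ≤ η') {C : ℝ≥0∞} (hD : DB d q A η C) : DB d q A η' C := by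
  intro a
  refine Dec_mono (mul_le_mul_right (two_rpow_mono ?_) _) (hD a)
  gcongr

lemma DB_trivial (d : ℕ) {q : ℝ} (hq : 2 ≤ q) (A : ℕ) : ∃ C : ℝ≥0∞, C ≠ ∞ ∧ 1 ≤ C ∧ DB d q A d C := by
  refine ⟨((5 ^ d : ℕ) : ℝ≥0∞), by simp, by exact_mod_cast Nat.one_le_pow _ _ (by norm_num), fun a => Dec_mono ?_ (Dec_trivial hq A a)⟩
  have h1 : (2 * (2 * 2 ^ a) + 1) ^ d ≤ 5 ^ d * (2 ^ a) ^ d := by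
    rw [← mul_pow]
    apply Nat.pow_le_pow_left
    have := Nat.one_le_two_pow (n := a)
    omega
  have h2 : (2:ℝ≥0∞) ^ ((a : ℝ) * d) = (((2 ^ a) ^ d : ℕ) : ℝ≥0∞) := by
    push_cast
    rw [← pow_mul, ← ENNReal.rpow_natCast]; push_cast; rfl
  rw [h2]
  exact_mod_cast h1

theorem decoupling (d : ℕ) : ∀ (q : ℝ), 2 ≤ q → q * (d : ℝ) ≤ 2 * d + 4 → ∀ (A : ℕ) (η : ℝ), 0 < η →
    ∃ C : ℝ≥0∞, C ≠ ∞ ∧ 1 ≤ C ∧ DB d q A η C := by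
  induction d with
  | zero =>
    intro q hq _ A η hη
    obtain ⟨C, h1, h2, h3⟩ := DB_trivial 0 hq A
    exact ⟨C, h1, h2, DB_mono (by simpa using hη.le) h3⟩
  | succ e ih =>
    intro q hq hqd A η hη
    have ih' := ih q hq (by push_cast at hqd; linarith)
    obtain ⟨M, hM⟩ := exists_nat_ge (4 * (2 * ((e + 1 : ℕ) : ℝ) + 1) / η)
    rw [div_le_iff₀ hη] at hM
    have hM1 : 1 ≤ M := by
      rcases Nat.eq_zero_or_pos M with h | h
      · subst h
        have : (0:ℝ) ≤ ((e + 1 : ℕ) : ℝ) := by positivity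
        simp only [Nat.cast_zero, zero_mul] at hM
        linarith
      · exact h
    set ρ := (1 - (1 / 2 : ℝ) ^ M) with hρ
    have hρ1 : ρ < 1 := by have : (0:ℝ) < (1 / 2 : ℝ) ^ M := by positivity
                           linarith
    have hρ0 : 0 < ρ := by have : (1 / 2 : ℝ) ^ M < 1 := pow_lt_one₀ (by norm_num) (by norm_num) (by omega)
                           linarith
    have key : ∀ j : ℕ, ∃ C : ℝ≥0∞, C ≠ ∞ ∧ 1 ≤ C ∧ DB (e + 1) q A (max (ρ ^ j * ((e + 1 : ℕ) : ℝ)) η) C := by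
      intro j
      induction j with
      | zero =>
        obtain ⟨C, h1, h2, h3⟩ := DB_trivial (e + 1) hq A
        exact ⟨C, h1, h2, DB_mono (by simp) h3⟩
      | succ j hj =>
        obtain ⟨C, h1, h2, h3⟩ := hj
        rcases le_total η (ρ ^ j * ((e + 1 : ℕ) : ℝ)) with h | h
        · rw [max_eq_left h] at h3
          obtain ⟨C', h1', h2', h3'⟩ := boot e q hq A hqd (fun A' η' hη' => ih' A' η' hη') _ (hη.trans_le h) M
            (hM.trans (by rw [mul_comm]; gcongr)) C h1 h2 h3
          refine ⟨C', h1', h2', DB_mono (le_max_of_le_left (le_of_eq ?_)) h3'⟩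
          rw [pow_succ]; ring
        · rw [max_eq_right h] at h3
          exact ⟨C, h1, h2, DB_mono (le_max_right _ _) h3⟩
    have hlim : Tendsto (fun j : ℕ => ρ ^ j * ((e + 1 : ℕ) : ℝ)) atTop (nhds 0) := by
      have := (tendsto_pow_atTop_nhds_zero_of_lt_one hρ0.le hρ1).mul_const (((e + 1 : ℕ) : ℝ))
      rwa [zero_mul] at this
    obtain ⟨j, hj⟩ := (hlim.eventually (gt_mem_nhds hη)).exists
    obtain ⟨C, h1, h2, h3⟩ := key j
    refine ⟨C, h1, h2, ?_⟩
    rwa [max_eq_right hj.le] at h3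

end QPS

namespace QPS
set_option linter.all false
open scoped ENNReal NNReal BigOperators FourierTransform SchwartzMap ComplexConjugate
variable {m : ℕ}

noncomputable def lift {d : ℕ} (ξ : Fin d → ℝ) : V (d + 1) := Fin.cons (∑ i, ξ i ^ 2) ξ

lemma disc1 {d a A : ℕ} {q : ℝ} (hq : 2 ≤ q) {D : ℝ≥0∞} (hD : Dec d q A a D) {ι : Type*} (T : Finset ι) (ξ : ι → Fin d → ℝ)
    (hξ : ∀ n ∈ T, ∀ i, |ξ n i| ≤ 1) (hsep : ∀ n ∈ T, ∀ n' ∈ T, n ≠ n' → ∃ i, 1 / 2 ^ a ≤ |ξ n i - ξ n' i|) (c : ι → ℂ)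
    {W : V (d + 1) → ℝ≥0∞} (hW : SV A (4 ^ a) W) :
    N2 q W (fun x => ∑ n ∈ T, c n * ch (lift (ξ n)) x) ≤ D * ((∑ n ∈ T, ‖c n‖ₑ ^ 2) * (∫⁻ x, W x) ^ (2 / q)) := by
  classical
  have h2a : (0:ℝ) < 2 ^ a := by positivity
  set k : ι → Fin d → ℤ := fun n i => ⌊2 ^ a * ξ n i⌋ with hk
  have hinj : Set.InjOn k T := by
    intro n hn n' hn' h
    by_contra hne
    obtain ⟨i, hi⟩ := hsep n hn n' hn' hne
    have h1 : ⌊2 ^ a * ξ n i⌋ = ⌊2 ^ a * ξ n' i⌋ := congrFun h i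
    have h2 := Int.abs_sub_lt_one_of_floor_eq_floor h1
    rw [← mul_sub, abs_mul, abs_of_pos h2a] at h2
    rw [div_le_iff₀ h2a] at hi
    linarith
  set f : (Fin d → ℤ) → V (d + 1) → ℂ := fun k' x => ∑ n ∈ T with k n = k', c n * ch (lift (ξ n)) x with hf
  have hfT : ∀ k' ∈ T.image k, f k' ∈ TP (cap d a k') := by
    intro k' _
    apply TP_sum
    intro n hn
    obtain ⟨hnT, rfl⟩ := Finset.mem_filter.1 hn
    have : (fun x => c n * ch (lift (ξ n)) x) = c n • ch (lift (ξ n)) := rfl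
    rw [this]
    apply Submodule.smul_mem
    apply ch_mem
    constructor
    · intro i
      simp only [lift, Fin.cons_succ, hk]
      have e1 := Int.floor_le (2 ^ a * ξ n i)
      have e2 := Int.lt_floor_add_one (2 ^ a * ξ n i)
      have e3 : ξ n i - (⌊2 ^ a * ξ n i⌋ : ℝ) / 2 ^ a = (2 ^ a * ξ n i - ⌊2 ^ a * ξ n i⌋) / 2 ^ a := by field_simp
      rw [e3, abs_div, abs_of_pos h2a]
      gcongr
      rw [abs_of_nonneg (by linarith)]; linarith
    · simp only [lift, Fin.cons_succ, Fin.cons_zero, sub_self, abs_zero]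
      positivity
  have hkb : ∀ k' ∈ T.image k, ∀ i, |k' i| ≤ 2 ^ a := by
    intro k' hk'
    obtain ⟨n, hn, rfl⟩ := Finset.mem_image.1 hk'
    intro i
    have h1 := abs_le.1 (hξ n hn i)
    rw [abs_le]
    constructor
    · simp only [hk]
      rw [Int.le_floor]
      push_cast
      nlinarith
    · simp only [hk]
      have : ((⌊2 ^ a * ξ n i⌋ : ℤ) : ℝ) ≤ ((2 ^ a : ℤ) : ℝ) := by
        refine (Int.floor_le _).trans ?_
        push_cast
        nlinarith
      exact_mod_cast this
  have hmain := hD (T.image k) hkb f hfT W hW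
  have e1 : (fun x => ∑ k' ∈ T.image k, f k' x) = fun x => ∑ n ∈ T, c n * ch (lift (ξ n)) x := by
    ext x
    exact Finset.sum_fiberwise_of_maps_to (fun n hn => Finset.mem_image_of_mem _ hn) _
  rw [e1] at hmain
  refine hmain.trans (mul_le_mul_right (le_of_eq ?_) _)
  rw [Finset.sum_image hinj, Finset.sum_mul]
  apply Finset.sum_congr rfl
  intro n hn
  have e2 : f (k n) = fun x => ch (lift (ξ n)) x * c n := by
    ext x
    simp only [hf]
    rw [Finset.sum_eq_single n, mul_comm]
    · intro n' hn' hne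
      obtain ⟨h1, h2⟩ := Finset.mem_filter.1 hn'
      exact absurd (hinj h1 hn h2) hne
    · intro h
      exact (h (Finset.mem_filter.2 ⟨hn, rfl⟩)).elim
  rw [e2]
  unfold N2 II
  simp_rw [ch_enorm_mul]
  rw [lintegral_const_mul _ hW.1, ENNReal.mul_rpow_of_nonneg _ _ (by positivity), ← ENNReal.rpow_mul]
  congr 1
  rw [mul_div_cancel₀ _ (by linarith), ENNReal.rpow_two]

/-- the space-time exponential -/
noncomputable def st {d : ℕ} (ζ : Fin d → ℝ) (y : V (d + 1)) : ℂ :=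
  Complex.exp (Complex.I * ((∑ i, ζ i * y i.succ - y 0 * ∑ i, ζ i ^ 2 : ℝ) : ℂ))

lemma st_cont {d : ℕ} (ζ : Fin d → ℝ) : Continuous (st ζ) := by unfold st; fun_prop

lemma disc2 {d a A : ℕ} {q : ℝ} (hq : 2 ≤ q) {D : ℝ≥0∞} (hD : Dec d q A a D) {Λ : ℝ} (hΛ : 1 ≤ Λ) {ι : Type*} (T : Finset ι) (ζ : ι → Fin d → ℝ)
    (hζ : ∀ n ∈ T, ∀ i, |ζ n i| ≤ Λ) (hsep : ∀ n ∈ T, ∀ n' ∈ T, n ≠ n' → ∃ i, Λ / 2 ^ a ≤ |ζ n i - ζ n' i|) (c : ι → ℂ)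
    {L : ℝ} (hL : 4 ^ a ≤ L) :
    N2 q (fun y => kk A (L⁻¹ • y)) (fun x => ∑ n ∈ T, c n * st (ζ n) x) ≤ D * ((∑ n ∈ T, ‖c n‖ₑ ^ 2) * (∫⁻ y : V (d + 1), kk A (L⁻¹ • y)) ^ (2 / q)) := by
  have hΛ0 : 0 < Λ := by linarith
  have hL0 : 0 < L := lt_of_lt_of_le (by positivity) hL
  set s : Fin (d + 1) → ℝ := Fin.cons (-(Λ ^ 2)) (fun _ => Λ) with hs
  have hs1 : ∀ i, 1 ≤ |s i| := by
    intro i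
    refine Fin.cases ?_ (fun i => ?_) i
    · simp only [hs, Fin.cons_zero]
      rw [abs_neg, abs_of_pos (by positivity)]
      exact one_le_pow₀ hΛ
    · simp only [hs, Fin.cons_succ]
      rw [abs_of_pos hΛ0]; exact hΛ
  have hs0 : ∀ i, s i ≠ 0 := fun i h => by
    have := hs1 i
    rw [h] at this; simp at this; linarith
  set Tm : V (d + 1) ≃ₗ[ℝ] V (d + 1) := LinearEquiv.piCongrRight (fun i => LinearEquiv.smulOfNeZero ℝ ℝ (s i) (hs0 i)) with hTm
  have hTap : ∀ z i, Tm z i = s i * z i := fun z i => rfl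
  have hTsym : ∀ z, ‖Tm.symm z‖ ≤ ‖z‖ := by
    intro z
    rw [pi_norm_le_iff_of_nonneg (norm_nonneg _)]
    intro i
    have h1 : s i * Tm.symm z i = z i := by
      rw [← hTap]; simp
    calc ‖Tm.symm z i‖ ≤ |s i| * ‖Tm.symm z i‖ := le_mul_of_one_le_left (norm_nonneg _) (hs1 i)
      _ = ‖z i‖ := by rw [← h1, norm_mul, Real.norm_eq_abs (s i)]
      _ ≤ _ := norm_le_pi_norm _ _
  have hTsc : Continuous Tm.symm := LinearMap.continuous_of_finiteDimensional (Tm.symm : V (d + 1) →ₗ[ℝ] V (d + 1))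
  have hkm := kk_meas (m := d + 1) A
  set W : V (d + 1) → ℝ≥0∞ := fun z => kk A (L⁻¹ • Tm.symm z) with hW
  have hWm : Measurable W := by
    have := hTsc.measurable
    rw [hW]; fun_prop
  have hWSV : SV A (4 ^ a) W := by
    apply SV.mono_r (by positivity) hL
    refine ⟨hWm, fun x y => ?_⟩
    have := (SV_kk (m := d + 1) A hL0 0).2 (Tm.symm x) (Tm.symm y)
    simp only [sub_zero] at this
    simp only [hW, map_add]
    refine this.trans (mul_le_mul_left ?_ _)
    apply ENNReal.ofReal_le_ofReal
    gcongr
    exact hTsym y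
  have hd1 := disc1 hq hD T (fun n i => ζ n i / Λ) (fun n hn i => by
      rw [abs_div, abs_of_pos hΛ0, div_le_one hΛ0]; exact hζ n hn i)
    (fun n hn n' hn' hne => by
      obtain ⟨i, hi⟩ := hsep n hn n' hn' hne
      refine ⟨i, ?_⟩
      rw [← sub_div, abs_div, abs_of_pos hΛ0, le_div_iff₀ hΛ0]
      rw [div_mul_eq_mul_div, one_mul]; exact hi) c hWSV
  obtain ⟨cc, hcc0, hcct, hcc⟩ := lintegral_lin Tm
  have hch : ∀ n y, ch (lift (fun i => ζ n i / Λ)) (Tm y) = st (ζ n) y := by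
    intro n y
    unfold ch st
    congr 3
    rw [Fin.sum_univ_succ]
    simp only [lift, Fin.cons_zero, Fin.cons_succ, hTap, hs]
    rw [add_comm, sub_eq_add_neg]
    congr 1
    · apply Finset.sum_congr rfl; intro i _; field_simp
    · simp_rw [div_pow]
      rw [← Finset.sum_div]
      field_simp
  set F := fun x => ∑ n ∈ T, c n * ch (lift (fun i => ζ n i / Λ)) x with hF
  have hFm : Measurable F := by
    apply Finset.measurable_fun_sum
    intro n _
    exact ((ch_cont _).measurable).const_mul _
  have i1 : ∫⁻ y : V (d + 1), kk A (L⁻¹ • y) = cc * ∫⁻ z, W z := by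
    rw [← hcc W hWm]; simp [hW]
  have i2 : II q (fun y => kk A (L⁻¹ • y)) (fun x => ∑ n ∈ T, c n * st (ζ n) x) = cc * II q W F := by
    unfold II
    rw [← hcc _ (by fun_prop)]
    simp [hW, hF, hch]
  unfold N2 at hd1 ⊢
  rw [i1, i2, ENNReal.mul_rpow_of_nonneg _ _ (by positivity), ENNReal.mul_rpow_of_nonneg _ _ (by positivity)]
  calc _ ≤ cc ^ (2 / q) * (D * ((∑ n ∈ T, ‖c n‖ₑ ^ 2) * (∫⁻ x, W x) ^ (2 / q))) := mul_le_mul_right hd1 _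
    _ = _ := by ring

end QPS

namespace QPS
set_option linter.all false
open scoped ENNReal NNReal BigOperators FourierTransform SchwartzMap ComplexConjugate
variable {m : ℕ}

lemma N2_weighted (J : Finset ℕ) (g : ℕ → V m → ℂ) (hg : ∀ j ∈ J, Measurable (g j)) {W : V m → ℝ≥0∞} (hW : Measurable W)
    {q : ℝ} (hq : 2 ≤ q) (ε : ℝ) :
    N2 q W (fun x => ∑ j ∈ J, g j x) ≤ (∑' j : ℕ, (2:ℝ≥0∞) ^ (-((j:ℝ) * ε))) * ∑ j ∈ J, 2 ^ ((j:ℝ) * ε) * N2 q W (g j) := by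
  have h1 := II_sum_le J g hg hW (q := q) (by linarith)
  have hcs := ENNReal.inner_le_Lp_mul_Lq J (fun j => (2:ℝ≥0∞) ^ (-((j:ℝ) * ε / 2)))
    (fun j => (2:ℝ≥0∞) ^ ((j:ℝ) * ε / 2) * (II q W (g j)) ^ (1 / q)) (p := 2) (q := 2) (by norm_num [Real.holderConjugate_iff])
  have e1 : ∀ j : ℕ, (2:ℝ≥0∞) ^ (-((j:ℝ) * ε / 2)) * (2 ^ ((j:ℝ) * ε / 2) * (II q W (g j)) ^ (1 / q)) = (II q W (g j)) ^ (1 / q) := by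
    intro j
    rw [← mul_assoc, ← two_rpow_add]; simp
  have e2 : ∀ j : ℕ, ((2:ℝ≥0∞) ^ (-((j:ℝ) * ε / 2))) ^ (2:ℝ) = 2 ^ (-((j:ℝ) * ε)) := by
    intro j
    rw [← ENNReal.rpow_mul]; congr 1; ring
  have e3 : ∀ j : ℕ, ((2:ℝ≥0∞) ^ ((j:ℝ) * ε / 2) * (II q W (g j)) ^ (1 / q)) ^ (2:ℝ) = 2 ^ ((j:ℝ) * ε) * N2 q W (g j) := by
    intro j
    rw [ENNReal.mul_rpow_of_nonneg _ _ (by norm_num), ← ENNReal.rpow_mul, N2_eq_sq hq, ENNReal.rpow_two]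
    congr 2; ring
  simp only [e1, e2, e3] at hcs
  have h2 := h1.trans hcs
  rw [N2_eq_sq hq]
  calc _ ≤ _ := pow_le_pow_left' h2 2
    _ = (∑ j ∈ J, (2:ℝ≥0∞) ^ (-((j:ℝ) * ε))) * ∑ j ∈ J, 2 ^ ((j:ℝ) * ε) * N2 q W (g j) := by
      rw [mul_pow, ← ENNReal.rpow_two, ← ENNReal.rpow_two, ← ENNReal.rpow_mul, ← ENNReal.rpow_mul]
      norm_num
    _ ≤ _ := mul_le_mul_left (ENNReal.sum_le_tsum J) _

lemma geo_ne_top {ε : ℝ} (hε : 0 < ε) : (∑' j : ℕ, (2:ℝ≥0∞) ^ (-((j:ℝ) * ε))) ≠ ∞ := by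
  have : ∀ j : ℕ, (2:ℝ≥0∞) ^ (-((j:ℝ) * ε)) = ((2:ℝ≥0∞) ^ (-ε)) ^ j := by
    intro j
    rw [← ENNReal.rpow_natCast, ← ENNReal.rpow_mul]; congr 1; ring
  simp_rw [this]
  rw [ENNReal.tsum_geometric]
  apply ENNReal.inv_ne_top.2
  apply (tsub_pos_of_lt _).ne'
  rw [ENNReal.rpow_neg]
  apply ENNReal.inv_lt_one.2
  exact ENNReal.one_lt_rpow (by norm_num) hε

lemma disc3 {d A w B : ℕ} (hB : 1 ≤ B) {q : ℝ} (hq : 2 ≤ q) (hqd : q * (d : ℝ) ≤ 2 * d + 4) {ε : ℝ} (hε : 0 < ε)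
    {ι : Type*} (ζ : ι → Fin d → ℝ) (h : ι → ℝ) (h0 : ∀ n, 0 ≤ h n) (hζ : ∀ n i, |ζ n i| ≤ 2 ^ w * (1 + h n))
    (hsep : ∀ j : ℕ, ∀ n n', n ≠ n' → 1 + h n ≤ 2 ^ (j + 1) → 1 + h n' ≤ 2 ^ (j + 1) →
      ∃ i, (2:ℝ) ^ (w + j + 1) / 2 ^ (B * (j + 1)) ≤ |ζ n i - ζ n' i|) :
    ∃ C : ℝ≥0∞, C ≠ ∞ ∧ ∀ (T : Finset ι) (c : ι → ℂ), ∀ᶠ L : ℝ in atTop,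
      N2 q (fun y => kk A (L⁻¹ • y)) (fun x => ∑ n ∈ T, c n * st (ζ n) x) ≤
        C * ((∑ n ∈ T, ENNReal.ofReal ((1 + h n) ^ (2 * ε)) * ‖c n‖ₑ ^ 2) * (∫⁻ y : V (d + 1), kk A (L⁻¹ • y)) ^ (2 / q)) := by
  classical
  have hB0 : (0:ℝ) < B := by exact_mod_cast hB
  obtain ⟨C, hC, hC1, hD⟩ := decoupling d q hq hqd A (ε / B) (by positivity)
  refine ⟨(∑' j : ℕ, (2:ℝ≥0∞) ^ (-((j:ℝ) * ε))) * (C * 2 ^ ε), ?_, ?_⟩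
  · have := geo_ne_top hε
    have := two_rpow_ne_top ε
    finiteness
  intro T c
  set jj : ι → ℕ := fun n => Nat.log 2 ⌊1 + h n⌋₊ with hjj
  set J := T.image jj with hJ
  have hlow : ∀ n, (2:ℝ) ^ jj n ≤ 1 + h n := by
    intro n
    have hf : ⌊1 + h n⌋₊ ≠ 0 := by
      have : 1 ≤ ⌊1 + h n⌋₊ := Nat.le_floor (by simpa using h0 n)
      omega
    have h1 := Nat.pow_log_le_self 2 hf
    have h2 := Nat.floor_le (a := 1 + h n) (by linarith [h0 n])
    calc (2:ℝ) ^ jj n = ((2 ^ jj n : ℕ) : ℝ) := by push_cast; rfl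
      _ ≤ (⌊1 + h n⌋₊ : ℝ) := by exact_mod_cast h1
      _ ≤ _ := h2
  have hupp : ∀ n, 1 + h n ≤ (2:ℝ) ^ (jj n + 1) := by
    intro n
    have h1 := Nat.lt_pow_succ_log_self (b := 2) (by norm_num) ⌊1 + h n⌋₊
    have h2 := Nat.lt_floor_add_one (1 + h n)
    have h3 : ((⌊1 + h n⌋₊ + 1 : ℕ) : ℝ) ≤ ((2 ^ (jj n + 1) : ℕ) : ℝ) := by exact_mod_cast h1
    push_cast at h3
    linarith
  filter_upwards [eventually_ge_atTop ((4:ℝ) ^ (B * (J.sup id + 1)))] with L hL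
  have hWm : Measurable (fun y : V (d + 1) => kk A (L⁻¹ • y)) := (kk_meas A).comp (by fun_prop)
  set W := (fun y : V (d + 1) => kk A (L⁻¹ • y)) with hW
  set I := (∫⁻ y : V (d + 1), kk A (L⁻¹ • y)) ^ (2 / q) with hI
  have e : (fun x => ∑ n ∈ T, c n * st (ζ n) x) = fun x => ∑ j ∈ J, ∑ n ∈ T with jj n = j, c n * st (ζ n) x := by
    funext x
    exact (Finset.sum_fiberwise_of_maps_to (fun n hn => Finset.mem_image_of_mem jj hn) _).symm
  rw [e]
  refine (N2_weighted J (fun j x => ∑ n ∈ T with jj n = j, c n * st (ζ n) x) ?_ hWm hq ε).trans ?_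
  · intro j _
    apply Finset.measurable_fun_sum
    intro n _
    exact (st_cont (ζ n)).measurable.const_mul _
  rw [mul_assoc]
  apply mul_le_mul_right
  have hblock : ∀ j ∈ J, 2 ^ ((j:ℝ) * ε) * N2 q W (fun x => ∑ n ∈ T with jj n = j, c n * st (ζ n) x) ≤
      (C * 2 ^ ε) * ((∑ n ∈ T with jj n = j, ENNReal.ofReal ((1 + h n) ^ (2 * ε)) * ‖c n‖ₑ ^ 2) * I) := by
    intro j hj
    have hjs : j ≤ J.sup id := Finset.le_sup (f := id) hj
    have hd2 := disc2 (Λ := 2 ^ (w + j + 1)) hq (hD (B * (j + 1))) (one_le_pow₀ (by norm_num)) (T.filter (fun n => jj n = j)) ζ ?_ ?_ c (L := L) ?_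
    · refine (mul_le_mul_right hd2 _).trans ?_
      have e1 : (2:ℝ≥0∞) ^ (((B * (j + 1) : ℕ) : ℝ) * (ε / B)) = 2 ^ ((j:ℝ) * ε) * 2 ^ ε := by
        rw [← two_rpow_add]; congr 1; push_cast; field_simp
      rw [e1]
      have e2 : (2:ℝ≥0∞) ^ ((j:ℝ) * ε) * 2 ^ ((j:ℝ) * ε) * (∑ n ∈ T with jj n = j, ‖c n‖ₑ ^ 2) ≤ ∑ n ∈ T with jj n = j, ENNReal.ofReal ((1 + h n) ^ (2 * ε)) * ‖c n‖ₑ ^ 2 := by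
        rw [Finset.mul_sum]
        apply Finset.sum_le_sum
        intro n hn
        apply mul_le_mul_left
        have hnj := (Finset.mem_filter.1 hn).2
        have h3 := hlow n
        rw [hnj] at h3
        have : (2:ℝ≥0∞) ^ ((j:ℝ) * ε) * 2 ^ ((j:ℝ) * ε) = ENNReal.ofReal (((2:ℝ) ^ j) ^ (2 * ε)) := by
          rw [← two_rpow_add, ← ENNReal.ofReal_rpow_of_pos (by positivity), ENNReal.ofReal_pow (by norm_num), ← ENNReal.rpow_natCast, ← ENNReal.rpow_mul]
          norm_num
          congr 1; ring
        rw [this]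
        apply ENNReal.ofReal_le_ofReal
        exact Real.rpow_le_rpow (by positivity) h3 (by positivity)
      calc _ = (C * 2 ^ ε) * ((2 ^ ((j:ℝ) * ε) * 2 ^ ((j:ℝ) * ε) * (∑ n ∈ T with jj n = j, ‖c n‖ₑ ^ 2)) * I) := by ring
        _ ≤ _ := mul_le_mul_right (mul_le_mul_left e2 _) _
    · intro n hn i
      have hnj := (Finset.mem_filter.1 hn).2
      refine (hζ n i).trans ?_
      have := hupp n
      rw [hnj] at this
      calc (2:ℝ) ^ w * (1 + h n) ≤ 2 ^ w * 2 ^ (j + 1) := by gcongr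
        _ = _ := by rw [← pow_add]; rfl
    · intro n hn n' hn' hne
      have h1 := hupp n
      have h2 := hupp n'
      rw [(Finset.mem_filter.1 hn).2] at h1
      rw [(Finset.mem_filter.1 hn').2] at h2
      exact hsep j n n' hne h1 h2
    · refine le_trans ?_ hL
      apply pow_le_pow_right₀ (by norm_num)
      gcongr
  refine (Finset.sum_le_sum hblock).trans ?_
  rw [← Finset.mul_sum, ← Finset.sum_mul, Finset.sum_fiberwise_of_maps_to (fun n hn => Finset.mem_image_of_mem jj hn)]

end QPS

namespace QPS
set_option linter.all false
open scoped ENNReal NNReal BigOperators FourierTransform SchwartzMap ComplexConjugate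
variable {m : ℕ}

lemma fin_bd {d : ℕ} (f : Fin d → ℝ) : ∃ N : ℕ, ∀ i, f i ≤ N := by
  obtain ⟨N, hN⟩ := exists_nat_ge (∑ i, |f i|)
  refine ⟨N, fun i => (le_abs_self _).trans (le_trans ?_ hN)⟩
  exact Finset.single_le_sum (f := fun i => |f i|) (fun _ _ => abs_nonneg _) (Finset.mem_univ i)

lemma nat_le_two_pow (N : ℕ) : (N : ℝ) ≤ 2 ^ N := by
  exact_mod_cast (Nat.lt_two_pow_self (n := N)).le

lemma inner_le_height {d : ℕ} {ν : Fin d → ℕ} (n : ∀ i, Fin (ν i) → ℤ) (i : Fin d) :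
    ∑ j, ((n i j : ℝ)) ^ 2 ≤ heightVec n ^ 2 := by
  unfold heightVec
  rw [Real.sq_sqrt (by positivity)]
  exact Finset.single_le_sum (f := fun i => ∑ j, ((n i j : ℝ)) ^ 2) (fun _ _ => by positivity) (Finset.mem_univ i)

lemma arith {d : ℕ} {ν : Fin d → ℕ} (ω : ∀ i, Fin (ν i) → ℝ) (hpos : ∀ i j, 0 < ω i j)
    (hdio : ∀ i, ∃ α : ℝ, 0 < α ∧ ∃ β : ℝ, 0 < β ∧
      ∀ m : Fin (ν i) → ℤ, m ≠ 0 →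
        α * (Real.sqrt (∑ j, ((m j : ℝ)) ^ 2)) ^ (-β) ≤ |∑ j, (m j : ℝ) * ω i j|) :
    ∃ w B : ℕ, 1 ≤ B ∧ (∀ n i, |freqVec ω n i| ≤ 2 ^ w * (1 + heightVec n)) ∧
    (∀ j : ℕ, ∀ n n' : ∀ i, Fin (ν i) → ℤ, n ≠ n' → 1 + heightVec n ≤ 2 ^ (j + 1) → 1 + heightVec n' ≤ 2 ^ (j + 1) →
      ∃ i, (2:ℝ) ^ (w + j + 1) / 2 ^ (B * (j + 1)) ≤ |freqVec ω n i - freqVec ω n' i|) := by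
  choose α hα β hβ hdio using hdio
  obtain ⟨w, hw⟩ := fin_bd (fun i => ∑ j, ω i j)
  obtain ⟨b, hb⟩ := fin_bd β
  obtain ⟨A0, hA0⟩ := fin_bd (fun i => 1 / α i)
  have hh0 : ∀ n : ∀ i, Fin (ν i) → ℤ, 0 ≤ heightVec n := fun n => Real.sqrt_nonneg _
  refine ⟨w, w + A0 + 3 * b + 2, by omega, ?_, ?_⟩
  · intro n i
    unfold freqVec
    calc |∑ j, (n i j : ℝ) * ω i j| ≤ ∑ j, |(n i j : ℝ) * ω i j| := Finset.abs_sum_le_sum_abs _ _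
      _ ≤ ∑ j, heightVec n * ω i j := by
        apply Finset.sum_le_sum
        intro j _
        rw [abs_mul, abs_of_pos (hpos i j)]
        apply mul_le_mul_of_nonneg_right _ (hpos i j).le
        apply abs_le_of_sq_le_sq _ (hh0 n)
        refine le_trans ?_ (inner_le_height n i)
        exact Finset.single_le_sum (f := fun j => ((n i j : ℝ)) ^ 2) (fun _ _ => by positivity) (Finset.mem_univ j)
      _ = heightVec n * ∑ j, ω i j := by rw [Finset.mul_sum]
      _ ≤ heightVec n * 2 ^ w := mul_le_mul_of_nonneg_left ((hw i).trans (nat_le_two_pow w)) (hh0 n)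
      _ ≤ 2 ^ w * (1 + heightVec n) := by
        have : (0:ℝ) < 2 ^ w := by positivity
        nlinarith
  · intro j n n' hne h1 h2
    obtain ⟨i, hi⟩ := Function.ne_iff.1 hne
    refine ⟨i, ?_⟩
    have hm : (n i - n' i) ≠ 0 := sub_ne_zero.2 hi
    have hd := hdio i (n i - n' i) hm
    have e : freqVec ω n i - freqVec ω n' i = ∑ j, (((n i - n' i) j : ℤ) : ℝ) * ω i j := by
      unfold freqVec
      rw [← Finset.sum_sub_distrib]
      apply Finset.sum_congr rfl
      intro k _
      rw [Pi.sub_apply]; push_cast; ring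
    rw [e]
    refine le_trans ?_ hd
    set s := Real.sqrt (∑ j, (((n i - n' i) j : ℤ) : ℝ) ^ 2) with hs
    have hs0 : 0 < s := by
      apply Real.sqrt_pos.2
      obtain ⟨k, hk⟩ := Function.ne_iff.1 hm
      apply Finset.sum_pos' (fun _ _ => by positivity) ⟨k, Finset.mem_univ k, ?_⟩
      have : (((n i - n' i) k : ℤ) : ℝ) ≠ 0 := by exact_mod_cast hk
      positivity
    have hsu : s ≤ 2 ^ (j + 2) := by
      apply Real.sqrt_le_iff.2 ⟨by positivity, ?_⟩
      have i1 := inner_le_height n i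
      have i2 := inner_le_height n' i
      have hle : ∑ k, (((n i - n' i) k : ℤ) : ℝ) ^ 2 ≤ 2 * ∑ k, ((n i k : ℝ)) ^ 2 + 2 * ∑ k, ((n' i k : ℝ)) ^ 2 := by
        rw [Finset.mul_sum, Finset.mul_sum, ← Finset.sum_add_distrib]
        apply Finset.sum_le_sum
        intro k _
        rw [Pi.sub_apply]; push_cast
        nlinarith [sq_nonneg ((n i k : ℝ) + n' i k)]
      have e2 : (2:ℝ) ^ (j + 2) = 2 * 2 ^ (j + 1) := by rw [pow_succ]; ring
      rw [e2]
      have k1 : heightVec n ^ 2 ≤ (2 ^ (j + 1)) ^ 2 := pow_le_pow_left₀ (hh0 n) (by linarith) 2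
      have k2 : heightVec n' ^ 2 ≤ (2 ^ (j + 1)) ^ 2 := pow_le_pow_left₀ (hh0 n') (by linarith) 2
      nlinarith
    have f1 : ((2:ℝ) ^ (b * (j + 2)))⁻¹ ≤ s ^ (-β i) := by
      have g1 : ((2:ℝ) ^ (j + 2)) ^ (-β i) ≤ s ^ (-β i) := Real.rpow_le_rpow_of_nonpos hs0 hsu (by linarith [hβ i])
      refine le_trans ?_ g1
      have g2 : ((2:ℝ) ^ (j + 2)) ^ (-(b:ℝ)) ≤ ((2:ℝ) ^ (j + 2)) ^ (-β i) :=
        Real.rpow_le_rpow_of_exponent_le (one_le_pow₀ (by norm_num)) (by linarith [hb i])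
      refine le_trans (le_of_eq ?_) g2
      rw [Real.rpow_neg (by positivity), Real.rpow_natCast, ← pow_mul, mul_comm]
    have f2 : ((2:ℝ) ^ A0)⁻¹ ≤ α i := by
      have := (hA0 i).trans (nat_le_two_pow A0)
      rw [div_le_iff₀ (hα i)] at this
      rw [inv_le_iff_one_le_mul₀ (by positivity)]
      linarith
    refine le_trans ?_ (mul_le_mul f2 f1 (by positivity) (hα i).le)
    rw [← mul_inv, ← pow_add, ← one_div, div_le_div_iff₀ (by positivity) (by positivity), one_mul, ← pow_add]
    apply pow_le_pow_right₀ (by norm_num)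
    have : (w + A0) * (j + 1) ≥ w + A0 := Nat.le_mul_of_pos_right _ (by omega)
    nlinarith

end QPS

namespace QPS
set_option linter.all false
open scoped ENNReal NNReal BigOperators FourierTransform SchwartzMap ComplexConjugate
variable {m : ℕ}

lemma lintegral_cons {n : ℕ} (h : V (n + 1) → ℝ≥0∞) (hh : Measurable h) :
    ∫⁻ z, h z = ∫⁻ y : ℝ, ∫⁻ u : V n, h (Fin.cons y u) := by
  have hmp := (volume_preserving_piFinSuccAbove (fun _ : Fin (n + 1) => ℝ) 0).symm
  rw [← hmp.lintegral_comp hh, Measure.volume_eq_prod, lintegral_prod]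
  · apply lintegral_congr; intro y
    apply lintegral_congr; intro u
    congr 1
    show Fin.insertNth (α := fun _ => ℝ) 0 y u = _
    rw [Fin.insertNth_zero']
  · exact (hh.comp (MeasurableEquiv.measurable _)).aemeasurable

lemma box_le {d A : ℕ} {q : ℝ} (hq : 0 ≤ q) {L : ℝ} (hL : 0 < L) (g : V (d + 1) → ℂ) (hg : Measurable g) :
    ‖∫ t in Set.Icc (-L) L, ∫ x in (Set.univ.pi fun _ : Fin d => Set.Icc (-L) L), ‖g (Fin.cons t x)‖ ^ q‖ₑ ≤
      2 ^ A * II q (fun y => kk A (L⁻¹ • y)) g := by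
  have hkm : Measurable (fun y : V (d + 1) => kk A (L⁻¹ • y)) := (kk_meas A).comp (by fun_prop)
  have hk : ∀ y : V (d + 1), ‖y‖ ≤ L → 1 ≤ 2 ^ A * kk A (L⁻¹ • y) := by
    intro y hy
    unfold kk
    have h2 : (2:ℝ≥0∞) ^ A = ENNReal.ofReal (2 ^ A) := by
      rw [ENNReal.ofReal_pow (by norm_num)]; norm_num
    rw [h2, ← ENNReal.ofReal_mul (by positivity), ← ENNReal.ofReal_one]
    apply ENNReal.ofReal_le_ofReal
    rw [← div_eq_mul_inv, one_le_div (by positivity)]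
    apply pow_le_pow_left₀ (by positivity)
    rw [norm_smul, norm_inv, Real.norm_of_nonneg hL.le]
    have : L⁻¹ * ‖y‖ ≤ 1 := by rw [inv_mul_le_iff₀ hL]; linarith
    linarith
  refine (enorm_integral_le_lintegral_enorm _).trans ?_
  have hm : Measurable (fun y => ‖g y‖ₑ ^ q * kk A (L⁻¹ • y)) := by fun_prop
  calc _ ≤ ∫⁻ t in Set.Icc (-L) L, ∫⁻ x in (Set.univ.pi fun _ : Fin d => Set.Icc (-L) L), ‖g (Fin.cons t x)‖ₑ ^ q := by
        apply lintegral_mono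
        intro t
        refine (enorm_integral_le_lintegral_enorm _).trans ?_
        apply lintegral_mono
        intro x
        dsimp only
        rw [Real.enorm_rpow_of_nonneg (norm_nonneg _) hq, enorm_norm]
    _ ≤ ∫⁻ t in Set.Icc (-L) L, ∫⁻ x : V d, 2 ^ A * (‖g (Fin.cons t x)‖ₑ ^ q * kk A (L⁻¹ • (Fin.cons t x : V (d + 1)))) := by
        apply setLIntegral_mono' measurableSet_Icc
        intro t ht
        refine le_trans ?_ (setLIntegral_le_lintegral (Set.univ.pi fun _ : Fin d => Set.Icc (-L) L) _)
        apply setLIntegral_mono' (MeasurableSet.univ_pi (fun _ => measurableSet_Icc))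
        intro x hx
        have hn : ‖(Fin.cons t x : V (d + 1))‖ ≤ L := by
          rw [pi_norm_le_iff_of_nonneg hL.le]
          intro i
          refine Fin.cases ?_ (fun i => ?_) i
          · rw [Fin.cons_zero]; exact abs_le.2 ht
          · rw [Fin.cons_succ]; exact abs_le.2 (hx i (Set.mem_univ i))
        calc ‖g (Fin.cons t x)‖ₑ ^ q = ‖g (Fin.cons t x)‖ₑ ^ q * 1 := (mul_one _).symm
          _ ≤ ‖g (Fin.cons t x)‖ₑ ^ q * (2 ^ A * kk A (L⁻¹ • (Fin.cons t x : V (d + 1)))) := mul_le_mul_right (hk _ hn) _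
          _ = _ := by ring
    _ ≤ ∫⁻ t : ℝ, ∫⁻ x : V d, 2 ^ A * (‖g (Fin.cons t x)‖ₑ ^ q * kk A (L⁻¹ • (Fin.cons t x : V (d + 1)))) := setLIntegral_le_lintegral _ _
    _ = _ := by
        unfold II
        rw [← lintegral_const_mul _ hm, lintegral_cons _ (hm.const_mul _)]

lemma final_bound {d A : ℕ} (hA : d + 2 ≤ A) {q : ℝ} (hq : 2 ≤ q) {ι : Type*} (ζ : ι → Fin d → ℝ) (h : ι → ℝ) (h0 : ∀ n, 0 ≤ h n) {ε : ℝ}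
    {C : ℝ≥0∞} (hC : C ≠ ∞) (T : Finset ι) (c : ι → ℂ) {L : ℝ} (hL : 0 < L)
    (hN : N2 q (fun y => kk A (L⁻¹ • y)) (fun x => ∑ n ∈ T, c n * st (ζ n) x) ≤
        C * ((∑ n ∈ T, ENNReal.ofReal ((1 + h n) ^ (2 * ε)) * ‖c n‖ₑ ^ 2) * (∫⁻ y : V (d + 1), kk A (L⁻¹ • y)) ^ (2 / q))) :
    (1 / (2 * L) ^ (d + 1)) * ∫ t in Set.Icc (-L) L, ∫ x in (Set.univ.pi fun _ : Fin d => Set.Icc (-L) L),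
       ‖∑ n ∈ T, c n * st (ζ n) (Fin.cons t x)‖ ^ q ≤
    (2 ^ A * (∫⁻ y : V (d + 1), kk A y).toReal * C.toReal ^ (q / 2)) * (∑ n ∈ T, (1 + h n) ^ (2 * ε) * ‖c n‖ ^ 2) ^ (q / 2) := by
  have hq2 : 0 ≤ q / 2 := by linarith
  set g : V (d + 1) → ℂ := fun x => ∑ n ∈ T, c n * st (ζ n) x with hg
  have hgm : Measurable g := by
    apply Finset.measurable_fun_sum
    intro n _
    exact (st_cont (ζ n)).measurable.const_mul _
  have hb := box_le (A := A) (q := q) (by linarith) hL g hgm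
  set Y := ∫ t in Set.Icc (-L) L, ∫ x in (Set.univ.pi fun _ : Fin d => Set.Icc (-L) L), ‖g (Fin.cons t x)‖ ^ q with hY
  have hS : (∑ n ∈ T, ENNReal.ofReal ((1 + h n) ^ (2 * ε)) * ‖c n‖ₑ ^ 2) = ENNReal.ofReal (∑ n ∈ T, (1 + h n) ^ (2 * ε) * ‖c n‖ ^ 2) := by
    have hn : ∀ n, 0 ≤ (1 + h n) ^ (2 * ε) := fun n => Real.rpow_nonneg (by linarith [h0 n]) _
    rw [ENNReal.ofReal_sum_of_nonneg (fun n _ => mul_nonneg (hn n) (by positivity))]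
    apply Finset.sum_congr rfl
    intro n _
    rw [ENNReal.ofReal_mul (hn n), ENNReal.ofReal_pow (norm_nonneg _), ofReal_norm_eq_enorm]
  have hS0 : 0 ≤ ∑ n ∈ T, (1 + h n) ^ (2 * ε) * ‖c n‖ ^ 2 :=
    Finset.sum_nonneg fun n _ => mul_nonneg (Real.rpow_nonneg (by linarith [h0 n]) _) (by positivity)
  set S := ∑ n ∈ T, (1 + h n) ^ (2 * ε) * ‖c n‖ ^ 2 with hSd
  set I0 := ∫⁻ y : V (d + 1), kk A y with hI0
  have hI0t : I0 ≠ ∞ := kk_integrable (by omega)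
  have hI : ∫⁻ y : V (d + 1), kk A (L⁻¹ • y) = ENNReal.ofReal (L ^ (d + 1)) * I0 := by
    rw [lintegral_comp_smul _ (kk_meas A) (inv_pos.2 hL), inv_pow, inv_inv]
  rw [hS, hI] at hN
  have hII : II q (fun y => kk A (L⁻¹ • y)) g ≤ C ^ (q / 2) * (ENNReal.ofReal S ^ (q / 2) * (ENNReal.ofReal (L ^ (d + 1)) * I0)) := by
    rw [← N2_rpow hq]
    refine (ENNReal.rpow_le_rpow hN hq2).trans (le_of_eq ?_)
    rw [ENNReal.mul_rpow_of_nonneg _ _ hq2, ENNReal.mul_rpow_of_nonneg _ _ hq2, ← ENNReal.rpow_mul, div_mul_div_cancel₀' (by norm_num) , div_self (by linarith), ENNReal.rpow_one]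
  have hb2 := hb.trans (mul_le_mul_right hII _)
  have hRt : 2 ^ A * (C ^ (q / 2) * (ENNReal.ofReal S ^ (q / 2) * (ENNReal.ofReal (L ^ (d + 1)) * I0))) ≠ ∞ := by
    have h1 : C ^ (q / 2) ≠ ∞ := ENNReal.rpow_ne_top_of_nonneg hq2 hC
    have h2 : ENNReal.ofReal S ^ (q / 2) ≠ ∞ := ENNReal.rpow_ne_top_of_nonneg hq2 ENNReal.ofReal_ne_top
    finiteness
  have hYr := ENNReal.toReal_mono hRt hb2
  rw [toReal_enorm] at hYr
  simp only [ENNReal.toReal_mul, ENNReal.toReal_pow, ENNReal.toReal_ofNat, ← ENNReal.toReal_rpow, ENNReal.toReal_ofReal hS0, ENNReal.toReal_ofReal (pow_nonneg hL.le (d + 1))] at hYr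
  have hYY : Y ≤ ‖Y‖ := Real.le_norm_self Y
  have hLp : 0 < L ^ (d + 1) := by positivity
  calc 1 / (2 * L) ^ (d + 1) * Y ≤ 1 / (2 * L) ^ (d + 1) * (2 ^ A * (C.toReal ^ (q / 2) * (S ^ (q / 2) * (L ^ (d + 1) * I0.toReal)))) :=
        mul_le_mul_of_nonneg_left (hYY.trans hYr) (by positivity)
    _ = (1 / 2 ^ (d + 1)) * ((2 ^ A * I0.toReal * C.toReal ^ (q / 2)) * S ^ (q / 2)) := by
        rw [mul_pow]; field_simp
    _ ≤ 1 * ((2 ^ A * I0.toReal * C.toReal ^ (q / 2)) * S ^ (q / 2)) := by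
        apply mul_le_mul_of_nonneg_right
        · rw [div_le_one (by positivity)]; exact one_le_pow₀ (by norm_num)
        · have : 0 ≤ S ^ (q / 2) := Real.rpow_nonneg hS0 _
          positivity
    _ = _ := one_mul _

end QPS

/-- Time-averaged `L^{p_d}` Strichartz estimate for quasi-periodic functions in
higher dimensions under a diophantine condition (Theorem 4.2). -/
theorem averaged_Lpd_strichartz_higher_dim
    (d : ℕ) (hd : 1 ≤ d) (ν : Fin d → ℕ) (hν : ∀ i, 1 ≤ ν i)
    (ω : ∀ i, Fin (ν i) → ℝ)
    (hpos : ∀ i j, 0 < ω i j)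
    (hnr : ∀ i, ∀ m : Fin (ν i) → ℤ, (∑ j, (m j : ℝ) * ω i j) = 0 → m = 0)
    (hdio : ∀ i, ∃ α : ℝ, 0 < α ∧ ∃ β : ℝ, 0 < β ∧
      ∀ m : Fin (ν i) → ℤ, m ≠ 0 →
        α * (Real.sqrt (∑ j, ((m j : ℝ)) ^ 2)) ^ (-β) ≤ |∑ j, (m j : ℝ) * ω i j|)
    (ε : ℝ) (hε : 0 < ε) :
    ∃ K : ℝ, 0 < K ∧
      ∀ a : (∀ i, Fin (ν i) → ℤ) → ℂ, (Function.support a).Finite →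
      limsup (fun L : ℝ =>
          (1 / (2 * L) ^ (d + 1)) * ∫ t in Set.Icc (-L) L,
            ∫ x in (Set.univ.pi fun _ : Fin d => Set.Icc (-L) L),
              ‖∑' n : ∀ i, Fin (ν i) → ℤ, a n *
                Complex.exp (Complex.I *
                  ((∑ i, freqVec ω n i * x i
                      - t * ∑ i, freqVec ω n i ^ 2 : ℝ) : ℂ))‖
                ^ (2 * ((d : ℝ) + 2) / d)) atTop
        ≤ K ^ (2 * ((d : ℝ) + 2) / d) *
            (∑' n : ∀ i, Fin (ν i) → ℤ,
              (1 + heightVec n) ^ (2 * ε) * ‖a n‖ ^ 2)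
              ^ ((2 * ((d : ℝ) + 2) / d) / 2) := by
  have hd0 : (0:ℝ) < d := by exact_mod_cast hd
  set q : ℝ := 2 * ((d : ℝ) + 2) / d with hqd
  have hq2 : 2 ≤ q := by rw [hqd, le_div_iff₀ hd0]; linarith
  have hqe : q * (d : ℝ) ≤ 2 * d + 4 := by rw [hqd, div_mul_cancel₀ _ hd0.ne']; linarith
  obtain ⟨w, B, hB, hζ, hsep⟩ := QPS.arith ω hpos hdio
  have hh0 : ∀ n : ∀ i, Fin (ν i) → ℤ, 0 ≤ heightVec n := fun n => Real.sqrt_nonneg _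
  obtain ⟨C, hC, hmain⟩ := QPS.disc3 (A := d + 2) hB hq2 hqe hε (freqVec ω) heightVec hh0 hζ hsep
  set M : ℝ := 2 ^ (d + 2) * (∫⁻ y : QPS.V (d + 1), QPS.kk (d + 2) y).toReal * C.toReal ^ (q / 2) with hM
  have hM0 : 0 ≤ M := by positivity
  refine ⟨(M + 1) ^ (1 / q), by positivity, ?_⟩
  intro a ha
  have hK : ((M + 1) ^ (1 / q)) ^ q = M + 1 := by
    rw [← Real.rpow_mul (by positivity), one_div_mul_cancel (by linarith), Real.rpow_one]
  rw [hK]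
  have e1 : ∑' n : ∀ i, Fin (ν i) → ℤ, (1 + heightVec n) ^ (2 * ε) * ‖a n‖ ^ 2 = ∑ n ∈ ha.toFinset, (1 + heightVec n) ^ (2 * ε) * ‖a n‖ ^ 2 := by
    apply tsum_eq_sum
    intro n hn
    have : a n = 0 := by simpa using hn
    simp [this]
  have e2 : ∀ (t : ℝ) (x : Fin d → ℝ), ∑' n : ∀ i, Fin (ν i) → ℤ, a n * Complex.exp (Complex.I *
                  ((∑ i, freqVec ω n i * x i - t * ∑ i, freqVec ω n i ^ 2 : ℝ) : ℂ)) = 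
      ∑ n ∈ ha.toFinset, a n * QPS.st (freqVec ω n) (Fin.cons t x) := by
    intro t x
    rw [tsum_eq_sum (s := ha.toFinset)]
    · rfl
    · intro n hn
      have : a n = 0 := by simpa using hn
      simp [this]
  simp_rw [e2]
  rw [e1]
  have hS0 : 0 ≤ ∑ n ∈ ha.toFinset, (1 + heightVec n) ^ (2 * ε) * ‖a n‖ ^ 2 :=
    Finset.sum_nonneg fun n _ => mul_nonneg (Real.rpow_nonneg (by linarith [hh0 n]) _) (by positivity)
  apply limsup_le_of_le
  · apply IsBoundedUnder.isCoboundedUnder_le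
    refine isBoundedUnder_of_eventually_ge (a := 0) ?_
    filter_upwards [eventually_gt_atTop 0] with L hL
    apply mul_nonneg (by positivity)
    apply integral_nonneg
    intro t
    apply integral_nonneg
    intro x
    positivity
  · filter_upwards [hmain ha.toFinset a, eventually_gt_atTop 0] with L hL hL0
    refine (QPS.final_bound (le_refl (d + 2)) hq2 (freqVec ω) heightVec hh0 hC ha.toFinset a hL0 hL).trans ?_
    apply mul_le_mul_of_nonneg_right
    · linarith
    · exact Real.rpow_nonneg hS0 _
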